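/- (Maynard) There is an absolute constant C > 0 such that for every positive integer m one has liminf_{n→∞} (p_{n+m} − p_n) ≤ C · m^3 · e^{4m}. -/

import Mathlib

open Real Filter

/-- `nthPrime n` is the `n`-th prime number `p_n` (so `p_1 = 2`, `p_2 = 3`, ...). -/
noncomputable def nthPrime (n : ℕ) : ℕ := Nat.nth Nat.Prime (n - 1)

set_option linter.all false
namespace MG
open Finset

/-- additive exponential -/
noncomputable def ee (x : ℝ) : ℂ := Complex.exp (2 * Real.pi * Complex.I * x)

lemma ee_add (x y : ℝ) : ee (x + y) = ee x * ee y := by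
  simp only [ee, ← Complex.exp_add]; congr 1; push_cast; ring

lemma ee_norm (x : ℝ) : ‖ee x‖ = 1 := by
  have : (2 * Real.pi * Complex.I * x : ℂ) = ((2 * Real.pi * x : ℝ) : ℂ) * Complex.I := by
    push_cast; ring
  rw [ee, this, Complex.norm_exp_ofReal_mul_I]

lemma ee_int (n : ℤ) : ee n = 1 := by
  rw [ee, Complex.exp_eq_one_iff]; exact ⟨n, by push_cast; ring⟩

lemma ee_conj (x : ℝ) : (starRingEnd ℂ) (ee x) = ee (-x) := by
  have h : ee (-x) * ee x = 1 := by rw [← ee_add]; simp [ee]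
  have h2 : (starRingEnd ℂ) (ee x) * ee x = 1 := by
    rw [mul_comm, Complex.mul_conj, Complex.normSq_eq_norm_sq, ee_norm]; simp
  have h3 : ee x ≠ 0 := by intro h0; rw [h0] at h; simp at h
  exact mul_right_cancel₀ h3 (h2.trans h.symm)

lemma ee_nat_mul (n : ℕ) (x : ℝ) : ee (n * x) = ee x ^ n := by
  rw [ee, ee, ← Complex.exp_nat_mul]; congr 1; push_cast; ring

/-- `|1 - e(t)| ≥ 4 min(t,1-t)` for t in [0,1]; weak form -/
lemma ee_sub_one_norm (t : ℝ) (h0 : 0 ≤ t) (h1 : t ≤ 1) : 4 * (t * (1 - t)) ≤ ‖ee t - 1‖ := by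
  have h : ‖ee t - 1‖ = 2 * |Real.sin (Real.pi * t)| := by
    have : (2 * Real.pi * Complex.I * t : ℂ) = Complex.I * ((2 * Real.pi * t : ℝ) : ℂ) := by
      push_cast; ring
    rw [ee, this, Complex.norm_exp_I_mul_ofReal_sub_one]
    rw [norm_mul, Real.norm_eq_abs, Real.norm_eq_abs]; norm_num
    congr 2; ring
  rw [h]
  have key : ∀ s : ℝ, 0 ≤ s → s ≤ 1/2 → 2 * s ≤ Real.sin (Real.pi * s) := by
    intro s hs hs2
    have := Real.mul_le_sin (x := Real.pi * s) (by positivity) (by nlinarith [Real.pi_pos])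
    have h3 : 2 / Real.pi * (Real.pi * s) = 2 * s := by field_simp
    linarith
  rcases le_total t (1/2) with ht | ht
  · have := key t h0 ht
    have h4 := le_abs_self (Real.sin (Real.pi * t))
    nlinarith
  · have := key (1 - t) (by linarith) (by linarith)
    have e : Real.sin (Real.pi * (1 - t)) = Real.sin (Real.pi * t) := by
      rw [mul_sub, mul_one, Real.sin_pi_sub]
    rw [e] at this
    have h4 := le_abs_self (Real.sin (Real.pi * t))
    nlinarith

/-- geometric sum bound -/
lemma dir_kernel (H : ℕ) (t : ℝ) (h0 : 0 < t) (h1 : t < 1) :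
    ‖∑ u ∈ range H, ee (u * t)‖ ^ 2 ≤ 1 / t ^ 2 + 1 / (1 - t) ^ 2 := by
  have hb := ee_sub_one_norm t h0.le h1.le
  have h1t : 0 < 1 - t := by linarith
  have hpos : 0 < t * (1 - t) := by positivity
  have hne : ee t ≠ 1 := by
    intro h; rw [h] at hb; simp at hb; linarith
  have : ∑ u ∈ range H, ee (u * t) = (ee t ^ H - 1) / (ee t - 1) := by
    rw [← geom_sum_eq hne]; exact sum_congr rfl fun u _ => ee_nat_mul u t
  rw [this, norm_div]
  have hn : ‖ee t ^ H - 1‖ ≤ 2 := by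
    refine (norm_sub_le _ _).trans ?_
    rw [norm_pow, ee_norm]; norm_num
  have h2 : ‖ee t ^ H - 1‖ / ‖ee t - 1‖ ≤ 2 / (4 * (t * (1 - t))) := by gcongr
  have h3 : 2 / (4 * (t * (1 - t))) = (1 / t + 1 / (1 - t)) / 2 := by field_simp; ring
  rw [h3] at h2
  have ha : 0 < 1 / t := by positivity
  have hb' : 0 < 1 / (1 - t) := by positivity
  calc _ ≤ ((1 / t + 1 / (1 - t)) / 2) ^ 2 := by gcongr
    _ ≤ _ := by
      rw [← one_div_pow, ← one_div_pow]; nlinarith [sq_nonneg (1/t - 1/(1-t))]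

lemma sum_inv_sq_nat (s : Finset ℕ) (hs : ∀ n ∈ s, 1 ≤ n) : ∑ n ∈ s, (1 : ℝ) / n ^ 2 ≤ 2 := by
  obtain ⟨B, hB⟩ : ∃ B, s ⊆ Ioc 0 B := ⟨s.sup id, fun n hn => by
    simp only [mem_Ioc]; exact ⟨hs n hn, le_sup (f := id) hn⟩⟩
  calc _ ≤ ∑ n ∈ Ioc 0 B, (1 : ℝ) / n ^ 2 :=
        sum_le_sum_of_subset_of_nonneg hB fun _ _ _ => by positivity
    _ ≤ 2 := by
      have h := sum_Ioo_inv_sq_le (α := ℝ) 0 (B + 1)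
      have e : Ioo 0 (B + 1) = Ioc 0 B := by ext; simp [Nat.lt_succ_iff]
      rw [e] at h
      simp only [one_div]; simpa using h

lemma sum_inv_sq_spaced {ι : Type*} (s : Finset ι) (t : ι → ℝ) (δ : ℝ) (hδ : 0 < δ)
    (h1 : ∀ i ∈ s, δ ≤ t i) (h2 : ∀ i ∈ s, ∀ j ∈ s, i ≠ j → δ ≤ |t i - t j|) :
    ∑ i ∈ s, 1 / t i ^ 2 ≤ 2 / δ ^ 2 := by
  classical
  have hfl : ∀ i ∈ s, 1 ≤ ⌊t i / δ⌋₊ := fun i hi => by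
    rw [Nat.one_le_floor_iff, le_div_iff₀ hδ]; linarith [h1 i hi]
  have hinj : Set.InjOn (fun i => ⌊t i / δ⌋₊) s := by
    intro i hi j hj hij
    by_contra hne
    have := h2 i hi j hj hne
    have hi0 : 0 ≤ t i / δ := div_nonneg (hδ.le.trans (h1 i hi)) hδ.le
    have hj0 : 0 ≤ t j / δ := div_nonneg (hδ.le.trans (h1 j hj)) hδ.le
    have a1 := Nat.floor_le hi0
    have a2 := Nat.lt_floor_add_one (t i / δ)
    have b1 := Nat.floor_le hj0
    have b2 := Nat.lt_floor_add_one (t j / δ)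
    simp only at hij
    rw [hij] at a1 a2
    have : |t i / δ - t j / δ| < 1 := by rw [abs_lt]; constructor <;> linarith
    rw [← sub_div, abs_div, abs_of_pos hδ, div_lt_one hδ] at this
    linarith
  calc ∑ i ∈ s, 1 / t i ^ 2 ≤ ∑ i ∈ s, (1 / δ ^ 2) * (1 / (⌊t i / δ⌋₊ : ℝ) ^ 2) := by
        refine sum_le_sum fun i hi => ?_
        have hp : (1 : ℝ) ≤ ⌊t i / δ⌋₊ := by exact_mod_cast hfl i hi
        have hle : (⌊t i / δ⌋₊ : ℝ) ≤ t i / δ :=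
          Nat.floor_le (div_nonneg (hδ.le.trans (h1 i hi)) hδ.le)
        rw [le_div_iff₀ hδ] at hle
        rw [one_div_mul_one_div, ← mul_pow, mul_comm δ]
        gcongr
    _ = (1 / δ ^ 2) * ∑ n ∈ s.image (fun i => ⌊t i / δ⌋₊), (1 / (n : ℝ) ^ 2) := by
        rw [sum_image hinj, mul_sum]
    _ ≤ (1 / δ ^ 2) * 2 := by
        gcongr
        refine sum_inv_sq_nat _ fun n hn => ?_
        obtain ⟨i, hi, rfl⟩ := mem_image.1 hn
        exact hfl i hi
    _ = _ := by ring

/-- duality -/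
lemma duality {ι κ : Type*} (s : Finset ι) (u : Finset κ) (z : ι → κ → ℂ) (Δ : ℝ) (hΔ : 0 ≤ Δ)
    (h : ∀ b : ι → ℂ, ∑ n ∈ u, ‖∑ j ∈ s, b j * z j n‖ ^ 2 ≤ Δ * ∑ j ∈ s, ‖b j‖ ^ 2)
    (a : κ → ℂ) : ∑ j ∈ s, ‖∑ n ∈ u, a n * z j n‖ ^ 2 ≤ Δ * ∑ n ∈ u, ‖a n‖ ^ 2 := by
  set T : ι → ℂ := fun j => ∑ n ∈ u, a n * z j n with hT
  set Y := ∑ j ∈ s, ‖T j‖ ^ 2 with hY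
  have hY0 : 0 ≤ Y := sum_nonneg fun _ _ => by positivity
  have e1 : (Y : ℂ) = ∑ n ∈ u, a n * ∑ j ∈ s, (starRingEnd ℂ (T j)) * z j n := by
    rw [hY]; push_cast
    simp_rw [mul_sum]
    rw [sum_comm]
    refine sum_congr rfl fun j _ => ?_
    rw [← Complex.mul_conj', hT, sum_mul]
    refine sum_congr rfl fun n _ => by ring
  have e2 : Y ≤ ∑ n ∈ u, ‖a n‖ * ‖∑ j ∈ s, (starRingEnd ℂ (T j)) * z j n‖ := by
    have : Y = ‖(Y : ℂ)‖ := by rw [Complex.norm_real, Real.norm_of_nonneg hY0]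
    rw [this, e1]
    refine (norm_sum_le _ _).trans (le_of_eq ?_)
    simp
  have e3 := sum_mul_sq_le_sq_mul_sq u (fun n => ‖a n‖)
    (fun n => ‖∑ j ∈ s, (starRingEnd ℂ (T j)) * z j n‖)
  have e4 := h fun j => starRingEnd ℂ (T j)
  simp only [RCLike.norm_conj] at e4
  rw [← hY] at e4
  have hA : 0 ≤ ∑ n ∈ u, ‖a n‖ ^ 2 := sum_nonneg fun _ _ => by positivity
  have e5 : Y ^ 2 ≤ (∑ n ∈ u, ‖a n‖ ^ 2) * (Δ * Y) :=
    (pow_le_pow_left₀ hY0 e2 2).trans (e3.trans (mul_le_mul_of_nonneg_left e4 hA))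
  rcases hY0.eq_or_lt with h0 | h0
  · rw [← h0]; positivity
  · have : Y * Y ≤ (Δ * ∑ n ∈ u, ‖a n‖ ^ 2) * Y := by nlinarith
    exact le_of_mul_le_mul_right this h0

/-- dual additive large sieve -/
lemma dual_ls {ι : Type*} (s : Finset ι) (α : ι → ℝ) (δ : ℝ) (hδ : 0 < δ)
    (hsp : ∀ i ∈ s, ∀ j ∈ s, i ≠ j → ∀ m : ℤ, δ ≤ |α i - α j - m|)
    (M K H : ℕ) (hH : 2 * K ≤ H) (hH2 : 1 / δ ≤ H) (hH0 : 0 < H) (b : ι → ℂ) :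
    ∑ n ∈ range K, ‖∑ j ∈ s, b j * ee ((M + n : ℕ) * α j)‖ ^ 2
      ≤ 10 * H * ∑ j ∈ s, ‖b j‖ ^ 2 := by
  classical
  set S : ℝ → ℂ := fun y => ∑ j ∈ s, b j * ee (y * α j) with hS
  set B := ∑ j ∈ s, ‖b j‖ ^ 2 with hB
  -- lower bound
  have low : ((H - K : ℕ) : ℝ) * ∑ n ∈ range K, ‖S ((M + n : ℕ))‖ ^ 2 ≤
      ∑ u ∈ range H, ∑ v ∈ range H, ‖S ((M : ℝ) + u - v)‖ ^ 2 := by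
    rw [sum_comm]
    calc _ = ∑ v ∈ range (H - K), ∑ n ∈ range K, ‖S ((M : ℝ) + (n + v : ℕ) - v)‖ ^ 2 := by
          have : ∀ v ∈ range (H - K), ∑ n ∈ range K, ‖S ((M : ℝ) + (n + v : ℕ) - v)‖ ^ 2 =
              ∑ n ∈ range K, ‖S ((M + n : ℕ))‖ ^ 2 := by
            intro v _
            refine sum_congr rfl fun n _ => ?_
            congr 3; push_cast; ring
          rw [sum_congr rfl this, sum_const, card_range, nsmul_eq_mul]
      _ ≤ ∑ v ∈ range (H - K), ∑ u ∈ range H, ‖S ((M : ℝ) + u - v)‖ ^ 2 := by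
          refine sum_le_sum fun v hv => ?_
          rw [mem_range] at hv
          rw [← sum_image (s := range K) (g := fun n => n + v)
            (f := fun u : ℕ => ‖S ((M : ℝ) + u - v)‖ ^ 2) (by intro a _ b _ h; simpa using h)]
          refine sum_le_sum_of_subset_of_nonneg ?_ fun _ _ _ => by positivity
          intro u hu
          obtain ⟨n, hn, rfl⟩ := mem_image.1 hu
          rw [mem_range] at *; omega
      _ ≤ _ := sum_le_sum_of_subset_of_nonneg (range_mono (by omega))
          fun _ _ _ => sum_nonneg fun _ _ => by positivity
  -- expansion
  set D : ℝ → ℂ := fun β => ∑ u ∈ range H, ee (u * β) with hD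
  have hDn : ∀ β, D β * starRingEnd ℂ (D β) = (‖D β‖ ^ 2 : ℝ) := by
    intro β; rw [Complex.mul_conj']; push_cast; rfl
  have expand : ((∑ u ∈ range H, ∑ v ∈ range H, ‖S ((M : ℝ) + u - v)‖ ^ 2 : ℝ) : ℂ) =
      ∑ i ∈ s, ∑ j ∈ s, b i * starRingEnd ℂ (b j) * ee (M * (α i - α j)) *
        (‖D (α i - α j)‖ ^ 2 : ℝ) := by
    have h1 : ∀ y : ℝ, ((‖S y‖ ^ 2 : ℝ) : ℂ) = ∑ i ∈ s, ∑ j ∈ s,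
        b i * starRingEnd ℂ (b j) * ee (y * (α i - α j)) := by
      intro y
      push_cast
      rw [← Complex.mul_conj', hS, map_sum, sum_mul_sum]
      refine sum_congr rfl fun i _ => sum_congr rfl fun j _ => ?_
      rw [map_mul, ee_conj, mul_sub, sub_eq_add_neg, ee_add]; ring
    push_cast only [Complex.ofReal_sum]
    simp_rw [h1]
    simp_rw [sum_comm (s := range H) (t := s)]
    refine sum_congr rfl fun i _ => sum_congr rfl fun j _ => ?_
    rw [← hDn, hD, map_sum, sum_mul_sum, mul_sum]
    refine sum_congr rfl fun u _ => ?_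
    rw [mul_sum]
    refine sum_congr rfl fun v _ => ?_
    rw [ee_conj, mul_assoc _ (ee _) (_ * _), ← ee_add, ← ee_add]
    congr 2; ring
  have Dsymm : ∀ β, ‖D (-β)‖ = ‖D β‖ := by
    intro β
    have : D (-β) = starRingEnd ℂ (D β) := by
      simp only [hD, map_sum, ee_conj]; refine sum_congr rfl fun u _ => by congr 1; ring
    rw [this, RCLike.norm_conj]
  have DH : ∀ β, ‖D β‖ ≤ H := by
    intro β
    refine (norm_sum_le _ _).trans ?_
    simp [ee_norm]
  have row : ∀ i ∈ s, ∑ j ∈ s, ‖D (α i - α j)‖ ^ 2 ≤ 5 * (H : ℝ) ^ 2 := by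
    intro i hi
    rw [← add_sum_erase _ _ hi]
    set t : ι → ℝ := fun j => Int.fract (α i - α j) with ht
    have hd1 : ∀ j ∈ s.erase i, δ ≤ t j := by
      intro j hj
      rw [mem_erase] at hj
      have := hsp i hi j hj.2 (Ne.symm hj.1) ⌊α i - α j⌋
      rwa [Int.self_sub_floor, abs_of_nonneg (Int.fract_nonneg _)] at this
    have hd2 : ∀ j ∈ s.erase i, δ ≤ 1 - t j := by
      intro j hj
      rw [mem_erase] at hj
      have := hsp i hi j hj.2 (Ne.symm hj.1) (⌊α i - α j⌋ + 1)
      push_cast at this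
      rw [← sub_sub, Int.self_sub_floor, abs_sub_comm, abs_of_nonneg] at this
      · exact this
      · linarith [Int.fract_lt_one (α i - α j)]
    have hd3 : ∀ j ∈ s.erase i, ∀ l ∈ s.erase i, j ≠ l → δ ≤ |t j - t l| := by
      intro j hj l hl hjl
      rw [mem_erase] at hj hl
      have := hsp l hl.2 j hj.2 hjl.symm (⌊α i - α j⌋ - ⌊α i - α l⌋)
      simp only [ht, Int.fract]
      convert this using 2
      push_cast; ring
    have hk : ∀ j ∈ s.erase i, ‖D (α i - α j)‖ ^ 2 ≤ 1 / t j ^ 2 + 1 / (1 - t j) ^ 2 := by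
      intro j hj
      have e : D (α i - α j) = D (t j) := by
        simp only [hD]
        refine sum_congr rfl fun u _ => ?_
        have : (u : ℝ) * (α i - α j) = u * t j + ((u * ⌊α i - α j⌋ : ℤ) : ℝ) := by
          simp only [ht, Int.fract]; push_cast; ring
        rw [this, ee_add, ee_int, mul_one]
      rw [e]
      exact dir_kernel H _ (hδ.trans_le (hd1 j hj)) (by linarith [hd2 j hj])
    have s1 := sum_inv_sq_spaced (s.erase i) t δ hδ hd1 hd3
    have s2 := sum_inv_sq_spaced (s.erase i) (fun j => 1 - t j) δ hδ hd2 (by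
      intro j hj l hl hjl
      have := hd3 j hj l hl hjl
      rw [abs_sub_comm] at this
      convert this using 2; ring)
    have s3 := (sum_le_sum hk).trans_eq sum_add_distrib
    have s4 : 2 / δ ^ 2 ≤ 2 * (H : ℝ) ^ 2 := by
      have : 2 / δ ^ 2 = 2 * (1 / δ) ^ 2 := by ring
      rw [this]; gcongr
    have s5 : ‖D (α i - α i)‖ ^ 2 ≤ (H : ℝ) ^ 2 := by gcongr; exact DH _
    linarith
  have up : ∑ u ∈ range H, ∑ v ∈ range H, ‖S ((M : ℝ) + u - v)‖ ^ 2 ≤ 5 * (H : ℝ) ^ 2 * B := by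
    set Z := ∑ u ∈ range H, ∑ v ∈ range H, ‖S ((M : ℝ) + u - v)‖ ^ 2
    have hZ0 : 0 ≤ Z := sum_nonneg fun _ _ => sum_nonneg fun _ _ => by positivity
    have : Z = ‖(Z : ℂ)‖ := by rw [Complex.norm_real, Real.norm_of_nonneg hZ0]
    rw [this, expand]
    calc _ ≤ ∑ i ∈ s, ∑ j ∈ s, ((‖b i‖ ^ 2) * ‖D (α i - α j)‖ ^ 2 / 2
            + (‖b j‖ ^ 2) * ‖D (α i - α j)‖ ^ 2 / 2) := by
          refine (norm_sum_le _ _).trans (sum_le_sum fun i _ => (norm_sum_le _ _).trans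
            (sum_le_sum fun j _ => ?_))
          rw [norm_mul, norm_mul, norm_mul, ee_norm, RCLike.norm_conj, Complex.norm_real,
            Real.norm_of_nonneg (by positivity)]
          have hh : ‖b i‖ * ‖b j‖ ≤ (‖b i‖ ^ 2 + ‖b j‖ ^ 2) / 2 := by
            nlinarith [sq_nonneg (‖b i‖ - ‖b j‖)]
          have := mul_le_mul_of_nonneg_right hh (sq_nonneg ‖D (α i - α j)‖)
          linarith
      _ = ∑ i ∈ s, ‖b i‖ ^ 2 * ∑ j ∈ s, ‖D (α i - α j)‖ ^ 2 := by
          simp_rw [sum_add_distrib]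
          rw [sum_comm (f := fun i j => (‖b j‖ ^ 2) * ‖D (α i - α j)‖ ^ 2 / 2), ← sum_add_distrib]
          refine sum_congr rfl fun i _ => ?_
          rw [← sum_add_distrib, mul_sum]
          refine sum_congr rfl fun j _ => ?_
          rw [← Dsymm (α j - α i), neg_sub]; ring
      _ ≤ ∑ i ∈ s, ‖b i‖ ^ 2 * (5 * (H : ℝ) ^ 2) :=
          sum_le_sum fun i hi => mul_le_mul_of_nonneg_left (row i hi) (by positivity)
      _ = _ := by rw [← sum_mul, mul_comm]
  have hHK : (H : ℝ) / 2 ≤ ((H - K : ℕ) : ℝ) := by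
    rw [Nat.cast_sub (by omega)]
    have : (2 * K : ℝ) ≤ H := by exact_mod_cast hH
    linarith
  have hH0' : (0 : ℝ) < H := by exact_mod_cast hH0
  set Q := ∑ n ∈ range K, ‖S ((M + n : ℕ))‖ ^ 2
  have hQ : 0 ≤ Q := sum_nonneg fun _ _ => by positivity
  have h1 : (H : ℝ) / 2 * Q ≤ 5 * (H : ℝ) ^ 2 * B :=
    (mul_le_mul_of_nonneg_right hHK hQ).trans (low.trans up)
  have h2 : (H : ℝ) / 2 * Q ≤ (H : ℝ) / 2 * (10 * H * B) := by linarith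
  exact le_of_mul_le_mul_left h2 (by positivity)

end MG

namespace MG
open Finset

lemma farey_ls (D M K : ℕ) (hD : 1 ≤ D) (a : ℕ → ℂ) :
    ∑ r ∈ Icc 1 D, ∑ b ∈ (range r).filter (fun b => b.Coprime r),
      ‖∑ n ∈ range K, a (M + n) * ee ((M + n : ℕ) * (b / r))‖ ^ 2
      ≤ 20 * (K + D ^ 2) * ∑ n ∈ range K, ‖a (M + n)‖ ^ 2 := by
  rw [sum_sigma']
  set s := (Icc 1 D).sigma (fun r => (range r).filter (fun b => b.Coprime r)) with hs
  have hD0 : (0 : ℝ) < D := by exact_mod_cast hD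
  have key := dual_ls s (fun j => (j.2 : ℝ) / j.1) (1 / (D : ℝ) ^ 2) (by positivity)
    (by
      rintro ⟨r, b⟩ hi ⟨r', b'⟩ hj hne m
      simp only [hs, mem_sigma, mem_Icc, mem_filter, mem_range] at hi hj
      obtain ⟨⟨h1, h2⟩, h3, h4⟩ := hi
      obtain ⟨⟨h1', h2'⟩, h3', h4'⟩ := hj
      have p1 : (0 : ℝ) < r := by exact_mod_cast h1
      have p2 : (0 : ℝ) < r' := by exact_mod_cast h1'
      set z : ℤ := b * r' - b' * r - m * (r * r') with hz
      have e : (b : ℝ) / r - b' / r' - m = z / (r * r') := by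
        rw [hz]; push_cast; field_simp
      have hz0 : z ≠ 0 := by
        intro h0
        have e0 : (b : ℝ) / r - b' / r' - m = 0 := by rw [e, h0]; simp
        have l1 : (b : ℝ) / r < 1 := by rw [div_lt_one p1]; exact_mod_cast h3
        have l2 : (b' : ℝ) / r' < 1 := by rw [div_lt_one p2]; exact_mod_cast h3'
        have l3 : (0 : ℝ) ≤ (b : ℝ) / r := by positivity
        have l4 : (0 : ℝ) ≤ (b' : ℝ) / r' := by positivity
        have m1 : (m : ℝ) < 1 := by linarith
        have m2 : (-1 : ℝ) < m := by linarith
        have m0 : m = 0 := by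
          have : m < 1 := by exact_mod_cast m1
          have : -1 < m := by exact_mod_cast m2
          omega
        rw [hz, m0] at h0
        have h5 : b * r' = b' * r := by zify; linarith
        have d1 : r ∣ r' := h4.symm.dvd_of_dvd_mul_left (Dvd.intro_left b' h5.symm)
        have d2 : r' ∣ r := h4'.symm.dvd_of_dvd_mul_left (Dvd.intro_left b h5)
        have hr := Nat.dvd_antisymm d1 d2
        subst hr
        have := Nat.eq_of_mul_eq_mul_right (by omega) h5
        subst this
        exact hne rfl
      simp only
      rw [e, abs_div, abs_of_pos (mul_pos p1 p2)]
      have : (1 : ℝ) ≤ |(z : ℝ)| := by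
        rw [← Int.cast_abs]; exact_mod_cast Int.one_le_abs hz0
      have q1 : (r : ℝ) ≤ D := by exact_mod_cast h2
      have q2 : (r' : ℝ) ≤ D := by exact_mod_cast h2'
      rw [sq]
      gcongr)
    M K (2 * K + D ^ 2) (by omega) (by push_cast; simp) (by positivity)
  have := duality s (range K) (fun j n => ee ((M + n : ℕ) * ((j.2 : ℝ) / j.1))) _ (by positivity)
    key (fun n => a (M + n))
  refine this.trans ?_
  refine mul_le_mul_of_nonneg_right ?_ (sum_nonneg fun _ _ => by positivity)
  push_cast
  nlinarith [hD0]

section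
variable {r : ℕ} [NeZero r]

lemma chi_norm_sq (χ : DirichletCharacter ℂ r) (c : ZMod r) :
    starRingEnd ℂ (χ c) = χ⁻¹ c := by
  rw [MulChar.inv_apply_eq_inv']
  by_cases h : IsUnit c
  · have h1 : ‖χ c‖ = 1 := by
      obtain ⟨u, rfl⟩ := h; exact χ.unit_norm_eq_one u
    rw [Complex.inv_def, Complex.normSq_eq_norm_sq, h1]; simp
  · rw [MulChar.map_nonunit _ h]; simp

lemma char_orth (f : ZMod r → ℂ) :
    ∑ χ : DirichletCharacter ℂ r, ‖∑ b, χ b * f b‖ ^ 2 =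
      r.totient * ∑ b with IsUnit b, ‖f b‖ ^ 2 := by
  have : ((∑ χ : DirichletCharacter ℂ r, ‖∑ b, χ b * f b‖ ^ 2 : ℝ) : ℂ) =
      ((r.totient * ∑ b with IsUnit b, ‖f b‖ ^ 2 : ℝ) : ℂ) := by
    push_cast
    calc _ = ∑ χ : DirichletCharacter ℂ r, ∑ b, ∑ c, (χ b * f b) * (χ⁻¹ c * starRingEnd ℂ (f c)) := by
          refine sum_congr rfl fun χ _ => ?_
          rw [← Complex.mul_conj', map_sum, sum_mul_sum]
          simp_rw [map_mul, chi_norm_sq]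
      _ = ∑ c, ∑ b, (f b * starRingEnd ℂ (f c)) * ∑ χ : DirichletCharacter ℂ r, χ⁻¹ c * χ b := by
          rw [sum_comm]
          simp_rw [sum_comm (s := (univ : Finset (DirichletCharacter ℂ r)))]
          rw [sum_comm]
          refine sum_congr rfl fun c _ => sum_congr rfl fun b _ => ?_
          rw [mul_sum]
          refine sum_congr rfl fun χ _ => by ring
      _ = ∑ c, if IsUnit c then (r.totient : ℂ) * ‖f c‖ ^ 2 else 0 := by
          refine sum_congr rfl fun c _ => ?_
          split_ifs with hc
          · have : ∀ b, ∑ χ : DirichletCharacter ℂ r, χ⁻¹ c * χ b =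
                if c = b then (r.totient : ℂ) else 0 := by
              intro b
              rw [← DirichletCharacter.sum_char_inv_mul_char_eq ℂ hc b]
              refine sum_congr rfl fun χ _ => ?_
              congr 1
              rw [MulChar.inv_apply]
              congr 1
              obtain ⟨u, rfl⟩ := hc
              rw [Ring.inverse_unit]
              exact (ZMod.inv_coe_unit u).symm
            simp_rw [this, mul_ite, mul_zero]
            rw [sum_ite_eq]
            simp [Complex.mul_conj']; ring
          · refine sum_eq_zero fun b _ => ?_
            rw [sum_eq_zero, mul_zero]
            intro χ _
            rw [MulChar.map_nonunit _ hc, zero_mul]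
      _ = _ := by rw [← sum_filter, mul_sum]
  exact_mod_cast this

lemma parseval_zmod (f : ZMod r → ℂ) :
    ∑ a, ‖∑ b, f b * ZMod.stdAddChar (a * b)‖ ^ 2 = r * ∑ b, ‖f b‖ ^ 2 := by
  have : ((∑ a, ‖∑ b, f b * ZMod.stdAddChar (a * b)‖ ^ 2 : ℝ) : ℂ) =
      ((r * ∑ b, ‖f b‖ ^ 2 : ℝ) : ℂ) := by
    push_cast
    calc _ = ∑ a, ∑ b, ∑ c, (f b * starRingEnd ℂ (f c)) * ZMod.stdAddChar (a * (b - c)) := by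
          refine sum_congr rfl fun a _ => ?_
          rw [← Complex.mul_conj', map_sum, sum_mul_sum]
          refine sum_congr rfl fun b _ => sum_congr rfl fun c _ => ?_
          rw [map_mul (starRingEnd ℂ), ← AddChar.map_neg_eq_conj, mul_sub, sub_eq_add_neg, AddChar.map_add_eq_mul]
          ring
      _ = ∑ b, ∑ c, (f b * starRingEnd ℂ (f c)) * ∑ a, ZMod.stdAddChar (a * (b - c)) := by
          rw [sum_comm]
          refine sum_congr rfl fun b _ => ?_
          rw [sum_comm]
          simp_rw [mul_sum]
      _ = ∑ b, (r : ℂ) * ‖f b‖ ^ 2 := by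
          refine sum_congr rfl fun b _ => ?_
          have : ∀ c, ∑ a, ZMod.stdAddChar (a * (b - c)) = if b = c then (r : ℂ) else 0 := by
            intro c
            rw [AddChar.sum_mulShift (R' := ℂ) _ (ZMod.isPrimitive_stdAddChar r)]
            simp [sub_eq_zero, ZMod.card]
          simp_rw [this, mul_ite, mul_zero]
          rw [sum_ite_eq]
          simp [Complex.mul_conj']; ring
      _ = _ := by rw [mul_sum]
  exact_mod_cast this

lemma gauss_norm {χ : DirichletCharacter ℂ r} (hχ : χ.IsPrimitive) :
    ‖gaussSum χ ZMod.stdAddChar‖ ^ 2 = r := by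
  have h := parseval_zmod (r := r) (fun b => χ b)
  have h1 : ∀ a : ZMod r, ∑ b, χ b * ZMod.stdAddChar (a * b) =
      χ⁻¹ a * gaussSum χ ZMod.stdAddChar := by
    intro a
    rw [← gaussSum_mulShift_of_isPrimitive _ hχ, gaussSum]
    rfl
  simp_rw [h1, norm_mul, mul_pow] at h
  rw [← sum_mul, mul_comm] at h
  have h2 : ∀ a : ZMod r, ‖χ⁻¹ a‖ = ‖χ a‖ := by
    intro a; rw [← chi_norm_sq, RCLike.norm_conj]
  simp_rw [h2] at h
  refine mul_right_cancel₀ (b := ∑ b, ‖χ b‖ ^ 2) ?_ h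
  have : 0 < ∑ b, ‖χ b‖ ^ 2 :=
    sum_pos' (fun _ _ => by positivity) ⟨1, mem_univ _, by simp⟩
  exact this.ne'

open Classical in
lemma mult_one (u : Finset ℕ) (a : ℕ → ℂ) :
    (r : ℝ) * ∑ χ : DirichletCharacter ℂ r with χ.IsPrimitive, ‖∑ n ∈ u, a n * χ n‖ ^ 2 ≤
    r.totient * ∑ b ∈ (range r).filter (fun b => b.Coprime r),
      ‖∑ n ∈ u, a n * ee (n * (b / r))‖ ^ 2 := by
  set f : ZMod r → ℂ := fun b => ∑ n ∈ u, a n * ZMod.stdAddChar ((n : ZMod r) * b) with hf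
  have e1 : ∑ b ∈ (range r).filter (fun b => b.Coprime r), ‖∑ n ∈ u, a n * ee (n * (b / r))‖ ^ 2
      = ∑ b with IsUnit b, ‖f b‖ ^ 2 := by
    symm
    refine sum_bij (fun (b : ZMod r) _ => b.val) ?_ ?_ ?_ ?_
    · intro b hb
      simp only [mem_filter, mem_univ, true_and, mem_range] at *
      refine ⟨b.val_lt, ?_⟩
      rw [← ZMod.isUnit_iff_coprime, ZMod.natCast_zmod_val]; exact hb
    · intro b _ c _ h; exact ZMod.val_injective r h
    · intro b hb
      simp only [mem_filter, mem_range] at hb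
      exact ⟨b, by simp [(ZMod.isUnit_iff_coprime b r).2 hb.2], ZMod.val_cast_of_lt hb.1⟩
    · intro b _
      simp only [hf]
      congr 2
      refine sum_congr rfl fun n _ => ?_
      congr 1
      have : (n : ZMod r) * b = (((n * b.val : ℕ) : ℤ) : ZMod r) := by push_cast; simp
      rw [this, ZMod.stdAddChar_coe, ee]
      congr 1; push_cast; ring
  rw [e1, ← char_orth f, mul_sum]
  calc _ = ∑ χ : DirichletCharacter ℂ r with χ.IsPrimitive, ‖∑ b, χ⁻¹ b * f b‖ ^ 2 := by
        refine sum_congr rfl fun χ hχ => ?_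
        rw [mem_filter] at hχ
        have hp : (χ⁻¹).IsPrimitive := by
          have := hχ.2
          unfold DirichletCharacter.IsPrimitive at *
          rw [DirichletCharacter.conductor_inv]; exact this
        rw [← gauss_norm hp, ← mul_pow, ← norm_mul]
        congr 2
        rw [mul_sum]
        simp_rw [hf, mul_sum]
        rw [sum_comm]
        refine sum_congr rfl fun n _ => ?_
        have := gaussSum_mulShift_of_isPrimitive (ZMod.stdAddChar (N := r)) hp (n : ZMod r)
        rw [inv_inv] at this
        calc _ = a n * (χ n * gaussSum χ⁻¹ ZMod.stdAddChar) := by ring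
          _ = _ := by
            rw [← this, gaussSum, mul_sum]
            refine sum_congr rfl fun b _ => ?_
            rw [AddChar.mulShift_apply]; ring
    _ ≤ ∑ χ : DirichletCharacter ℂ r, ‖∑ b, χ⁻¹ b * f b‖ ^ 2 :=
        sum_le_sum_of_subset_of_nonneg (filter_subset _ _) fun _ _ _ => by positivity
    _ = _ := Equiv.sum_comp (Equiv.inv (DirichletCharacter ℂ r)) (fun χ => ‖∑ b, χ b * f b‖ ^ 2)
end

/-- primitive characters mod r -/
noncomputable def prims (r : ℕ) : Finset (DirichletCharacter ℂ r) :=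
  {χ | χ.IsPrimitive}.toFinite.toFinset

lemma mem_prims {r : ℕ} {χ : DirichletCharacter ℂ r} : χ ∈ prims r ↔ χ.IsPrimitive := by
  simp [prims]

/-- multiplicative large sieve -/
theorem large_sieve (D M K : ℕ) (hD : 1 ≤ D) (a : ℕ → ℂ) :
    ∑ r ∈ Icc 1 D, (r : ℝ) / r.totient * ∑ χ ∈ prims r,
      ‖∑ n ∈ Ico M (M + K), a n * χ n‖ ^ 2 ≤ 20 * (K + D ^ 2) * ∑ n ∈ Ico M (M + K), ‖a n‖ ^ 2 := by
  classical
  have h := farey_ls D M K hD a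
  simp_rw [sum_Ico_eq_sum_range, Nat.add_sub_cancel_left]
  refine le_trans (sum_le_sum fun r hr => ?_) h
  rw [mem_Icc] at hr
  have : NeZero r := ⟨by omega⟩
  have h1 := mult_one (r := r) (Ico M (M + K)) a
  simp_rw [sum_Ico_eq_sum_range, Nat.add_sub_cancel_left] at h1
  have hp : prims r = univ.filter (fun χ : DirichletCharacter ℂ r => χ.IsPrimitive) := by
    ext χ; simp [mem_prims]
  rw [hp, div_mul_eq_mul_div, div_le_iff₀ (by exact_mod_cast Nat.totient_pos.2 hr.1), mul_comm _ (r.totient : ℝ)]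
  exact h1
end MG

namespace MG
open Finset Filter Topology

lemma cpow_hasDeriv (s : ℂ) {t : ℝ} (ht : 0 < t) :
    HasDerivAt (fun y : ℝ => (y : ℂ) ^ (-s)) (-s * (t : ℂ) ^ (-s - 1)) t := by
  have h : HasDerivAt (fun z : ℂ => z ^ (-s)) (-s * (t : ℂ) ^ (-s - 1)) (t : ℂ) := by
    have := (hasDerivAt_id (t : ℂ)).cpow_const (c := -s) (Or.inl (by simpa using ht))
    simpa using this
  exact h.comp_ofReal

lemma cpow_diff (s : ℂ) {x y : ℝ} (hx : 0 < x) (hxy : x ≤ y) (hs : -1 ≤ s.re) :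
    ‖(y : ℂ) ^ (-s) - (x : ℂ) ^ (-s)‖ ≤ ‖s‖ * x ^ (-s.re - 1) * (y - x) := by
  have := Convex.norm_image_sub_le_of_norm_hasDerivWithin_le (𝕜 := ℝ) (s := Set.Icc x y)
    (f := fun y : ℝ => (y : ℂ) ^ (-s)) (f' := fun t => -s * (t : ℂ) ^ (-s - 1))
    (C := ‖s‖ * x ^ (-s.re - 1)) (x := x) (y := y)
    (fun t ht => (cpow_hasDeriv s (hx.trans_le ht.1)).hasDerivWithinAt)
    (fun t ht => by
      rw [norm_mul, norm_neg, Complex.norm_cpow_eq_rpow_re_of_pos (hx.trans_le ht.1)]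
      simp only [Complex.sub_re, Complex.neg_re, Complex.one_re]
      gcongr 1 with
      exact Real.rpow_le_rpow_of_nonpos hx ht.1 (by linarith)) (convex_Icc x y)
    ⟨le_rfl, hxy⟩ ⟨hxy, le_rfl⟩
  rwa [Real.norm_of_nonneg (by linarith)] at this

/-- partial sums `∑_{1≤k≤n} f k` -/
noncomputable def SS (f : ℕ → ℂ) (n : ℕ) : ℂ := ∑ k ∈ range n, f (k + 1)

noncomputable def Lct (f : ℕ → ℂ) (n : ℕ) (s : ℂ) : ℂ :=
  SS f (n + 1) * (((n + 1 : ℕ) : ℂ) ^ (-s) - ((n + 2 : ℕ) : ℂ) ^ (-s))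

noncomputable def Lc (f : ℕ → ℂ) (s : ℂ) : ℂ := ∑' n, Lct f n s

/-- constant -/
noncomputable def Zc (η : ℝ) : ℝ := ∑' n : ℕ, ((n + 1 : ℕ) : ℝ) ^ (-1 - η)

lemma Zc_summable {η : ℝ} (h : 0 < η) : Summable (fun n : ℕ => ((n + 1 : ℕ) : ℝ) ^ (-1 - η)) := by
  have := (summable_nat_add_iff 1).2 (Real.summable_nat_rpow.2 (show -1 - η < -1 by linarith))
  exact this

lemma Zc_pos {η : ℝ} (h : 0 < η) : 1 ≤ Zc η := by
  have := (Zc_summable h).sum_le_tsum (range 1) (fun _ _ => by positivity)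
  simpa [Zc] using this

/-- bounded function with bounded sums -/
structure BS (f : ℕ → ℂ) (r : ℕ) : Prop where
  le_one : ∀ n, ‖f n‖ ≤ 1
  sum_le : ∀ n, ‖SS f n‖ ≤ r
  pos : 1 ≤ r

lemma SS_le {f : ℕ → ℂ} {r : ℕ} (h : BS f r) (n : ℕ) : ‖SS f n‖ ≤ n := by
  refine (norm_sum_le _ _).trans ((sum_le_sum fun k _ => h.le_one (k + 1)).trans ?_)
  simp

lemma Lct_le {f : ℕ → ℂ} {r : ℕ} (h : BS f r) {η : ℝ} (h0 : 0 < η) (h1 : η ≤ 1 / 2) {s : ℂ}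
    (hs : 1 - η ≤ s.re) (n : ℕ) :
    ‖Lct f n s‖ ≤ ‖s‖ * (r : ℝ) ^ (2 * η) * ((n + 1 : ℕ) : ℝ) ^ (-1 - η) := by
  have hn : (1 : ℝ) ≤ ((n + 1 : ℕ) : ℝ) := by exact_mod_cast Nat.le_add_left 1 n
  have hn0 : (0 : ℝ) < ((n + 1 : ℕ) : ℝ) := by linarith
  have hr0 : (0 : ℝ) < r := by exact_mod_cast h.pos
  have a1 : ‖SS f (n + 1)‖ ≤ ((n + 1 : ℕ) : ℝ) ^ (1 - 2 * η) * (r : ℝ) ^ (2 * η) := by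
    set S := ‖SS f (n + 1)‖
    have b1 : S ≤ ((n + 1 : ℕ) : ℝ) := SS_le h _
    have b2 : S ≤ r := h.sum_le _
    have hS : 0 ≤ S := norm_nonneg _
    calc S = S ^ ((1 - 2 * η) + 2 * η) := by simp
      _ = S ^ (1 - 2 * η) * S ^ (2 * η) := by
        apply Real.rpow_add_of_nonneg hS <;> linarith
      _ ≤ _ := by
        apply mul_le_mul (Real.rpow_le_rpow hS b1 (by linarith))
          (Real.rpow_le_rpow hS b2 (by linarith)) (by positivity) (by positivity)
  have a2 := cpow_diff s hn0 (show ((n + 1 : ℕ) : ℝ) ≤ ((n + 2 : ℕ) : ℝ) by push_cast; linarith)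
    (by linarith)
  have e : ((n + 2 : ℕ) : ℝ) - ((n + 1 : ℕ) : ℝ) = 1 := by push_cast; ring
  rw [e, mul_one, norm_sub_rev] at a2
  rw [Lct, norm_mul]
  have a3 : ‖(((n + 1 : ℕ) : ℂ) ^ (-s) - ((n + 2 : ℕ) : ℂ) ^ (-s))‖ ≤
      ‖s‖ * ((n + 1 : ℕ) : ℝ) ^ (-(1 - η) - 1) := by
    refine le_trans (by exact_mod_cast a2) ?_
    gcongr 1 with
    exact Real.rpow_le_rpow_of_exponent_le hn (by linarith)
  calc _ ≤ (((n + 1 : ℕ) : ℝ) ^ (1 - 2 * η) * (r : ℝ) ^ (2 * η)) *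
        (‖s‖ * ((n + 1 : ℕ) : ℝ) ^ (-(1 - η) - 1)) := by gcongr
    _ = ‖s‖ * (r : ℝ) ^ (2 * η) *
        (((n + 1 : ℕ) : ℝ) ^ (1 - 2 * η) * ((n + 1 : ℕ) : ℝ) ^ (-(1 - η) - 1)) := by ring
    _ = _ := by rw [← Real.rpow_add hn0]; congr 2; ring

lemma Lct_summable {f : ℕ → ℂ} {r : ℕ} (h : BS f r) {s : ℂ} (hs : 0 < s.re) :
    Summable (fun n => Lct f n s) := by
  obtain ⟨η, h0, h1, h2⟩ : ∃ η : ℝ, 0 < η ∧ η ≤ 1/2 ∧ (1 / 2 < s.re → 1 - η ≤ s.re) :=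
    ⟨1/2, by norm_num, le_rfl, fun h => by linarith⟩
  by_cases hs2 : 1 / 2 < s.re
  · exact Summable.of_norm_bounded ((Zc_summable h0).mul_left _) (Lct_le h h0 h1 (h2 hs2))
  · -- crude
    refine Summable.of_norm_bounded (g := fun n : ℕ => (r : ℝ) * ‖s‖ * ((n + 1 : ℕ) : ℝ) ^ (-1 - s.re))
      ((Zc_summable hs).mul_left _) fun n => ?_
    have hn0 : (0 : ℝ) < ((n + 1 : ℕ) : ℝ) := by positivity
    have a2 := cpow_diff s hn0 (show ((n + 1 : ℕ) : ℝ) ≤ ((n + 2 : ℕ) : ℝ) by push_cast; linarith)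
      (by linarith)
    have e : ((n + 2 : ℕ) : ℝ) - ((n + 1 : ℕ) : ℝ) = 1 := by push_cast; ring
    rw [e, mul_one, norm_sub_rev] at a2
    rw [Lct, norm_mul, mul_assoc]
    have e2 : -1 - s.re = -s.re - 1 := by ring
    rw [e2]
    exact mul_le_mul (h.sum_le _) (by exact_mod_cast a2) (norm_nonneg _) (Nat.cast_nonneg _)

lemma Lc_le {f : ℕ → ℂ} {r : ℕ} (h : BS f r) {η : ℝ} (h0 : 0 < η) (h1 : η ≤ 1 / 2) {s : ℂ}
    (hs : 1 - η ≤ s.re) : ‖Lc f s‖ ≤ ‖s‖ * (r : ℝ) ^ (2 * η) * Zc η := by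
  rw [Lc, Zc, ← tsum_mul_left]
  exact tsum_of_norm_bounded ((Zc_summable h0).mul_left _).hasSum (Lct_le h h0 h1 hs)

lemma Lct_diff (f : ℕ → ℂ) (n : ℕ) : Differentiable ℂ (Lct f n) := by
  intro s
  unfold Lct
  have h1 : ((n + 1 : ℕ) : ℂ) ≠ 0 := by exact_mod_cast Nat.succ_ne_zero n
  have h2 : ((n + 2 : ℕ) : ℂ) ≠ 0 := by exact_mod_cast Nat.succ_ne_zero (n + 1)
  refine ((differentiableAt_id.neg.const_cpow (Or.inl h1)).sub
    (differentiableAt_id.neg.const_cpow (Or.inl h2))).const_mul _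

lemma Lc_diff {f : ℕ → ℂ} {r : ℕ} (h : BS f r) {η : ℝ} (h0 : 0 < η) (h1 : η ≤ 1 / 2) :
    DifferentiableOn ℂ (Lc f) {s | 1 - η < s.re} := by
  intro s hs
  have hs' : 1 - η < s.re := hs
  have hopen : IsOpen {z : ℂ | 1 - η < z.re ∧ ‖z‖ < ‖s‖ + 1} :=
    (isOpen_lt continuous_const Complex.continuous_re).inter
      (isOpen_lt continuous_norm continuous_const)
  have := Complex.differentiableOn_tsum_of_summable_norm (F := fun n s => Lct f n s)
    (u := fun n : ℕ => (‖s‖ + 1) * (r : ℝ) ^ (2 * η) * ((n + 1 : ℕ) : ℝ) ^ (-1 - η))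
    ((Zc_summable h0).mul_left _)
    (fun n => (Lct_diff f n).differentiableOn)
    hopen
    (fun n z hz => (Lct_le h h0 h1 hz.1.le n).trans (by
      gcongr 1; gcongr 1; exact hz.2.le))
  exact (this.differentiableAt (hopen.mem_nhds ⟨hs', by linarith⟩)).differentiableWithinAt

lemma Lc_eq_LSeries {f : ℕ → ℂ} {r : ℕ} (h : BS f r) {s : ℂ} (hs : 1 < s.re) :
    Lc f s = LSeries f s := by
  have hsum : LSeriesSummable f s :=
    LSeriesSummable_of_bounded_of_one_lt_re (m := 1) (fun n _ => h.le_one n) hs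
  have t1 : Tendsto (fun N => ∑ n ∈ range (N + 1), LSeries.term f s n) atTop (𝓝 (LSeries f s)) :=
    (tendsto_add_atTop_iff_nat 1).2 hsum.hasSum.tendsto_sum_nat
  have t2 : Tendsto (fun N => ∑ n ∈ range N, Lct f n s) atTop (𝓝 (Lc f s)) :=
    (Lct_summable h (by linarith)).hasSum.tendsto_sum_nat
  have key : ∀ N, ∑ n ∈ range (N + 1), LSeries.term f s n =
      ∑ n ∈ range N, Lct f n s + SS f N * ((N + 1 : ℕ) : ℂ) ^ (-s) := by
    intro N
    induction N with
    | zero => simp [SS]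
    | succ N ih =>
      rw [sum_range_succ, ih, sum_range_succ, Lct, LSeries.term_of_ne_zero (by omega)]
      have : SS f (N + 1) = SS f N + f (N + 1) := by rw [SS, sum_range_succ, SS]
      rw [this, Complex.cpow_neg, div_eq_mul_inv]; ring
  have t3 : Tendsto (fun N : ℕ => SS f N * ((N + 1 : ℕ) : ℂ) ^ (-s)) atTop (𝓝 0) := by
    refine squeeze_zero_norm (a := fun N : ℕ => (r : ℝ) * ((N + 1 : ℕ) : ℝ) ^ (-s.re)) (fun N => ?_) ?_
    · rw [norm_mul, Complex.norm_natCast_cpow_of_pos (by omega), Complex.neg_re]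
      gcongr; exact h.sum_le N
    · rw [show (0 : ℝ) = r * 0 by simp]
      refine Tendsto.const_mul _ ?_
      have := (tendsto_rpow_neg_atTop (show 0 < s.re by linarith)).comp
        (tendsto_natCast_atTop_atTop (R := ℝ))
      exact this.comp (tendsto_add_atTop_nat 1)
  have t4 := t2.add t3
  rw [add_zero] at t4
  exact tendsto_nhds_unique t4 (by simpa only [key] using t1)

/-- derivative bound -/
lemma Lc_deriv_le {f : ℕ → ℂ} {r : ℕ} (h : BS f r) {η : ℝ} (h0 : 0 < η) (h1 : η ≤ 1 / 2) {s : ℂ}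
    (hs : 1 - η / 2 < s.re) :
    ‖deriv (Lc f) s‖ ≤ (‖s‖ + 1) * (r : ℝ) ^ (2 * η) * Zc η / (η / 2) := by
  have hsub : Metric.closedBall s (η / 2) ⊆ {z : ℂ | 1 - η < z.re} := by
    intro z hz
    have h3 : |(z - s).re| ≤ ‖z - s‖ := Complex.abs_re_le_norm _
    rw [Metric.mem_closedBall, dist_eq_norm] at hz
    have := (abs_le.1 (h3.trans hz)).1
    simp only [Complex.sub_re] at this
    show 1 - η < z.re
    linarith
  refine Complex.norm_deriv_le_of_forall_mem_sphere_norm_le (by linarith) ?_ ?_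
  · refine DifferentiableOn.diffContOnCl ?_
    exact (Lc_diff h h0 h1).mono ((Metric.closure_ball_subset_closedBall).trans hsub)
  · intro z hz
    have hz' := Metric.sphere_subset_closedBall hz
    refine (Lc_le h h0 h1 (hsub hz').le).trans ?_
    have : ‖z‖ ≤ ‖s‖ + 1 := by
      rw [mem_sphere_iff_norm] at hz
      have := norm_le_norm_add_norm_sub' z s
      linarith
    have := Zc_pos h0
    gcongr
end MG

namespace MG
open Finset Filter Topology

lemma BS_of_periodic {f : ℕ → ℂ} {r : ℕ} (hr : 1 ≤ r) (h1 : ∀ n, ‖f n‖ ≤ 1)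
    (hp : ∀ n, f (n + r) = f n) (hz : SS f r = 0) : BS f r := by
  have hs : ∀ n, SS f (n + r) = SS f n := by
    intro n
    induction n with
    | zero => simpa [SS] using hz
    | succ n ih =>
      have e1 : SS f (n + 1 + r) = SS f (n + r) + f (n + r + 1) := by
        rw [show n + 1 + r = (n + r) + 1 by ring, SS, sum_range_succ, SS]
      have e2 : SS f (n + 1) = SS f n + f (n + 1) := by rw [SS, sum_range_succ, SS]
      rw [e1, e2, ih, show n + r + 1 = (n + 1) + r by ring, hp]
  refine ⟨h1, fun n => ?_, hr⟩
  induction n using Nat.strong_induction_on with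
  | _ n ih =>
    by_cases hn : n < r
    · refine (norm_sum_le _ _).trans ((sum_le_sum fun k _ => h1 (k + 1)).trans ?_)
      simp; exact_mod_cast hn.le
    · have := ih (n - r) (by omega)
      rwa [← hs, Nat.sub_add_cancel (by omega)] at this

lemma sum_range_zmod {r : ℕ} [NeZero r] (F : ZMod r → ℂ) :
    ∑ k ∈ range r, F ((k + 1 : ℕ) : ZMod r) = ∑ a, F a := by
  rw [← Equiv.sum_comp (Equiv.addRight (1 : ZMod r))]
  symm
  refine sum_bij (fun (b : ZMod r) _ => b.val) ?_ ?_ ?_ ?_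
  · intro b _; simpa using b.val_lt
  · intro b _ c _ h; exact ZMod.val_injective r h
  · intro b hb; exact ⟨b, mem_univ _, ZMod.val_cast_of_lt (mem_range.1 hb)⟩
  · intro b _; simp

lemma BS_char {r : ℕ} [NeZero r] {χ : DirichletCharacter ℂ r} (hχ : χ ≠ 1) :
    BS (fun n => χ n) r := by
  refine BS_of_periodic (NeZero.one_le) (fun n => χ.norm_le_one _) (fun n => by simp) ?_
  rw [SS, sum_range_zmod (fun a => χ a)]
  exact MulChar.sum_eq_zero_of_ne_one hχ

lemma sum_triv (r : ℕ) [NeZero r] : ∑ a, (1 : DirichletCharacter ℂ r) a = r.totient := by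
  have := MulChar.sum_one_eq_card_units (R := ZMod r) (R' := ℂ)
  rw [ZMod.card_units_eq_totient] at this
  exact_mod_cast this

lemma BS_triv (r : ℕ) [NeZero r] :
    BS (fun n => (1 : DirichletCharacter ℂ r) n - (r.totient / r : ℝ)) r := by
  have hr : (0 : ℝ) < r := by exact_mod_cast NeZero.one_le (n := r)
  have hφ : (r.totient : ℝ) / r ≤ 1 := by
    rw [div_le_one hr]; exact_mod_cast Nat.totient_le r
  have hφ0 : 0 ≤ (r.totient : ℝ) / r := by positivity
  refine BS_of_periodic (NeZero.one_le) (fun n => ?_) (fun n => by simp) ?_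
  · by_cases h : IsUnit (n : ZMod r)
    · rw [MulChar.one_apply h, ← Complex.ofReal_one, ← Complex.ofReal_sub, Complex.norm_real,
        Real.norm_of_nonneg (by linarith)]
      linarith
    · rw [MulChar.map_nonunit _ h, zero_sub, norm_neg, Complex.norm_real, Real.norm_of_nonneg hφ0]
      exact hφ
  · rw [SS, sum_range_zmod (fun a => (1 : DirichletCharacter ℂ r) a - (r.totient / r : ℝ)),
      sum_sub_distrib, sum_triv]
    simp only [sum_const, card_univ, ZMod.card, nsmul_eq_mul]
    have : (r : ℂ) ≠ 0 := NeZero.ne _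
    push_cast; field_simp; simp

/-! zeta -/
noncomputable def Ht (n : ℕ) (s : ℂ) : ℂ :=
  (s - 1) * ((n + 1 : ℕ) : ℂ) ^ (-s) - ((n + 1 : ℕ) : ℂ) ^ (1 - s) + ((n + 2 : ℕ) : ℂ) ^ (1 - s)

noncomputable def Hz (s : ℂ) : ℂ := 1 + ∑' n, Ht n s

lemma Ht_le (n : ℕ) {s : ℂ} (hs : 1 / 2 ≤ s.re) :
    ‖Ht n s‖ ≤ ‖s‖ * ‖s - 1‖ * ((n + 1 : ℕ) : ℝ) ^ (-1 - (1 / 2 : ℝ)) := by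
  have hn : (1 : ℝ) ≤ ((n + 1 : ℕ) : ℝ) := by exact_mod_cast Nat.le_add_left 1 n
  set x : ℝ := ((n + 1 : ℕ) : ℝ) with hx
  have hx0 : 0 < x := by linarith
  have := Convex.norm_image_sub_le_of_norm_hasDerivWithin_le (𝕜 := ℝ) (s := Set.Icc x (x + 1))
    (f := fun y : ℝ => (s - 1) * (x : ℂ) ^ (-s) * (y : ℂ) + (y : ℂ) ^ (-(s - 1)))
    (f' := fun t => (s - 1) * (x : ℂ) ^ (-s) * ((1 : ℝ) : ℂ) + (-(s - 1) * (t : ℂ) ^ (-(s - 1) - 1)))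
    (C := ‖s‖ * ‖s - 1‖ * x ^ (-1 - (1 / 2 : ℝ))) (x := x) (y := x + 1)
    (fun t ht => by
      refine HasDerivAt.hasDerivWithinAt (HasDerivAt.add ?_ (cpow_hasDeriv (s - 1) (hx0.trans_le ht.1)))
      exact ((hasDerivAt_id t).ofReal_comp).const_mul _)
    (fun t ht => by
      have e : (s - 1) * (x : ℂ) ^ (-s) * ((1 : ℝ) : ℂ) + (-(s - 1) * (t : ℂ) ^ (-(s - 1) - 1)) =
          -(s - 1) * ((t : ℂ) ^ (-s) - (x : ℂ) ^ (-s)) := by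
        rw [show -(s - 1) - 1 = -s by ring]; push_cast; ring
      rw [e, norm_mul, norm_neg]
      have h1 := cpow_diff s hx0 ht.1 (by linarith)
      have h2 : ‖s‖ * x ^ (-s.re - 1) * (t - x) ≤ ‖s‖ * x ^ (-1 - (1 / 2 : ℝ)) * 1 := by
        have : t - x ≤ 1 := by linarith [ht.2]
        have h3 : 0 ≤ t - x := by linarith [ht.1]
        have h4 := Real.rpow_le_rpow_of_exponent_le hn (show -s.re - 1 ≤ -1 - (1 / 2 : ℝ) by linarith)
        gcongr
      calc _ ≤ ‖s - 1‖ * (‖s‖ * x ^ (-1 - (1 / 2 : ℝ)) * 1) := by gcongr; exact h1.trans h2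
        _ = _ := by ring)
    (convex_Icc _ _) ⟨le_rfl, by linarith⟩ ⟨by linarith, le_rfl⟩
  have e2 : x + 1 - x = 1 := by ring
  rw [e2, norm_one, mul_one] at this
  refine le_trans (le_of_eq ?_) this
  rw [Ht]
  congr 1
  simp only [hx]
  push_cast
  rw [show (n : ℂ) + 1 + 1 = n + 2 by ring, neg_sub]
  ring

lemma Ht_diff (n : ℕ) : Differentiable ℂ (Ht n) := by
  intro s
  unfold Ht
  have h1 : ((n + 1 : ℕ) : ℂ) ≠ 0 := by exact_mod_cast Nat.succ_ne_zero n
  have h2 : ((n + 2 : ℕ) : ℂ) ≠ 0 := by exact_mod_cast Nat.succ_ne_zero (n + 1)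
  have d : DifferentiableAt ℂ (fun s : ℂ => 1 - s) s := by fun_prop
  exact (((differentiableAt_id.sub_const 1).mul (differentiableAt_id.neg.const_cpow (Or.inl h1))).sub
    (d.const_cpow (Or.inl h1))).add (d.const_cpow (Or.inl h2))

lemma Hz_sub_one {s : ℂ} (hs : 1 / 2 ≤ s.re) : ‖Hz s - 1‖ ≤ ‖s‖ * ‖s - 1‖ * Zc (1/2) := by
  rw [Hz, add_sub_cancel_left, Zc, ← tsum_mul_left]
  exact tsum_of_norm_bounded ((Zc_summable (by norm_num)).mul_left _).hasSum (fun n => Ht_le n hs)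

lemma Hz_diff : DifferentiableOn ℂ Hz {s | 1 / 2 < s.re} := by
  intro s hs
  have hs' : 1 / 2 < s.re := hs
  have hopen : IsOpen {z : ℂ | 1 / 2 < z.re ∧ ‖z‖ < ‖s‖ + 1} :=
    (isOpen_lt continuous_const Complex.continuous_re).inter
      (isOpen_lt continuous_norm continuous_const)
  have := Complex.differentiableOn_tsum_of_summable_norm (F := fun n s => Ht n s)
    (u := fun n : ℕ => (‖s‖ + 1) * (‖s‖ + 2) * ((n + 1 : ℕ) : ℝ) ^ (-1 - (1 / 2 : ℝ)))
    ((Zc_summable (by norm_num)).mul_left _)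
    (fun n => (Ht_diff n).differentiableOn)
    hopen
    (fun n z hz => (Ht_le n hz.1.le).trans (by
      have h1 : ‖z - 1‖ ≤ ‖z‖ + 1 := by simpa using norm_sub_le z 1
      have := hz.2
      gcongr <;> linarith))
  exact (((this.differentiableAt (hopen.mem_nhds ⟨hs', by linarith⟩)).const_add 1)).differentiableWithinAt

lemma Hz_eq {s : ℂ} (hs : 1 < s.re) : Hz s = (s - 1) * riemannZeta s := by
  have hsum : LSeriesSummable 1 s := LSeriesSummable_one_iff.2 hs
  have t1 : Tendsto (fun N => ∑ n ∈ range (N + 1), LSeries.term 1 s n) atTop (𝓝 (riemannZeta s)) := by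
    rw [← LSeries_one_eq_riemannZeta hs]
    exact (tendsto_add_atTop_iff_nat 1).2 hsum.hasSum.tendsto_sum_nat
  have hsum2 : Summable (fun n => Ht n s) := Summable.of_norm_bounded
    ((Zc_summable (by norm_num)).mul_left _) (fun n => Ht_le n (by linarith))
  have t2 := hsum2.hasSum.tendsto_sum_nat
  have key : ∀ N, ∑ n ∈ range N, Ht n s =
      (s - 1) * ∑ n ∈ range (N + 1), LSeries.term 1 s n - 1 + ((N + 1 : ℕ) : ℂ) ^ (-(s - 1)) := by
    intro N
    induction N with
    | zero => simp
    | succ N ih =>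
      rw [sum_range_succ, ih, sum_range_succ _ (N + 1), Ht, LSeries.term_of_ne_zero (by omega)]
      rw [neg_sub, Complex.cpow_neg, Pi.one_apply, one_div]; push_cast; ring
  have t3 : Tendsto (fun N : ℕ => ((N + 1 : ℕ) : ℂ) ^ (-(s - 1))) atTop (𝓝 0) := by
    rw [tendsto_zero_iff_norm_tendsto_zero]
    have := (tendsto_rpow_neg_atTop (show 0 < (s - 1).re by simpa using hs)).comp
        (tendsto_natCast_atTop_atTop (R := ℝ))
    refine (this.comp (tendsto_add_atTop_nat 1)).congr fun N => ?_
    rw [Complex.norm_natCast_cpow_of_pos (by omega), Complex.neg_re]; rfl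
  have t4 := (((t1.const_mul (s - 1)).sub_const 1).add t3)
  have := tendsto_nhds_unique t2 (by simpa only [key] using t4)
  rw [Hz, this]; ring

lemma zeta_le {s : ℂ} (hs : 1 < s.re) :
    ‖riemannZeta s‖ ≤ 1 / ‖s - 1‖ + ‖s‖ * Zc (1/2) := by
  have h1 := Hz_sub_one (show 1/2 ≤ s.re by linarith)
  have h0 : s - 1 ≠ 0 := by intro h; rw [sub_eq_zero] at h; rw [h] at hs; simp at hs
  have hp : 0 < ‖s - 1‖ := norm_pos_iff.2 h0
  have h2 : ‖s - 1‖ * ‖riemannZeta s‖ ≤ 1 + ‖s‖ * ‖s - 1‖ * Zc (1/2) := by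
    rw [← norm_mul, ← Hz_eq hs]
    calc ‖Hz s‖ = ‖1 + (Hz s - 1)‖ := by congr 1; ring
      _ ≤ ‖(1 : ℂ)‖ + ‖Hz s - 1‖ := norm_add_le _ _
      _ ≤ _ := by rw [norm_one]; linarith
  rw [← le_div_iff₀' hp] at h2
  refine h2.trans (le_of_eq ?_)
  field_simp

lemma triv_le (r : ℕ) [NeZero r] {η : ℝ} (h0 : 0 < η) (h1 : η ≤ 1 / 2) {s : ℂ} (hs : 1 < s.re) :
    ‖LSeries (fun n => (1 : DirichletCharacter ℂ r) n) s‖ ≤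
      1 / ‖s - 1‖ + ‖s‖ * (r : ℝ) ^ (2 * η) * (Zc (1/2) + Zc η) := by
  have hb := BS_triv r
  have h2 := Lc_le hb h0 h1 (show 1 - η ≤ s.re by linarith)
  rw [Lc_eq_LSeries hb hs] at h2
  have hr : (1 : ℝ) ≤ r := by exact_mod_cast NeZero.one_le (n := r)
  have hφ : (r.totient : ℝ) / r ≤ 1 := by
    rw [div_le_one (by linarith)]; exact_mod_cast Nat.totient_le r
  have hs1 : LSeriesSummable (fun n => (1 : DirichletCharacter ℂ r) n) s :=
    LSeriesSummable_of_bounded_of_one_lt_re (m := 1) (fun n _ => DirichletCharacter.norm_le_one _ _) hs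
  have hs2 : LSeriesSummable (1 : ℕ → ℂ) s := LSeriesSummable_one_iff.2 hs
  have e : LSeries (fun n => (1 : DirichletCharacter ℂ r) n - (r.totient / r : ℝ)) s =
      LSeries (fun n => (1 : DirichletCharacter ℂ r) n) s - (r.totient / r : ℝ) * riemannZeta s := by
    rw [← LSeries_one_eq_riemannZeta hs, ← LSeries_smul, ← LSeries_sub hs1 (hs2.smul _)]
    congr 1; ext n; simp
  rw [e] at h2
  have h3 := zeta_le hs
  have h4 : ‖((r.totient / r : ℝ) : ℂ) * riemannZeta s‖ ≤ ‖riemannZeta s‖ := by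
    rw [norm_mul, Complex.norm_real, Real.norm_of_nonneg (by positivity)]
    exact mul_le_of_le_one_left (norm_nonneg _) hφ
  have h5 := norm_le_norm_sub_add (LSeries (fun n => (1 : DirichletCharacter ℂ r) n) s)
    (((r.totient / r : ℝ) : ℂ) * riemannZeta s)
  have h6 : ‖s‖ * Zc (1/2) ≤ ‖s‖ * (r : ℝ) ^ (2 * η) * Zc (1/2) := by
    have a := Real.one_le_rpow hr (show 0 ≤ 2 * η by linarith)
    have b := Zc_pos (show (0:ℝ) < 1/2 by norm_num)
    have : ‖s‖ * 1 ≤ ‖s‖ * (r : ℝ) ^ (2 * η) := by gcongr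
    rw [mul_one] at this
    gcongr
  rw [mul_add]
  linarith
end MG

namespace MG
open Finset Filter Topology

/-- the basic analytic bounds at height `ℓ = log x` -/
structure AB (B η ℓ : ℝ) : Prop where
  V_large : 10000 ≤ ℓ ^ (1/20 : ℝ)
  eta : ((ℓ ^ (1/20 : ℝ)) ^ 10)⁻¹ < η / 2
  T_large : 1 ≤ Real.log ℓ
  one_le : 1 ≤ ℓ
  bd : ∀ r : ℕ, (r : ℝ) ≤ ℓ ^ B → ∀ f, BS f r → ∀ s : ℂ, 1 - η / 2 < s.re → s.re ≤ 2 →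
    |s.im| ≤ 2 * Real.log ℓ → ‖Lc f s‖ ≤ ℓ ^ (1/20 : ℝ) ∧ ‖deriv (Lc f) s‖ ≤ ℓ ^ (1/20 : ℝ)
  triv : ∀ (r : ℕ) [NeZero r], (r : ℝ) ≤ ℓ ^ B → ∀ s : ℂ, 1 < s.re → s.re ≤ 2 →
    |s.im| ≤ 2 * Real.log ℓ →
    ‖LSeries (fun n => (1 : DirichletCharacter ℂ r) n) s‖ ≤ 1 / ‖s - 1‖ + ℓ ^ (1/20 : ℝ)

lemma ev_AB (B : ℝ) (hB : 1 ≤ B) : ∀ᶠ ℓ in atTop, AB B (1 / (80 * B)) ℓ := by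
  set η : ℝ := 1 / (80 * B) with hη
  have h0 : 0 < η := by positivity
  have h1 : η ≤ 1 / 2 := by
    rw [hη]; apply one_div_le_one_div_of_le <;> linarith
  set C : ℝ := (Zc (1/2) + Zc η) / (η / 2) with hC
  have z1 := Zc_pos (show (0:ℝ) < 1/2 by norm_num)
  have z2 := Zc_pos h0
  have hC0 : 0 < C := by positivity
  have tV : Tendsto (fun ℓ : ℝ => ℓ ^ (1/20 : ℝ)) atTop atTop := tendsto_rpow_atTop (by norm_num)
  have tT : Tendsto Real.log atTop atTop := Real.tendsto_log_atTop
  have l1 : ∀ᶠ ℓ in atTop, Real.log ℓ ≤ (1 / (6 * C)) * ℓ ^ (1/40 : ℝ) := by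
    have := (isLittleO_log_rpow_atTop (show (0:ℝ) < 1/40 by norm_num)).def
      (show 0 < 1 / (6 * C) by positivity)
    filter_upwards [this, tT.eventually_ge_atTop 0, eventually_ge_atTop 0] with ℓ h hh h3
    rwa [Real.norm_of_nonneg hh, Real.norm_of_nonneg (by positivity)] at h
  have l2 : ∀ᶠ ℓ in atTop, ((ℓ ^ (1/20 : ℝ)) ^ 10)⁻¹ < η / 2 := by
    have := (tendsto_inv_atTop_zero.comp ((tendsto_pow_atTop (n := 10) (by norm_num)).comp tV))
    exact this.eventually_lt_const (by positivity)
  filter_upwards [tV.eventually_ge_atTop 10000, tT.eventually_ge_atTop 4, l1, l2,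
    eventually_ge_atTop 1] with ℓ a1 a2 a3 a4 a5
  set T := Real.log ℓ
  have hℓ0 : 0 < ℓ := by linarith
  have main : (3 * T) * ℓ ^ (1/40 : ℝ) * C ≤ ℓ ^ (1/20 : ℝ) := by
    have e : ℓ ^ (1/20 : ℝ) = ℓ ^ (1/40 : ℝ) * ℓ ^ (1/40 : ℝ) := by
      rw [← Real.rpow_add hℓ0]; norm_num
    have hp : 0 < ℓ ^ (1/40 : ℝ) := by positivity
    rw [e]
    calc _ ≤ (3 * ((1 / (6 * C)) * ℓ ^ (1/40 : ℝ))) * ℓ ^ (1/40 : ℝ) * C := by gcongr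
      _ = (1 / 2) * (ℓ ^ (1/40 : ℝ) * ℓ ^ (1/40 : ℝ)) := by field_simp; norm_num
      _ ≤ _ := by nlinarith
  have hr : ∀ r : ℕ, (r : ℝ) ≤ ℓ ^ B → (r : ℝ) ^ (2 * η) ≤ ℓ ^ (1/40 : ℝ) := by
    intro r hr
    calc (r : ℝ) ^ (2 * η) ≤ (ℓ ^ B) ^ (2 * η) := by gcongr
      _ = ℓ ^ (B * (2 * η)) := by rw [Real.rpow_mul hℓ0.le]
      _ = _ := by congr 1; rw [hη]; field_simp; norm_num
  have hsn : ∀ s : ℂ, 0 ≤ s.re → s.re ≤ 2 → |s.im| ≤ 2 * T → ‖s‖ + 1 ≤ 3 * T := by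
    intro s s1 s2 s3
    have := Complex.norm_le_abs_re_add_abs_im s
    rw [abs_of_nonneg s1] at this
    linarith
  have hCη : Zc (1/2) + Zc η = C * (η / 2) := by rw [hC]; field_simp
  refine ⟨a1, a4, by linarith, a5, ?_, ?_⟩
  · intro r hrB f hf s s1 s2 s3
    have b1 := hsn s (by linarith) s2 s3
    have b2 := hr r hrB
    constructor
    · refine (Lc_le hf h0 h1 (by linarith)).trans (le_trans ?_ main)
      have : Zc η ≤ C := by
        have : C * (η / 2) ≤ C * 1 := by gcongr; linarith
        linarith
      gcongr; linarith
    · refine (Lc_deriv_le hf h0 h1 (by linarith)).trans (le_trans ?_ main)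
      have : Zc η / (η / 2) ≤ C := by rw [hC]; gcongr; linarith
      rw [mul_div_assoc]
      gcongr
  · intro r _ hrB s s1 s2 s3
    have b1 := hsn s (by linarith) s2 s3
    have b2 := hr r hrB
    refine (triv_le r h0 h1 s1).trans (add_le_add_right ?_ _)
    refine le_trans ?_ main
    have : Zc (1/2) + Zc η ≤ C := by
      have : C * (η / 2) ≤ C * 1 := by gcongr; linarith
      linarith
    gcongr
    linarith

lemma low1 {V a y b : ℝ} (hV : 10000 ≤ V) (ha0 : 0 ≤ a) (ha : a ≤ 2 * V ^ 10) (hb0 : 0 ≤ b)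
    (hb : b ≤ 2 * V ^ 5) (hy : 0 ≤ y) (h : 1 ≤ a ^ 3 * y ^ 4 * b) : 3 * (V ^ 9)⁻¹ ≤ y := by
  by_contra hcon
  push Not at hcon
  have hV0 : 0 < V := by linarith
  have h1 : a ^ 3 * y ^ 4 * b ≤ (2 * V ^ 10) ^ 3 * (3 * (V ^ 9)⁻¹) ^ 4 * (2 * V ^ 5) := by gcongr
  have e : (2 * V ^ 10) ^ 3 * (3 * (V ^ 9)⁻¹) ^ 4 * (2 * V ^ 5) = 1296 * V⁻¹ := by
    field_simp; norm_num
  have : V⁻¹ ≤ 10000⁻¹ := by gcongr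
  rw [e] at h1
  linarith

lemma low2 {V a y b : ℝ} (hV : 10000 ≤ V) (ha0 : 0 ≤ a) (ha : a ≤ 2 * V ^ 10) (hb0 : 0 ≤ b)
    (hb : b ≤ 2 * V) (hy : 0 ≤ y) (h : 1 ≤ a ^ 3 * y ^ 4 * b) : (V ^ 8)⁻¹ ≤ y := by
  by_contra hcon
  push Not at hcon
  have hV0 : 0 < V := by linarith
  have h1 : a ^ 3 * y ^ 4 * b ≤ (2 * V ^ 10) ^ 3 * ((V ^ 8)⁻¹) ^ 4 * (2 * V) := by gcongr
  have e : (2 * V ^ 10) ^ 3 * ((V ^ 8)⁻¹) ^ 4 * (2 * V) = 16 * V⁻¹ := by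
    field_simp; norm_num
  have : V⁻¹ ≤ 10000⁻¹ := by gcongr
  rw [e] at h1
  linarith

/-- mean value in a convex set -/
lemma mv_re {L : ℂ → ℂ} {V : ℝ} {U : Set ℂ} (hU : Convex ℝ U)
    (hd : ∀ z ∈ U, DifferentiableAt ℂ L z) (hb : ∀ z ∈ U, ‖deriv L z‖ ≤ V) {z w : ℂ}
    (hz : z ∈ U) (hw : w ∈ U) : ‖L z‖ - V * ‖w - z‖ ≤ ‖L w‖ := by
  have := Convex.norm_image_sub_le_of_norm_deriv_le (𝕜 := ℂ) hd hb hU hz hw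
  have h2 := norm_sub_norm_le (L z) (L w)
  rw [norm_sub_rev] at h2
  linarith

lemma box_convex (a b c d : ℝ) : Convex ℝ {z : ℂ | a < z.re ∧ z.re ≤ b ∧ |z.im| ≤ d} := by
  have h1 : Convex ℝ {z : ℂ | a < z.re} := convex_halfSpace_re_gt a
  have h2 : Convex ℝ {z : ℂ | z.re ≤ b} := convex_halfSpace_re_le b
  have h3 : Convex ℝ {z : ℂ | z.im ≤ d} := convex_halfSpace_im_le d
  have h4 : Convex ℝ {z : ℂ | -d ≤ z.im} := convex_halfSpace_im_ge (-d)
  convert h1.inter (h2.inter (h3.inter h4)) using 1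
  ext z; simp [abs_le]; tauto

theorem L_lower {B η ℓ : ℝ} (hη0 : 0 < η) (hη1 : η ≤ 1/2) (hAB : AB B η ℓ) {r : ℕ} [NeZero r]
    (hr : (r : ℝ) ≤ ℓ ^ B)
    {χ : DirichletCharacter ℂ r} (hχ : χ ≠ 1)
    (hgood : χ ^ 2 = 1 → ((ℓ ^ (1/20 : ℝ)) ^ 3)⁻¹ ≤ ‖Lc (fun n => χ n) 1‖) {s : ℂ}
    (hs : |s.re - 1| ≤ ((ℓ ^ (1/20 : ℝ)) ^ 10)⁻¹) (hT : |s.im| ≤ Real.log ℓ) :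
    ((ℓ ^ (1/20 : ℝ)) ^ 9)⁻¹ ≤ ‖Lc (fun n => χ n) s‖ := by
  set V := ℓ ^ (1/20 : ℝ) with hV
  have hVl := hAB.V_large
  rw [← hV] at hVl
  have hV0 : 0 < V := by linarith
  set u := (V ^ 10)⁻¹ with hu
  have hu0 : 0 < u := by positivity
  have hue := hAB.eta
  rw [← hV, ← hu] at hue
  have hbs := BS_char hχ
  set L := Lc (fun n => χ n) with hL
  set U := {z : ℂ | 1 - η / 2 < z.re ∧ z.re ≤ 2 ∧ |z.im| ≤ Real.log ℓ} with hU
  have hUc : Convex ℝ U := box_convex _ _ 0 _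
  have hT1 := hAB.T_large
  have hd : ∀ z ∈ U, DifferentiableAt ℂ L z := fun z hz =>
    (Lc_diff hbs hη0 hη1).differentiableAt ((isOpen_lt continuous_const
      Complex.continuous_re).mem_nhds (show 1 - η < z.re by linarith [hz.1]))
  have hb : ∀ z ∈ U, ‖deriv L z‖ ≤ V := fun z hz =>
    (hAB.bd r hr _ hbs z hz.1 hz.2.1 (by linarith [hz.2.2])).2
  have hs2 := abs_le.1 hs
  have hsU : s ∈ U := ⟨by linarith, by linarith, hT⟩
  have hVle : ∀ n m : ℕ, n ≤ m → (V ^ m)⁻¹ ≤ (V ^ n)⁻¹ := fun n m h => by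
    gcongr
    linarith
  by_cases hnear : χ ^ 2 = 1 ∧ |s.im| ≤ (V ^ 5)⁻¹
  · have h1U : (1 : ℂ) ∈ U := ⟨by simp; linarith, by simp, by simp; linarith⟩
    have := mv_re hUc hd hb h1U hsU
    have g := hgood hnear.1
    have n1 : ‖s - 1‖ ≤ u + (V ^ 5)⁻¹ := by
      refine (Complex.norm_le_abs_re_add_abs_im _).trans ?_
      simp only [Complex.sub_re, Complex.one_re, Complex.sub_im, Complex.one_im, sub_zero]
      exact add_le_add hs hnear.2
    have n2 : u ≤ (V ^ 5)⁻¹ := hVle 5 10 (by norm_num)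
    have n3 : V * ‖s - 1‖ ≤ V * (2 * (V ^ 5)⁻¹) := by gcongr; linarith
    have n4 : V * (2 * (V ^ 5)⁻¹) = 2 * V⁻¹ * (V ^ 3)⁻¹ := by field_simp
    have n5 : V⁻¹ ≤ 10000⁻¹ := by gcongr
    have n6 : (V ^ 9)⁻¹ = (V ^ 6)⁻¹ * (V ^ 3)⁻¹ := by rw [← mul_inv]; congr 1; ring
    have n7 : (V ^ 6)⁻¹ ≤ V⁻¹ := by simpa using hVle 1 6 (by norm_num)
    have n8 : 0 < (V ^ 3)⁻¹ := by positivity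
    have n9 : 2 * V⁻¹ * (V ^ 3)⁻¹ ≤ (1/2) * (V ^ 3)⁻¹ := by gcongr; linarith
    have n10 : (V ^ 9)⁻¹ ≤ (1/2) * (V ^ 3)⁻¹ := by rw [n6]; gcongr; linarith
    linarith
  · set w : ℂ := 1 + u + Complex.I * s.im with hw
    have wre : w.re = 1 + u := by simp [hw]
    have wim : w.im = s.im := by simp [hw]
    have hwU : w ∈ U := ⟨by rw [wre]; linarith, by rw [wre]; linarith, by rw [wim]; exact hT⟩
    have := mv_re hUc hd hb hwU hsU
    have p := DirichletCharacter.norm_LSeries_product_ge_one (N := r) χ hu0 s.im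
    rw [norm_mul, norm_mul, norm_pow, norm_pow] at p
    have hw1 : 1 < w.re := by rw [wre]; linarith
    have eχ : LSeries (fun n => χ n) (1 + u + Complex.I * s.im) = L w := (Lc_eq_LSeries hbs hw1).symm
    have hu1 : u ≤ 1 := by
      have := hVle 0 10 (by norm_num)
      simpa using this
    have hT0 : |s.im| ≤ 2 * Real.log ℓ := by linarith
    have hVu : V ≤ u⁻¹ := by
      rw [hu, inv_inv]; exact le_self_pow₀ (by linarith) (by norm_num)
    have key := low1 (V := V) (y := ‖L w‖) hVl
      (norm_nonneg (LSeries (fun n => (1 : DirichletCharacter ℂ r) n) (1 + u))) (by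
        have := hAB.triv r hr (1 + u) (by simpa using hu0) (by simpa using by linarith) (by simp; linarith)
        refine this.trans ?_
        rw [add_sub_cancel_left, Complex.norm_real, Real.norm_of_nonneg hu0.le, one_div]
        have : u⁻¹ = V ^ 10 := by rw [hu, inv_inv]
        rw [← this, ← hV]; linarith)
      (norm_nonneg (LSeries (fun n => (χ ^ 2) n) (1 + u + 2 * Complex.I * s.im)))
      (by
        set z : ℂ := 1 + u + 2 * Complex.I * s.im with hz
        have zre : z.re = 1 + u := by simp [hz]
        have zim : z.im = 2 * s.im := by simp [hz]
        have zi : |z.im| ≤ 2 * Real.log ℓ := by rw [zim, abs_mul, abs_two]; linarith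
        have hz1 : 1 < z.re := by rw [zre]; linarith
        have hV5 : V ≤ V ^ 5 := le_self_pow₀ (by linarith) (by norm_num)
        by_cases h2 : χ ^ 2 = 1
        · rw [h2]
          have hfar : (V ^ 5)⁻¹ ≤ |s.im| := by
            by_contra hc; exact hnear ⟨h2, (not_le.1 hc).le⟩
          refine (hAB.triv r hr z hz1 (by rw [zre]; linarith) zi).trans ?_
          have : |z.im| ≤ ‖z - 1‖ := by
            have := Complex.abs_im_le_norm (z - 1); simpa using this
          rw [zim, abs_mul, abs_two] at this
          have h3 : 1 / ‖z - 1‖ ≤ 1 / (V ^ 5)⁻¹ := by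
            gcongr
            have : 0 ≤ |s.im| := abs_nonneg _
            linarith
          rw [one_div, one_div, inv_inv] at h3
          rw [one_div, ← hV]
          linarith
        · have hbs2 := BS_char h2
          have := (hAB.bd r hr _ hbs2 z (by rw [zre]; linarith) (by rw [zre]; linarith) zi).1
          rw [Lc_eq_LSeries hbs2 hz1] at this
          refine this.trans ?_
          rw [← hV]; linarith)
      (norm_nonneg _) (by
        rw [← eχ]
        exact p)
    have n1 : ‖s - w‖ ≤ 2 * u := by
      refine (Complex.norm_le_abs_re_add_abs_im _).trans ?_
      simp only [Complex.sub_re, Complex.sub_im, wre, wim, sub_self, abs_zero, add_zero]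
      rw [abs_le]; constructor <;> linarith
    have n2 : V * ‖s - w‖ ≤ V * (2 * u) := by gcongr
    have n3 : V * (2 * u) = 2 * (V ^ 9)⁻¹ := by rw [hu]; field_simp
    linarith
end MG

namespace MG
open Finset Filter Topology

lemma fac_le {z a b : ℂ} (hz : ∃ t : ℝ, 0 ≤ t ∧ t ≤ 1 ∧ z = t) (ha : a = 0 ∨ a = 1 ∨ a = -1)
    (hb : b = 0 ∨ b = 1 ∨ b = -1) :
    ‖(1 - 1 * z) * (1 - a * z) * ((1 - b * z) * (1 - a * b * z))‖ ≤ 1 := by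
  obtain ⟨t, t0, t1, rfl⟩ := hz
  have n1 : ‖(1 : ℂ) - t‖ = 1 - t := by
    rw [← Complex.ofReal_one, ← Complex.ofReal_sub, Complex.norm_real, Real.norm_of_nonneg (by linarith)]
  have n2 : ‖(1 : ℂ) + t‖ = 1 + t := by
    rw [← Complex.ofReal_one, ← Complex.ofReal_add, Complex.norm_real, Real.norm_of_nonneg (by linarith)]
  have h3 : (1 - t) ≤ 1 := by linarith
  have h4 : 0 ≤ 1 - t := by linarith
  have h5 : (1 - t) * (1 + t) ≤ 1 := by nlinarith
  have h5' : 0 ≤ (1 - t) * (1 + t) := by positivity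
  have h6 : (1 - t) * (1 - t) ≤ 1 := mul_le_one₀ h3 h4 h3
  have h7 : ((1 - t) * (1 + t)) * ((1 - t) * (1 + t)) ≤ 1 := mul_le_one₀ h5 h5' h5
  have h8 : ((1 - t) * (1 - t)) * ((1 - t) * (1 - t)) ≤ 1 := mul_le_one₀ h6 (by positivity) h6
  rcases ha with rfl | rfl | rfl <;> rcases hb with rfl | rfl | rfl <;>
    simp only [norm_mul, zero_mul, mul_zero, one_mul, mul_one, neg_mul, neg_neg, sub_neg_eq_add, n1, n2,
      sub_zero] <;> linarith

lemma quad_val {r : ℕ} {χ : DirichletCharacter ℂ r} (h : χ ^ 2 = 1) (a : ZMod r) :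
    χ a = 0 ∨ χ a = 1 ∨ χ a = -1 := by
  by_cases ha : IsUnit a
  · right
    have : (χ ^ 2) a = 1 := by rw [h, MulChar.one_apply ha]
    rw [MulChar.pow_apply' _ two_ne_zero] at this
    simpa using this
  · left; exact χ.map_nonunit ha

theorem euler_ge_one {r₁ r₂ N : ℕ} {χ₁ : DirichletCharacter ℂ r₁} {χ₂ : DirichletCharacter ℂ r₂}
    {ψ : DirichletCharacter ℂ N} (h1 : χ₁ ^ 2 = 1) (h2 : χ₂ ^ 2 = 1)
    (hψ : ∀ p : ℕ, p.Prime → ψ p = χ₁ p * χ₂ p) {v : ℝ} (hv : 0 < v) :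
    1 ≤ ‖LSeries (fun n => (1 : DirichletCharacter ℂ 1) n) (1 + v)‖ * ‖LSeries (fun n => χ₁ n) (1 + v)‖ *
      (‖LSeries (fun n => χ₂ n) (1 + v)‖ * ‖LSeries (fun n => ψ n) (1 + v)‖) := by
  have hs : 1 < (1 + v : ℂ).re := by simpa using hv
  have P := ((DirichletCharacter.LSeries_eulerProduct_hasProd (1 : DirichletCharacter ℂ 1) hs).mul
    (DirichletCharacter.LSeries_eulerProduct_hasProd χ₁ hs)).mul
    ((DirichletCharacter.LSeries_eulerProduct_hasProd χ₂ hs).mul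
    (DirichletCharacter.LSeries_eulerProduct_hasProd ψ hs))
  have P2 := (continuous_norm.tendsto _).comp P
  rw [← norm_mul, ← norm_mul, ← norm_mul]
  refine ge_of_tendsto' P2 (fun S => ?_)
  simp only [Function.comp]
  rw [norm_prod]
  refine Finset.one_le_prod (fun p _ => ?_)
  have hp := p.2
  have hp1 : (1:ℝ) ≤ (p : ℕ) := by exact_mod_cast hp.one_lt.le
  have hz : ∃ t : ℝ, 0 ≤ t ∧ t ≤ 1 ∧ ((p : ℕ) : ℂ) ^ (-(1 + v : ℂ)) = t := by
    refine ⟨((p : ℕ) : ℝ) ^ (-(1 + v)), by positivity,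
      Real.rpow_le_one_of_one_le_of_nonpos hp1 (by linarith), ?_⟩
    rw [Complex.ofReal_cpow (by positivity)]
    push_cast; rfl
  have := fac_le hz (quad_val h1 ((p : ℕ) : ZMod r₁)) (quad_val h2 ((p : ℕ) : ZMod r₂))
  have e1 : (1 : DirichletCharacter ℂ 1) ((p : ℕ) : ZMod 1) = 1 := by
    rw [Subsingleton.elim ((p : ℕ) : ZMod 1) 1, map_one]
  rw [hψ _ hp, e1, ← mul_inv, ← mul_inv, ← mul_inv, norm_inv]
  refine (one_le_inv₀ ?_).2 this
  have hz2 : ∀ {n : ℕ} (χ : DirichletCharacter ℂ n), 1 - χ (p : ℕ) * ((p : ℕ) : ℂ) ^ (-(1 + v : ℂ)) ≠ 0 := by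
    intro n χ h0
    have : ‖χ (p : ℕ) * ((p : ℕ) : ℂ) ^ (-(1 + v : ℂ))‖ < 1 := by
      rw [norm_mul, Complex.norm_natCast_cpow_of_pos hp.pos]
      calc _ ≤ 1 * ((p : ℕ) : ℝ) ^ (-(1 + v : ℂ)).re := by gcongr; exact χ.norm_le_one _
        _ < 1 := by
          rw [one_mul]
          apply Real.rpow_lt_one_of_one_lt_of_neg (by exact_mod_cast hp.one_lt)
          simp; linarith
    rw [← sub_eq_zero.1 h0] at this
    simp at this
  have k1 := hz2 (1 : DirichletCharacter ℂ 1)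
  rw [e1] at k1
  have k4 := hz2 ψ
  rw [hψ _ hp] at k4
  exact norm_pos_iff.2 (mul_ne_zero (mul_ne_zero k1 (hz2 _)) (mul_ne_zero (hz2 _) k4))

theorem repulsion {B η ℓ : ℝ} (hB : 0 ≤ B) (hη0 : 0 < η) (hη1 : η ≤ 1/2) (hAB : AB (2 * B) η ℓ)
    {r₁ r₂ : ℕ} [NeZero r₁] [NeZero r₂] (hr₁ : (r₁ : ℝ) ≤ ℓ ^ B) (hr₂ : (r₂ : ℝ) ≤ ℓ ^ B)
    {χ₁ : DirichletCharacter ℂ r₁} {χ₂ : DirichletCharacter ℂ r₂} (p1 : χ₁.IsPrimitive)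
    (p2 : χ₂.IsPrimitive) (n1 : χ₁ ≠ 1) (n2 : χ₂ ≠ 1) (h1 : χ₁ ^ 2 = 1) (h2 : χ₂ ^ 2 = 1)
    (b1 : ‖Lc (fun n => χ₁ n) 1‖ ≤ 2 * ((ℓ ^ (1/20 : ℝ)) ^ 3)⁻¹)
    (b2 : ‖Lc (fun n => χ₂ n) 1‖ ≤ 2 * ((ℓ ^ (1/20 : ℝ)) ^ 3)⁻¹) :
    ‖Lc (fun n => χ₁ n) 1‖ = ‖Lc (fun n => χ₂ n) 1‖ := by
  have : NeZero (r₁ * r₂) := ⟨mul_ne_zero (NeZero.ne _) (NeZero.ne _)⟩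
  set ψ₁ := χ₁.changeLevel (dvd_mul_right r₁ r₂) with hψ₁
  set ψ₂ := χ₂.changeLevel (dvd_mul_left r₂ r₁) with hψ₂
  by_cases hψ : ψ₁ * ψ₂ = 1
  · have e2 : ψ₂ * ψ₂ = 1 := by
      rw [hψ₂, ← map_mul, ← sq, h2, map_one]
    have e : ψ₁ = ψ₂ := by
      rw [← mul_one ψ₁, ← e2, ← mul_assoc, hψ, one_mul]
    have c1 := DirichletCharacter.conductor_changeLevel χ₁ (dvd_mul_right r₁ r₂)
    have c2 := DirichletCharacter.conductor_changeLevel χ₂ (dvd_mul_left r₂ r₁)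
    rw [← hψ₁, p1] at c1
    rw [← hψ₂, p2, ← e, c1] at c2
    subst c2
    have : χ₁ = χ₂ := DirichletCharacter.changeLevel_injective _ e
    rw [this]
  exfalso
  set V := ℓ ^ (1/20 : ℝ) with hV
  have hVl := hAB.V_large
  rw [← hV] at hVl
  have hV0 : 0 < V := by linarith
  set v := (V ^ 4)⁻¹ with hv
  have hv0 : 0 < v := by positivity
  have hv1 : v ≤ 1 := by rw [hv]; exact inv_le_one_of_one_le₀ (one_le_pow₀ (by linarith))
  have hℓ1 := hAB.one_le
  have hle : ℓ ^ B ≤ ℓ ^ (2 * B) := Real.rpow_le_rpow_of_exponent_le hℓ1 (by linarith)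
  have hone : 1 ≤ ℓ ^ (2 * B) := Real.one_le_rpow hℓ1 (by linarith)
  have hs1 : 1 < (1 + v : ℂ).re := by simpa using hv0
  have hs2 : (1 + v : ℂ).re ≤ 2 := by simp; linarith
  have hT := hAB.T_large
  have hs3 : |(1 + v : ℂ).im| ≤ 2 * Real.log ℓ := by simp; linarith
  have key := euler_ge_one (ψ := ψ₁ * ψ₂) h1 h2 (by
    intro p hp
    by_cases hu : IsUnit ((p : ℕ) : ZMod (r₁ * r₂))
    · rw [MulChar.mul_apply, hψ₁, hψ₂]
      have := DirichletCharacter.changeLevel_eq_cast_of_dvd χ₁ (dvd_mul_right r₁ r₂) hu.unit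
      have t2 := DirichletCharacter.changeLevel_eq_cast_of_dvd χ₂ (dvd_mul_left r₂ r₁) hu.unit
      rw [IsUnit.unit_spec] at this t2
      rw [this, t2, ZMod.cast_natCast (dvd_mul_right r₁ r₂), ZMod.cast_natCast (dvd_mul_left r₂ r₁)]
    · rw [MulChar.map_nonunit _ hu]
      rw [ZMod.isUnit_iff_coprime, Nat.coprime_mul_iff_right] at hu
      symm
      rw [mul_eq_zero]
      by_contra hc
      push Not at hc
      apply hu
      constructor
      · rw [← ZMod.isUnit_iff_coprime]; by_contra h; exact hc.1 (χ₁.map_nonunit h)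
      · rw [← ZMod.isUnit_iff_coprime]; by_contra h; exact hc.2 (χ₂.map_nonunit h)) hv0
  set U := {z : ℂ | 1 - η / 2 < z.re ∧ z.re ≤ 2 ∧ |z.im| ≤ Real.log ℓ} with hU
  have hUc : Convex ℝ U := box_convex _ _ 0 _
  have h1U : (1 : ℂ) ∈ U := ⟨by simp; linarith, by simp, by simp; linarith⟩
  have h2U : (1 + v : ℂ) ∈ U := ⟨by linarith, hs2, by simp; linarith⟩
  have bL : ∀ (r : ℕ) [NeZero r], (r : ℝ) ≤ ℓ ^ B → ∀ χ : DirichletCharacter ℂ r, χ ≠ 1 →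
      ‖Lc (fun n => χ n) 1‖ ≤ 2 * (V ^ 3)⁻¹ → ‖LSeries (fun n => χ n) (1 + v)‖ ≤ 3 * (V ^ 3)⁻¹ := by
    intro r _ hr χ hχ hb
    have hbs := BS_char hχ
    have := mv_re (L := Lc (fun n => χ n)) (V := V) hUc (fun z hz =>
      (Lc_diff hbs hη0 hη1).differentiableAt ((isOpen_lt continuous_const
      Complex.continuous_re).mem_nhds (show 1 - η < z.re by linarith [hz.1])))
      (fun z hz => (hAB.bd r (hr.trans hle) _ hbs z hz.1 hz.2.1 (by linarith [hz.2.2])).2) h2U h1U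
    rw [Lc_eq_LSeries hbs hs1] at this
    have e : V * ‖(1 : ℂ) - (1 + v)‖ = (V ^ 3)⁻¹ := by
      rw [sub_add_cancel_left, norm_neg, Complex.norm_real, Real.norm_of_nonneg hv0.le, hv]
      field_simp
    rw [e] at this
    linarith
  have a1 := bL r₁ hr₁ χ₁ n1 b1
  have a2 := bL r₂ hr₂ χ₂ n2 b2
  have hbs3 := BS_char hψ
  have a3 := (hAB.bd (r₁ * r₂) (by
    push_cast
    calc (r₁ : ℝ) * r₂ ≤ ℓ ^ B * ℓ ^ B := by gcongr
      _ = ℓ ^ (2 * B) := by rw [← Real.rpow_add (by linarith)]; congr 1; ring) _ hbs3 (1 + v)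
    (by linarith) hs2 hs3).1
  rw [Lc_eq_LSeries hbs3 hs1, ← hV] at a3
  have a4 := hAB.triv 1 (by simpa using hone) (1 + v) hs1 hs2 hs3
  rw [add_sub_cancel_left, Complex.norm_real, Real.norm_of_nonneg hv0.le, one_div, hv, inv_inv, ← hV, ← hv] at a4
  have a5 : V ≤ V ^ 4 := le_self_pow₀ (by linarith) (by norm_num)
  have fin : (1:ℝ) ≤ (2 * V ^ 4) * (3 * (V ^ 3)⁻¹) * ((3 * (V ^ 3)⁻¹) * V) := by
    refine key.trans ?_
    gcongr
    linarith
  have e : (2 * V ^ 4) * (3 * (V ^ 3)⁻¹) * ((3 * (V ^ 3)⁻¹) * V) = 18 * V⁻¹ := by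
    field_simp; norm_num
  have : V⁻¹ ≤ 10000⁻¹ := by gcongr
  rw [e] at fin
  linarith

lemma Lc_one_ne {r : ℕ} [NeZero r] {χ : DirichletCharacter ℂ r} (hχ : χ ≠ 1) :
    Lc (fun n => χ n) 1 ≠ 0 := by
  have hbs := BS_char hχ
  have c1 : ContinuousAt (Lc (fun n => χ n)) 1 :=
    ((Lc_diff hbs (show (0:ℝ) < 1/2 by norm_num) le_rfl).differentiableAt ((isOpen_lt continuous_const
      Complex.continuous_re).mem_nhds (by simp))).continuousAt
  have c2 : ContinuousAt (χ.LFunction) 1 := (DirichletCharacter.differentiable_LFunction hχ).continuous.continuousAt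
  have t : Tendsto (fun v : ℝ => (1 + v : ℂ)) (𝓝[>] 0) (𝓝 1) := by
    have : Continuous (fun v : ℝ => (1 + v : ℂ)) := by fun_prop
    have := this.tendsto 0
    simp at this
    exact this.mono_left nhdsWithin_le_nhds
  have : Lc (fun n => χ n) 1 = χ.LFunction 1 := by
    refine tendsto_nhds_unique_of_eventuallyEq (c1.tendsto.comp t) (c2.tendsto.comp t) ?_
    filter_upwards [self_mem_nhdsWithin] with v hv
    have hs : 1 < (1 + v : ℂ).re := by simpa using hv
    simp only [Function.comp]
    rw [Lc_eq_LSeries hbs hs, DirichletCharacter.LFunction_eq_LSeries _ hs]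
  rw [this]
  exact DirichletCharacter.LFunction_apply_one_ne_zero hχ

/-- no exceptional characters -/
def Good (B ℓ : ℝ) : Prop := ∀ (r : ℕ) [NeZero r], (r : ℝ) ≤ ℓ ^ B → ∀ χ : DirichletCharacter ℂ r,
  χ ≠ 1 → χ.IsPrimitive → χ ^ 2 = 1 → ((ℓ ^ (1/20 : ℝ)) ^ 3)⁻¹ ≤ ‖Lc (fun n => χ n) 1‖

theorem freq_good (B : ℝ) (hB : 1 ≤ B) : ∃ᶠ ℓ in atTop, Good B ℓ := by
  intro hbad
  have hAB := ev_AB (2 * B) (by linarith)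
  obtain ⟨ℓ₀, h0⟩ := (eventually_atTop.1 (hbad.and hAB))
  have hη0 : 0 < 1 / (80 * (2 * B)) := by positivity
  have hη1 : 1 / (80 * (2 * B)) ≤ 1 / 2 := by
    apply one_div_le_one_div_of_le <;> linarith
  obtain ⟨g0, ab0⟩ := h0 ℓ₀ le_rfl
  unfold Good at g0
  push Not at g0
  obtain ⟨r₀, _, hr₀, χ₀, c1, c2, c3, c4⟩ := g0
  set a := ‖Lc (fun n => χ₀ n) 1‖ with ha
  have ha0 : 0 < a := norm_pos_iff.2 (Lc_one_ne c1)
  set ℓ₁ : ℝ := (2 / a) ^ (20/3 : ℝ) with hℓ₁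
  have e1 : (ℓ₁ ^ (1/20 : ℝ)) ^ 3 = 2 / a := by
    rw [hℓ₁, ← Real.rpow_natCast, ← Real.rpow_mul (by positivity), ← Real.rpow_mul (by positivity)]
    norm_num
  have hℓ0 := ab0.one_le
  have hle : ℓ₀ ≤ ℓ₁ := by
    by_contra hc
    push Not at hc
    have : (ℓ₁ ^ (1/20 : ℝ)) ^ 3 ≤ (ℓ₀ ^ (1/20 : ℝ)) ^ 3 := by
      gcongr
    rw [e1] at this
    have h3 : ((ℓ₀ ^ (1/20 : ℝ)) ^ 3)⁻¹ ≤ (2 / a)⁻¹ := by gcongr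
    rw [inv_div] at h3
    linarith
  obtain ⟨g1, ab1⟩ := h0 ℓ₁ hle
  unfold Good at g1
  push Not at g1
  obtain ⟨r₁, _, hr₁, χ₁, d1, d2, d3, d4⟩ := g1
  rw [e1, inv_div] at d4
  have := repulsion (by linarith) hη0 hη1 ab1 (hr₀.trans (by gcongr)) hr₁ c2 d2 c1 d1 c3 d3
    (by rw [e1, inv_div]; linarith) (by rw [e1, inv_div]; linarith)
  rw [← ha] at this
  linarith
end MG

namespace MG
open Finset Filter Topology MeasureTheory

/-- log-Gaussian weight, `l = log x` -/
noncomputable def gw (l : ℝ) (t : ℝ) : ℝ := Real.exp (-(Real.log t - l) ^ 2 / 2)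

noncomputable def Kf (l : ℝ) (s : ℂ) : ℂ := Complex.exp (s ^ 2 / 2 + l * s)

lemma Kf_diff (l : ℝ) : Differentiable ℂ (Kf l) := by unfold Kf; fun_prop

lemma Kf_norm (l σ t : ℝ) : ‖Kf l (σ + t * Complex.I)‖ = Real.exp (σ ^ 2 / 2 + l * σ) * Real.exp (-(1/2) * t ^ 2) := by
  rw [Kf, Complex.norm_exp, ← Real.exp_add]
  congr 1
  have : ((σ + t * Complex.I : ℂ)) ^ 2 / 2 + l * (σ + t * Complex.I) =
    ((σ ^ 2 / 2 + l * σ - t ^ 2 / 2 : ℝ) : ℂ) + ((σ * t + l * t : ℝ) : ℂ) * Complex.I := by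
    push_cast
    ring_nf
    rw [Complex.I_sq]; ring
  rw [this, Complex.add_re, Complex.ofReal_re, Complex.re_ofReal_mul]
  simp only [Complex.I_re]; ring

lemma mellin (l L σ : ℝ) :
    ∫ t : ℝ, Kf l (σ + t * Complex.I) * Complex.exp (-(σ + t * Complex.I) * L) =
      (Real.sqrt (2 * Real.pi) * Real.exp (-(L - l) ^ 2 / 2) : ℝ) := by
  have h := integral_cexp_quadratic (b := -(1/2)) (by norm_num) (Complex.I * (σ + l - L))
    (σ ^ 2 / 2 + l * σ - L * σ)
  have e : ∀ t : ℝ, Kf l (σ + t * Complex.I) * Complex.exp (-(σ + t * Complex.I) * L) =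
      Complex.exp (-(1/2) * t ^ 2 + Complex.I * (σ + l - L) * t + (σ ^ 2 / 2 + l * σ - L * σ)) := by
    intro t
    rw [Kf, ← Complex.exp_add]
    congr 1
    ring_nf
    rw [Complex.I_sq]; ring
  simp_rw [e]
  rw [h]
  push_cast
  congr 1
  · rw [Real.sqrt_eq_rpow, Complex.ofReal_cpow (by positivity)]
    congr 1
    · push_cast; ring
    · norm_num
  · congr 1
    ring_nf
    rw [Complex.I_sq]; ring

lemma gauss_int : Integrable (fun t : ℝ => Real.exp (-(1/2) * t ^ 2)) :=
  integrable_exp_neg_mul_sq (by norm_num)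

lemma gauss_val : ∫ t : ℝ, Real.exp (-(1/2) * t ^ 2) = Real.sqrt (2 * Real.pi) := by
  rw [integral_gaussian]; congr 1; ring

lemma sqrt2pi_le : Real.sqrt (2 * Real.pi) ≤ 3 := by
  rw [Real.sqrt_le_left (by norm_num)]
  have := Real.pi_lt_four
  nlinarith

lemma sqrt2pi_ge : 1 ≤ Real.sqrt (2 * Real.pi) := by
  rw [Real.one_le_sqrt]
  have := Real.pi_gt_three
  linarith

lemma exp_half_le : Real.exp (1/2) ≤ 2 := by
  have h5 : Real.exp (1/2) * Real.exp (1/2) = Real.exp 1 := by rw [← Real.exp_add]; norm_num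
  have h6 := Real.exp_one_lt_d9
  nlinarith [Real.exp_pos (1/2)]

theorem contour {l T u Bd M : ℝ} (a : ℕ → ℂ) (F : ℂ → ℂ) (hl : 1 ≤ l) (hu0 : 0 ≤ u) (hu1 : u ≤ 1)
    (hT : 0 ≤ T) (ha0 : a 0 = 0)
    (hsum : LSeriesSummable a ((1 + 1 / l : ℝ) : ℂ)) (hM : ∑' n, ‖LSeries.term a ((1 + 1 / l : ℝ) : ℂ) n‖ ≤ M)
    (hF : DifferentiableOn ℂ F (Set.uIcc (1 - u) (1 + 1 / l) ×ℂ Set.uIcc (-T) T))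
    (hFe : ∀ t : ℝ, F ((1 + 1 / l : ℝ) + t * Complex.I) = LSeries a ((1 + 1 / l : ℝ) + t * Complex.I))
    (hB : ∀ s ∈ Set.uIcc (1 - u) (1 + 1 / l) ×ℂ Set.uIcc (-T) T, ‖F s‖ ≤ Bd) :
    (Summable fun n : ℕ => a n * gw l n) ∧
    ‖∑' n : ℕ, a n * gw l n‖ ≤ 200 * Real.exp l * (M * Real.exp (-T ^ 2 / 4) + Bd * Real.exp (-T ^ 2 / 2)
      + Bd * T * Real.exp (-u * l)) := by
  set c : ℝ := 1 + 1 / l with hc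
  have hl0 : 0 < l := by linarith
  have hlc : l * c = l + 1 := by rw [hc]; field_simp
  have hc1 : 1 ≤ c := by rw [hc]; have : 0 < 1 / l := by positivity
                         linarith
  have hc2 : c ≤ 2 := by
    rw [hc]; have : 1 / l ≤ 1 := by rw [div_le_one hl0]; exact hl
    linarith
  have tn : ∀ n (t : ℝ), ‖LSeries.term a (c + t * Complex.I) n‖ = ‖LSeries.term a (c : ℂ) n‖ := by
    intro n t
    rw [LSeries.norm_term_eq, LSeries.norm_term_eq]; simp
  set Fn : ℕ → ℝ → ℂ := fun n t => LSeries.term a (c + t * Complex.I) n * Kf l (c + t * Complex.I) with hFn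
  set E : ℝ := Real.exp (c ^ 2 / 2 + l * c) with hE
  have hE0 : 0 < E := Real.exp_pos _
  have nK : ∀ t : ℝ, ‖Kf l (c + t * Complex.I)‖ = E * Real.exp (-(1/2) * t ^ 2) := fun t => Kf_norm l c t
  have nF : ∀ n t, ‖Fn n t‖ = ‖LSeries.term a (c : ℂ) n‖ * E * Real.exp (-(1/2) * t ^ 2) := by
    intro n t
    simp only [hFn]
    rw [norm_mul, tn, nK, mul_assoc]
  have contF : ∀ n, Continuous (Fn n) := by
    intro n
    rcases Nat.eq_zero_or_pos n with rfl | hn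
    · simp only [hFn, LSeries.term_zero, zero_mul]; exact continuous_const
    · simp only [hFn]
      refine Continuous.mul ?_ ((Kf_diff l).continuous.comp (by fun_prop))
      simp only [LSeries.term_of_ne_zero hn.ne']
      have hn' : ((n : ℕ) : ℂ) ≠ 0 := by exact_mod_cast hn.ne'
      refine continuous_const.div (Continuous.const_cpow (by fun_prop) (Or.inl hn')) (fun t => ?_)
      simp [Complex.cpow_eq_zero_iff, hn']
  have intF : ∀ n, Integrable (Fn n) := by
    intro n
    refine ((gauss_int.const_mul (‖LSeries.term a (c : ℂ) n‖ * E)).mono' (contF n).aestronglyMeasurable ?_)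
    exact Filter.Eventually.of_forall fun t => (nF n t).le
  have sumF : Summable fun n => ∫ t, ‖Fn n t‖ := by
    simp_rw [nF, MeasureTheory.integral_const_mul]
    exact (hsum.norm.mul_right E).mul_right _
  have HS := hasSum_integral_of_summable_integral_norm intF sumF
  have ev : ∀ n : ℕ, ∫ t, Fn n t = (Real.sqrt (2 * Real.pi) : ℂ) * (a n * gw l n) := by
    intro n
    rcases Nat.eq_zero_or_pos n with rfl | hn
    · simp [hFn, ha0]
    · have hn' : ((n : ℕ) : ℂ) ≠ 0 := by exact_mod_cast hn.ne'
      have : ∀ t : ℝ, Fn n t = a n * (Kf l (c + t * Complex.I) * Complex.exp (-(c + t * Complex.I) * (Real.log n : ℝ))) := by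
        intro t
        simp only [hFn]
        rw [LSeries.term_of_ne_zero hn.ne', div_eq_mul_inv, ← Complex.cpow_neg,
          Complex.cpow_def_of_ne_zero hn', Complex.natCast_log]
        ring_nf
      simp_rw [this]
      rw [MeasureTheory.integral_const_mul, mellin, gw]
      push_cast; ring
  simp_rw [ev] at HS
  set G : ℝ → ℂ := fun t => LSeries a (c + t * Complex.I) * Kf l (c + t * Complex.I) with hG
  have eG : ∀ t, ∑' n, Fn n t = G t := by
    intro t; simp only [hFn, hG]; rw [tsum_mul_right, LSeries]
  simp_rw [eG] at HS
  have s2 : (Real.sqrt (2 * Real.pi) : ℂ) ≠ 0 := by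
    have := sqrt2pi_ge
    exact_mod_cast (by linarith : Real.sqrt (2 * Real.pi) ≠ 0)
  have summ : Summable fun n : ℕ => a n * gw l n := (summable_mul_left_iff s2).1 HS.summable
  refine ⟨summ, ?_⟩
  have heq : (Real.sqrt (2 * Real.pi) : ℂ) * ∑' n : ℕ, a n * gw l n = ∫ t, G t := by
    rw [← tsum_mul_left]; exact HS.tsum_eq
  have nle : ‖∑' n : ℕ, a n * gw l n‖ ≤ ‖∫ t, G t‖ := by
    rw [← heq, norm_mul, Complex.norm_real, Real.norm_of_nonneg (by positivity)]
    exact le_mul_of_one_le_left (norm_nonneg _) sqrt2pi_ge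
  -- bound for G
  have nG : ∀ t, ‖G t‖ ≤ M * E * Real.exp (-(1/2) * t ^ 2) := by
    intro t
    simp only [hG]
    rw [norm_mul, nK, mul_assoc]
    gcongr
    refine le_trans ?_ hM
    rw [LSeries]
    refine (norm_tsum_le_tsum_norm ?_).trans (le_of_eq ?_)
    · simp_rw [tn]; exact hsum.norm
    · simp_rw [tn]
  have hM0 : 0 ≤ M := (tsum_nonneg fun _ => norm_nonneg _).trans hM
  have eGF : ∀ t : ℝ, G t = F (c + t * Complex.I) * Kf l (c + t * Complex.I) := by
    intro t; simp only [hG]; rw [hFe]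
  have hTm : -T ≤ T := by linarith
  have intG : Integrable G := by
    refine (gauss_int.const_mul (M * E)).mono' ?_ (Filter.Eventually.of_forall nG)
    have mG : Measurable G := by
      have : G = fun t => ∑' n, Fn n t := by funext t; rw [eG]
      rw [this]
      exact Measurable.tsum (fun n => (contF n).measurable)
    exact mG.aestronglyMeasurable
  have hBd : 0 ≤ Bd := (norm_nonneg _).trans (hB ((1 - u : ℝ) + (T : ℝ) * Complex.I) (by
    rw [Complex.mem_reProdIm]; simp))
  have hE2 : E ≤ 21 * Real.exp l := by
    have h1 : E ≤ Real.exp (l + 3) := by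
      rw [hE, hlc]; apply Real.exp_le_exp.2
      have : c ^ 2 ≤ 2 ^ 2 := by gcongr
      linarith
    rw [Real.exp_add] at h1
    have h2 : Real.exp 3 ≤ 21 := by
      have : Real.exp 3 = Real.exp 1 ^ 3 := by rw [← Real.exp_nat_mul]; norm_num
      rw [this]
      calc Real.exp 1 ^ 3 ≤ 2.7182818286 ^ 3 := by gcongr; exact Real.exp_one_lt_d9.le
        _ ≤ 21 := by norm_num
    have := mul_le_mul_of_nonneg_left h2 (Real.exp_pos l).le
    linarith
  have tail : ‖∫ t in (Set.Ioc (-T) T)ᶜ, G t‖ ≤ 4 * (M * E * Real.exp (-T ^ 2 / 4)) := by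
    have i4 : Integrable (fun t : ℝ => Real.exp (-(1/4) * t ^ 2)) := integrable_exp_neg_mul_sq (by norm_num)
    calc ‖∫ t in (Set.Ioc (-T) T)ᶜ, G t‖ ≤ ∫ t in (Set.Ioc (-T) T)ᶜ, ‖G t‖ := norm_integral_le_integral_norm _
      _ ≤ ∫ t in (Set.Ioc (-T) T)ᶜ, M * E * Real.exp (-T ^ 2 / 4) * Real.exp (-(1/4) * t ^ 2) := by
          refine setIntegral_mono_on intG.norm.integrableOn (i4.const_mul _).integrableOn
            measurableSet_Ioc.compl (fun t ht => (nG t).trans ?_)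
          rw [mul_assoc (M * E), ← Real.exp_add]
          gcongr
          have : T ^ 2 ≤ t ^ 2 := by
            rw [Set.mem_compl_iff, Set.mem_Ioc, not_and_or, not_lt, not_le] at ht
            rw [sq_le_sq, abs_of_nonneg hT, le_abs]
            rcases ht with h | h
            · right; linarith
            · left; linarith
          linarith
      _ ≤ ∫ t : ℝ, M * E * Real.exp (-T ^ 2 / 4) * Real.exp (-(1/4) * t ^ 2) :=
          setIntegral_le_integral (i4.const_mul _) (Filter.Eventually.of_forall fun t => by positivity)
      _ = M * E * Real.exp (-T ^ 2 / 4) * Real.sqrt (Real.pi / (1/4)) := by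
          rw [MeasureTheory.integral_const_mul, integral_gaussian]
      _ ≤ M * E * Real.exp (-T ^ 2 / 4) * 4 := by
          gcongr
          rw [Real.sqrt_le_left (by norm_num)]
          have := Real.pi_lt_four
          linarith
      _ = _ := by ring
  have spl := integral_add_compl (measurableSet_Ioc (a := -T) (b := T)) intG
  rw [← intervalIntegral.integral_of_le hTm] at spl
  -- rectangle
  set H : ℂ → ℂ := fun s => F s * Kf l s with hH
  have rect := Complex.integral_boundary_rect_eq_zero_of_differentiableOn H
    ((1 - u : ℝ) + (-T : ℝ) * Complex.I) ((c : ℝ) + (T : ℝ) * Complex.I) (by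
      have : DifferentiableOn ℂ H (Set.uIcc (1 - u) c ×ℂ Set.uIcc (-T) T) :=
        hF.mul ((Kf_diff l).differentiableOn)
      have e0 : (((1 - u : ℝ) : ℂ) + ((-T : ℝ) : ℂ) * Complex.I).re = 1 - u := by simp
      have e2 : (((1 - u : ℝ) : ℂ) + ((-T : ℝ) : ℂ) * Complex.I).im = -T := by simp
      have e3 : ((c : ℂ) + (T : ℂ) * Complex.I).re = c := by simp
      have e4 : ((c : ℂ) + (T : ℂ) * Complex.I).im = T := by simp
      rw [e0, e2, e3, e4]
      exact this)
  have e1 : (((1 - u : ℝ) : ℂ) + ((-T : ℝ) : ℂ) * Complex.I).re = 1 - u := by simp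
  have e2 : (((1 - u : ℝ) : ℂ) + ((-T : ℝ) : ℂ) * Complex.I).im = -T := by simp
  have e3 : ((c : ℂ) + (T : ℂ) * Complex.I).re = c := by simp
  have e4 : ((c : ℂ) + (T : ℂ) * Complex.I).im = T := by simp
  rw [e1, e2, e3, e4] at rect
  have hwidth : |c - (1 - u)| ≤ 2 := by
    rw [abs_le]; constructor
    · linarith
    · have : c ≤ 1 + 1 := by linarith
      linarith
  have horiz : ∀ τ : ℝ, τ ∈ Set.uIcc (-T) T → τ ^ 2 = T ^ 2 →
      ‖∫ x in (1 - u)..c, H (x + τ * Complex.I)‖ ≤ 2 * (Bd * (E * Real.exp (-T ^ 2 / 2))) := by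
    intro τ hτ hτ2
    refine (intervalIntegral.norm_integral_le_of_norm_le_const (C := Bd * (E * Real.exp (-T ^ 2 / 2))) ?_).trans ?_
    · intro σ hσ
      have hσ' := Set.uIoc_subset_uIcc hσ
      simp only [hH]
      rw [norm_mul, Kf_norm, hτ2]
      have m : ((σ : ℂ) + (τ : ℂ) * Complex.I) ∈ Set.uIcc (1 - u) c ×ℂ Set.uIcc (-T) T := by
        rw [Complex.mem_reProdIm]; simpa using ⟨hσ', hτ⟩
      have := hB _ m
      rw [Set.uIcc_of_le (by linarith)] at hσ'
      have h0 : 0 ≤ σ := by linarith [hσ'.1]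
      have hσc := hσ'.2
      have q : Real.exp (σ ^ 2 / 2 + l * σ) ≤ E := by rw [hE]; gcongr
      have : -(1/2) * T ^ 2 = -T ^ 2 / 2 := by ring
      rw [this]
      gcongr
    · rw [mul_comm]
      gcongr
  have h1 := horiz (-T) (by simp) (by ring)
  have h2 := horiz T (by simp) (by ring)
  have vert : ‖∫ y in (-T)..T, H ((1 - u : ℝ) + y * Complex.I)‖ ≤ (Bd * (2 * Real.exp (l - u * l))) * (2 * T) := by
    refine (intervalIntegral.norm_integral_le_of_norm_le_const (C := Bd * (2 * Real.exp (l - u * l))) ?_).trans ?_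
    · intro y hy
      have hy' := Set.uIoc_subset_uIcc hy
      simp only [hH]
      rw [norm_mul, Kf_norm]
      have m : (((1 - u : ℝ) : ℂ) + (y : ℂ) * Complex.I) ∈ Set.uIcc (1 - u) c ×ℂ Set.uIcc (-T) T := by
        rw [Complex.mem_reProdIm]; simpa using hy'
      have b := hB _ m
      have q1 : Real.exp (-(1/2) * y ^ 2) ≤ 1 := by
        rw [Real.exp_le_one_iff]; have := sq_nonneg y; linarith
      have q2 : Real.exp ((1 - u) ^ 2 / 2 + l * (1 - u)) ≤ 2 * Real.exp (l - u * l) := by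
        have : Real.exp ((1 - u) ^ 2 / 2 + l * (1 - u)) ≤ Real.exp (1 / 2 + (l - u * l)) := by
          apply Real.exp_le_exp.2
          have : (1 - u) ^ 2 ≤ 1 := pow_le_one₀ (by linarith) (by linarith)
          linarith
        rw [Real.exp_add (1 / 2)] at this
        have h3 := exp_half_le
        refine this.trans ?_
        gcongr
      calc _ ≤ Bd * ((2 * Real.exp (l - u * l)) * 1) := by gcongr
        _ = _ := by ring
    · rw [abs_of_nonneg (by linarith)]
      apply le_of_eq; ring
  have eGi : ∫ t in (-T)..T, G t = ∫ y in (-T)..T, H (c + y * Complex.I) := by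
    congr 1; funext t; rw [eGF]
  have hfin : ‖∫ t in (-T)..T, G t‖ ≤ 4 * (Bd * (E * Real.exp (-T ^ 2 / 2))) +
      (Bd * (2 * Real.exp (l - u * l))) * (2 * T) := by
    have e : Complex.I • (∫ t in (-T)..T, G t) = Complex.I • (∫ y in (-T)..T, H ((1 - u : ℝ) + y * Complex.I))
        + (∫ x in (1 - u)..c, H (x + T * Complex.I)) - (∫ x in (1 - u)..c, H (x + (-T : ℝ) * Complex.I)) := by
      rw [eGi]
      linear_combination rect
    have e2 : ‖∫ t in (-T)..T, G t‖ = ‖Complex.I • (∫ t in (-T)..T, G t)‖ := by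
      rw [norm_smul, Complex.norm_I, one_mul]
    rw [e2, e]
    refine (norm_sub_le _ _).trans ?_
    refine (add_le_add_left (norm_add_le _ _) _).trans ?_
    rw [norm_smul, Complex.norm_I, one_mul]
    linarith
  refine nle.trans ?_
  rw [← spl]
  refine (norm_add_le _ _).trans ?_
  have el : Real.exp (l - u * l) = Real.exp l * Real.exp (-u * l) := by
    rw [← Real.exp_add]; congr 1; ring
  rw [el] at hfin
  have f1 : M * E * Real.exp (-T ^ 2 / 4) ≤ M * (21 * Real.exp l) * Real.exp (-T ^ 2 / 4) := by gcongr
  have f2 : Bd * (E * Real.exp (-T ^ 2 / 2)) ≤ Bd * ((21 * Real.exp l) * Real.exp (-T ^ 2 / 2)) := by gcongr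
  have p1 : 0 ≤ M * Real.exp l * Real.exp (-T ^ 2 / 4) := by positivity
  have p2 : 0 ≤ Bd * Real.exp l * Real.exp (-T ^ 2 / 2) := by positivity
  have p3 : 0 ≤ Bd * T * Real.exp l * Real.exp (-u * l) := by positivity
  linarith
end MG

namespace MG
open Finset Filter Topology

lemma Zc_le {η : ℝ} (h : 0 < η) (h1 : η ≤ 1) : Zc η ≤ 1 / η + 2 * Zc (1/2) := by
  have hs : 1 < (1 + η : ℂ).re := by simpa using h
  have e : (Zc η : ℂ) = riemannZeta (1 + η) := by
    rw [zeta_eq_tsum_one_div_nat_add_one_cpow hs, Zc, Complex.ofReal_tsum]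
    congr 1; funext n
    rw [Complex.ofReal_cpow (by positivity), one_div, ← Complex.cpow_neg]
    push_cast
    congr 1; ring
  have := zeta_le hs
  rw [← e, Complex.norm_real, Real.norm_of_nonneg (by linarith [Zc_pos h]), add_sub_cancel_left,
    Complex.norm_real, Real.norm_of_nonneg h.le] at this
  refine this.trans ?_
  have n2 : ‖(1 + η : ℂ)‖ ≤ 2 := by
    refine (norm_add_le _ _).trans ?_
    rw [norm_one, Complex.norm_real, Real.norm_of_nonneg h.le]; linarith
  have := Zc_pos (show (0:ℝ) < 1/2 by norm_num)
  gcongr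

lemma Mbound {l : ℝ} (hl : 1 ≤ l) {a : ℕ → ℂ}
    (ha : ∀ n, ‖a n‖ ≤ ArithmeticFunction.vonMangoldt n + 1) :
    LSeriesSummable a ((1 + 1 / l : ℝ) : ℂ) ∧
    ∑' n, ‖LSeries.term a ((1 + 1 / l : ℝ) : ℂ) n‖ ≤ 3 * l * (2 * l + 2 * Zc (1/2)) := by
  have hl0 : 0 < l := by linarith
  set η : ℝ := 1 / (2 * l) with hη
  have hη0 : 0 < η := by positivity
  have hη1 : η ≤ 1 := by rw [hη, div_le_one (by positivity)]; linarith
  have hb : ∀ n : ℕ, ‖LSeries.term a ((1 + 1 / l : ℝ) : ℂ) (n + 1)‖ ≤ 3 * l * ((n + 1 : ℕ) : ℝ) ^ (-1 - η) := by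
    intro n
    have hn : (1 : ℝ) ≤ ((n + 1 : ℕ) : ℝ) := by exact_mod_cast Nat.le_add_left 1 n
    set x : ℝ := ((n + 1 : ℕ) : ℝ) with hx
    rw [LSeries.norm_term_eq, if_neg (Nat.succ_ne_zero n)]
    simp only [Complex.ofReal_re]
    have h1 : ‖a (n + 1)‖ ≤ 3 * l * x ^ η := by
      refine (ha _).trans ?_
      have h2 : ArithmeticFunction.vonMangoldt (n + 1) ≤ Real.log x := ArithmeticFunction.vonMangoldt_le_log
      have h3 := Real.log_le_rpow_div (show 0 ≤ x by linarith) hη0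
      have h4 : x ^ η / η = 2 * l * x ^ η := by rw [hη]; field_simp
      have h5 : 1 ≤ x ^ η := Real.one_le_rpow hn hη0.le
      have h6 : 1 * 1 ≤ l * x ^ η := by gcongr
      linarith
    have h7 : x ^ (-1 - η) = x ^ η / x ^ (1 + 1 / l) := by
      rw [← Real.rpow_sub (by linarith)]; congr 1; rw [hη]; field_simp; ring
    rw [← hx, h7, ← mul_div_assoc]
    gcongr
  have hs := (Zc_summable hη0).mul_left (3 * l)
  have s1 : Summable fun n => ‖LSeries.term a ((1 + 1 / l : ℝ) : ℂ) (n + 1)‖ :=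
    Summable.of_nonneg_of_le (fun _ => norm_nonneg _) hb hs
  have s2 : Summable fun n => ‖LSeries.term a ((1 + 1 / l : ℝ) : ℂ) n‖ := (summable_nat_add_iff 1).1 s1
  refine ⟨s2.of_norm, ?_⟩
  rw [s2.tsum_eq_zero_add, LSeries.term_zero, norm_zero, zero_add]
  refine (s1.tsum_le_tsum hb hs).trans ?_
  rw [tsum_mul_left]
  have := Zc_le hη0 hη1
  rw [hη, one_div_one_div] at this
  rw [← hη] at this
  gcongr
  exact this

lemma final_decay (K A : ℝ) (hK : 0 ≤ K) (hA : 0 ≤ A) : ∀ᶠ l : ℝ in atTop,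
    200 * Real.exp l * (3 * l * (2 * l + K) * Real.exp (-(Real.log l) ^ 2 / 4)
      + 2 * l ^ (1/2 : ℝ) * Real.exp (-(Real.log l) ^ 2 / 2)
      + 2 * l ^ (1/2 : ℝ) * Real.log l * Real.exp (-(l ^ (1/20 : ℝ)) ^ 10) ) ≤ Real.exp l * l ^ (-A) := by
  set c := Real.log (200 * (10 + 3 * K)) with hc
  have hc0 : 0 ≤ c := Real.log_nonneg (by linarith)
  filter_upwards [eventually_ge_atTop 1, Real.tendsto_log_atTop.eventually_ge_atTop (8 * (A + 2 + c)),
    Real.tendsto_log_atTop.eventually_ge_atTop 1] with l l1 T1 T2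
  have hl0 : 0 < l := by linarith
  set T := Real.log l with hT
  have hlT : l = Real.exp T := (Real.exp_log hl0).symm
  have hsq : l ^ (1/2 : ℝ) ≤ l := by
    calc l ^ (1/2 : ℝ) ≤ l ^ (1 : ℝ) := Real.rpow_le_rpow_of_exponent_le l1 (by norm_num)
      _ = l := Real.rpow_one l
  have hTl : T ≤ l := by have := Real.add_one_le_exp T; rw [← hlT] at this; linarith
  set e := Real.exp (-T ^ 2 / 8) with he
  have he0 : 0 < e := Real.exp_pos _
  have e1 : Real.exp (-T ^ 2 / 4) ≤ e := by
    apply Real.exp_le_exp.2; have := sq_nonneg T; linarith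
  have e2 : Real.exp (-T ^ 2 / 2) ≤ e := by
    apply Real.exp_le_exp.2; have := sq_nonneg T; linarith
  have e3 : Real.exp (-(l ^ (1/20 : ℝ)) ^ 10) ≤ e := by
    rw [he, ← Real.rpow_natCast, ← Real.rpow_mul hl0.le, hlT, ← Real.exp_mul]
    gcongr
    have h2 := Real.quadratic_le_exp_of_nonneg (show 0 ≤ T / 2 by linarith)
    have : T * (1 / 20 * ((10 : ℕ) : ℝ)) = T / 2 := by norm_num; ring
    rw [this]
    linarith
  have b1 : 3 * l * (2 * l + K) ≤ (6 + 3 * K) * l ^ 2 := by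
    have h1 : l ≤ l ^ 2 := le_self_pow₀ l1 (by norm_num)
    have h2 := mul_le_mul_of_nonneg_left h1 hK
    linarith [show 3 * l * (2 * l + K) = 6 * l ^ 2 + 3 * (K * l) by ring]
  have b2 : 2 * l ^ (1/2 : ℝ) ≤ 2 * l ^ 2 := by
    have h1 : l ≤ l ^ 2 := le_self_pow₀ l1 (by norm_num)
    linarith
  have b3 : 2 * l ^ (1/2 : ℝ) * T ≤ 2 * l ^ 2 := by
    calc 2 * l ^ (1/2 : ℝ) * T ≤ 2 * l * l := by gcongr
      _ = _ := by ring
  have fin : 200 * (10 + 3 * K) * l ^ 2 * e ≤ l ^ (-A) := by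
    have q1 : 200 * (10 + 3 * K) = Real.exp c := (Real.exp_log (by linarith)).symm
    have q2 : l ^ (-A) = Real.exp (T * (-A)) := by rw [hlT, ← Real.exp_mul]
    have q3 : l ^ 2 = Real.exp (2 * T) := by rw [hlT, ← Real.exp_nat_mul]; norm_num
    rw [q1, q2, q3, he, ← Real.exp_add, ← Real.exp_add]
    gcongr
    nlinarith
  calc _ ≤ 200 * Real.exp l * ((6 + 3 * K) * l ^ 2 * e + 2 * l ^ 2 * e + 2 * l ^ 2 * e) := by gcongr
    _ = Real.exp l * (200 * (10 + 3 * K) * l ^ 2 * e) := by ring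
    _ ≤ _ := by gcongr

/-- common wrapper -/
lemma contour_fin {l A : ℝ} (hl : 1 ≤ l) (hT : 0 ≤ Real.log l)
    (hV1 : 1 ≤ l ^ (1/20 : ℝ))
    (hfin : 200 * Real.exp l * (3 * l * (2 * l + 2 * Zc (1/2)) * Real.exp (-(Real.log l) ^ 2 / 4)
      + 2 * l ^ (1/2 : ℝ) * Real.exp (-(Real.log l) ^ 2 / 2)
      + 2 * l ^ (1/2 : ℝ) * Real.log l * Real.exp (-(l ^ (1/20 : ℝ)) ^ 10) ) ≤ Real.exp l * l ^ (-A))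
    {a : ℕ → ℂ} (ha0 : a 0 = 0) (ha : ∀ n, ‖a n‖ ≤ ArithmeticFunction.vonMangoldt n + 1) (F : ℂ → ℂ)
    (hF : ∀ s : ℂ, |s.re - 1| ≤ ((l ^ (1/20 : ℝ)) ^ 10)⁻¹ → |s.im| ≤ Real.log l →
      DifferentiableAt ℂ F s ∧ ‖F s‖ ≤ 2 * (l ^ (1/20 : ℝ)) ^ 10)
    (hFe : ∀ s : ℂ, 1 < s.re → F s = LSeries a s) :
    (Summable fun n : ℕ => a n * gw l n) ∧ ‖∑' n : ℕ, a n * gw l n‖ ≤ Real.exp l * l ^ (-A) := by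
  have hl0 : 0 < l := by linarith
  set V := l ^ (1/20 : ℝ) with hV
  obtain ⟨m1, m2⟩ := Mbound hl ha
  have hV10 : V ^ 10 = l ^ (1/2 : ℝ) := by
    rw [hV, ← Real.rpow_natCast, ← Real.rpow_mul hl0.le]; norm_num
  have hV20 : V ^ 20 = l := by
    rw [hV, ← Real.rpow_natCast, ← Real.rpow_mul hl0.le]; norm_num
  have hV0 : 0 < V := by linarith
  have huc : 1 / l ≤ (V ^ 10)⁻¹ := by
    rw [one_div]
    conv_lhs => rw [← hV20]
    exact inv_anti₀ (by positivity) (pow_le_pow_right₀ hV1 (by norm_num))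
  have hp : 0 < 1 / l := by positivity
  have hu0 : 0 < (V ^ 10)⁻¹ := by positivity
  have mem : ∀ s ∈ Set.uIcc (1 - (V ^ 10)⁻¹) (1 + 1 / l) ×ℂ Set.uIcc (-Real.log l) (Real.log l),
      |s.re - 1| ≤ (V ^ 10)⁻¹ ∧ |s.im| ≤ Real.log l := by
    intro s hs
    rw [Complex.mem_reProdIm, Set.uIcc_of_le (by linarith), Set.uIcc_of_le (by linarith)] at hs
    refine ⟨abs_le.2 ⟨by linarith [hs.1.1], by linarith [hs.1.2]⟩, abs_le.2 hs.2⟩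
  obtain ⟨c1, c2⟩ := contour (u := (V ^ 10)⁻¹) (T := Real.log l) (Bd := 2 * V ^ 10) a F hl hu0.le
    (inv_le_one_of_one_le₀ (one_le_pow₀ hV1)) hT ha0 m1 m2
    (fun s hs => ((hF s (mem s hs).1 (mem s hs).2).1).differentiableWithinAt)
    (fun t => hFe _ (by simpa using hl0)) (fun s hs => (hF s (mem s hs).1 (mem s hs).2).2)
  refine ⟨c1, c2.trans (le_trans (le_of_eq ?_) hfin)⟩
  have : -(V ^ 10)⁻¹ * l = -V ^ 10 := by
    conv_lhs => rw [← hV20]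
    field_simp
  rw [this, hV10]

theorem SW_char (A B : ℝ) (hA : 0 ≤ A) (hB : 1 ≤ B) : ∀ᶠ l : ℝ in atTop, Good B l →
    ∀ (r : ℕ) [NeZero r], (r : ℝ) ≤ l ^ B → ∀ χ : DirichletCharacter ℂ r, χ ≠ 1 → χ.IsPrimitive →
    (Summable fun n : ℕ => (χ n * ArithmeticFunction.vonMangoldt n) * gw l n) ∧
    ‖∑' n : ℕ, (χ n * ArithmeticFunction.vonMangoldt n) * gw l n‖ ≤ Real.exp l * l ^ (-A) := by
  have hη0 : 0 < 1 / (80 * B) := by positivity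
  have hη1 : 1 / (80 * B) ≤ 1 / 2 := by
    apply one_div_le_one_div_of_le <;> linarith
  filter_upwards [ev_AB B hB, final_decay (2 * Zc (1/2)) A
    (by linarith [Zc_pos (show (0:ℝ) < 1/2 by norm_num)]) hA] with l hAB hfin hgood r _ hr χ hχ hprim
  have hVl := hAB.V_large
  have hT := hAB.T_large
  have hbs := BS_char hχ
  set V := l ^ (1/20 : ℝ) with hV
  have hue := hAB.eta
  rw [← hV] at hue
  set L := Lc (fun n => χ n) with hL
  have hd : DifferentiableOn ℂ L {s | 1 - 1 / (80 * B) < s.re} := Lc_diff hbs hη0 hη1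
  have hop : IsOpen {s : ℂ | 1 - 1 / (80 * B) < s.re} := isOpen_lt continuous_const Complex.continuous_re
  have hn : ∀ n : ℕ, ‖χ n * ArithmeticFunction.vonMangoldt n‖ ≤ ArithmeticFunction.vonMangoldt n + 1 := by
    intro n
    have h0 : 0 ≤ ArithmeticFunction.vonMangoldt n := ArithmeticFunction.vonMangoldt_nonneg
    rw [norm_mul, Complex.norm_real, Real.norm_of_nonneg h0]
    calc _ ≤ 1 * ArithmeticFunction.vonMangoldt n := by gcongr; exact χ.norm_le_one _
      _ ≤ _ := by linarith
  refine contour_fin hAB.one_le (by linarith) (by linarith) hfin (a := fun n => χ n * ArithmeticFunction.vonMangoldt n)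
    (by simp) hn (fun s => -deriv L s / L s) ?_ ?_
  · intro s s1 s2
    have low := L_lower hη0 hη1 hAB hr hχ (fun h => hgood r hr χ hχ hprim h) s1 s2
    rw [← hV] at low s1
    have hV0 : 0 < V := by linarith
    have hre := abs_le.1 s1
    have hsd : 1 - 1 / (80 * B) / 2 < s.re := by linarith
    have hsU : s ∈ {s : ℂ | 1 - 1 / (80 * B) < s.re} := by show 1 - 1 / (80 * B) < s.re; linarith
    have hLs : 0 < ‖L s‖ := lt_of_lt_of_le (by positivity) low
    have bd := (hAB.bd r hr _ hbs s hsd (by linarith) (by linarith)).2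
    refine ⟨((hd.deriv hop).differentiableAt (hop.mem_nhds hsU)).neg.div
      (hd.differentiableAt (hop.mem_nhds hsU)) (norm_pos_iff.1 hLs), ?_⟩
    rw [norm_div, norm_neg, div_le_iff₀ hLs]
    calc ‖deriv L s‖ ≤ V := bd
      _ ≤ 2 * V ^ 10 * (V ^ 9)⁻¹ := by
        have : 2 * V ^ 10 * (V ^ 9)⁻¹ = 2 * V := by field_simp
        linarith
      _ ≤ _ := by gcongr
  · intro s hs
    have h := DirichletCharacter.LSeries_twist_vonMangoldt_eq χ hs
    have ee : L =ᶠ[𝓝 s] LSeries (fun n => χ n) := by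
      filter_upwards [(isOpen_lt continuous_const Complex.continuous_re).mem_nhds hs] with z hz
      exact Lc_eq_LSeries hbs hz
    rw [ee.deriv_eq, ee.eq_of_nhds, ← h]
    rfl

lemma Hz_one : Hz 1 = 1 := by
  have := Hz_sub_one (s := 1) (by norm_num)
  simp at this
  exact sub_eq_zero.1 this

lemma Hz_deriv_le {s : ℂ} (hs : 3 / 4 < s.re) :
    ‖deriv Hz s‖ ≤ (1 + (‖s‖ + 1) * (‖s‖ + 2) * Zc (1/2)) / (1/4) := by
  have z := Zc_pos (show (0:ℝ) < 1/2 by norm_num)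
  have hsub : Metric.closedBall s (1/4) ⊆ {z : ℂ | 1/2 < z.re} := by
    intro z hz
    have h3 : |(z - s).re| ≤ ‖z - s‖ := Complex.abs_re_le_norm _
    rw [Metric.mem_closedBall, dist_eq_norm] at hz
    have := (abs_le.1 (h3.trans hz)).1
    rw [Complex.sub_re] at this
    show 1/2 < z.re
    linarith
  have hop : IsOpen {s : ℂ | 1/2 < s.re} := isOpen_lt continuous_const Complex.continuous_re
  refine Complex.norm_deriv_le_of_forall_mem_sphere_norm_le (by norm_num)
    (Hz_diff.diffContOnCl_ball hsub) (fun w hw => ?_)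
  have hw1 : 1/2 < w.re := hsub (Metric.sphere_subset_closedBall hw)
  have h1 := Hz_sub_one hw1.le
  rw [mem_sphere_iff_norm] at hw
  have h2 : ‖w‖ ≤ ‖s‖ + 1 := by
    have := norm_add_le (w - s) s
    rw [sub_add_cancel, hw] at this; linarith
  have h3 : ‖w - 1‖ ≤ ‖s‖ + 2 := by
    have := norm_sub_le w 1
    rw [norm_one] at this; linarith
  have h4 := norm_add_le (Hz w - 1) 1
  rw [sub_add_cancel, norm_one] at h4
  have h5 : ‖w‖ * ‖w - 1‖ * Zc (1/2) ≤ (‖s‖ + 1) * (‖s‖ + 2) * Zc (1/2) := by gcongr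
  linarith

theorem PNT_w (A : ℝ) (hA : 0 ≤ A) : ∀ᶠ l : ℝ in atTop,
    (Summable fun n : ℕ => ((ArithmeticFunction.vonMangoldt n : ℂ) - (if n = 0 then 0 else 1)) * gw l n) ∧
    ‖∑' n : ℕ, ((ArithmeticFunction.vonMangoldt n : ℂ) - (if n = 0 then 0 else 1)) * gw l n‖
      ≤ Real.exp l * l ^ (-A) := by
  have z := Zc_pos (show (0:ℝ) < 1/2 by norm_num)
  have ev : ∀ᶠ l : ℝ in atTop, 400 * (Real.log l) ^ 2 * Zc (1/2) ≤ l ^ (1/20 : ℝ) := by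
    have h := (isLittleO_log_rpow_atTop (show (0:ℝ) < 1/40 by norm_num)).def
      (show 0 < 1 / (400 * Zc (1/2)) by positivity)
    filter_upwards [h, Real.tendsto_log_atTop.eventually_ge_atTop 0, eventually_gt_atTop 0] with l h hh h3
    rw [Real.norm_of_nonneg hh, Real.norm_of_nonneg (by positivity)] at h
    have e : l ^ (1/20 : ℝ) = l ^ (1/40 : ℝ) * l ^ (1/40 : ℝ) := by
      rw [← Real.rpow_add h3]; norm_num
    have h4 : Real.log l ^ 2 ≤ (1 / (400 * Zc (1/2)) * l ^ (1/40 : ℝ)) ^ 2 := by gcongr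
    rw [e]
    calc _ ≤ 400 * (1 / (400 * Zc (1/2)) * l ^ (1/40 : ℝ)) ^ 2 * Zc (1/2) := by gcongr
      _ = (1 / (400 * Zc (1/2))) * (l ^ (1/40 : ℝ) * l ^ (1/40 : ℝ)) := by field_simp
      _ ≤ 1 * (l ^ (1/40 : ℝ) * l ^ (1/40 : ℝ)) := by
        gcongr
        rw [div_le_one (by positivity)]; linarith
      _ = _ := one_mul _
  filter_upwards [ev_AB 1 le_rfl, final_decay (2 * Zc (1/2)) A (by linarith) hA, ev] with l hAB hfin hV2
  have hVl := hAB.V_large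
  have hT := hAB.T_large
  have hl1 := hAB.one_le
  set V := l ^ (1/20 : ℝ) with hV
  set T := Real.log l with hTd
  have hV0 : 0 < V := by linarith
  have hTT : T ≤ T ^ 2 := by rw [sq]; exact le_mul_of_one_le_left (by linarith) hT
  have hTZ : 400 * T * Zc (1/2) ≤ V := by
    refine le_trans ?_ hV2; gcongr
  have hZT : Zc (1/2) ≤ T ^ 2 * Zc (1/2) := le_mul_of_one_le_left (by linarith) (by linarith)
  set u := (V ^ 10)⁻¹ with hu
  have hu0 : 0 < u := by positivity
  have hVle : ∀ n m : ℕ, n ≤ m → (V ^ m)⁻¹ ≤ (V ^ n)⁻¹ := fun n m h => by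
    gcongr
    linarith
  have hVi : V⁻¹ ≤ 10000⁻¹ := by gcongr
  have huV : u ≤ V⁻¹ := by simpa using hVle 1 10 (by norm_num)

  have hz : ∀ z : ℂ, 1 < z.re → z.re ≤ 2 → |z.im| ≤ 2 * T →
      ‖LSeries (fun n => (1 : DirichletCharacter ℂ 1) n) z‖ ≤ 1 / ‖z - 1‖ + V :=
    fun z h1 h2 h3 => hAB.triv 1 (by simpa using hl1) z h1 h2 h3
  clear_value V T u
  have hop : IsOpen {s : ℂ | 1/2 < s.re} := isOpen_lt continuous_const Complex.continuous_re
  have hsn : ∀ s : ℂ, 0 ≤ s.re → s.re ≤ 2 → |s.im| ≤ T → ‖s‖ ≤ 3 * T := by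
    intro s s1 s2 s3
    have := Complex.norm_le_abs_re_add_abs_im s
    rw [abs_of_nonneg s1] at this
    linarith
  set U := {z : ℂ | 3/4 < z.re ∧ z.re ≤ 2 ∧ |z.im| ≤ T} with hU
  have hUc : Convex ℝ U := box_convex _ _ 0 _
  have hdiff : ∀ s ∈ U, DifferentiableAt ℂ Hz s := fun s hs =>
    Hz_diff.differentiableAt (hop.mem_nhds (show 1/2 < s.re by linarith [hs.1]))
  have hder : ∀ s ∈ U, ‖deriv Hz s‖ ≤ V := by
    intro s hs
    refine (Hz_deriv_le hs.1).trans ?_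
    have h1 := hsn s (by linarith [hs.1]) hs.2.1 hs.2.2
    have : (‖s‖ + 1) * (‖s‖ + 2) * Zc (1/2) ≤ (4 * T) * (5 * T) * Zc (1/2) := by gcongr <;> linarith
    have h2 : (4 * T) * (5 * T) * Zc (1/2) = 20 * (T ^ 2 * Zc (1/2)) := by ring
    rw [div_le_iff₀ (by norm_num)]
    linarith
  have hlow : ∀ s ∈ U, |s.re - 1| ≤ u → (V ^ 9)⁻¹ ≤ ‖Hz s‖ := by
    intro s hs s1
    have hre := abs_le.1 s1
    have V9 : (V ^ 9)⁻¹ ≤ V⁻¹ := by simpa using hVle 1 9 (by norm_num)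
    by_cases hnear : |s.im| ≤ 10 * V⁻¹
    · have h1 := Hz_sub_one (s := s) (by linarith [hs.1])
      have h2 : ‖s - 1‖ ≤ 11 * V⁻¹ := by
        refine (Complex.norm_le_abs_re_add_abs_im _).trans ?_
        simp only [Complex.sub_re, Complex.one_re, Complex.sub_im, Complex.one_im, sub_zero]
        linarith
      have h3 := hsn s (by linarith [hs.1]) hs.2.1 hs.2.2
      have h4 : ‖s‖ * ‖s - 1‖ * Zc (1/2) ≤ (3 * T) * (11 * V⁻¹) * Zc (1/2) := by gcongr
      have h5 : (3 * T) * (11 * V⁻¹) * Zc (1/2) = (33/400) * ((400 * T * Zc (1/2)) * V⁻¹) := by ring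
      have h6 : (400 * T * Zc (1/2)) * V⁻¹ ≤ V * V⁻¹ := by gcongr
      rw [mul_inv_cancel₀ hV0.ne'] at h6
      have h7 := norm_sub_norm_le 1 (Hz s)
      rw [norm_one, norm_sub_rev] at h7
      linarith
    · push Not at hnear
      set w : ℂ := 1 + u + Complex.I * s.im with hw
      have wre : w.re = 1 + u := by simp [hw]
      have wim : w.im = s.im := by simp [hw]
      have p := DirichletCharacter.norm_LSeries_product_ge_one (N := 1) 1 hu0 s.im
      rw [← hw] at p
      clear_value w
      have hwU : w ∈ U := ⟨by rw [wre]; linarith, by rw [wre]; linarith, by rw [wim]; exact hs.2.2⟩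
      have mv := mv_re hUc hdiff hder hwU hs
      rw [norm_mul, norm_mul, norm_pow, norm_pow] at p
      have hw1 : 1 < w.re := by rw [wre]; linarith
      have e1 : (fun n : ℕ => (1 : DirichletCharacter ℂ 1) n) = 1 := by
        funext n; rw [Subsingleton.elim (n : ZMod 1) 1, map_one]; rfl
      have key := low2 (V := V) (y := ‖riemannZeta w‖) hVl
        (norm_nonneg (LSeries (fun n => (1 : DirichletCharacter ℂ 1) n) (1 + u))) (by
          refine (hz (1 + u) (by simpa using hu0) (by simp; linarith) (by simp; linarith)).trans ?_
          rw [add_sub_cancel_left, Complex.norm_real, Real.norm_of_nonneg hu0.le, hu, one_div, inv_inv]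
          have : V ≤ V ^ 10 := le_self_pow₀ (by linarith) (by norm_num)
          linarith)
        (norm_nonneg (LSeries (fun n => (1 : DirichletCharacter ℂ 1) n) (1 + u + 2 * Complex.I * s.im))) (by
          set q : ℂ := 1 + u + 2 * Complex.I * s.im with hq
          have qre : q.re = 1 + u := by simp [hq]
          have qim : q.im = 2 * s.im := by simp [hq]
          refine (hz q (by rw [qre]; linarith) (by rw [qre]; linarith) (by
            rw [qim, abs_mul, abs_two]; linarith [hs.2.2])).trans ?_
          have : |q.im| ≤ ‖q - 1‖ := by
            have := Complex.abs_im_le_norm (q - 1); simpa using this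
          rw [qim, abs_mul, abs_two] at this
          have h3 : 1 / ‖q - 1‖ ≤ 1 / V⁻¹ := by
            have := inv_pos.2 hV0
            gcongr
            linarith
          rw [div_inv_eq_mul, one_mul] at h3
          linarith)
        (norm_nonneg _) (by
          rw [one_pow] at p
          have : LSeries (fun n => (1 : DirichletCharacter ℂ 1) n) w = riemannZeta w := by
            rw [e1]; exact LSeries_one_eq_riemannZeta hw1
          rw [← this]
          exact p)
      have hHw : ‖Hz w‖ = ‖w - 1‖ * ‖riemannZeta w‖ := by rw [Hz_eq hw1, norm_mul]
      have hw2 : 10 * V⁻¹ ≤ ‖w - 1‖ := by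
        have := Complex.abs_im_le_norm (w - 1)
        rw [Complex.sub_im, wim, Complex.one_im, sub_zero] at this
        linarith
      have hHw2 : (10 * V⁻¹) * (V ^ 8)⁻¹ ≤ ‖Hz w‖ := by rw [hHw]; gcongr
      have e9 : (10 * V⁻¹) * (V ^ 8)⁻¹ = 10 * (V ^ 9)⁻¹ := by field_simp
      have n1 : ‖s - w‖ ≤ 2 * u := by
        refine (Complex.norm_le_abs_re_add_abs_im _).trans ?_
        simp only [Complex.sub_re, Complex.sub_im, wre, wim, sub_self, abs_zero, add_zero]
        rw [abs_le]; constructor <;> linarith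
      have n2 : V * ‖s - w‖ ≤ V * (2 * u) := by gcongr
      have n3 : V * (2 * u) = 2 * (V ^ 9)⁻¹ := by rw [hu]; field_simp
      have : 0 < (V ^ 9)⁻¹ := by positivity
      linarith
  refine contour_fin (a := fun n => (ArithmeticFunction.vonMangoldt n : ℂ) - (if n = 0 then 0 else 1)) hl1
    (by linarith) (by linarith) (by subst hu hV hTd; exact hfin) (by simp) ?_ (fun s => -deriv Hz s / Hz s - dslope Hz 1 s) ?_ ?_
  · intro n
    refine (norm_sub_le _ _).trans ?_
    have h0 : 0 ≤ ArithmeticFunction.vonMangoldt n := ArithmeticFunction.vonMangoldt_nonneg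
    rw [Complex.norm_real, Real.norm_of_nonneg h0]
    gcongr
    split_ifs <;> simp
  · intro s s1 s2
    rw [← hV, ← hu] at s1
    rw [← hTd] at s2
    have hre := abs_le.1 s1
    have hsU : s ∈ U := ⟨by linarith, by linarith, s2⟩
    have hmem : s ∈ {s : ℂ | 1/2 < s.re} := by show 1/2 < s.re; linarith [hsU.1]
    have low := hlow s hsU s1
    have hLs : 0 < ‖Hz s‖ := lt_of_lt_of_le (by positivity) low
    have d2 : DifferentiableOn ℂ (dslope Hz 1) {s : ℂ | 1/2 < s.re} :=
      (Complex.differentiableOn_dslope (hop.mem_nhds (by simp; norm_num))).2 Hz_diff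
    refine ⟨(((Hz_diff.deriv hop).differentiableAt (hop.mem_nhds hmem)).neg.div
      (hdiff s hsU) (norm_pos_iff.1 hLs)).sub (d2.differentiableAt (hop.mem_nhds hmem)), ?_⟩
    have b1 : ‖-deriv Hz s / Hz s‖ ≤ V ^ 10 := by
      rw [norm_div, norm_neg, div_le_iff₀ hLs]
      calc ‖deriv Hz s‖ ≤ V := hder s hsU
        _ = V ^ 10 * (V ^ 9)⁻¹ := by field_simp
        _ ≤ _ := by gcongr
    have b2 : ‖dslope Hz 1 s‖ ≤ V := by
      by_cases h : s = 1
      · rw [h, dslope_same]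
        exact hder 1 ⟨by norm_num, by norm_num, by simp; linarith⟩
      · rw [dslope_of_ne _ h, slope_def_field, Hz_one, norm_div]
        have : 0 < ‖s - 1‖ := norm_pos_iff.2 (sub_ne_zero.2 h)
        rw [div_le_iff₀ this]
        refine (Hz_sub_one (by linarith [hsU.1])).trans ?_
        have h3 := hsn s (by linarith [hsU.1]) hsU.2.1 s2
        calc ‖s‖ * ‖s - 1‖ * Zc (1/2) ≤ (3 * T) * ‖s - 1‖ * Zc (1/2) := by gcongr
          _ = (3 * T * Zc (1/2)) * ‖s - 1‖ := by ring
          _ ≤ V * ‖s - 1‖ := by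
            gcongr
            have : 0 ≤ T * Zc (1/2) := by positivity
            linarith
    have : V ≤ V ^ 10 := le_self_pow₀ (by linarith) (by norm_num)
    refine (norm_sub_le _ _).trans ?_
    rw [← hV]; linarith
  · intro s hs
    have h := ArithmeticFunction.LSeries_vonMangoldt_eq_deriv_riemannZeta_div hs
    have sm1 : LSeriesSummable (fun n => (ArithmeticFunction.vonMangoldt n : ℂ)) s :=
      ArithmeticFunction.LSeriesSummable_vonMangoldt hs
    have sm2 : LSeriesSummable 1 s := LSeriesSummable_one_iff.2 hs
    have e1 : LSeries (fun n => (ArithmeticFunction.vonMangoldt n : ℂ) - (if n = 0 then 0 else 1)) s =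
        LSeries (fun n => (ArithmeticFunction.vonMangoldt n : ℂ)) s - LSeries 1 s := by
      rw [← LSeries_sub sm1 sm2]
      apply LSeries_congr
      intro n hn
      simp [hn]
    rw [e1, h, LSeries_one_eq_riemannZeta hs]
    have hs1 : s - 1 ≠ 0 := by intro h; rw [sub_eq_zero] at h; rw [h] at hs; simp at hs
    have hζ : riemannZeta s ≠ 0 := riemannZeta_ne_zero_of_one_lt_re hs
    have dζ : HasDerivAt riemannZeta (deriv riemannZeta s) s :=
      (differentiableAt_riemannZeta (sub_ne_zero.1 hs1)).hasDerivAt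
    have ee : Hz =ᶠ[𝓝 s] fun z => (z - 1) * riemannZeta z := by
      filter_upwards [(isOpen_lt continuous_const Complex.continuous_re).mem_nhds hs] with z hz
      exact Hz_eq hz
    have dd : deriv Hz s = 1 * riemannZeta s + (s - 1) * deriv riemannZeta s := by
      rw [ee.deriv_eq]
      exact (((hasDerivAt_id s).sub_const 1).mul dζ).deriv
    rw [dslope_of_ne _ (sub_ne_zero.1 hs1), slope_def_field, Hz_one, dd, Hz_eq hs]
    field_simp
    ring
end MG

namespace MG
open Finset Filter Topology
open ArithmeticFunction (vonMangoldt moebius)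

lemma hyp (α β : ArithmeticFunction ℝ) (f : ℕ → ℂ) (N : ℕ) :
    ∑ n ∈ Ioc 0 N, ((α * β) n : ℂ) * f n = ∑ a ∈ Ioc 0 N, (α a : ℂ) * ∑ k ∈ Ioc 0 (N / a), (β k : ℂ) * f (a * k) := by
  have h1 : ∑ n ∈ Ioc 0 N, ((α * β) n : ℂ) * f n
      = ∑ x ∈ Ioc 0 N ×ˢ Ioc 0 N with x.1 * x.2 ≤ N, (α x.1 : ℂ) * (β x.2 * f (x.1 * x.2)) := by
    simp only [ArithmeticFunction.mul_apply]
    trans ∑ n ∈ Ioc 0 N, ∑ x ∈ Ioc 0 N ×ˢ Ioc 0 N with x.1 * x.2 = n, (α x.1 : ℂ) * (β x.2 * f (x.1 * x.2))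
    · refine sum_congr rfl fun n hn ↦ ?_
      simp only [mem_Ioc] at hn
      rw [Nat.divisorsAntidiagonal_eq_prod_filter_of_le hn.1.ne' hn.2]
      push_cast
      rw [sum_mul]
      refine sum_congr rfl fun x hx => ?_
      rw [(mem_filter.1 hx).2]; ring
    · simp_rw [sum_filter]
      rw [sum_comm]
      exact sum_congr rfl fun _ _ ↦ (by simp_all)
  rw [h1, sum_filter, sum_product]
  refine sum_congr rfl fun n hn ↦ ?_
  simp only [sum_ite, not_le, sum_const_zero, add_zero, mul_sum]
  congr
  ext
  simp only [mem_filter, mem_Ioc, and_assoc, and_congr_right_iff] at hn ⊢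
  intro _
  constructor
  · intro ⟨_, h⟩
    grw [← h, Nat.mul_div_cancel_left _ (by lia)]
  · intro hm
    grw [hm]
    simp [Nat.mul_div_le, Nat.div_le_self]

lemma harm_le (K : ℕ) : ∑ k ∈ range K, (1 : ℝ) / ((k : ℝ) + 1) ≤ 1 + Real.log K := by
  have := harmonic_le_one_add_log K
  rw [harmonic] at this
  push_cast at this
  simpa using this

lemma tv {f : ℕ → ℂ} {r : ℕ} (h : BS f r) (F : ℕ → ℝ) (K : ℕ) {b c : ℝ} (hb : 0 ≤ b) (hc : 0 ≤ c)
    (hF : 1 ≤ K → |F K| ≤ b) (hd : ∀ k, 1 ≤ k → k < K → |F (k + 1) - F k| ≤ c / k) :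
    ‖∑ k ∈ Ioc 0 K, (F k : ℂ) * f k‖ ≤ r * (b + c * (1 + Real.log K)) := by
  have id : ∀ K : ℕ, ∑ k ∈ Ioc 0 K, (F k : ℂ) * f k
      = SS f K * F K - ∑ k ∈ range K, SS f k * ((F (k + 1) : ℂ) - F k) := by
    intro K
    induction K with
    | zero => simp [SS]
    | succ K ih =>
      rw [sum_Ioc_succ_top (by simp), ih, sum_range_succ]
      have : SS f (K + 1) = SS f K + f (K + 1) := by rw [SS, SS, sum_range_succ]
      rw [this]; ring
  rw [id]
  have hr : (0 : ℝ) ≤ r := by positivity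
  rcases Nat.eq_zero_or_pos K with rfl | hK
  · simp [SS]; positivity
  have h1 : ‖SS f K * F K‖ ≤ r * b := by
    rw [norm_mul, Complex.norm_real, Real.norm_eq_abs]
    exact mul_le_mul (h.sum_le K) (hF hK) (abs_nonneg _) hr
  have h2 : ‖∑ k ∈ range K, SS f k * ((F (k + 1) : ℂ) - F k)‖ ≤ r * (c * (1 + Real.log K)) := by
    obtain ⟨J, rfl⟩ : ∃ J, K = J + 1 := ⟨K - 1, by omega⟩
    rw [sum_range_succ']
    simp only [SS, range_zero, sum_empty, zero_mul, add_zero]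
    refine (norm_sum_le _ _).trans ?_
    have hh : ∑ k ∈ range J, (1 : ℝ) / ((k : ℝ) + 1) ≤ 1 + Real.log ((J + 1 : ℕ) : ℝ) := by
      refine le_trans ?_ (harm_le (J + 1))
      rw [sum_range_succ]
      have : (0 : ℝ) ≤ 1 / ((J : ℝ) + 1) := by positivity
      linarith
    calc _ ≤ ∑ k ∈ range J, (r : ℝ) * (c * (1 / ((k : ℝ) + 1))) := by
          refine sum_le_sum fun k hk => ?_
          rw [norm_mul]
          refine mul_le_mul (h.sum_le (k + 1)) ?_ (norm_nonneg _) hr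
          have := hd (k + 1) (by omega) (by have := mem_range.1 hk; omega)
          rw [← Complex.ofReal_sub, Complex.norm_real, Real.norm_eq_abs]
          push_cast at this
          rw [mul_one_div]; exact this
      _ = r * (c * ∑ k ∈ range J, (1 : ℝ) / ((k : ℝ) + 1)) := by rw [mul_sum, mul_sum]
      _ ≤ _ := by gcongr
  calc _ ≤ _ := norm_sub_le _ _
    _ ≤ r * b + r * (c * (1 + Real.log K)) := add_le_add h1 h2
    _ = _ := by ring

lemma gauss_lip (a b : ℝ) : |Real.exp (-a ^ 2 / 2) - Real.exp (-b ^ 2 / 2)| ≤ |a - b| := by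
  have hd : ∀ t : ℝ, HasDerivAt (fun t : ℝ => Real.exp (-t ^ 2 / 2)) (Real.exp (-t ^ 2 / 2) * (-t)) t := by
    intro t
    have h1 : HasDerivAt (fun t : ℝ => -t ^ 2 / 2) (-t) t := by
      have h0 : HasDerivAt (fun t : ℝ => -t ^ 2 / 2) (-(((2 : ℕ) : ℝ) * t ^ (2 - 1)) / 2) t :=
        ((hasDerivAt_pow 2 t).neg).div_const 2
      have e : -(((2 : ℕ) : ℝ) * t ^ (2 - 1)) / 2 = -t := by norm_num; ring
      rwa [e] at h0
    exact h1.exp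
  have := Convex.norm_image_sub_le_of_norm_hasDerivWithin_le (C := 1) (s := Set.univ) (x := b) (y := a)
    (fun t _ => (hd t).hasDerivWithinAt) (fun t _ => by
      rw [norm_mul, norm_neg, Real.norm_eq_abs, Real.norm_eq_abs, abs_of_pos (Real.exp_pos _)]
      have h1 : |t| ≤ Real.exp (t ^ 2 / 2) := by
        have := Real.add_one_le_exp (t ^ 2 / 2)
        have h3 : 0 ≤ (|t| - 1) ^ 2 := sq_nonneg _
        rw [sub_sq, sq_abs] at h3
        linarith
      calc Real.exp (-t ^ 2 / 2) * |t| ≤ Real.exp (-t ^ 2 / 2) * Real.exp (t ^ 2 / 2) := by gcongr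
        _ = 1 := by rw [← Real.exp_add]; simp; ring) convex_univ (Set.mem_univ _) (Set.mem_univ _)
  simpa using this

lemma gw_nonneg (l t : ℝ) : 0 ≤ gw l t := (Real.exp_pos _).le
lemma gw_le_one (l t : ℝ) : gw l t ≤ 1 := by
  rw [gw, Real.exp_le_one_iff]; have := sq_nonneg (Real.log t - l); linarith

lemma log_step {k : ℕ} (hk : 1 ≤ k) : |Real.log ((k : ℝ) + 1) - Real.log k| ≤ 1 / k := by
  have hk0 : (0 : ℝ) < k := by exact_mod_cast hk
  rw [← Real.log_div (by positivity) (by positivity), abs_of_nonneg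
    (Real.log_nonneg (by rw [le_div_iff₀ hk0]; linarith))]
  refine (Real.log_le_sub_one_of_pos (by positivity)).trans (le_of_eq ?_)
  field_simp; ring

lemma gw_step (l : ℝ) {d k : ℕ} (hd : 1 ≤ d) (hk : 1 ≤ k) :
    |gw l ((d * (k + 1) : ℕ)) - gw l ((d * k : ℕ))| ≤ 1 / k := by
  have hk0 : (0 : ℝ) < k := by exact_mod_cast hk
  have hd0 : (0 : ℝ) < d := by exact_mod_cast hd
  refine (gauss_lip _ _).trans ?_
  push_cast
  rw [Real.log_mul hd0.ne' (by positivity), Real.log_mul hd0.ne' hk0.ne']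
  refine le_trans (le_of_eq ?_) (log_step hk)
  congr 1; ring

/-- truncated arithmetic functions -/
noncomputable def trLe (U : ℕ) (f : ArithmeticFunction ℝ) : ArithmeticFunction ℝ :=
  ⟨fun n => if n ≤ U then f n else 0, by simp⟩
noncomputable def trGt (U : ℕ) (f : ArithmeticFunction ℝ) : ArithmeticFunction ℝ :=
  ⟨fun n => if n ≤ U then 0 else f n, by simp⟩
lemma trLe_apply (U : ℕ) (f : ArithmeticFunction ℝ) (n : ℕ) : trLe U f n = if n ≤ U then f n else 0 := rfl
lemma trGt_apply (U : ℕ) (f : ArithmeticFunction ℝ) (n : ℕ) : trGt U f n = if n ≤ U then 0 else f n := rfl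
lemma tr_add (U : ℕ) (f : ArithmeticFunction ℝ) : f = trLe U f + trGt U f := by
  ext n; rw [ArithmeticFunction.add_apply, trLe_apply, trGt_apply]; split_ifs <;> simp

noncomputable def muR : ArithmeticFunction ℝ := (moebius : ArithmeticFunction ℝ)
noncomputable def zeR : ArithmeticFunction ℝ := (ArithmeticFunction.zeta : ArithmeticFunction ℝ)
lemma muR_abs (n : ℕ) : |muR n| ≤ 1 := by
  rw [muR, ArithmeticFunction.intCoe_apply]
  exact_mod_cast ArithmeticFunction.abs_moebius_le_one

noncomputable def bb (U : ℕ) : ArithmeticFunction ℝ := trGt U muR * zeR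

lemma vaughan_id (U : ℕ) : vonMangoldt = trLe U vonMangoldt + trLe U muR * ArithmeticFunction.log
    - trLe U muR * (trLe U vonMangoldt * zeR) + trGt U vonMangoldt * bb U := by
  have h1 : muR * zeR = 1 := ArithmeticFunction.coe_moebius_mul_coe_zeta
  have h2 : vonMangoldt * zeR = ArithmeticFunction.log := ArithmeticFunction.vonMangoldt_mul_zeta
  have h3 := tr_add U muR
  have h4 := tr_add U vonMangoldt
  rw [bb]
  linear_combination (1 + trLe U muR * (-zeR)) * h4 + trGt U vonMangoldt * (-h1 + zeR * h3) + trLe U muR * h2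

lemma sum_supp_le {U N : ℕ} {g : ℕ → ℂ} {c : ℝ} (hc : 0 ≤ c) (h0 : ∀ a, U < a → g a = 0)
    (h : ∀ a, 1 ≤ a → a ≤ U → ‖g a‖ ≤ c) : ‖∑ a ∈ Ioc 0 N, g a‖ ≤ U * c := by
  have h1 : ∑ a ∈ Ioc 0 N, ‖g a‖ ≤ ∑ a ∈ Ioc 0 U, c := by
    calc _ ≤ ∑ a ∈ Ioc 0 N, (if a ∈ Ioc 0 U then c else 0) := by
          refine sum_le_sum fun a ha => ?_
          have ha' := mem_Ioc.1 ha
          split_ifs with hh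
          · exact h a ha'.1 (mem_Ioc.1 hh).2
          · rw [h0 a (by simp at hh; omega), norm_zero]
      _ = ∑ a ∈ (Ioc 0 N) ∩ (Ioc 0 U), c := by rw [sum_ite_mem]
      _ ≤ _ := sum_le_sum_of_subset_of_nonneg inter_subset_right (fun _ _ _ => hc)
  refine (norm_sum_le _ _).trans (h1.trans ?_)
  simp

theorem vaughan_bound {r : ℕ} [NeZero r] {χ : DirichletCharacter ℂ r} (hχ : χ ≠ 1) (l : ℝ) {N U : ℕ}
    (hU : 1 ≤ U) (hUN : U ≤ N) :
    ‖∑ n ∈ Ioc 0 N, (vonMangoldt n : ℂ) * (χ n * gw l n)‖ ≤ 5 * r * U ^ 2 * (1 + Real.log N) ^ 2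
      + ‖∑ a ∈ Ioc 0 N, (trGt U vonMangoldt a : ℂ) * ∑ k ∈ Ioc 0 (N / a), (bb U k : ℂ) *
        (χ (a * k : ℕ) * gw l (a * k : ℕ))‖ := by
  have hbs := BS_char hχ
  set L := Real.log N with hL
  have hL0 : 0 ≤ L := Real.log_natCast_nonneg N
  have hr1 : (1 : ℝ) ≤ r := by exact_mod_cast NeZero.one_le
  have hU1 : (1 : ℝ) ≤ U := by exact_mod_cast hU
  have hlogle : ∀ k : ℕ, k ≤ N → Real.log k ≤ L := by
    intro k hk
    rcases Nat.eq_zero_or_pos k with rfl | h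
    · simpa using hL0
    · exact Real.log_le_log (by exact_mod_cast h) (by exact_mod_cast hk)
  have hch : ∀ n : ℕ, ‖χ n‖ ≤ 1 := fun n => χ.norm_le_one _
  have hgn : ∀ n : ℕ, ‖((gw l n : ℝ) : ℂ)‖ ≤ 1 := fun n => by
    rw [Complex.norm_real, Real.norm_of_nonneg (gw_nonneg _ _)]; exact gw_le_one _ _
  set f : ℕ → ℂ := fun n => χ n * gw l n with hf
  have e0 : ∑ n ∈ Ioc 0 N, (vonMangoldt n : ℂ) * f n
      = ∑ n ∈ Ioc 0 N, (trLe U vonMangoldt n : ℂ) * f n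
      + ∑ n ∈ Ioc 0 N, ((trLe U muR * ArithmeticFunction.log) n : ℂ) * f n
      - ∑ n ∈ Ioc 0 N, ((trLe U muR * (trLe U vonMangoldt * zeR)) n : ℂ) * f n
      + ∑ n ∈ Ioc 0 N, ((trGt U vonMangoldt * bb U) n : ℂ) * f n := by
    rw [← sum_add_distrib, ← sum_sub_distrib, ← sum_add_distrib]
    refine sum_congr rfl fun n _ => ?_
    conv_lhs => rw [vaughan_id U]
    rw [ArithmeticFunction.add_apply, sub_eq_add_neg, ArithmeticFunction.add_apply, ArithmeticFunction.neg_apply,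
      ArithmeticFunction.add_apply]
    push_cast; ring
  have hΛ : ∀ b : ℕ, b ≤ U → ‖(trLe U vonMangoldt b : ℂ)‖ ≤ L := by
    intro b hb
    rw [trLe_apply, if_pos hb, Complex.norm_real, Real.norm_of_nonneg ArithmeticFunction.vonMangoldt_nonneg]
    exact ArithmeticFunction.vonMangoldt_le_log.trans (hlogle b (hb.trans hUN))
  have hμ : ∀ b : ℕ, ‖(trLe U muR b : ℂ)‖ ≤ 1 := by
    intro b
    rw [trLe_apply, Complex.norm_real, Real.norm_eq_abs]
    split_ifs
    · exact muR_abs b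
    · simp
  have b1 : ‖∑ n ∈ Ioc 0 N, (trLe U vonMangoldt n : ℂ) * f n‖ ≤ U * L := by
    refine sum_supp_le hL0 (fun a ha => by rw [trLe_apply, if_neg (by omega)]; simp) fun a _ ha => ?_
    rw [norm_mul, hf, norm_mul]
    calc _ ≤ L * (1 * 1) := by gcongr; exacts [hΛ a ha, hch a, hgn a]
      _ = L := by ring
  have b2 : ‖∑ n ∈ Ioc 0 N, ((trLe U muR * ArithmeticFunction.log) n : ℂ) * f n‖ ≤ U * (r * (L + (1 + L) * (1 + L))) := by
    rw [hyp]
    refine sum_supp_le (by positivity) (fun a ha => by rw [trLe_apply, if_neg (by omega)]; simp) fun a ha1 ha => ?_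
    have e : ∑ k ∈ Ioc 0 (N / a), (ArithmeticFunction.log k : ℂ) * f (a * k)
        = χ a * ∑ k ∈ Ioc 0 (N / a), ((Real.log k * gw l (a * k : ℕ) : ℝ) : ℂ) * χ k := by
      rw [mul_sum]; refine sum_congr rfl fun k _ => ?_
      rw [hf, ArithmeticFunction.log_apply]
      simp only
      push_cast
      rw [map_mul]; ring
    have hle : N / a ≤ N := Nat.div_le_self _ _
    have t := tv hbs (fun k : ℕ => Real.log k * gw l (a * k : ℕ)) (N / a) hL0 (c := 1 + L) (by linarith) (fun _ => by
      rw [abs_mul, abs_of_nonneg (gw_nonneg _ _), abs_of_nonneg (Real.log_natCast_nonneg _)]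
      calc _ ≤ L * 1 := by
            exact mul_le_mul (hlogle _ hle) (gw_le_one _ _) (gw_nonneg _ _) hL0
        _ = L := mul_one L) (fun k k1 k2 => by
      have s1 := gw_step l (d := a) ha1 k1
      have s2 := log_step k1
      have s3 : |Real.log ((k + 1 : ℕ) : ℝ)| ≤ L := by
        rw [abs_of_nonneg (Real.log_natCast_nonneg _)]; exact hlogle _ (by omega)
      have : Real.log ((k + 1 : ℕ) : ℝ) * gw l (a * (k + 1) : ℕ) - Real.log k * gw l (a * k : ℕ)
        = Real.log ((k + 1 : ℕ) : ℝ) * (gw l (a * (k + 1) : ℕ) - gw l (a * k : ℕ))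
          + (Real.log ((k : ℝ) + 1) - Real.log k) * gw l (a * k : ℕ) := by push_cast; ring
      rw [this]
      refine (abs_add_le _ _).trans ?_
      rw [abs_mul, abs_mul, abs_of_nonneg (gw_nonneg _ _)]
      calc _ ≤ L * (1 / k) + 1 / k * 1 := by
            gcongr
            · exact gw_nonneg _ _
            · exact gw_le_one _ _
        _ = (1 + L) / k := by ring)
    rw [e, norm_mul, norm_mul]
    calc _ ≤ 1 * (1 * (r * (L + (1 + L) * (1 + Real.log (N / a : ℕ))))) := by
          gcongr; exacts [hμ a, hch a]
      _ ≤ 1 * (1 * (r * (L + (1 + L) * (1 + L)))) := by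
          gcongr; exact hlogle _ hle
      _ = _ := by ring
  have b3 : ‖∑ n ∈ Ioc 0 N, ((trLe U muR * (trLe U vonMangoldt * zeR)) n : ℂ) * f n‖
      ≤ U * (U * (L * (r * (1 + 1 * (1 + L))))) := by
    rw [hyp]
    refine sum_supp_le (by positivity) (fun a ha => by rw [trLe_apply, if_neg (by omega)]; simp) fun a ha1 ha => ?_
    rw [norm_mul]
    refine (mul_le_of_le_one_left (norm_nonneg _) (hμ a)).trans ?_
    rw [hyp]
    refine sum_supp_le (by positivity) (fun a ha => by rw [trLe_apply, if_neg (by omega)]; simp) fun b hb1 hb => ?_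
    have e : ∑ k ∈ Ioc 0 (N / a / b), (zeR k : ℂ) * f (a * (b * k))
        = χ (a * b : ℕ) * ∑ k ∈ Ioc 0 (N / a / b), ((gw l (a * b * k : ℕ) : ℝ) : ℂ) * χ k := by
      rw [mul_sum]; refine sum_congr rfl fun k hk => ?_
      have hk0 : k ≠ 0 := by have := (mem_Ioc.1 hk).1; omega
      rw [hf, zeR, ArithmeticFunction.natCoe_apply, ArithmeticFunction.zeta_apply_ne hk0]
      simp only
      push_cast
      rw [map_mul, map_mul, map_mul, mul_assoc (a : ℝ)]; ring
    have t := tv hbs (fun k : ℕ => gw l (a * b * k : ℕ)) (N / a / b) (b := 1) zero_le_one (c := 1) zero_le_one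
      (fun _ => by rw [abs_of_nonneg (gw_nonneg _ _)]; exact gw_le_one _ _)
      (fun k k1 _ => gw_step l (d := a * b) (Nat.mul_pos ha1 hb1) k1)
    have hle : N / a / b ≤ N := (Nat.div_le_self _ _).trans (Nat.div_le_self _ _)
    rw [e, norm_mul, norm_mul]
    calc _ ≤ L * (1 * (r * (1 + 1 * (1 + Real.log (N / a / b : ℕ))))) := by
          gcongr; exacts [hΛ b hb, hch _]
      _ ≤ L * (1 * (r * (1 + 1 * (1 + L)))) := by
          gcongr; exact hlogle _ hle
      _ = _ := by ring
  have e4 := hyp (trGt U vonMangoldt) (bb U) f N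
  rw [e0, e4]
  have hsum : U * L + U * (r * (L + (1 + L) * (1 + L))) + U * (U * (L * (r * (1 + 1 * (1 + L)))))
      ≤ 5 * r * U ^ 2 * (1 + L) ^ 2 := by
    have q0 : (1 : ℝ) ≤ (1 + L) ^ 2 := one_le_pow₀ (by linarith)
    have qL : L ≤ (1 + L) ^ 2 := by nlinarith
    have hUU : (U : ℝ) ≤ U ^ 2 := le_self_pow₀ hU1 (by norm_num)
    have q1 : U * L ≤ r * U ^ 2 * (1 + L) ^ 2 := by
      calc (U : ℝ) * L = 1 * U * L := by ring
        _ ≤ r * U ^ 2 * (1 + L) ^ 2 := by gcongr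
    have q2 : U * (r * (L + (1 + L) * (1 + L))) ≤ U ^ 2 * (r * (2 * (1 + L) ^ 2)) := by
      gcongr; linarith [sq (1 + L)]
    have q3 : U * (U * (L * (r * (1 + 1 * (1 + L))))) ≤ U ^ 2 * (r * (2 * (1 + L) ^ 2)) := by
      have : L * (1 + 1 * (1 + L)) ≤ 2 * (1 + L) ^ 2 := by nlinarith
      calc _ = U ^ 2 * (r * (L * (1 + 1 * (1 + L)))) := by ring
        _ ≤ _ := by gcongr
    calc _ ≤ _ := add_le_add (add_le_add q1 q2) q3
      _ = _ := by ring
  refine (norm_add_le _ _).trans (add_le_add ?_ le_rfl)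
  refine (norm_sub_le _ _).trans ?_
  have := norm_add_le (∑ n ∈ Ioc 0 N, (trLe U vonMangoldt n : ℂ) * f n)
    (∑ n ∈ Ioc 0 N, ((trLe U muR * ArithmeticFunction.log) n : ℂ) * f n)
  linarith
end MG

namespace MG
open Finset Filter Topology
open ArithmeticFunction (vonMangoldt moebius)

lemma mel_int (l L σ : ℝ) : MeasureTheory.Integrable
    (fun t : ℝ => Kf l (σ + t * Complex.I) * Complex.exp (-(σ + t * Complex.I) * L)) := by
  refine (gauss_int.const_mul (Real.exp (σ ^ 2 / 2 + l * σ) * Real.exp (-σ * L))).mono' ?_ ?_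
  · refine Continuous.aestronglyMeasurable ?_
    have := (Kf_diff l).continuous
    fun_prop
  · refine Filter.Eventually.of_forall fun t => ?_
    rw [norm_mul, Kf_norm, Complex.norm_exp]
    refine le_of_eq ?_
    have : (-(σ + t * Complex.I) * (L : ℂ)).re = -σ * L := by simp
    rw [this]; ring

lemma cs_w {ι : Type*} (s : Finset ι) (w a b : ι → ℝ) (hw : ∀ i ∈ s, 0 ≤ w i) {X Y : ℝ}
    (hX : ∑ i ∈ s, w i * a i ^ 2 ≤ X) (hY : ∑ i ∈ s, w i * b i ^ 2 ≤ Y) :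
    ∑ i ∈ s, w i * (a i * b i) ≤ Real.sqrt X * Real.sqrt Y := by
  have h := Finset.sum_mul_sq_le_sq_mul_sq s (fun i => Real.sqrt (w i) * a i) (fun i => Real.sqrt (w i) * b i)
  have e1 : ∀ i ∈ s, (Real.sqrt (w i) * a i) * (Real.sqrt (w i) * b i) = w i * (a i * b i) := fun i hi => by
    have := Real.mul_self_sqrt (hw i hi); linear_combination (a i * b i) * this
  have e2 : ∀ (c : ι → ℝ), ∀ i ∈ s, (Real.sqrt (w i) * c i) ^ 2 = w i * c i ^ 2 := fun c i hi => by
    rw [mul_pow, Real.sq_sqrt (hw i hi)]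
  rw [sum_congr rfl e1, sum_congr rfl (e2 a), sum_congr rfl (e2 b)] at h
  have hX0 : 0 ≤ ∑ i ∈ s, w i * a i ^ 2 := sum_nonneg fun i hi => mul_nonneg (hw i hi) (sq_nonneg _)
  have hY0 : 0 ≤ ∑ i ∈ s, w i * b i ^ 2 := sum_nonneg fun i hi => mul_nonneg (hw i hi) (sq_nonneg _)
  rw [← Real.sqrt_mul (hX0.trans hX)]
  exact Real.le_sqrt_of_sq_le (h.trans (mul_le_mul hX hY hY0 (hX0.trans hX)))

/-- Dirichlet polynomial -/
noncomputable def DP (α : ℕ → ℝ) (σ : ℝ) (M : ℕ) {r : ℕ} (χ : DirichletCharacter ℂ r) (t : ℝ) : ℂ :=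
  ∑ m ∈ Ico M (M + M), ((α m : ℂ) * Complex.exp (-(σ + t * Complex.I) * Real.log m)) * χ m

lemma DP_ls (α : ℕ → ℝ) (σ : ℝ) {D M : ℕ} (hD : 1 ≤ D) (t : ℝ) :
    ∑ i ∈ (Icc 1 D).sigma prims, ((i.1 : ℝ) / i.1.totient) * ‖DP α σ M i.2 t‖ ^ 2
      ≤ 20 * ((M + D ^ 2) * ∑ m ∈ Ico M (M + M), α m ^ 2 * Real.exp (-(2 * σ) * Real.log m)) := by
  rw [← mul_assoc]
  have h := large_sieve D M M hD (fun m => (α m : ℂ) * Complex.exp (-(σ + t * Complex.I) * Real.log m))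
  rw [sum_sigma]
  simp_rw [mul_sum] at h
  refine h.trans (le_of_eq ?_)
  rw [mul_sum]
  refine sum_congr rfl fun m _ => ?_
  rw [norm_mul, Complex.norm_exp, Complex.norm_real, Real.norm_eq_abs, mul_pow, sq_abs, ← Real.exp_nat_mul]
  have : (-(σ + t * Complex.I) * (Real.log m : ℂ)).re = -σ * Real.log m := by
    rw [Complex.re_mul_ofReal]; simp
  rw [this]
  congr 3
  push_cast; ring

theorem block (l σ : ℝ) (h0 : 0 ≤ σ) (h1 : σ ≤ 1) {D M K : ℕ} (hD : 1 ≤ D) (hM : 1 ≤ M) (hK : 1 ≤ K)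
    (α β : ℕ → ℝ) :
    ∑ i ∈ (Icc 1 D).sigma prims, ((i.1 : ℝ) / i.1.totient) * ‖∑ m ∈ Ico M (M + M), ∑ k ∈ Ico K (K + K),
      ((α m * β k : ℝ) : ℂ) * (i.2 (m * k : ℕ) * gw l (m * k : ℕ))‖
    ≤ 40 * Real.exp (l * σ) * (Real.sqrt ((M + D ^ 2) * ∑ m ∈ Ico M (M + M), α m ^ 2 * Real.exp (-(2 * σ) * Real.log m))
      * Real.sqrt ((K + D ^ 2) * ∑ k ∈ Ico K (K + K), β k ^ 2 * Real.exp (-(2 * σ) * Real.log k))) := by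
  set s2 := Real.sqrt (2 * Real.pi) with hs2
  have hs2p : 0 < s2 := lt_of_lt_of_le one_pos sqrt2pi_ge
  set SA := (M + D ^ 2 : ℝ) * ∑ m ∈ Ico M (M + M), α m ^ 2 * Real.exp (-(2 * σ) * Real.log m)
  set SB := (K + D ^ 2 : ℝ) * ∑ k ∈ Ico K (K + K), β k ^ 2 * Real.exp (-(2 * σ) * Real.log k)
  set S : (Σ r : ℕ, DirichletCharacter ℂ r) → ℂ := fun i => ∑ m ∈ Ico M (M + M), ∑ k ∈ Ico K (K + K),
      ((α m * β k : ℝ) : ℂ) * (i.2 (m * k : ℕ) * gw l (m * k : ℕ)) with hS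
  set G : (Σ r : ℕ, DirichletCharacter ℂ r) → ℝ → ℂ := fun i t =>
    Kf l (σ + t * Complex.I) * (DP α σ M i.2 t * DP β σ K i.2 t) with hG
  have eG : ∀ i t, G i t = ∑ m ∈ Ico M (M + M), ∑ k ∈ Ico K (K + K), (((α m * β k : ℝ) : ℂ) * i.2 (m * k : ℕ)) *
      (Kf l (σ + t * Complex.I) * Complex.exp (-(σ + t * Complex.I) * Real.log (m * k : ℕ))) := by
    intro i t
    simp only [hG, DP]
    rw [sum_mul_sum, mul_sum]
    refine sum_congr rfl fun m hm => ?_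
    rw [mul_sum]
    refine sum_congr rfl fun k hk => ?_
    have hm0 : (m : ℝ) ≠ 0 := by have := (mem_Ico.1 hm).1; norm_cast; omega
    have hk0 : (k : ℝ) ≠ 0 := by have := (mem_Ico.1 hk).1; norm_cast; omega
    push_cast
    rw [Real.log_mul hm0 hk0, map_mul]
    push_cast
    rw [mul_add, Complex.exp_add]
    ring
  have iG : ∀ i, MeasureTheory.Integrable (G i) := by
    intro i
    have : G i = fun t => G i t := rfl
    rw [this]
    simp_rw [eG]
    refine MeasureTheory.integrable_finsetSum _ fun m _ => MeasureTheory.integrable_finsetSum _ fun k _ => ?_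
    exact (mel_int l _ σ).const_mul _
  have vG : ∀ i, ∫ t, G i t = s2 * S i := by
    intro i
    simp_rw [eG]
    rw [MeasureTheory.integral_finsetSum _ fun m _ => MeasureTheory.integrable_finsetSum _ fun k _ =>
      (mel_int l _ σ).const_mul _]
    rw [hS]; simp only
    rw [mul_sum]
    refine sum_congr rfl fun m _ => ?_
    rw [MeasureTheory.integral_finsetSum _ fun k _ => (mel_int l _ σ).const_mul _, mul_sum]
    refine sum_congr rfl fun k _ => ?_
    rw [MeasureTheory.integral_const_mul, mellin, gw]
    push_cast; ring
  have hw : ∀ i ∈ (Icc 1 D).sigma prims, 0 ≤ ((i.1 : ℝ) / i.1.totient) := fun i _ => by positivity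
  have key : ∑ i ∈ (Icc 1 D).sigma prims, ((i.1 : ℝ) / i.1.totient) * ‖(s2 : ℂ) * S i‖
      ≤ (Real.sqrt (20 * SA) * Real.sqrt (20 * SB)) * (Real.exp (σ ^ 2 / 2 + l * σ) * s2) := by
    calc _ ≤ ∑ i ∈ (Icc 1 D).sigma prims, ((i.1 : ℝ) / i.1.totient) * ∫ t, ‖G i t‖ := by
          refine sum_le_sum fun i hi => mul_le_mul_of_nonneg_left ?_ (hw i hi)
          rw [← vG]; exact MeasureTheory.norm_integral_le_integral_norm _
      _ = ∫ t, ∑ i ∈ (Icc 1 D).sigma prims, ((i.1 : ℝ) / i.1.totient) * ‖G i t‖ := by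
          rw [MeasureTheory.integral_finsetSum _ fun i _ => ((iG i).norm.const_mul _)]
          refine sum_congr rfl fun i _ => ?_
          rw [MeasureTheory.integral_const_mul]
      _ ≤ ∫ t, (Real.sqrt (20 * SA) * Real.sqrt (20 * SB)) * (Real.exp (σ ^ 2 / 2 + l * σ) * Real.exp (-(1/2) * t ^ 2)) := by
          refine MeasureTheory.integral_mono
            (MeasureTheory.integrable_finsetSum _ fun i _ => ((iG i).norm.const_mul _))
            ((gauss_int.const_mul _).const_mul _) fun t => ?_
          have c := cs_w ((Icc 1 D).sigma prims) (fun i => (i.1 : ℝ) / i.1.totient) (fun i => ‖DP α σ M i.2 t‖)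
            (fun i => ‖DP β σ K i.2 t‖) hw (DP_ls α σ hD t) (DP_ls β σ hD t)
          simp only
          calc _ = (∑ i ∈ (Icc 1 D).sigma prims, ((i.1 : ℝ) / i.1.totient) * (‖DP α σ M i.2 t‖ * ‖DP β σ K i.2 t‖))
                * (Real.exp (σ ^ 2 / 2 + l * σ) * Real.exp (-(1/2) * t ^ 2)) := by
                rw [sum_mul]
                refine sum_congr rfl fun i _ => ?_
                simp only [hG]
                rw [norm_mul, Kf_norm, norm_mul]; ring
            _ ≤ _ := by
                gcongr
      _ = _ := by
          rw [MeasureTheory.integral_const_mul, MeasureTheory.integral_const_mul, gauss_val]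
  have e : ∀ i, ‖(s2 : ℂ) * S i‖ = s2 * ‖S i‖ := fun i => by
    rw [norm_mul, Complex.norm_real, Real.norm_of_nonneg hs2p.le]
  simp_rw [e] at key
  have k2 : s2 * ∑ i ∈ (Icc 1 D).sigma prims, ((i.1 : ℝ) / i.1.totient) * ‖S i‖
      ≤ s2 * ((Real.sqrt (20 * SA) * Real.sqrt (20 * SB)) * Real.exp (σ ^ 2 / 2 + l * σ)) := by
    rw [mul_sum]
    calc _ = _ := sum_congr rfl fun i _ => by ring
      _ ≤ _ := key
      _ = _ := by ring
  refine (le_of_mul_le_mul_left k2 hs2p).trans ?_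
  rw [Real.sqrt_mul (by norm_num) SA, Real.sqrt_mul (by norm_num) SB, Real.exp_add]
  have h20 : Real.sqrt 20 * Real.sqrt 20 = 20 := Real.mul_self_sqrt (by norm_num)
  have he : Real.exp (σ ^ 2 / 2) ≤ 2 := by
    refine le_trans (Real.exp_le_exp.2 ?_) exp_half_le
    have : σ ^ 2 ≤ 1 := pow_le_one₀ h0 h1
    linarith
  calc _ = (Real.sqrt 20 * Real.sqrt 20) * Real.exp (σ ^ 2 / 2) * Real.exp (l * σ) * (Real.sqrt SA * Real.sqrt SB) := by ring
    _ ≤ 20 * 2 * Real.exp (l * σ) * (Real.sqrt SA * Real.sqrt SB) := by rw [h20]; gcongr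
    _ = _ := by ring
end MG

namespace MG
open Finset Filter Topology
open ArithmeticFunction (vonMangoldt moebius)

lemma zeR_apply {n : ℕ} (h : n ≠ 0) : zeR n = 1 := by
  rw [zeR, ArithmeticFunction.natCoe_apply, ArithmeticFunction.zeta_apply_ne h]; simp

lemma harm_Ioc (N : ℕ) : ∑ a ∈ Ioc 0 N, (1 : ℝ) / a ≤ 1 + Real.log N := by
  have e : ∑ a ∈ Ioc 0 N, (1 : ℝ) / a = ∑ k ∈ range N, (1 : ℝ) / (k + 1) := by
    induction N with
    | zero => simp
    | succ n ih => rw [sum_Ioc_succ_top (by omega), sum_range_succ, ih]; push_cast; rfl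
  rw [e]; simpa using harm_le N

lemma zpow_sum (j N : ℕ) : ∑ n ∈ Ioc 0 N, (zeR ^ (j + 1)) n ≤ N * (1 + Real.log N) ^ j := by
  induction j generalizing N with
  | zero =>
    simp only [zero_add, pow_one, pow_zero, mul_one]
    rw [sum_congr rfl fun n hn => zeR_apply (by have := (mem_Ioc.1 hn).1; omega)]
    simp
  | succ j ih =>
    rw [pow_succ', ArithmeticFunction.sum_Ioc_mul_eq_sum_sum]
    calc _ ≤ ∑ n ∈ Ioc 0 N, (N * (1 + Real.log N) ^ j) * (1 / (n : ℝ)) := by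
          refine sum_le_sum fun n hn => ?_
          have hn' := mem_Ioc.1 hn
          rw [zeR_apply (by omega), one_mul]
          refine (ih (N / n)).trans ?_
          have h1 : ((N / n : ℕ) : ℝ) ≤ N / n := Nat.cast_div_le
          have h2 : Real.log (N / n : ℕ) ≤ Real.log N := by
            rcases Nat.eq_zero_or_pos (N / n) with h | h
            · rw [h]; simpa using Real.log_natCast_nonneg N
            · exact Real.log_le_log (by exact_mod_cast h) (by exact_mod_cast Nat.div_le_self _ _)
          have h3 := Real.log_natCast_nonneg (N / n)
          calc _ ≤ (N / n : ℝ) * (1 + Real.log N) ^ j := by gcongr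
            _ = _ := by ring
      _ = (N * (1 + Real.log N) ^ j) * ∑ n ∈ Ioc 0 N, (1 : ℝ) / n := by rw [mul_sum]
      _ ≤ (N * (1 + Real.log N) ^ j) * (1 + Real.log N) := by
          have := Real.log_natCast_nonneg N
          gcongr; exact harm_Ioc N
      _ = _ := by ring

lemma zeR_sq (n : ℕ) : (zeR ^ 2) n = n.divisors.card := by
  rw [pow_two, ArithmeticFunction.mul_apply, sum_congr rfl (g := fun _ => (1 : ℝ))]
  · rw [sum_const, ← Nat.map_div_right_divisors, card_map]; simp
  · intro x hx
    rw [zeR_apply (Nat.left_ne_zero_of_mem_divisorsAntidiagonal hx),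
      zeR_apply (Nat.right_ne_zero_of_mem_divisorsAntidiagonal hx), one_mul]

lemma dsq_le (n : ℕ) : (n.divisors.card : ℝ) ^ 2 ≤ (zeR ^ 4) n := by
  have e : zeR ^ 4 = zeR ^ 2 * zeR ^ 2 := by ring
  rw [e, ArithmeticFunction.mul_apply]
  calc (n.divisors.card : ℝ) ^ 2 = ∑ x ∈ n.divisorsAntidiagonal, (n.divisors.card : ℝ) := by
        rw [sum_const, ← Nat.map_div_right_divisors, card_map]; simp [sq]
    _ ≤ _ := by
        refine sum_le_sum fun x hx => ?_
        rw [zeR_sq, zeR_sq, ← (Nat.mem_divisorsAntidiagonal.1 hx).1, Nat.divisors_mul]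
        exact_mod_cast Finset.card_mul_le

lemma bb_le (U n : ℕ) : |bb U n| ≤ n.divisors.card := by
  rw [bb, ArithmeticFunction.mul_apply, ← zeR_sq, pow_two, ArithmeticFunction.mul_apply]
  refine (abs_sum_le_sum_abs _ _).trans (sum_le_sum fun x hx => ?_)
  rw [abs_mul, zeR_apply (Nat.left_ne_zero_of_mem_divisorsAntidiagonal hx),
      zeR_apply (Nat.right_ne_zero_of_mem_divisorsAntidiagonal hx), abs_one, mul_one, mul_one, trGt_apply]
  split_ifs
  · simp
  · exact muR_abs _

lemma bb_zero {U n : ℕ} (h : n ≤ U) : bb U n = 0 := by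
  rw [bb, ArithmeticFunction.mul_apply]
  refine sum_eq_zero fun x hx => ?_
  have : x.1 ≤ U := (Nat.divisor_le (Nat.fst_mem_divisors_of_mem_antidiagonal hx)).trans h
  rw [trGt_apply, if_pos this, zero_mul]

lemma bb_sum (U : ℕ) {K : ℕ} (hK : 1 ≤ K) {H : ℝ} (hH : 1 + Real.log (2 * K) ≤ H) :
    ∑ k ∈ Ico K (K + K), bb U k ^ 2 ≤ 2 * K * H ^ 3 := by
  have h0 : 0 ≤ Real.log (2 * K) := by exact_mod_cast Real.log_natCast_nonneg (2 * K)
  calc _ ≤ ∑ k ∈ Ico K (K + K), (zeR ^ 4) k := by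
        refine sum_le_sum fun k _ => le_trans ?_ (dsq_le k)
        rw [← sq_abs]
        exact pow_le_pow_left₀ (abs_nonneg _) (bb_le U k) 2
    _ ≤ ∑ k ∈ Ioc 0 (2 * K), (zeR ^ 4) k := by
        refine sum_le_sum_of_subset_of_nonneg (fun k hk => ?_) fun k _ _ => (sq_nonneg _).trans (dsq_le k)
        have := mem_Ico.1 hk
        exact mem_Ioc.2 ⟨by omega, by omega⟩
    _ ≤ _ := zpow_sum 3 (2 * K)
    _ ≤ _ := by push_cast; gcongr

lemma lam_sum (U : ℕ) {K : ℕ} (hK : 1 ≤ K) {H : ℝ} (hH : 1 + Real.log (2 * K) ≤ H) :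
    ∑ k ∈ Ico K (K + K), trGt U vonMangoldt k ^ 2 ≤ K * H ^ 2 := by
  have h0 : 0 ≤ Real.log (2 * K) := by exact_mod_cast Real.log_natCast_nonneg (2 * K)
  calc _ ≤ ∑ k ∈ Ico K (K + K), H ^ 2 := by
        refine sum_le_sum fun k hk => ?_
        have hk' := mem_Ico.1 hk
        have hk0 : (0 : ℝ) < k := by exact_mod_cast (by omega : 0 < k)
        rw [trGt_apply]
        split_ifs
        · rw [zero_pow two_ne_zero]; exact sq_nonneg _
        · have h1 : vonMangoldt k ≤ Real.log k := ArithmeticFunction.vonMangoldt_le_log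
          have h2 : Real.log k ≤ Real.log (2 * K) := Real.log_le_log hk0 (by exact_mod_cast (by omega : k ≤ 2 * K))
          exact pow_le_pow_left₀ ArithmeticFunction.vonMangoldt_nonneg (by linarith) 2
    _ = _ := by simp

lemma card_prims (r : ℕ) (hr : 1 ≤ r) : ((prims r).card : ℝ) ≤ r.totient := by
  haveI : NeZero r := ⟨by omega⟩
  classical
  have h : Fintype.card (DirichletCharacter ℂ r) = r.totient := by
    rw [← Nat.card_eq_fintype_card]
    exact DirichletCharacter.card_eq_totient_of_hasEnoughRootsOfUnity ℂ r
  exact_mod_cast (card_le_univ (prims r)).trans h.le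

lemma sqrt_prod_le {M D : ℝ} (hM : 0 ≤ M) (hD : 0 ≤ D) : Real.sqrt ((M + D ^ 2) * M) ≤ M + D * Real.sqrt M := by
  apply Real.sqrt_le_iff.2
  have := Real.sq_sqrt hM
  have h2 := Real.sqrt_nonneg M
  refine ⟨by positivity, ?_⟩
  have h3 : 0 ≤ 2 * M * (D * Real.sqrt M) := by positivity
  nlinarith [this]

lemma block2 (l : ℝ) {D M K U : ℕ} (hD : 1 ≤ D) (hU : 1 ≤ U) (hM : U ≤ M) (hK : U ≤ K) {H : ℝ}
    (hHM : 1 + Real.log (2 * M) ≤ H) (hHK : 1 + Real.log (2 * K) ≤ H) (V : ℕ) :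
    ∑ i ∈ (Icc 1 D).sigma prims, ((i.1 : ℝ) / i.1.totient) * ‖∑ m ∈ Ico M (M + M), ∑ k ∈ Ico K (K + K),
      ((trGt V vonMangoldt m * bb V k : ℝ) : ℂ) * (i.2 (m * k : ℕ) * gw l (m * k : ℕ))‖
    ≤ 80 * H ^ 3 * (Real.exp l + 2 * D * (Real.exp l / Real.sqrt U) + D ^ 2 * Real.exp (l / 2)) := by
  have hM1 : 1 ≤ M := by omega
  have hK1 : 1 ≤ K := by omega
  have hM0 : (0 : ℝ) < M := by exact_mod_cast hM1
  have hK0 : (0 : ℝ) < K := by exact_mod_cast hK1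
  have hU0 : (0 : ℝ) < U := by exact_mod_cast hU
  set x := Real.exp l with hx
  have hx0 : 0 < x := Real.exp_pos l
  have hH1 : 1 ≤ H := by
    have : 0 ≤ Real.log (2 * K) := by exact_mod_cast Real.log_natCast_nonneg (2 * K)
    linarith
  set P := (M + D * Real.sqrt M) * (K + D * Real.sqrt K) with hP
  have hP0 : 0 ≤ P := by positivity
  -- generic sum bound
  have gen : ∀ (σ : ℝ), 0 ≤ σ → ∀ (T : ℕ) (α : ℕ → ℝ) (c : ℝ), 1 ≤ T → 0 ≤ c → ∑ k ∈ Ico T (T + T), α k ^ 2 ≤ T * c →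
      Real.sqrt ((T + D ^ 2) * ∑ k ∈ Ico T (T + T), α k ^ 2 * Real.exp (-(2 * σ) * Real.log k))
        ≤ (T + D * Real.sqrt T) * Real.sqrt c * Real.exp (-σ * Real.log T) := by
    intro σ hσ T α c hT hc h
    have hT0 : (0 : ℝ) < T := by exact_mod_cast hT
    have h1 : ∑ k ∈ Ico T (T + T), α k ^ 2 * Real.exp (-(2 * σ) * Real.log k) ≤ T * c * Real.exp (-(2 * σ) * Real.log T) := by
      calc _ ≤ ∑ k ∈ Ico T (T + T), α k ^ 2 * Real.exp (-(2 * σ) * Real.log T) := by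
            refine sum_le_sum fun k hk => ?_
            have hle : Real.log T ≤ Real.log k :=
              Real.log_le_log hT0 (by exact_mod_cast (mem_Ico.1 hk).1)
            have := mul_le_mul_of_nonneg_left hle (show 0 ≤ 2 * σ by linarith)
            gcongr ?_ * ?_
            exact Real.exp_le_exp.2 (by linarith)
        _ = (∑ k ∈ Ico T (T + T), α k ^ 2) * Real.exp (-(2 * σ) * Real.log T) := by rw [sum_mul]
        _ ≤ _ := by gcongr
    have h2 : Real.exp (-(2 * σ) * Real.log T) = Real.exp (-σ * Real.log T) ^ 2 := by
      rw [← Real.exp_nat_mul]; congr 1; push_cast; ring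
    calc _ ≤ Real.sqrt (((T + D ^ 2) * T) * (c * Real.exp (-σ * Real.log T) ^ 2)) := by
          apply Real.sqrt_le_sqrt
          rw [← h2]
          calc _ ≤ (T + D ^ 2 : ℝ) * (T * c * Real.exp (-(2 * σ) * Real.log T)) := by gcongr
            _ = _ := by ring
      _ = Real.sqrt ((T + D ^ 2) * T) * (Real.sqrt c * Real.exp (-σ * Real.log T)) := by
          rw [Real.sqrt_mul (by positivity), Real.sqrt_mul hc, Real.sqrt_sq (Real.exp_pos _).le]
      _ ≤ (T + D * Real.sqrt T) * (Real.sqrt c * Real.exp (-σ * Real.log T)) := by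
          gcongr; exact sqrt_prod_le hT0.le (by positivity)
      _ = _ := by ring
  have hb := bb_sum V hK1 hHK
  have ha := lam_sum V hM1 hHM
  have b : ∀ σ : ℝ, 0 ≤ σ → σ ≤ 1 → ∑ i ∈ (Icc 1 D).sigma prims, ((i.1 : ℝ) / i.1.totient) *
      ‖∑ m ∈ Ico M (M + M), ∑ k ∈ Ico K (K + K),
      ((trGt V vonMangoldt m * bb V k : ℝ) : ℂ) * (i.2 (m * k : ℕ) * gw l (m * k : ℕ))‖
      ≤ 80 * H ^ 3 * (Real.exp (l * σ) * Real.exp (-σ * Real.log M) * Real.exp (-σ * Real.log K) * P) := by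
    intro σ h0 h1
    refine (block l σ h0 h1 hD hM1 hK1 (fun m => trGt V vonMangoldt m) (fun k => bb V k)).trans ?_
    have g1 := gen σ h0 M (fun m => trGt V vonMangoldt m) (H ^ 2) hM1 (by positivity) ha
    have g2 := gen σ h0 K (fun k => bb V k) (2 * H ^ 3) hK1 (by positivity) (by linarith)
    have s1 : Real.sqrt (H ^ 2) = H := Real.sqrt_sq (by linarith)
    have s2 : Real.sqrt (2 * H ^ 3) ≤ 2 * H ^ 2 := by
      apply Real.sqrt_le_iff.2 ⟨by positivity, ?_⟩
      have : H ^ 3 ≤ H ^ 4 := pow_le_pow_right₀ hH1 (by norm_num)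
      have h4 : 0 ≤ H ^ 4 := by positivity
      calc 2 * H ^ 3 ≤ 2 * H ^ 4 := by linarith
        _ ≤ 4 * H ^ 4 := by linarith
        _ = _ := by ring
    rw [s1] at g1
    calc _ ≤ 40 * Real.exp (l * σ) * (((M + D * Real.sqrt M) * H * Real.exp (-σ * Real.log M)) *
          ((K + D * Real.sqrt K) * (2 * H ^ 2) * Real.exp (-σ * Real.log K))) := by
          gcongr
          refine g2.trans ?_
          gcongr
      _ = _ := by rw [hP]; ring
  have hsM := Real.sq_sqrt hM0.le
  have hsK := Real.sq_sqrt hK0.le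
  have hsM0 := Real.sqrt_pos.2 hM0
  have hsK0 := Real.sqrt_pos.2 hK0
  have hsU0 := Real.sqrt_pos.2 hU0
  have Pe : P = M * K * (1 + D / Real.sqrt M + D / Real.sqrt K) + D ^ 2 * (Real.sqrt M * Real.sqrt K) := by
    have e1 : M * K * (D / Real.sqrt M) = D * Real.sqrt M * K := by
      rw [mul_div_assoc', div_eq_iff hsM0.ne']; linear_combination (-K * D : ℝ) * hsM
    have e2 : M * K * (D / Real.sqrt K) = D * Real.sqrt K * M := by
      rw [mul_div_assoc', div_eq_iff hsK0.ne']; linear_combination (-M * D : ℝ) * hsK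
    rw [hP]; linear_combination -e1 - e2
  have dM : (D : ℝ) / Real.sqrt M ≤ D / Real.sqrt U := by gcongr
  have dK : (D : ℝ) / Real.sqrt K ≤ D / Real.sqrt U := by gcongr
  have hhalf : Real.exp (l / 2) ^ 2 = x := by rw [hx, ← Real.exp_nat_mul]; congr 1; push_cast; ring
  have hfin : ∀ θ : ℝ, 0 ≤ θ → θ * (M * K) ≤ x → θ * (Real.sqrt M * Real.sqrt K) ≤ Real.exp (l / 2) →
      θ * P ≤ x + 2 * D * (x / Real.sqrt U) + D ^ 2 * Real.exp (l / 2) := by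
    intro θ h0 h1 h2
    calc θ * P = θ * (M * K) * (1 + D / Real.sqrt M + D / Real.sqrt K) + D ^ 2 * (θ * (Real.sqrt M * Real.sqrt K)) := by
          rw [Pe]; ring
      _ ≤ x * (1 + D / Real.sqrt U + D / Real.sqrt U) + D ^ 2 * Real.exp (l / 2) := by gcongr
      _ = _ := by ring
  have hMK : (Real.sqrt M * Real.sqrt K) ^ 2 = M * K := by rw [mul_pow, hsM, hsK]
  rcases le_total ((M : ℝ) * K) x with h | h
  · refine (b 0 le_rfl zero_le_one).trans ?_
    gcongr
    have := hfin 1 zero_le_one (by linarith) (by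
      rw [one_mul]
      exact le_of_sq_le_sq (by rw [hMK, hhalf]; exact h) (by positivity))
    simpa using this
  · refine (b 1 zero_le_one le_rfl).trans ?_
    gcongr
    have e1 : ∀ T : ℝ, 0 < T → Real.exp (-1 * Real.log T) = T⁻¹ := fun T hT => by
      rw [neg_one_mul, Real.exp_neg, Real.exp_log hT]
    rw [mul_one, e1 M hM0, e1 K hK0]
    refine hfin _ (by positivity) (le_of_eq (by field_simp; exact hx.symm)) ?_
    have : Real.exp (l / 2) ≤ Real.sqrt M * Real.sqrt K :=
      le_of_sq_le_sq (by rw [hMK, hhalf]; exact h) (by positivity)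
    have hpos : 0 < Real.sqrt M * Real.sqrt K := by positivity
    calc _ = x / (M * K) * (Real.sqrt M * Real.sqrt K) := by field_simp; exact hx.symm
      _ = x / (Real.sqrt M * Real.sqrt K) := by rw [← hMK]; field_simp
      _ ≤ _ := by
        rw [div_le_iff₀ hpos, ← hhalf, sq]; gcongr
end MG

namespace MG
open Finset Filter Topology
open ArithmeticFunction (vonMangoldt moebius)

lemma dyadic {E : Type*} [AddCommMonoid E] (f : ℕ → E) (U J : ℕ) :
    ∑ a ∈ Ico U (2 ^ J * U), f a = ∑ i ∈ range J, ∑ a ∈ Ico (2 ^ i * U) (2 ^ i * U + 2 ^ i * U), f a := by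
  induction J with
  | zero => simp
  | succ n ih =>
    rw [sum_range_succ, ← ih, show 2 ^ (n + 1) * U = 2 ^ n * U + 2 ^ n * U by ring,
      sum_Ico_consecutive _ (Nat.le_mul_of_pos_left _ (by positivity)) (by omega)]

lemma char_le_one {r : ℕ} (χ : DirichletCharacter ℂ r) (n : ℕ) : ‖χ n‖ ≤ 1 := χ.norm_le_one _

lemma w_sum (D : ℕ) : ∑ i ∈ (Icc 1 D).sigma prims, ((i.1 : ℝ) / i.1.totient) ≤ D ^ 2 := by
  rw [sum_sigma]
  calc _ ≤ ∑ r ∈ Icc 1 D, (D : ℝ) := by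
        refine sum_le_sum fun r hr => ?_
        have hr' := mem_Icc.1 hr
        have h0 : (0 : ℝ) < r.totient := by exact_mod_cast Nat.totient_pos.2 (by omega)
        have h2 : (r : ℝ) ≤ D := by exact_mod_cast hr'.2
        simp only [sum_const, nsmul_eq_mul]
        calc _ ≤ (r.totient : ℝ) * (r / r.totient) := mul_le_mul_of_nonneg_right (card_prims r hr'.1) (by positivity)
          _ = r := by field_simp
          _ ≤ _ := h2
    _ = _ := by simp [sq]

lemma typeII (l : ℝ) {D U N J : ℕ} (hD : 1 ≤ D) (hU : 1 ≤ U) (hZ : N < 2 ^ J * (U + 1)) {H γ : ℝ} (hγ : 0 ≤ γ)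
    (hH : 1 + Real.log (2 ^ J * (U + 1) : ℕ) ≤ H) (hg : ∀ n : ℕ, N < n → gw l n ≤ γ) :
    ∑ i ∈ (Icc 1 D).sigma prims, ((i.1 : ℝ) / i.1.totient) *
      ‖∑ a ∈ Ioc 0 N, (trGt U vonMangoldt a : ℂ) * ∑ k ∈ Ioc 0 (N / a), (bb U k : ℂ) * (i.2 (a * k : ℕ) * gw l (a * k : ℕ))‖
    ≤ J ^ 2 * (80 * H ^ 3 * (Real.exp l + 2 * D * (Real.exp l / Real.sqrt (U + 1)) + D ^ 2 * Real.exp (l / 2)))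
      + D ^ 2 * ((2 ^ J * (U + 1) : ℕ) ^ 4 * γ) := by
  set Z := 2 ^ J * (U + 1) with hZd
  set F : (Σ r : ℕ, DirichletCharacter ℂ r) → ℕ → ℕ → ℂ := fun i m k =>
    ((trGt U vonMangoldt m * bb U k : ℝ) : ℂ) * (i.2 (m * k : ℕ) * gw l (m * k : ℕ)) with hF
  have hF0 : ∀ i m k, m ≤ U ∨ k ≤ U → F i m k = 0 := by
    intro i m k h
    rcases h with h | h
    · simp [hF, trGt_apply, h]
    · simp [hF, bb_zero h]
  have key : ∀ i : (Σ r : ℕ, DirichletCharacter ℂ r),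
      ‖∑ a ∈ Ioc 0 N, (trGt U vonMangoldt a : ℂ) * ∑ k ∈ Ioc 0 (N / a), (bb U k : ℂ) * (i.2 (a * k : ℕ) * gw l (a * k : ℕ))‖
      ≤ (∑ s ∈ range J ×ˢ range J, ‖∑ m ∈ Ico (2 ^ s.1 * (U + 1)) (2 ^ s.1 * (U + 1) + 2 ^ s.1 * (U + 1)),
          ∑ k ∈ Ico (2 ^ s.2 * (U + 1)) (2 ^ s.2 * (U + 1) + 2 ^ s.2 * (U + 1)), F i m k‖) + (Z : ℝ) ^ 4 * γ := by
    intro i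
    have e1 : ∑ a ∈ Ioc 0 N, (trGt U vonMangoldt a : ℂ) * ∑ k ∈ Ioc 0 (N / a), (bb U k : ℂ) * (i.2 (a * k : ℕ) * gw l (a * k : ℕ))
        = ∑ a ∈ Ico (U + 1) Z, ∑ k ∈ Ico (U + 1) Z, if a * k ≤ N then F i a k else 0 := by
      have e0 : ∀ a ∈ Ioc 0 N, (trGt U vonMangoldt a : ℂ) * ∑ k ∈ Ioc 0 (N / a), (bb U k : ℂ) * (i.2 (a * k : ℕ) * gw l (a * k : ℕ))
          = ∑ k ∈ Ico (U + 1) Z, if a * k ≤ N then F i a k else 0 := by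
        intro a ha
        have ha' := mem_Ioc.1 ha
        rw [mul_sum, ← sum_filter]
        symm
        apply sum_subset_zero_on_sdiff
        · intro k hk
          have h1 := mem_filter.1 hk
          have h2 := mem_Ico.1 h1.1
          exact mem_Ioc.2 ⟨by omega, (Nat.le_div_iff_mul_le ha'.1).2 (by linarith [h1.2, mul_comm a k])⟩
        · intro k hk
          have h1 := mem_sdiff.1 hk
          have h2 := mem_Ioc.1 h1.1
          have h3 : a * k ≤ N := by have := (Nat.le_div_iff_mul_le ha'.1).1 h2.2; linarith [mul_comm a k]
          have h4 : k ≤ N := le_trans (Nat.le_mul_of_pos_left k ha'.1) h3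
          have h5 : k ≤ U := by
            by_contra hc
            exact h1.2 (mem_filter.2 ⟨mem_Ico.2 ⟨by omega, by omega⟩, h3⟩)
          simp [bb_zero h5]
        · intro k _
          simp only [hF]; push_cast; ring
      rw [sum_congr rfl e0]
      trans ∑ a ∈ Ico 1 Z, ∑ k ∈ Ico (U + 1) Z, if a * k ≤ N then F i a k else 0
      · refine sum_subset (fun a ha => ?_) fun a ha hn => sum_eq_zero fun k hk => if_neg ?_
        · have := mem_Ioc.1 ha; exact mem_Ico.2 ⟨by omega, by omega⟩
        · have h1 := mem_Ico.1 ha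
          have h2 := mem_Ico.1 hk
          have h3 : N < a := by by_contra hc; exact hn (mem_Ioc.2 ⟨by omega, by omega⟩)
          have := Nat.le_mul_of_pos_right a (show 0 < k by omega)
          omega
      · symm
        refine sum_subset (fun a ha => ?_) fun a ha hn => sum_eq_zero fun k hk => ?_
        · have := mem_Ico.1 ha; exact mem_Ico.2 ⟨by omega, by omega⟩
        · have h1 := mem_Ico.1 ha
          have h3 : a ≤ U := by by_contra hc; exact hn (mem_Ico.2 ⟨by omega, by omega⟩)
          rw [hF0 i a k (Or.inl h3), ite_self]
    have e2 : ∀ a k, (if a * k ≤ N then F i a k else 0) = F i a k - if a * k ≤ N then 0 else F i a k := by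
      intro a k; split_ifs <;> simp
    have e3 : ∑ a ∈ Ico (U + 1) Z, ∑ k ∈ Ico (U + 1) Z, F i a k
        = ∑ s ∈ range J ×ˢ range J, ∑ m ∈ Ico (2 ^ s.1 * (U + 1)) (2 ^ s.1 * (U + 1) + 2 ^ s.1 * (U + 1)),
          ∑ k ∈ Ico (2 ^ s.2 * (U + 1)) (2 ^ s.2 * (U + 1) + 2 ^ s.2 * (U + 1)), F i m k := by
      rw [hZd, dyadic, sum_product]
      refine sum_congr rfl fun s _ => ?_
      rw [sum_comm, dyadic]
      exact sum_congr rfl fun t _ => sum_comm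
    rw [e1]
    simp only [e2, sum_sub_distrib]
    refine (norm_sub_le _ _).trans (add_le_add ?_ ?_)
    · rw [e3]; exact norm_sum_le _ _
    · have e4 : ∀ a ∈ Ico (U + 1) Z, ‖∑ k ∈ Ico (U + 1) Z, if a * k ≤ N then 0 else F i a k‖ ≤ (Z : ℝ) * ((Z : ℝ) * Z * γ) := by
        intro a ha
        have h1 := mem_Ico.1 ha
        refine (norm_sum_le_of_le (f := fun k => if a * k ≤ N then 0 else F i a k) _ (n := fun _ => (Z : ℝ) * Z * γ) fun k hk => ?_).trans ?_
        · have h2 := mem_Ico.1 hk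
          split_ifs with h
          · rw [norm_zero]; positivity
          · simp only [hF, norm_mul, Complex.norm_real, Real.norm_eq_abs]
            have hk1 : (0 : ℝ) < a := by exact_mod_cast (by omega : 0 < a)
            have b1 : |trGt U vonMangoldt a| ≤ Z := by
              rw [trGt_apply, if_neg (by omega), abs_of_nonneg ArithmeticFunction.vonMangoldt_nonneg]
              have := ArithmeticFunction.vonMangoldt_le_log (n := a)
              have h5 := Real.log_le_sub_one_of_pos hk1
              have h6 : (a : ℝ) ≤ Z := by exact_mod_cast h1.2.le
              linarith
            have b2 : |bb U k| ≤ Z := by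
              refine (bb_le U k).trans ?_
              exact_mod_cast (Nat.card_divisors_le_self k).trans h2.2.le
            have b3 : |gw l (a * k : ℕ)| ≤ γ := by
              rw [abs_of_nonneg (gw_nonneg _ _)]; exact hg _ (by omega)
            calc _ ≤ (Z : ℝ) * Z * (1 * γ) := by
                  gcongr
                  exact char_le_one _ _
              _ = _ := by ring
        · rw [sum_const, nsmul_eq_mul, Nat.card_Ico]
          gcongr
          omega
      refine (norm_sum_le_of_le _ e4).trans ?_
      rw [sum_const, nsmul_eq_mul, Nat.card_Ico]
      calc _ ≤ (Z : ℝ) * ((Z : ℝ) * ((Z : ℝ) * Z * γ)) := by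
            gcongr; omega
        _ = _ := by ring
  calc _ ≤ ∑ i ∈ (Icc 1 D).sigma prims, (((∑ s ∈ range J ×ˢ range J, ((i.1 : ℝ) / i.1.totient) * ‖∑ m ∈ Ico (2 ^ s.1 * (U + 1)) (2 ^ s.1 * (U + 1) + 2 ^ s.1 * (U + 1)),
          ∑ k ∈ Ico (2 ^ s.2 * (U + 1)) (2 ^ s.2 * (U + 1) + 2 ^ s.2 * (U + 1)), F i m k‖)) + ((i.1 : ℝ) / i.1.totient) * ((Z : ℝ) ^ 4 * γ)) := by
        refine sum_le_sum fun i _ => ?_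
        rw [← mul_sum, ← mul_add]
        exact mul_le_mul_of_nonneg_left (key i) (by positivity)
    _ ≤ _ := by
        rw [sum_add_distrib, ← sum_mul]
        refine add_le_add ?_ (mul_le_mul_of_nonneg_right (w_sum D) (by positivity))
        rw [sum_comm]
        have hlog : ∀ s ∈ range J, 1 + Real.log (2 * (2 ^ s * (U + 1) : ℕ)) ≤ H := by
          intro s hs
          refine le_trans (add_le_add le_rfl (Real.log_le_log (by positivity) ?_)) hH
          have : 2 * (2 ^ s * (U + 1)) ≤ Z := by
            rw [hZd, ← mul_assoc, ← pow_succ']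
            gcongr
            · norm_num
            · exact mem_range.1 hs
          exact_mod_cast this
        refine (sum_le_card_nsmul _ _ (80 * H ^ 3 * (Real.exp l + 2 * D * (Real.exp l / Real.sqrt (U + 1)) + D ^ 2 * Real.exp (l / 2)))
          fun s hs => ?_).trans (le_of_eq ?_)
        · have hs' := mem_product.1 hs
          have := block2 l hD (show 1 ≤ U + 1 by omega) (Nat.le_mul_of_pos_left (U + 1) (show 0 < 2 ^ s.1 by positivity))
            (Nat.le_mul_of_pos_left (U + 1) (show 0 < 2 ^ s.2 by positivity)) (hlog _ hs'.1) (hlog _ hs'.2) U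
          rw [Nat.cast_add_one] at this
          exact this
        · simp [sq]
end MG

namespace MG
open Finset Filter Topology
open ArithmeticFunction (vonMangoldt moebius)

lemma abel_r (F : ℕ → ℝ) {L Q : ℕ} (hLQ : L ≤ Q) {A B : ℝ} (hA : 0 ≤ A) (hB : 0 ≤ B)
    (hS : ∀ D, L < D → D ≤ Q → ∑ r ∈ Ioc L D, F r ≤ A + D * B) :
    ∑ r ∈ Ioc L Q, F r / r ≤ A * (2 / (L + 1)) + B * (2 + Real.log Q) := by
  have e : ∀ n, ∑ r ∈ Ioc L (L + n), F r / r = (∑ r ∈ Ioc L (L + n), F r) / ((L + n : ℕ) + 1)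
      + ∑ D ∈ Ioc L (L + n), (∑ r ∈ Ioc L D, F r) / (D * (D + 1)) := by
    intro n
    induction n with
    | zero => simp
    | succ n ih =>
      rw [← add_assoc, sum_Ioc_succ_top (by omega), ih, sum_Ioc_succ_top (by omega) (fun r => F r),
        sum_Ioc_succ_top (by omega) (fun D : ℕ => (∑ r ∈ Ioc L D, F r) / ((D : ℝ) * (D + 1))), sum_Ioc_succ_top (by omega) (fun r => F r)]
      push_cast
      have : (0 : ℝ) < L + n + 1 := by positivity
      field_simp
      ring
  have tel : ∀ n, ∑ D ∈ Ioc L (L + n), (1 : ℝ) / (D * (D + 1)) = 1 / (L + 1) - 1 / ((L + n : ℕ) + 1) := by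
    intro n
    induction n with
    | zero => simp
    | succ n ih =>
      rw [← add_assoc, sum_Ioc_succ_top (by omega), ih]
      push_cast
      have : (0 : ℝ) < L + n + 1 := by positivity
      field_simp
      ring
  obtain ⟨n, rfl⟩ := Nat.exists_eq_add_of_le hLQ
  rcases Nat.eq_zero_or_pos n with rfl | hn
  · have := Real.log_natCast_nonneg (L + 0)
    simp only [add_zero, Ioc_self, sum_empty] at *; positivity
  have hharm : ∑ D ∈ Ioc L (L + n), (1 : ℝ) / D ≤ 1 + Real.log (L + n : ℕ) := by
    refine le_trans (sum_le_sum_of_subset_of_nonneg (fun k hk => ?_) fun _ _ _ => by positivity) (harm_Ioc (L + n))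
    have := mem_Ioc.1 hk; exact mem_Ioc.2 ⟨by omega, this.2⟩
  rw [e n]
  have h1 : (∑ r ∈ Ioc L (L + n), F r) / ((L + n : ℕ) + 1) ≤ A * (1 / (L + 1)) + B := by
    rw [div_le_iff₀ (by positivity)]
    refine (hS _ (by omega) le_rfl).trans ?_
    have : 1 ≤ 1 / ((L : ℝ) + 1) * ((L + n : ℕ) + 1) := by
      rw [div_mul_eq_mul_div, one_mul, le_div_iff₀ (by positivity)]; push_cast
      have := Nat.cast_nonneg (α := ℝ) n; linarith
    have := mul_le_mul_of_nonneg_left this hA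
    linarith
  have h2 : ∑ D ∈ Ioc L (L + n), (∑ r ∈ Ioc L D, F r) / ((D : ℝ) * (D + 1)) ≤
      A * (1 / (L + 1)) + B * (1 + Real.log (L + n : ℕ)) := by
    calc _ ≤ ∑ D ∈ Ioc L (L + n), (A * (1 / ((D : ℝ) * (D + 1))) + B * (1 / D)) := by
          refine sum_le_sum fun D hD => ?_
          have hD' := mem_Ioc.1 hD
          have h0 : (0 : ℝ) < D := by exact_mod_cast (by omega : 0 < D)
          rw [div_le_iff₀ (by positivity)]
          refine (hS D hD'.1 hD'.2).trans (le_of_sub_nonneg ?_)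
          have : (A * (1 / ((D : ℝ) * (D + 1))) + B * (1 / D)) * (D * (D + 1)) - (A + D * B) = B := by
            field_simp; ring
          rw [this]; exact hB
      _ = A * (1 / (L + 1) - 1 / ((L + n : ℕ) + 1)) + B * ∑ D ∈ Ioc L (L + n), (1 : ℝ) / D := by
          rw [sum_add_distrib, ← mul_sum, ← mul_sum, tel]
      _ ≤ _ := by
          gcongr
          linarith [show (0 : ℝ) ≤ 1 / ((L + n : ℕ) + 1) by positivity]
  have : A * (2 / ((L : ℝ) + 1)) = 2 * (A * (1 / (L + 1))) := by ring
  linarith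

lemma phi_sum (Q : ℕ) : ∑ s ∈ Ioc 0 Q, (1 : ℝ) / s.totient ≤ (1 + Real.log Q) ^ 2 := by
  set f : ArithmeticFunction ℝ := ⟨fun n => 1 / (n : ℝ), by simp⟩ with hf
  have fa : ∀ n, f n = 1 / (n : ℝ) := fun n => rfl
  have h1 : ∀ s ∈ Ioc 0 Q, (1 : ℝ) / s.totient ≤ (f * f) s := by
    intro s hs
    have hs0 := (mem_Ioc.1 hs).1
    have h0 : (0 : ℝ) < s.totient := by exact_mod_cast Nat.totient_pos.2 hs0
    have h0' : (0 : ℝ) < s := by exact_mod_cast hs0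
    have e : (f * f) s = s.divisors.card / s := by
      rw [ArithmeticFunction.mul_apply, sum_congr rfl (g := fun _ => 1 / (s : ℝ))]
      · rw [sum_const, ← Nat.map_div_right_divisors, card_map, nsmul_eq_mul]; ring
      · intro x hx
        rw [fa, fa, ← (Nat.mem_divisorsAntidiagonal.1 hx).1]; push_cast; rw [one_div_mul_one_div]
    rw [e, div_le_div_iff₀ h0 h0', one_mul]
    have : s ≤ s.divisors.card * s.totient := by
      calc s = ∑ d ∈ s.divisors, d.totient := (Nat.sum_totient s).symm
        _ ≤ ∑ d ∈ s.divisors, s.totient := sum_le_sum fun d hd => Nat.le_of_dvd (Nat.totient_pos.2 hs0) (Nat.totient_dvd_of_dvd (Nat.dvd_of_mem_divisors hd))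
        _ = _ := by simp
    exact_mod_cast this
  refine (sum_le_sum h1).trans ?_
  rw [ArithmeticFunction.sum_Ioc_mul_eq_sum_sum, sq]
  have hl := Real.log_natCast_nonneg Q
  calc _ ≤ ∑ n ∈ Ioc 0 Q, f n * (1 + Real.log Q) := by
        refine sum_le_sum fun n hn => mul_le_mul_of_nonneg_left ?_ (by rw [fa]; positivity)
        refine le_trans (sum_le_sum_of_subset_of_nonneg (Ioc_subset_Ioc_right (Nat.div_le_self _ _)) fun i _ _ => ?_) (harm_Ioc Q)
        exact one_div_nonneg.2 (Nat.cast_nonneg i)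
    _ = (∑ n ∈ Ioc 0 Q, (1 : ℝ) / n) * (1 + Real.log Q) := by rw [sum_mul]; rfl
    _ ≤ _ := by gcongr; exact harm_Ioc Q

lemma ap_char (S : Finset ℕ) (t : ℕ → ℝ) {q a : ℕ} (hq : 1 ≤ q) (ht : ∀ n ∈ S, t n ≠ 0 → n.Coprime q) (ha : a.Coprime q) :
    |∑ n ∈ S with n ≡ a [MOD q], t n - (∑ n ∈ S, t n) / q.totient| ≤
      (1 / q.totient) * ∑ r ∈ q.divisors.erase 1, ∑ χ ∈ prims r, ‖∑ n ∈ S, (t n : ℂ) * χ n‖ := by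
  classical
  have : NeZero q := ⟨by omega⟩
  have h0 : (0 : ℝ) < q.totient := by exact_mod_cast Nat.totient_pos.2 hq
  have hu : IsUnit (a : ZMod q) := (ZMod.isUnit_iff_coprime a q).2 ha
  have e1 : ((q.totient * ∑ n ∈ S with n ≡ a [MOD q], t n : ℝ) : ℂ) =
      ∑ χ : DirichletCharacter ℂ q, χ (a : ZMod q)⁻¹ * ∑ n ∈ S, (t n : ℂ) * χ n := by
    simp_rw [mul_sum]
    rw [sum_comm, sum_filter, Complex.ofReal_sum]
    push_cast
    refine sum_congr rfl fun n _ => ?_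
    have := DirichletCharacter.sum_char_inv_mul_char_eq ℂ hu (n : ZMod q)
    rw [show ∑ χ : DirichletCharacter ℂ q, χ (a : ZMod q)⁻¹ * ((t n : ℂ) * χ n) = t n * ∑ χ : DirichletCharacter ℂ q, χ (a : ZMod q)⁻¹ * χ n by
      rw [mul_sum]; exact sum_congr rfl fun _ _ => by ring, this]
    by_cases h : n ≡ a [MOD q]
    · rw [if_pos h, if_pos ((ZMod.natCast_eq_natCast_iff _ _ _).2 h.symm)]; push_cast; ring
    · rw [if_neg h, if_neg (fun h' => h ((ZMod.natCast_eq_natCast_iff _ _ _).1 h').symm)]; simp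
  have e2 : ∑ n ∈ S, (t n : ℂ) * (1 : DirichletCharacter ℂ q) n = ((∑ n ∈ S, t n : ℝ) : ℂ) := by
    push_cast
    refine sum_congr rfl fun n hn => ?_
    by_cases h : t n = 0
    · simp [h]
    · rw [MulChar.one_apply ((ZMod.isUnit_iff_coprime n q).2 (ht n hn h)), mul_one]
  have e3 : ((q.totient * ∑ n ∈ S with n ≡ a [MOD q], t n - ∑ n ∈ S, t n : ℝ) : ℂ) =
      ∑ χ ∈ univ.erase (1 : DirichletCharacter ℂ q), χ (a : ZMod q)⁻¹ * ∑ n ∈ S, (t n : ℂ) * χ n := by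
    rw [Complex.ofReal_sub, e1, ← add_sum_erase _ _ (mem_univ (1 : DirichletCharacter ℂ q)), e2,
      MulChar.one_apply (by rw [isUnit_iff_exists_inv]; exact ⟨a, ZMod.inv_mul_of_unit _ hu⟩)]
    ring
  have e4 : |q.totient * ∑ n ∈ S with n ≡ a [MOD q], t n - ∑ n ∈ S, t n| ≤
      ∑ r ∈ q.divisors.erase 1, ∑ χ ∈ prims r, ‖∑ n ∈ S, (t n : ℂ) * χ n‖ := by
    rw [← Real.norm_eq_abs, ← Complex.norm_real, e3]
    refine (norm_sum_le _ _).trans ?_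
    rw [← sum_sigma (q.divisors.erase 1) prims fun i : (Σ r : ℕ, DirichletCharacter ℂ r) => ‖∑ n ∈ S, (t n : ℂ) * i.2 n‖]
    set em : DirichletCharacter ℂ q → (Σ r : ℕ, DirichletCharacter ℂ r) := fun χ => ⟨χ.conductor, χ.primitiveCharacter⟩ with hem
    have inj : Function.Injective em := by
      intro χ χ' h
      have h1 : ∀ i j : (Σ r : ℕ, DirichletCharacter ℂ r), i = j → ∀ (hi : i.1 ∣ q) (hj : j.1 ∣ q),
        DirichletCharacter.changeLevel hi i.2 = DirichletCharacter.changeLevel hj j.2 := by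
        rintro i j rfl _ _; rfl
      have := h1 _ _ h χ.conductor_dvd_level χ'.conductor_dvd_level
      rwa [DirichletCharacter.changeLevel_primitiveCharacter, DirichletCharacter.changeLevel_primitiveCharacter] at this
    calc _ ≤ ∑ χ ∈ univ.erase (1 : DirichletCharacter ℂ q), ‖∑ n ∈ S, (t n : ℂ) * (em χ).2 n‖ := by
          refine sum_le_sum fun χ _ => ?_
          rw [norm_mul]
          refine (mul_le_of_le_one_left (norm_nonneg _) (χ.norm_le_one _)).trans (le_of_eq ?_)
          congr 1
          refine sum_congr rfl fun n hn => ?_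
          by_cases h : t n = 0
          · simp [h]
          · have := χ.primitiveCharacter_apply_of_isCoprime (a := (n : ℤ)) (Nat.isCoprime_iff_coprime.2 (ht n hn h))
            rw [Int.cast_natCast, Int.cast_natCast] at this
            rw [← this]
      _ = ∑ i ∈ (univ.erase (1 : DirichletCharacter ℂ q)).image em, ‖∑ n ∈ S, (t n : ℂ) * i.2 n‖ := by
          rw [sum_image fun x _ y _ h => inj h]
      _ ≤ _ := by
          refine sum_le_sum_of_subset_of_nonneg (fun i hi => ?_) fun _ _ _ => norm_nonneg _
          obtain ⟨χ, hχ, rfl⟩ := mem_image.1 hi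
          refine mem_sigma.2 ⟨mem_erase.2 ⟨fun h => ?_, Nat.mem_divisors.2 ⟨χ.conductor_dvd_level, by omega⟩⟩, mem_prims.2 χ.primitiveCharacter_isPrimitive⟩
          exact (mem_erase.1 hχ).1 (DirichletCharacter.eq_one_iff_conductor_eq_one.2 h)
  have e5 : ∑ n ∈ S with n ≡ a [MOD q], t n - (∑ n ∈ S, t n) / q.totient =
      (1 / q.totient) * (q.totient * ∑ n ∈ S with n ≡ a [MOD q], t n - ∑ n ∈ S, t n) := by
    field_simp
  rw [e5, abs_mul, abs_of_nonneg (by positivity)]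
  gcongr

lemma div_swap (G : ℕ → ℝ) (hG : ∀ r, 0 ≤ G r) (Q : ℕ) :
    ∑ q ∈ Ioc 0 Q, (1 / (q.totient : ℝ)) * ∑ r ∈ q.divisors.erase 1, G r ≤
      (∑ s ∈ Ioc 0 Q, (1 : ℝ) / s.totient) * ∑ r ∈ Ioc 1 Q, G r / r.totient := by
  have e : ∀ q ∈ Ioc 0 Q, (1 / (q.totient : ℝ)) * ∑ r ∈ q.divisors.erase 1, G r = ∑ r ∈ Ioc 1 Q, if r ∣ q then G r * (1 / q.totient) else 0 := by
    intro q hq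
    have hq' := mem_Ioc.1 hq
    rw [mul_sum, ← sum_filter]
    refine sum_congr (ext fun r => ?_) fun r _ => by ring
    simp only [mem_erase, Nat.mem_divisors, mem_filter, mem_Ioc]
    constructor
    · rintro ⟨h1, h2, h3⟩
      have := Nat.le_of_dvd hq'.1 h2
      have := Nat.pos_of_dvd_of_pos h2 hq'.1
      exact ⟨⟨by omega, by omega⟩, h2⟩
    · rintro ⟨h1, h2⟩; exact ⟨by omega, h2, by omega⟩
  rw [sum_congr rfl e, sum_comm, mul_sum]
  refine sum_le_sum fun r hr => ?_
  have hr' := mem_Ioc.1 hr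
  rw [← sum_filter, ← mul_sum, mul_div_assoc', mul_comm _ (G r), mul_div_assoc]
  refine mul_le_mul_of_nonneg_left ?_ (hG r)
  have h0 : (0 : ℝ) < r.totient := by exact_mod_cast Nat.totient_pos.2 (by omega)
  rw [sum_div]
  calc _ ≤ ∑ q ∈ Ioc 0 Q with r ∣ q, 1 / ((q / r).totient : ℝ) / r.totient := by
        refine sum_le_sum fun q hq => ?_
        obtain ⟨h1, s, rfl⟩ := mem_filter.1 hq
        have hs : 0 < s := Nat.pos_of_mul_pos_left (mem_Ioc.1 h1).1
        rw [Nat.mul_div_cancel_left _ (by omega), div_div]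
        have h2 := Nat.totient_super_multiplicative r s
        have h3 : (0 : ℝ) < s.totient := by exact_mod_cast Nat.totient_pos.2 hs
        refine one_div_le_one_div_of_le (by positivity) ?_
        rw [mul_comm]; exact_mod_cast h2
    _ = ∑ s ∈ {q ∈ Ioc 0 Q | r ∣ q}.image (· / r), 1 / (s.totient : ℝ) / r.totient := by
        rw [sum_image]
        rintro a ha b hb h
        obtain ⟨_, s, rfl⟩ := mem_filter.1 ha
        obtain ⟨_, s', rfl⟩ := mem_filter.1 hb
        simp only [Nat.mul_div_cancel_left _ (show 0 < r by omega)] at h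
        rw [h]
    _ ≤ _ := by
        refine sum_le_sum_of_subset_of_nonneg (fun s hs => ?_) fun _ _ _ => by positivity
        obtain ⟨q, hq, rfl⟩ := mem_image.1 hs
        obtain ⟨h1, s, rfl⟩ := mem_filter.1 hq
        have hs : 0 < s := Nat.pos_of_mul_pos_left (mem_Ioc.1 h1).1
        simp only [Nat.mul_div_cancel_left _ (show 0 < r by omega)]
        exact mem_Ioc.2 ⟨hs, le_trans (Nat.le_mul_of_pos_left s (by omega)) (mem_Ioc.1 h1).2⟩
end MG

namespace MG
open Finset Filter Topology
open ArithmeticFunction (vonMangoldt moebius)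

noncomputable def NN (ε l : ℝ) : ℕ := ⌊Real.exp ((1 + ε) * l)⌋₊
noncomputable def N0 (l : ℝ) : ℕ := ⌊Real.exp (l / 2)⌋₊
noncomputable def QQ (ε l : ℝ) : ℕ := ⌊Real.exp ((1 / 2 - ε) * l)⌋₊
noncomputable def th (l : ℝ) (n : ℕ) : ℝ := if n.Prime then Real.log n * gw l n else 0

lemma ev_pow (C : ℝ) {a b : ℝ} (h : a < b) : ∀ᶠ l : ℝ in atTop, C * l ^ a ≤ l ^ b := by
  have := (tendsto_rpow_atTop (show 0 < b - a by linarith)).eventually_ge_atTop C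
  filter_upwards [this, eventually_gt_atTop 0] with l h1 h2
  calc _ ≤ l ^ (b - a) * l ^ a := by gcongr
    _ = _ := by rw [← Real.rpow_add h2]; congr 1; ring

lemma ev_exp (C a b : ℝ) {c : ℝ} (hc : 0 < c) : ∀ᶠ l : ℝ in atTop, C * l ^ a * Real.exp (-c * l) ≤ l ^ b := by
  have h := isLittleO_exp_neg_mul_rpow_atTop hc (b - a - 1)
  filter_upwards [h.bound one_pos, ev_pow C (show a + (b - a - 1) < b by linarith), eventually_gt_atTop 0, eventually_ge_atTop 0] with l h1 h2 h3 _
  rw [one_mul, Real.norm_of_nonneg (Real.exp_pos _).le, Real.norm_of_nonneg (by positivity)] at h1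
  by_cases hC : 0 ≤ C
  · calc _ ≤ C * l ^ a * l ^ (b - a - 1) := by gcongr
      _ = C * l ^ (a + (b - a - 1)) := by rw [mul_assoc, ← Real.rpow_add h3]
      _ ≤ _ := h2
  · have : C * l ^ a * Real.exp (-c * l) ≤ 0 := by
      rw [mul_assoc]; exact mul_nonpos_of_nonpos_of_nonneg (by linarith) (by positivity)
    exact this.trans (by positivity)

lemma gw_tail {ε : ℝ} (hε : 0 < ε) (hε1 : ε ≤ 1) (J : ℕ) : ∀ᶠ l : ℝ in atTop, ∀ n : ℕ, NN ε l < n → gw l n ≤ 1 / (n : ℝ) ^ J := by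
  filter_upwards [eventually_ge_atTop (1 : ℝ), eventually_ge_atTop (8 * J / ε ^ 2)] with l h1 h2 n hn
  have hn' : Real.exp ((1 + ε) * l) < n := (Nat.floor_lt (Real.exp_pos _).le).1 hn
  have hn0 : (0 : ℝ) < n := (Real.exp_pos _).trans hn'
  set t := Real.log n with ht
  have h3 : (1 + ε) * l ≤ t := by rw [ht, Real.le_log_iff_exp_le hn0]; exact hn'.le
  have e : 1 / (n : ℝ) ^ J = Real.exp (-(J * t)) := by
    rw [Real.exp_neg, mul_comm, ht, Real.exp_mul, Real.exp_log hn0, Real.rpow_natCast, one_div]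
  rw [e, gw, ← ht]
  apply Real.exp_le_exp.2
  have h4 : ε / 2 * t ≤ t - l := by
    have a := mul_le_mul_of_nonneg_left h3 (show 0 ≤ 1 - ε / 2 by linarith)
    have b : 0 ≤ ε * l * (1 - ε) := mul_nonneg (by positivity) (by linarith)
    linarith
  have h5 : l ≤ t := by nlinarith
  have h6 : 8 * J ≤ ε ^ 2 * t := by
    rw [div_le_iff₀ (by positivity)] at h2; nlinarith [sq_nonneg ε]
  have h7 : (ε / 2 * t) ^ 2 ≤ (t - l) ^ 2 := pow_le_pow_left₀ (by positivity) h4 2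
  have h8 : 8 * J * t ≤ ε ^ 2 * t * t := mul_le_mul_of_nonneg_right h6 (by linarith)
  nlinarith

lemma tail_sum {ε : ℝ} (hε : 0 < ε) (hε1 : ε ≤ 1) : ∀ᶠ l : ℝ in atTop, ∀ f : ℕ → ℂ, Summable f → f 0 = 0 →
    (∀ n : ℕ, ‖f n‖ ≤ n * gw l n) → ‖∑ n ∈ Ioc 0 (NN ε l), f n‖ ≤ ‖∑' n, f n‖ + l := by
  have hs : Summable fun n : ℕ => 1 / (n : ℝ) ^ 2 := Real.summable_one_div_nat_pow.2 (by norm_num)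
  filter_upwards [gw_tail hε hε1 3, eventually_ge_atTop (∑' n : ℕ, 1 / (n : ℝ) ^ 2)] with l h1 h2 f hf h0 hfn
  set N := NN ε l
  have e1 := hf.sum_add_tsum_nat_add (N + 1)
  have e2 : ∑ n ∈ Ioc 0 N, f n = ∑ n ∈ range (N + 1), f n := by
    rw [range_eq_Ico, sum_eq_sum_Ico_succ_bot (by omega), h0, zero_add]
    rfl
  have hsh := (summable_nat_add_iff (N + 1)).2 hs
  have hb : ∀ i : ℕ, ‖f (i + (N + 1))‖ ≤ 1 / ((i + (N + 1) : ℕ) : ℝ) ^ 2 := by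
    intro i
    refine (hfn _).trans ((mul_le_mul_of_nonneg_left (h1 (i + (N + 1)) (by omega)) (Nat.cast_nonneg _)).trans (le_of_eq ?_))
    have : ((i + (N + 1) : ℕ) : ℝ) ≠ 0 := by positivity
    field_simp
  have e3 : ‖∑' i, f (i + (N + 1))‖ ≤ l := by
    refine (tsum_of_norm_bounded hsh.hasSum hb).trans (le_trans ?_ h2)
    rw [← hs.sum_add_tsum_nat_add (N + 1)]
    exact le_add_of_nonneg_left (sum_nonneg fun _ _ => by positivity)
  rw [e2, eq_sub_of_add_eq e1]
  exact (norm_sub_le _ _).trans (by linarith)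

lemma th_lam (l : ℝ) {N M r : ℕ} (hM : 1 ≤ M) (hMN : M ≤ N) (χ : DirichletCharacter ℂ r) :
    ‖∑ n ∈ Ioc M N, (th l n : ℂ) * χ n - ∑ n ∈ Ioc 0 N, (vonMangoldt n : ℂ) * (χ n * gw l n)‖ ≤
      2 * Real.sqrt N * Real.log N + 6 * M := by
  have e1 : ∑ n ∈ Ioc M N, (th l n : ℂ) * χ n = ∑ n ∈ Ioc 0 N, (vonMangoldt n : ℂ) * (χ n * gw l n)
      - ∑ n ∈ Ioc 0 N, ((vonMangoldt n : ℂ) * (χ n * gw l n) - if M < n then (th l n : ℂ) * χ n else 0) := by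
    rw [sum_sub_distrib, sub_sub_cancel, ← sum_filter]
    refine sum_congr (ext fun n => ?_) fun _ _ => rfl
    simp only [mem_filter, mem_Ioc]; omega
  rw [e1, sub_sub_cancel_left, norm_neg]
  have b : ∀ n ∈ Ioc 0 N, ‖(vonMangoldt n : ℂ) * (χ n * gw l n) - if M < n then (th l n : ℂ) * χ n else 0‖ ≤
      (if ¬ n.Prime then vonMangoldt n else 0) + (if n ≤ M then vonMangoldt n else 0) := by
    intro n _
    have h0 : 0 ≤ vonMangoldt n := ArithmeticFunction.vonMangoldt_nonneg
    have hn : ‖(vonMangoldt n : ℂ) * (χ n * gw l n)‖ ≤ vonMangoldt n := by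
      rw [norm_mul, norm_mul, Complex.norm_real, Complex.norm_real, Real.norm_of_nonneg h0, Real.norm_of_nonneg (gw_nonneg _ _)]
      exact mul_le_of_le_one_right h0 (mul_le_one₀ (char_le_one _ _) (gw_nonneg _ _) (gw_le_one _ _))
    by_cases hp : n.Prime
    · rw [th, if_pos hp, if_neg (not_not.2 hp), zero_add]
      by_cases hm : M < n
      · rw [if_pos hm, if_neg (by omega), ArithmeticFunction.vonMangoldt_apply_prime hp]
        rw [Complex.ofReal_mul, show (Real.log n : ℂ) * (χ n * gw l n) - Real.log n * gw l n * χ n = 0 by ring, norm_zero]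
      · rw [if_neg hm, if_pos (by omega), sub_zero]; exact hn
    · rw [th, if_neg hp, if_pos hp]
      simp only [Complex.ofReal_zero, zero_mul, ite_self, sub_zero]
      refine hn.trans (le_add_of_nonneg_right ?_)
      split_ifs <;> simp
  refine (norm_sum_le_of_le _ b).trans ?_
  rw [sum_add_distrib, ← sum_filter, ← sum_filter]
  refine add_le_add ?_ ?_
  · have := Chebyshev.psi_sub_theta_eq_sum_not_prime N
    rw [Nat.floor_natCast] at this
    rw [← this]
    exact Chebyshev.psi_sub_theta_le (by exact_mod_cast hM.trans hMN)
  · have h := Chebyshev.psi_le_const_mul_self (x := M) (Nat.cast_nonneg _)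
    rw [Chebyshev.psi, Nat.floor_natCast] at h
    have e : {n ∈ Ioc 0 N | n ≤ M} = Ioc 0 M := by ext n; simp only [mem_filter, mem_Ioc]; omega
    rw [e]
    refine h.trans ?_
    gcongr
    have : Real.log 4 = 2 * Real.log 2 := by rw [show (4 : ℝ) = 2 ^ 2 by norm_num, Real.log_pow]; norm_num
    linarith [Real.log_two_lt_d9]

lemma large_part {ε : ℝ} (hε : 0 < ε) (hε1 : ε ≤ 1 / 4) : ∀ᶠ l : ℝ in atTop, ∀ L D : ℕ, 1 ≤ L → L < D → D ≤ QQ ε l →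
    ∑ r ∈ Ioc L D, (r / r.totient : ℝ) * ∑ χ ∈ prims r, ‖∑ n ∈ Ioc 0 (NN ε l), (vonMangoldt n : ℂ) * (χ n * gw l n)‖
      ≤ 80 * (8 * l) ^ 5 * Real.exp l + D * (600 * (8 * l) ^ 5 * (Real.exp l * Real.exp (-(ε / 4) * l))) := by
  filter_upwards [gw_tail hε (by linarith) 8, eventually_ge_atTop (1 : ℝ)] with l hg hl L D hL hLD hDQ
  set N := NN ε l with hN
  set Q := QQ ε l with hQ
  set U := ⌊Real.exp (ε * l / 2)⌋₊ with hU
  set J := Nat.log 2 N + 1 with hJ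
  set x := Real.exp l with hx
  set β := Real.exp (-(ε / 4) * l) with hβ
  have hx0 : 0 < x := Real.exp_pos _
  have hβ0 : 0 < β := Real.exp_pos _
  have hεl : 0 < ε * l := by positivity
  have N1 : 1 ≤ N := Nat.one_le_floor_iff _ |>.2 (Real.one_le_exp (by positivity))
  have U1 : 1 ≤ U := Nat.one_le_floor_iff _ |>.2 (Real.one_le_exp (by positivity))
  have UN : U ≤ N := Nat.floor_le_floor (Real.exp_le_exp.2 (by linarith))
  have Nle : (N : ℝ) ≤ Real.exp (2 * l) := (Nat.floor_le (Real.exp_pos _).le).trans (Real.exp_le_exp.2 (by nlinarith))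
  have Qle : (Q : ℝ) ≤ Real.exp ((1 / 2 - ε) * l) := Nat.floor_le (Real.exp_pos _).le
  have Ule : (U : ℝ) ≤ Real.exp (ε * l / 2) := Nat.floor_le (Real.exp_pos _).le
  clear_value N Q U x β
  have N1' : (1 : ℝ) ≤ N := by exact_mod_cast N1
  have logN : Real.log N ≤ 2 * l := by rw [Real.log_le_iff_le_exp (by linarith)]; exact Nle
  have hJl : (J : ℝ) ≤ 8 * l := by
    have h1 : (2 : ℝ) ^ (Nat.log 2 N) ≤ N := by exact_mod_cast Nat.pow_log_le_self 2 (by omega)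
    have h2 := Real.log_le_log (by positivity) h1
    rw [Real.log_pow] at h2
    rw [hJ]; push_cast
    have h3 := Real.log_two_gt_d9
    have h4 : (0.5 : ℝ) * (Nat.log 2 N : ℝ) ≤ (Nat.log 2 N : ℝ) * Real.log 2 := by
      rw [mul_comm]; gcongr; linarith
    linarith
  have hZ1 : N < 2 ^ J * (U + 1) := (Nat.lt_pow_succ_log_self (by norm_num) N).trans_le (Nat.le_mul_of_pos_right _ (by omega))
  have hZ2 : 2 ^ J * (U + 1) ≤ 4 * N ^ 2 := by
    have h1 : 2 ^ J ≤ 2 * N := by rw [hJ, pow_succ']; exact Nat.mul_le_mul_left 2 (Nat.pow_log_le_self 2 (by omega))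
    calc _ ≤ (2 * N) * (2 * N) := Nat.mul_le_mul h1 (by omega)
      _ = _ := by ring
  clear_value J
  have hH : 1 + Real.log (2 ^ J * (U + 1) : ℕ) ≤ 8 * l := by
    have h1 : ((2 ^ J * (U + 1) : ℕ) : ℝ) ≤ 4 * N ^ 2 := by exact_mod_cast hZ2
    have h2 := Real.log_le_log (by positivity) h1
    have h3 : Real.log (4 * (N : ℝ) ^ 2) = 2 * Real.log 2 + 2 * Real.log N := by
      rw [show (4 : ℝ) * N ^ 2 = 2 ^ 2 * N ^ 2 by norm_num, Real.log_mul (by positivity) (by positivity), Real.log_pow, Real.log_pow]; norm_num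
    linarith [Real.log_two_lt_d9]
  have hgN : ∀ n : ℕ, N < n → gw l n ≤ 1 / (N : ℝ) ^ 8 := fun n hn => (hg n hn).trans (by gcongr)
  have hT := typeII l (show 1 ≤ D by omega) U1 hZ1 (γ := 1 / (N : ℝ) ^ 8) (by positivity) hH hgN
  have hZγ : ((2 ^ J * (U + 1) : ℕ) : ℝ) ^ 4 * (1 / (N : ℝ) ^ 8) ≤ 256 := by
    calc _ ≤ (4 * (N : ℝ) ^ 2) ^ 4 * (1 / (N : ℝ) ^ 8) := by gcongr; exact_mod_cast hZ2
      _ = 256 := by field_simp; norm_num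
  have hD0 : (0 : ℝ) < D := by exact_mod_cast (by omega : 0 < D)
  have hDQ' : (D : ℝ) ≤ Q := by exact_mod_cast hDQ
  have hQ0 : (0 : ℝ) < Q := hD0.trans_le hDQ'
  have step1 : ∑ r ∈ Ioc L D, (r / r.totient : ℝ) * ∑ χ ∈ prims r, ‖∑ n ∈ Ioc 0 N, (vonMangoldt n : ℂ) * (χ n * gw l n)‖
      ≤ D ^ 2 * (5 * D * U ^ 2 * (8 * l) ^ 2) + (J ^ 2 * (80 * (8 * l) ^ 3 * (x + 2 * D * (x / Real.sqrt (U + 1)) + D ^ 2 * Real.exp (l / 2)))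
      + D ^ 2 * ((2 ^ J * (U + 1) : ℕ) ^ 4 * (1 / (N : ℝ) ^ 8))) := by
    calc _ = ∑ i ∈ (Ioc L D).sigma prims, ((i.1 : ℝ) / i.1.totient) * ‖∑ n ∈ Ioc 0 N, (vonMangoldt n : ℂ) * (i.2 n * gw l n)‖ := by
          rw [sum_sigma]; exact sum_congr rfl fun r _ => mul_sum _ _ _
      _ ≤ ∑ i ∈ (Ioc L D).sigma prims, (((i.1 : ℝ) / i.1.totient) * (5 * D * U ^ 2 * (8 * l) ^ 2) + ((i.1 : ℝ) / i.1.totient) *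
          ‖∑ a ∈ Ioc 0 N, (trGt U vonMangoldt a : ℂ) * ∑ k ∈ Ioc 0 (N / a), (bb U k : ℂ) * (i.2 (a * k : ℕ) * gw l (a * k : ℕ))‖) := by
          refine sum_le_sum fun i hi => ?_
          obtain ⟨h1, h2⟩ := mem_sigma.1 hi
          have h1' := mem_Ioc.1 h1
          have : NeZero i.1 := ⟨by omega⟩
          have hne : i.2 ≠ 1 := fun h => by
            have h3 : i.2.conductor = i.1 := mem_prims.1 h2
            rw [DirichletCharacter.eq_one_iff_conductor_eq_one.1 h] at h3; omega
          rw [← mul_add]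
          refine mul_le_mul_of_nonneg_left ((vaughan_bound hne l U1 UN).trans (add_le_add ?_ le_rfl)) (by positivity)
          have : (i.1 : ℝ) ≤ D := by exact_mod_cast h1'.2
          have : 0 ≤ Real.log N := Real.log_nonneg N1'
          gcongr
          linarith
      _ ≤ ∑ i ∈ (Icc 1 D).sigma prims, (((i.1 : ℝ) / i.1.totient) * (5 * D * U ^ 2 * (8 * l) ^ 2) + ((i.1 : ℝ) / i.1.totient) *
          ‖∑ a ∈ Ioc 0 N, (trGt U vonMangoldt a : ℂ) * ∑ k ∈ Ioc 0 (N / a), (bb U k : ℂ) * (i.2 (a * k : ℕ) * gw l (a * k : ℕ))‖) := by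
          refine sum_le_sum_of_subset_of_nonneg (sigma_mono (fun r hr => ?_) fun _ => Subset.rfl) fun _ _ _ => by positivity
          have := mem_Ioc.1 hr; exact mem_Icc.2 ⟨by omega, this.2⟩
      _ ≤ _ := by
          rw [sum_add_distrib, ← sum_mul]
          exact add_le_add (mul_le_mul_of_nonneg_right (w_sum D) (by positivity)) (hx ▸ hT)
  set H := 8 * l with hHd
  have H1 : 1 ≤ H := by linarith
  have a1 : x / Real.sqrt (U + 1) ≤ x * β := by
    have h1 : Real.exp (ε / 4 * l) ≤ Real.sqrt (U + 1) := by
      apply Real.le_sqrt_of_sq_le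
      rw [← Real.exp_nat_mul]
      refine le_trans (le_of_eq ?_) (hU ▸ Nat.lt_floor_add_one (Real.exp (ε * l / 2))).le
      congr 1; push_cast; ring
    rw [hβ, neg_mul, Real.exp_neg, div_eq_mul_inv]
    gcongr
  have a2 : Q * Real.exp (l / 2) ≤ x * β := by
    calc _ ≤ Real.exp ((1 / 2 - ε) * l) * Real.exp (l / 2) := by gcongr
      _ ≤ _ := by rw [hx, hβ, ← Real.exp_add, ← Real.exp_add]; exact Real.exp_le_exp.2 (by linarith)
  have a3 : (Q : ℝ) ≤ x * β := le_trans (le_mul_of_one_le_right hQ0.le (Real.one_le_exp (by linarith))) a2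
  have a4 : (Q : ℝ) ^ 2 * U ^ 2 ≤ x * β := by
    calc _ ≤ Real.exp ((1 / 2 - ε) * l) ^ 2 * Real.exp (ε * l / 2) ^ 2 := by gcongr
      _ ≤ _ := by
        rw [hx, hβ, ← Real.exp_nat_mul, ← Real.exp_nat_mul, ← Real.exp_add, ← Real.exp_add]
        exact Real.exp_le_exp.2 (by push_cast; linarith)
  have a5 : H ^ 2 ≤ H ^ 5 := pow_le_pow_right₀ H1 (by norm_num)
  have a6 : 1 ≤ H ^ 5 := one_le_pow₀ H1
  have xb : 0 < x * β := by positivity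
  refine step1.trans ?_
  have t1 : (D : ℝ) ^ 2 * (5 * D * U ^ 2 * H ^ 2) ≤ D * (5 * H ^ 5 * (x * β)) := by
    calc _ = D * (5 * H ^ 2 * (D ^ 2 * U ^ 2)) := by ring
      _ ≤ D * (5 * H ^ 5 * (Q ^ 2 * U ^ 2)) := by gcongr
      _ ≤ _ := by gcongr
  have t2 : (J : ℝ) ^ 2 * (80 * H ^ 3 * (x + 2 * D * (x / Real.sqrt (U + 1)) + D ^ 2 * Real.exp (l / 2))) ≤
      80 * H ^ 5 * x + D * (240 * H ^ 5 * (x * β)) := by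
    calc _ ≤ H ^ 2 * (80 * H ^ 3 * (x + 2 * D * (x * β) + D * (Q * Real.exp (l / 2)))) := by
          have : (D : ℝ) ^ 2 * Real.exp (l / 2) ≤ D * (Q * Real.exp (l / 2)) := by rw [sq, mul_assoc]; gcongr
          gcongr
      _ ≤ H ^ 2 * (80 * H ^ 3 * (x + 2 * D * (x * β) + D * (x * β))) := by gcongr
      _ = _ := by ring
  have t3 : (D : ℝ) ^ 2 * ((2 ^ J * (U + 1) : ℕ) ^ 4 * (1 / (N : ℝ) ^ 8)) ≤ D * (256 * H ^ 5 * (x * β)) := by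
    calc _ ≤ (D : ℝ) ^ 2 * 256 := by gcongr
      _ = D * (256 * 1 * D) := by ring
      _ ≤ D * (256 * H ^ 5 * Q) := by gcongr
      _ ≤ _ := by gcongr
  have t4 : 0 ≤ D * (H ^ 5 * (x * β)) := by positivity
  linarith
end MG

namespace MG
open Finset Filter Topology
open ArithmeticFunction (vonMangoldt moebius)

def BVp (ε A l : ℝ) : Prop := ∃ E : ℕ → ℝ, (∀ q ∈ Ioc 0 (QQ ε l), ∀ a : ℕ, a.Coprime q →
    |∑ n ∈ Ioc (N0 l) (NN ε l) with n ≡ a [MOD q], th l n - (∑ n ∈ Ioc (N0 l) (NN ε l), th l n) / q.totient| ≤ E q) ∧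
    ∑ q ∈ Ioc 0 (QQ ε l), E q ≤ Real.exp l * l ^ (-A)

set_option maxHeartbeats 1000000 in
theorem BV {ε A : ℝ} (hε : 0 < ε) (hε1 : ε ≤ 1 / 4) (hA : 0 ≤ A) : ∃ᶠ l : ℝ in atTop, BVp ε A l := by
  set B := A + 8 with hB
  set A' := A + B + 3 with hA'
  clear_value A' B
  refine (freq_good B (by linarith)).mp ?_
  filter_upwards [SW_char A' B (by linarith) (by linarith), large_part hε hε1, tail_sum hε (by linarith), eventually_ge_atTop (1 : ℝ),
    ev_exp (5 * 64 * 10) 3 (-A) (show 0 < ε / 4 by linarith), ev_pow (5 * 64) (show B - A' + 2 < -A by linarith),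
    ev_exp (5 * 64) (B + 3) (-A) (show (0 : ℝ) < 1 by norm_num), ev_pow (5 * 64 * (160 * 8 ^ 5)) (show 7 - B < -A by linarith),
    ev_exp (5 * 64 * (600 * 8 ^ 6)) 8 (-A) (show 0 < ε / 4 by linarith), ev_exp 1 B 0 (show (0 : ℝ) < 1 / 4 by norm_num)] with
    l hSW hLP htail hl z1 z2 z3 z4 z5 z6 hgood
  set N := NN ε l with hN
  set Q := QQ ε l with hQ
  set M := N0 l with hM
  set x := Real.exp l with hx
  set β := Real.exp (-(ε / 4) * l) with hβ
  set L := ⌊l ^ B⌋₊ with hL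
  have hl0 : 0 < l := by linarith
  have hx0 : 0 < x := Real.exp_pos _
  have hεl : 0 < ε * l := mul_pos hε hl0
  have hε4 := mul_le_mul_of_nonneg_right hε1 hl0.le
  have Qle : (Q : ℝ) ≤ Real.exp ((1 / 2 - ε) * l) := Nat.floor_le (Real.exp_pos _).le
  have Nle' : (N : ℝ) ≤ Real.exp ((1 + ε) * l) := Nat.floor_le (Real.exp_pos _).le
  have Nle : (N : ℝ) ≤ Real.exp (2 * l) := Nle'.trans (Real.exp_le_exp.2 (by linarith))
  have Mle : (M : ℝ) ≤ Real.exp (l / 2) := Nat.floor_le (Real.exp_pos _).le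
  have M1 : 1 ≤ M := Nat.one_le_floor_iff _ |>.2 (Real.one_le_exp (by positivity))
  have Q1 : 1 ≤ Q := Nat.one_le_floor_iff _ |>.2 (Real.one_le_exp (mul_nonneg (by linarith) hl0.le))
  have MN : M ≤ N := Nat.floor_le_floor (Real.exp_le_exp.2 (by linarith))
  have QM : Q ≤ M := Nat.floor_le_floor (Real.exp_le_exp.2 (by linarith))
  have L1 : 1 ≤ L := Nat.one_le_floor_iff _ |>.2 (Real.one_le_rpow hl (by linarith))
  have Lle : (L : ℝ) ≤ l ^ B := Nat.floor_le (by positivity)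
  have LQ : L ≤ Q := by
    refine Nat.floor_le_floor ?_
    have h1 : l ^ B * Real.exp (-(1 / 4) * l) ≤ 1 := by simpa using z6
    calc l ^ B = (l ^ B * Real.exp (-(1 / 4) * l)) * Real.exp (1 / 4 * l) := by
          rw [mul_assoc, ← Real.exp_add]; simp
      _ ≤ 1 * Real.exp (1 / 4 * l) := by gcongr
      _ ≤ _ := by rw [one_mul]; exact Real.exp_le_exp.2 (by linarith)
  have hLB := (Nat.lt_floor_add_one (l ^ B)).le
  rw [← hL] at hLB
  have hβ0 : 0 < β := Real.exp_pos _
  clear_value N Q M x β L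
  have N1' : (1 : ℝ) ≤ N := by exact_mod_cast M1.trans MN
  have logN : Real.log N ≤ 2 * l := by rw [Real.log_le_iff_le_exp (by linarith)]; exact Nle
  have Q1' : (1 : ℝ) ≤ Q := by exact_mod_cast Q1
  have logQ : Real.log Q ≤ l := by
    rw [Real.log_le_iff_le_exp (by linarith)]; exact Qle.trans (Real.exp_le_exp.2 (by linarith))
  have logQ0 : 0 ≤ Real.log Q := Real.log_nonneg Q1'
  set Ψ : (r : ℕ) → DirichletCharacter ℂ r → ℝ := fun r χ => ‖∑ n ∈ Ioc 0 N, (vonMangoldt n : ℂ) * (χ n * gw l n)‖ with hΨ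
  set G : ℕ → ℝ := fun r => ∑ χ ∈ prims r, ‖∑ n ∈ Ioc M N, (th l n : ℂ) * χ n‖ with hG
  rw [BVp, ← hN, ← hQ, ← hM, ← hx]
  refine ⟨fun q => (1 / q.totient) * ∑ r ∈ q.divisors.erase 1, G r, fun q hq a ha => ?_, ?_⟩
  · have hq' := mem_Ioc.1 hq
    refine ap_char _ _ hq'.1 (fun n hn ht => ?_) ha
    have hn' := mem_Ioc.1 hn
    have hp : n.Prime := by by_contra h; exact ht (if_neg h)
    exact (Nat.coprime_of_lt_prime hq'.1.ne' ((hq'.2.trans QM).trans_lt hn'.1) hp)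
  refine (div_swap G (fun r => sum_nonneg fun _ _ => norm_nonneg _) Q).trans ?_
  set e := 2 * Real.sqrt N * Real.log N + 6 * M with he
  have he0 : 0 ≤ e := by have := Real.log_nonneg N1'; positivity
  have g1 : ∀ r ∈ Ioc 1 Q, G r / r.totient ≤ e + (∑ χ ∈ prims r, Ψ r χ) / r.totient := by
    intro r hr
    have hr' := mem_Ioc.1 hr
    have h0 : (0 : ℝ) < r.totient := by exact_mod_cast Nat.totient_pos.2 (by omega)
    rw [div_le_iff₀ h0, add_mul, div_mul_cancel₀ _ h0.ne']
    calc G r ≤ ∑ χ ∈ prims r, (Ψ r χ + e) := sum_le_sum fun χ _ => (norm_le_norm_add_norm_sub' _ _).trans (add_le_add le_rfl (th_lam l M1 MN χ))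
      _ = (prims r).card * e + ∑ χ ∈ prims r, Ψ r χ := by rw [sum_add_distrib, sum_const, nsmul_eq_mul, add_comm]
      _ ≤ _ := by
        rw [mul_comm e]
        exact add_le_add (mul_le_mul_of_nonneg_right (card_prims r (by omega)) he0) le_rfl
  have g2 : ∑ r ∈ Ioc 1 L, (∑ χ ∈ prims r, Ψ r χ) / r.totient ≤ l ^ B * (x * l ^ (-A') + l) := by
    calc _ ≤ ∑ r ∈ Ioc 1 L, (x * l ^ (-A') + l) := by
          refine sum_le_sum fun r hr => ?_
          have hr' := mem_Ioc.1 hr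
          have : NeZero r := ⟨by omega⟩
          have h0 : (0 : ℝ) < r.totient := by exact_mod_cast Nat.totient_pos.2 (by omega)
          have hrl : (r : ℝ) ≤ l ^ B := le_trans (by exact_mod_cast hr'.2) Lle
          rw [div_le_iff₀ h0]
          calc _ ≤ ∑ χ ∈ prims r, (x * l ^ (-A') + l) := by
                refine sum_le_sum fun χ hχ => ?_
                have hp := mem_prims.1 hχ
                have hne : χ ≠ 1 := fun h => by
                  have h3 : χ.conductor = r := hp
                  rw [DirichletCharacter.eq_one_iff_conductor_eq_one.1 h] at h3; omega
                obtain ⟨s1, s2⟩ := hSW hgood r hrl χ hne hp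
                have := htail (fun n => (χ n * vonMangoldt n) * gw l n) s1 (by simp) fun n => by
                  rw [norm_mul, norm_mul, Complex.norm_real, Complex.norm_real, Real.norm_of_nonneg ArithmeticFunction.vonMangoldt_nonneg,
                    Real.norm_of_nonneg (gw_nonneg _ _)]
                  have h1 : vonMangoldt n ≤ n := by
                    rcases Nat.eq_zero_or_pos n with rfl | h
                    · simp
                    · have := Real.log_le_sub_one_of_pos (show (0 : ℝ) < n by exact_mod_cast h)
                      linarith [ArithmeticFunction.vonMangoldt_le_log (n := n)]
                  gcongr
                  · exact gw_nonneg _ _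
                  · exact (mul_le_of_le_one_left ArithmeticFunction.vonMangoldt_nonneg (char_le_one _ _)).trans h1
                refine le_trans (le_of_eq ?_) (this.trans (add_le_add s2 le_rfl))
                simp only [hΨ]
                congr 1
                exact sum_congr rfl fun n _ => by ring
            _ = (prims r).card * (x * l ^ (-A') + l) := by rw [sum_const, nsmul_eq_mul]
            _ ≤ _ := by
              rw [mul_comm _ (r.totient : ℝ)]
              exact mul_le_mul_of_nonneg_right (card_prims r (by omega)) (by positivity)
      _ ≤ L * (x * l ^ (-A') + l) := by
          rw [sum_const, nsmul_eq_mul, Nat.card_Ioc]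
          gcongr; omega
      _ ≤ _ := by gcongr
  have g3 : ∑ r ∈ Ioc L Q, (∑ χ ∈ prims r, Ψ r χ) / r.totient ≤
      (80 * (8 * l) ^ 5 * x) * (2 / l ^ B) + (600 * (8 * l) ^ 5 * (x * β)) * (8 * l) := by
    have := abel_r (fun r : ℕ => (r / r.totient : ℝ) * ∑ χ ∈ prims r, Ψ r χ) LQ (A := 80 * (8 * l) ^ 5 * x) (B := 600 * (8 * l) ^ 5 * (x * β))
      (by positivity) (by positivity) fun D h1 h2 => hLP L D L1 h1 h2
    refine le_trans (le_of_eq (sum_congr rfl fun r hr => ?_)) (this.trans ?_)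
    · have hr' := mem_Ioc.1 hr
      have h0 : (r : ℝ) ≠ 0 := by exact_mod_cast (by omega : r ≠ 0)
      field_simp
    · gcongr
      linarith
  have Qe : Q * e ≤ x * (10 * l * β) := by
    have q1 : Q * Real.sqrt N ≤ x * β := by
      calc _ ≤ Real.exp ((1 / 2 - ε) * l) * Real.exp ((1 + ε) / 2 * l) := by
            gcongr
            rw [Real.sqrt_le_left (Real.exp_pos _).le, ← Real.exp_nat_mul]
            convert Nle' using 2; push_cast; ring
        _ ≤ _ := by rw [hx, hβ, ← Real.exp_add, ← Real.exp_add]; exact Real.exp_le_exp.2 (by linarith)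
    have q2 : (Q : ℝ) * M ≤ x * β := by
      calc _ ≤ Real.exp ((1 / 2 - ε) * l) * Real.exp (l / 2) := by gcongr
        _ ≤ _ := by rw [hx, hβ, ← Real.exp_add, ← Real.exp_add]; exact Real.exp_le_exp.2 (by linarith)
    have xb : 0 < x * β := by positivity
    calc Q * e = 2 * (Q * Real.sqrt N) * Real.log N + 6 * (Q * M) := by rw [he]; ring
      _ ≤ 2 * (x * β) * (2 * l) + 6 * (x * β) := by
          have := Real.log_nonneg N1'
          gcongr
      _ ≤ _ := by linarith [mul_le_mul_of_nonneg_left hl xb.le]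
  have g4 : ∑ r ∈ Ioc 1 Q, G r / r.totient ≤ x * (10 * l * β) + l ^ B * (x * l ^ (-A') + l) +
      ((80 * (8 * l) ^ 5 * x) * (2 / l ^ B) + (600 * (8 * l) ^ 5 * (x * β)) * (8 * l)) := by
    refine (sum_le_sum g1).trans ?_
    rw [add_assoc (x * (10 * l * β)), sum_add_distrib, ← sum_Ioc_consecutive (fun r : ℕ => (∑ χ ∈ prims r, Ψ r χ) / (r.totient : ℝ)) L1 LQ, sum_const, nsmul_eq_mul, Nat.card_Ioc]
    refine add_le_add (le_trans ?_ Qe) (add_le_add g2 g3)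
    gcongr; omega
  have g5 : ∑ s ∈ Ioc 0 Q, (1 : ℝ) / s.totient ≤ (8 * l) ^ 2 := by
    refine (phi_sum Q).trans ?_
    gcongr; linarith
  have g6 : 0 ≤ ∑ s ∈ Ioc 0 Q, (1 : ℝ) / s.totient := sum_nonneg fun _ _ => by positivity
  refine (mul_le_mul_of_nonneg_left g4 g6).trans ((mul_le_mul_of_nonneg_right g5 (by positivity)).trans ?_)
  have r1 : ∀ a b : ℝ, l ^ a * l ^ b = l ^ (a + b) := fun a b => (Real.rpow_add hl0 a b).symm
  have c1 : 5 * (64 * 10 * l ^ 3 * β) ≤ l ^ (-A) := by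
    refine le_trans (le_of_eq ?_) z1
    rw [show (3 : ℝ) = (3 : ℕ) by norm_num, Real.rpow_natCast]; ring
  have c2 : 5 * (64 * l ^ 2 * (l ^ B * l ^ (-A'))) ≤ l ^ (-A) := by
    refine le_trans (le_of_eq ?_) z2
    rw [r1, ← Real.rpow_natCast l 2, mul_assoc 64, r1, ← mul_assoc]; congr 2; push_cast; ring
  have c3 : 5 * (64 * l ^ 3 * l ^ B * x⁻¹) ≤ l ^ (-A) := by
    refine le_trans (le_of_eq ?_) z3
    rw [hx, show (-1 : ℝ) * l = -l by ring, Real.exp_neg, Real.rpow_add hl0 B 3, show l ^ (3 : ℝ) = l ^ 3 by exact_mod_cast Real.rpow_natCast l 3]; ring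
  have c4 : 5 * (64 * (160 * 8 ^ 5) * l ^ 7 / l ^ B) ≤ l ^ (-A) := by
    refine le_trans (le_of_eq ?_) z4
    rw [Real.rpow_sub hl0 7 B, show l ^ (7 : ℝ) = l ^ 7 by exact_mod_cast Real.rpow_natCast l 7]; ring
  have c5 : 5 * (64 * (600 * 8 ^ 6) * l ^ 8 * β) ≤ l ^ (-A) := by
    refine le_trans (le_of_eq ?_) z5
    rw [show (8 : ℝ) = (8 : ℕ) by norm_num, Real.rpow_natCast]; push_cast; ring
  have : (8 * l) ^ 2 * (x * (10 * l * β) + l ^ B * (x * l ^ (-A') + l) +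
      ((80 * (8 * l) ^ 5 * x) * (2 / l ^ B) + (600 * (8 * l) ^ 5 * (x * β)) * (8 * l))) =
      x * (64 * 10 * l ^ 3 * β + 64 * l ^ 2 * (l ^ B * l ^ (-A')) + 64 * l ^ 3 * l ^ B * x⁻¹
        + 64 * (160 * 8 ^ 5) * l ^ 7 / l ^ B + 64 * (600 * 8 ^ 6) * l ^ 8 * β) := by
    have : l ^ B ≠ 0 := by positivity
    generalize l ^ B = w at *
    generalize l ^ (-A') = w' at *
    field_simp
    ring
  rw [this]
  have fin : ∀ a b c d e L : ℝ, 5 * a ≤ L → 5 * b ≤ L → 5 * c ≤ L → 5 * d ≤ L → 5 * e ≤ L → a + b + c + d + e ≤ L := by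
    intros; linarith
  exact mul_le_mul_of_nonneg_left (fin _ _ _ _ _ _ c1 c2 c3 c4 c5) hx0.le
end MG

namespace MG
open Finset Filter Topology

theorem pse {ι α : Type*} [Fintype ι] [DecidableEq ι] [Fintype α] (f : ι → α → ℝ) : ∏ p, ∑ a, f p a = ∑ c : ι → α, ∏ p, f p (c p) := by
  rw [prod_univ_sum, Fintype.piFinset_univ]

theorem transport {ι α β : Type*} [Fintype ι] [DecidableEq ι] [Fintype α] [Fintype β] (u : ι → α → ℝ) (v : ι → β → ℝ) (τ : ι → α → β → ℝ)
    (K : ι → ℝ) (F : (ι → α) → ℝ) (F' : (ι → β) → ℝ) (hτ : ∀ p a b, 0 ≤ τ p a b) (hu : ∀ p a, 0 ≤ u p a) (h1 : ∀ p a, u p a ≤ ∑ b, τ p a b)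
    (h2 : ∀ p b, ∑ a, τ p a b ≤ K p * v p b) (hF : ∀ a, 0 ≤ F a) (hF' : ∀ b, 0 ≤ F' b)
    (hFF : ∀ a b, (∀ p, τ p (a p) (b p) ≠ 0) → F a ≤ F' b) :
    ∑ a, F a * ∏ p, u p (a p) ≤ (∏ p, K p) * ∑ b, F' b * ∏ p, v p (b p) := by
  calc _ ≤ ∑ a, F a * ∏ p, ∑ b, τ p (a p) b :=
        sum_le_sum fun a _ => mul_le_mul_of_nonneg_left (prod_le_prod (fun p _ => hu _ _) fun p _ => h1 _ _) (hF a)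
    _ = ∑ a, ∑ b, F a * ∏ p, τ p (a p) (b p) := sum_congr rfl fun a _ => by rw [pse, mul_sum]
    _ ≤ ∑ a, ∑ b, F' b * ∏ p, τ p (a p) (b p) := sum_le_sum fun a _ => sum_le_sum fun b _ => by
        by_cases h : ∀ p, τ p (a p) (b p) ≠ 0
        · exact mul_le_mul_of_nonneg_right (hFF a b h) (prod_nonneg fun p _ => hτ _ _ _)
        · push Not at h
          obtain ⟨p, hp⟩ := h
          rw [prod_eq_zero (f := fun p => τ p (a p) (b p)) (mem_univ p) hp]; simp
    _ = ∑ b : ι → β, F' b * ∏ p, ∑ a, τ p a (b p) := by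
        rw [sum_comm]; exact sum_congr rfl fun b _ => by rw [pse, mul_sum]
    _ ≤ ∑ b, F' b * ∏ p, (K p * v p (b p)) :=
        sum_le_sum fun b _ => mul_le_mul_of_nonneg_left (prod_le_prod (fun p _ => sum_nonneg fun a _ => hτ _ _ _) fun p _ => h2 _ _) (hF' b)
    _ = _ := by rw [mul_sum]; exact sum_congr rfl fun b _ => by rw [prod_mul_distrib]; ring

/-- erasure order on configurations -/
def er {ι κ : Type*} (d c : ι → Option κ) : Prop := ∀ p, d p = none ∨ d p = c p

theorem QF {ι κ : Type*} [Fintype ι] [DecidableEq ι] [Fintype κ] [DecidableEq κ] (t : ι → ℝ) (B : ι → Option κ → Option κ → ℝ)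
    (S : Option κ → Prop) (y : (ι → Option κ) → ℝ) (hy0 : ∀ c, 0 ≤ y c) (hyS : ∀ c, y c ≠ 0 → ∀ p, S (c p)) (hS : S none)
    (hy : ∀ c d, er d c → y c ≤ y d) (h0 : ∀ p, B p none none = 1) (h1 : ∀ p i, S i → 0 ≤ B p i i)
    (h2 : ∀ p i j, S i → S j → i ≠ j → |B p i j| ≤ 2 * t p ^ 2) :
    |∑ c, ∑ c', y c * y c' * ∏ p, B p (c p) (c' p) - ∑ c, y c ^ 2 * ∏ p, B p (c p) (c p)| ≤
      (∏ p, (1 + 2 * (Fintype.card κ + 1) ^ 2 * t p ^ 2) - 1) * ∑ c, y c ^ 2 * ∏ p, B p (c p) (c p) := by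
  classical
  set D := ∑ c, y c ^ 2 * ∏ p, B p (c p) (c p) with hD
  let F : (ι → Option κ × Option κ) → ℝ := fun e => y (fun p => (e p).1) * y (fun p => (e p).2)
  let u : ι → Option κ × Option κ → ℝ := fun p a => if S a.1 ∧ S a.2 then |B p a.1 a.2| else 0
  have hu : ∀ p a, 0 ≤ u p a := fun p a => by simp only [u]; split_ifs <;> positivity
  have key : ∑ e, F e * ∏ p, u p (e p) ≤ (∏ p, (1 + 2 * (Fintype.card κ + 1) ^ 2 * t p ^ 2)) *
      ∑ c : ι → Option κ, y c ^ 2 * ∏ p, (if S (c p) then B p (c p) (c p) else 0) := by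
    refine transport u (fun p b => if S b then B p b b else 0) (fun p a b => if (if a.1 = a.2 then a.1 else none) = b then u p a else 0)
      (fun p => 1 + 2 * (Fintype.card κ + 1) ^ 2 * t p ^ 2) F (fun c => y c ^ 2)
      (fun p a b => ?_) hu (fun p a => ?_) (fun p b => ?_) (fun a => mul_nonneg (hy0 _) (hy0 _)) (fun b => sq_nonneg _) fun a b h => ?_
    · split_ifs <;> simp [hu]
    · simp
    · have ht : (0 : ℝ) ≤ 2 * (Fintype.card κ + 1) ^ 2 * t p ^ 2 := by positivity
      rcases b with _ | b
      · simp only [h0, hS, if_true, mul_one]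
        calc _ ≤ ∑ a : Option κ × Option κ, ((if a = (none, none) then 1 else 0) + 2 * t p ^ 2) := by
              refine sum_le_sum fun a _ => ?_
              by_cases h : a.1 = a.2
              · obtain ⟨i, j⟩ := a
                simp only at h; subst h
                rcases i with _ | i
                · simp [u, hS, h0]; positivity
                · simp; positivity
              · have hne : a ≠ (none, none) := by rintro rfl; exact h rfl
                simp only [h, hne, if_false, if_true, zero_add, u]
                split_ifs with h3
                · exact h2 p _ _ h3.1 h3.2 h
                · positivity
          _ = _ := by
            rw [sum_add_distrib, sum_ite_eq' univ]
            simp [Fintype.card_prod, Fintype.card_option]; ring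
      · calc _ = ∑ a : Option κ × Option κ, if a = (some b, some b) then u p a else 0 := by
              refine sum_congr rfl fun a _ => ?_
              obtain ⟨i, j⟩ := a
              by_cases h : i = j
              · subst h; simp
              · have : (i, j) ≠ (some b, some b) := fun h' => h (by simp_all)
                simp [h, this]
          _ = u p (some b, some b) := by simp
          _ ≤ _ := by
            simp only [u, and_self]
            split_ifs with h3
            · rw [abs_of_nonneg (h1 p _ h3)]
              exact le_mul_of_one_le_left (h1 p _ h3) (by linarith)
            · simp
    · have hb : ∀ p, (if (a p).1 = (a p).2 then (a p).1 else none) = b p := fun p => by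
        by_contra h'; exact h p (if_neg h')
      simp only [F, sq]
      refine mul_le_mul (hy _ _ fun p => ?_) (hy _ _ fun p => ?_) (hy0 _) (hy0 _) <;> rw [← hb p] <;> split_ifs with h4 <;> simp [h4]
  have e1 : ∑ c : ι → Option κ, y c ^ 2 * ∏ p, (if S (c p) then B p (c p) (c p) else 0) = D := by
    refine sum_congr rfl fun c _ => ?_
    by_cases h : y c = 0
    · simp [h]
    · rw [prod_congr rfl fun p _ => if_pos (hyS c h p)]
  have e2 : ∑ e, F e * ∏ p, u p (e p) = ∑ c, ∑ c', |y c * y c' * ∏ p, B p (c p) (c' p)| := by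
    rw [← sum_product', univ_product_univ]
    refine Fintype.sum_equiv (Equiv.arrowProdEquivProdArrow ι (fun _ => Option κ) (fun _ => Option κ)) _ _ fun e => ?_
    simp only [Equiv.arrowProdEquivProdArrow_apply, F]
    rw [abs_mul, abs_of_nonneg (mul_nonneg (hy0 _) (hy0 _)), abs_prod]
    by_cases h : y (fun p => (e p).1) = 0
    · simp [h]
    by_cases h' : y (fun p => (e p).2) = 0
    · simp [h']
    rw [prod_congr rfl fun p _ => if_pos ⟨hyS _ h p, hyS _ h' p⟩]
  have e3 : ∀ c, 0 ≤ y c ^ 2 * ∏ p, B p (c p) (c p) := fun c => by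
    by_cases h : y c = 0
    · simp [h]
    · exact mul_nonneg (sq_nonneg _) (prod_nonneg fun p _ => h1 p _ (hyS c h p))
  rw [e1, e2] at key
  rw [sub_one_mul]
  have e4 : ∀ g : (ι → Option κ) → (ι → Option κ) → ℝ, ∑ c, ∑ c', g c c' = ∑ c, g c c + ∑ c, ∑ c' ∈ univ.erase c, g c c' := fun g => by
    rw [← sum_add_distrib]
    exact sum_congr rfl fun c _ => (add_sum_erase _ _ (mem_univ c)).symm
  rw [e4] at key ⊢
  have e5 : ∑ c, |y c * y c * ∏ p, B p (c p) (c p)| = D :=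
    sum_congr rfl fun c _ => by rw [← sq, abs_of_nonneg (e3 c)]
  have e6 : ∑ c, y c * y c * ∏ p, B p (c p) (c p) = D := sum_congr rfl fun c _ => by rw [sq]
  rw [e5] at key
  rw [e6, add_sub_cancel_left]
  refine le_trans ((abs_sum_le_sum_abs _ _).trans (sum_le_sum fun c _ => abs_sum_le_sum_abs _ _)) ?_
  linarith
end MG

namespace MG
open Finset Filter Topology

def ps {κ : Type*} [DecidableEq κ] (t : ℝ) : Option κ → Option κ → ℝ
  | none, _ => 1
  | some i, s => if s = some i then -1 else t

def uu {κ : Type*} [DecidableEq κ] (t : ℝ) (i j : Option κ) : Option κ → ℝ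
  | none => ps t i none * ps t j none
  | some a => ps t i (some a) * ps t j (some a) - ps t i none * ps t j none

def Bm {κ : Type*} [DecidableEq κ] [Fintype κ] (t : ℝ) (ϖ : κ → ℝ) (i j : Option κ) : ℝ := ∑ a, uu t i j a * a.elim 1 ϖ

def numc {ι κ : Type*} [Fintype ι] [DecidableEq κ] (q : ι → ℕ) (c : ι → Option κ) : ℕ := ∏ p, if c p = none then 1 else q p

section
variable {ι κ : Type*} [Fintype ι] [DecidableEq ι] [Fintype κ] [DecidableEq κ]

theorem ps_abs {t : ℝ} (h0 : 0 ≤ t) (h1 : t ≤ 1) (i s : Option κ) : |ps t i s| ≤ 1 := by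
  rcases i with _ | i
  · simp [ps]
  · simp only [ps]; split_ifs
    · simp
    · rwa [abs_of_nonneg h0]

theorem uu_expand (t : ℝ) (i j s : Option κ) : ps t i s * ps t j s = ∑ a, uu t i j a * if a = none ∨ s = a then 1 else 0 := by
  rw [Fintype.sum_option]
  rcases s with _ | s
  · simp [uu]
  · simp [uu]

theorem uu_none {t : ℝ} (h0 : 0 ≤ t) (h1 : t ≤ 1) : ∑ i, ∑ j, |uu t i j (none : Option κ)| ≤ 1 + (Fintype.card κ + 1) ^ 2 * t := by
  calc _ ≤ ∑ i : Option κ, ∑ j : Option κ, ((if i = none then if j = none then 1 else 0 else 0) + t) := by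
        refine sum_le_sum fun i _ => sum_le_sum fun j _ => ?_
        rcases i with _ | i <;> rcases j with _ | j <;> simp [uu, ps, abs_of_nonneg, h0]
        nlinarith
    _ = _ := by simp [sum_add_distrib, Fintype.card_option]; ring

theorem uu_some {t : ℝ} (h0 : 0 ≤ t) (h1 : t ≤ 1) (a : κ) : ∑ i, ∑ j, |uu t i j (some a)| ≤ 2 * (Fintype.card κ + 1) ^ 2 := by
  calc _ ≤ ∑ i : Option κ, ∑ j : Option κ, (2 : ℝ) := by
        refine sum_le_sum fun i _ => sum_le_sum fun j _ => ?_
        refine (abs_sub _ _).trans ?_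
        rw [abs_mul, abs_mul]
        have := fun i s => ps_abs (κ := κ) h0 h1 i s
        have h := mul_le_one₀ (this i (some a)) (abs_nonneg _) (this j (some a))
        have h' := mul_le_one₀ (this i none) (abs_nonneg _) (this j none)
        linarith
    _ = _ := by simp [Fintype.card_option]; ring

theorem sieve_err (q : ι → ℕ) (hq : ∀ p, 1 ≤ q p) (t : ι → ℝ) (t0 : ∀ p, 0 ≤ t p) (t1 : ∀ p, t p ≤ 1) (I : Finset ℕ) (s : ℕ → ι → Option κ)
    (w : ℕ → ℝ) (y : (ι → Option κ) → ℝ) (ϖ : ι → κ → ℝ) (X Ym R : ℝ) (E : (ι → Option κ) → ℝ) (hy : ∀ c, |y c| ≤ Ym)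
    (hs : ∀ c, y c ≠ 0 → (numc q c : ℝ) ≤ R)
    (hE : ∀ T : ι → Option κ, (numc q T : ℝ) ≤ R ^ 2 →
      |∑ n ∈ I with ∀ p, T p = none ∨ s n p = T p, w n - X * ∏ p, (T p).elim 1 (ϖ p)| ≤ E T) :
    |∑ n ∈ I, w n * (∑ c, y c * ∏ p, ps (t p) (c p) (s n p)) ^ 2 - X * ∑ c, ∑ c', y c * y c' * ∏ p, Bm (t p) (ϖ p) (c p) (c' p)| ≤
      Ym ^ 2 * ∑ T : ι → Option κ with (numc q T : ℝ) ≤ R ^ 2, E T * ∏ p,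
        (if T p = none then 1 + (Fintype.card κ + 1 : ℝ) ^ 2 * t p else 2 * (Fintype.card κ + 1 : ℝ) ^ 2) := by
  set Δ : (ι → Option κ) → ℝ := fun T => ∑ n ∈ I with ∀ p, T p = none ∨ s n p = T p, w n - X * ∏ p, (T p).elim 1 (ϖ p) with hΔ
  have e1 : ∑ n ∈ I, w n * (∑ c, y c * ∏ p, ps (t p) (c p) (s n p)) ^ 2 - X * ∑ c, ∑ c', y c * y c' * ∏ p, Bm (t p) (ϖ p) (c p) (c' p) =
      ∑ c, ∑ c', ∑ T, y c * y c' * (∏ p, uu (t p) (c p) (c' p) (T p)) * Δ T := by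
    have a1 : ∀ n, w n * (∑ c, y c * ∏ p, ps (t p) (c p) (s n p)) ^ 2 = ∑ c, ∑ c', ∑ T : ι → Option κ,
        y c * y c' * (∏ p, uu (t p) (c p) (c' p) (T p)) * if ∀ p, T p = none ∨ s n p = T p then w n else 0 := fun n => by
      rw [sq, sum_mul_sum, mul_sum]
      refine sum_congr rfl fun c _ => ?_
      rw [mul_sum]
      refine sum_congr rfl fun c' _ => ?_
      rw [mul_mul_mul_comm, ← prod_mul_distrib, prod_congr rfl fun p _ => uu_expand _ _ _ _, pse, mul_sum, mul_sum]
      refine sum_congr rfl fun T _ => ?_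
      rw [prod_mul_distrib, Finset.prod_ite_zero]
      simp only [mem_univ, true_implies, prod_const_one]
      split_ifs <;> ring
    rw [sum_congr rfl fun n _ => a1 n, sum_comm, mul_sum, ← sum_sub_distrib]
    refine sum_congr rfl fun c _ => ?_
    rw [sum_comm, mul_sum, ← sum_sub_distrib]
    refine sum_congr rfl fun c' _ => ?_
    rw [sum_comm]
    simp only [Bm]
    rw [pse, mul_sum, mul_sum, ← sum_sub_distrib]
    refine sum_congr rfl fun T _ => ?_
    rw [← mul_sum, ← sum_filter, prod_mul_distrib, hΔ]
    ring
  have hY : 0 ≤ Ym := (abs_nonneg _).trans (hy fun _ => none)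
  rw [e1]
  calc _ ≤ ∑ c, ∑ c', ∑ T, |y c * y c' * (∏ p, uu (t p) (c p) (c' p) (T p)) * Δ T| :=
        (abs_sum_le_sum_abs _ _).trans (sum_le_sum fun c _ => (abs_sum_le_sum_abs _ _).trans (sum_le_sum fun c' _ => abs_sum_le_sum_abs _ _))
    _ ≤ ∑ c : ι → Option κ, ∑ c' : ι → Option κ, ∑ T : ι → Option κ, if (numc q T : ℝ) ≤ R ^ 2 then Ym ^ 2 * E T * ∏ p, |uu (t p) (c p) (c' p) (T p)| else 0 := by
        refine sum_le_sum fun c _ => sum_le_sum fun c' _ => sum_le_sum fun T _ => ?_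
        have hr : (if (numc q T : ℝ) ≤ R ^ 2 then Ym ^ 2 * E T * ∏ p, |uu (t p) (c p) (c' p) (T p)| else 0) ≥ 0 := by
          split_ifs with h
          · exact mul_nonneg (mul_nonneg (sq_nonneg _) ((abs_nonneg _).trans (hE T h))) (prod_nonneg fun _ _ => abs_nonneg _)
          · exact le_rfl
        by_cases h0 : y c * y c' * (∏ p, uu (t p) (c p) (c' p) (T p)) = 0
        · rw [h0, zero_mul, abs_zero]; exact hr
        simp only [mul_ne_zero_iff, prod_ne_zero_iff, ne_eq] at h0
        have hT : (numc q T : ℝ) ≤ R ^ 2 := by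
          have b1 : numc q T ≤ numc q c * numc q c' := by
            rw [numc, numc, numc, ← prod_mul_distrib]
            refine prod_le_prod' fun p _ => ?_
            have h3 := h0.2 p (mem_univ p)
            have h4 := hq p
            rcases hT : T p with _ | a
            · simp only [if_true]; split_ifs <;> nlinarith
            · rw [hT] at h3
              rcases hc : c p with _ | i <;> rcases hc' : c' p with _ | j
              · rw [hc, hc'] at h3; simp [uu, ps] at h3
              all_goals simp
              nlinarith
          have b2 := mul_le_mul (hs c h0.1.1) (hs c' h0.1.2) (Nat.cast_nonneg _) ((Nat.cast_nonneg _).trans (hs c h0.1.1))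
          rw [sq]; exact le_trans (by exact_mod_cast b1) b2
        rw [if_pos hT, abs_mul, abs_mul, abs_mul, abs_prod, sq]
        have := mul_le_mul (hy c) (hy c') (abs_nonneg _) hY
        calc _ = (|y c| * |y c'|) * |Δ T| * ∏ p, |uu (t p) (c p) (c' p) (T p)| := by ring
          _ ≤ _ := mul_le_mul_of_nonneg_right (mul_le_mul this (hE T hT) (abs_nonneg _) (mul_nonneg hY hY)) (prod_nonneg fun _ _ => abs_nonneg _)
    _ = ∑ T : ι → Option κ with (numc q T : ℝ) ≤ R ^ 2, Ym ^ 2 * E T * ∏ p, ∑ i, ∑ j, |uu (t p) i j (T p)| := by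
        rw [sum_filter, sum_congr rfl fun c _ => sum_comm, sum_comm]
        refine sum_congr rfl fun T _ => ?_
        split_ifs
        · rw [pse, mul_sum]
          refine sum_congr rfl fun c _ => ?_
          rw [pse, mul_sum]
        · simp
    _ ≤ _ := by
        rw [mul_sum]
        refine sum_le_sum fun T hT => ?_
        rw [mul_assoc]
        refine mul_le_mul_of_nonneg_left (mul_le_mul_of_nonneg_left (prod_le_prod (fun _ _ => sum_nonneg fun _ _ => sum_nonneg fun _ _ => abs_nonneg _)
          fun p _ => ?_) ((abs_nonneg _).trans (hE T (mem_filter.1 hT).2))) (sq_nonneg _)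
        rcases T p with _ | a
        · simpa using uu_none (t0 p) (t1 p)
        · simpa using uu_some (t0 p) (t1 p) a
end
end MG

namespace MG
open Finset Filter Topology
section
variable {ι κ : Type*} [Fintype ι] [DecidableEq ι] [Fintype κ] [DecidableEq κ]

theorem Bm_nn (t : ℝ) (ϖ : κ → ℝ) : Bm t ϖ none none = 1 := by
  rw [Bm, Fintype.sum_option]; simp [uu, ps]

theorem Bm_sn (t : ℝ) (ϖ : κ → ℝ) (i : κ) : Bm t ϖ (some i) none = t - (1 + t) * ϖ i := by
  rw [Bm, Fintype.sum_option, Fintype.sum_eq_single i]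
  · simp [uu, ps]; ring
  · intro a ha; simp [uu, ps, ha]

theorem Bm_comm (t : ℝ) (ϖ : κ → ℝ) (i j : Option κ) : Bm t ϖ i j = Bm t ϖ j i := by
  refine sum_congr rfl fun a _ => ?_
  rcases a with _ | a <;> simp only [uu] <;> ring

theorem Bm_ss (t : ℝ) (ϖ : κ → ℝ) (i : κ) : Bm t ϖ (some i) (some i) = t ^ 2 + (1 - t ^ 2) * ϖ i := by
  rw [Bm, Fintype.sum_option, Fintype.sum_eq_single i]
  · simp [uu, ps]; ring
  · intro a ha; simp [uu, ps, ha]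

theorem Bm_ij (t : ℝ) (ϖ : κ → ℝ) {i j : κ} (h : i ≠ j) : Bm t ϖ (some i) (some j) = t ^ 2 - t * (1 + t) * (ϖ i + ϖ j) := by
  rw [Bm, Fintype.sum_option, Fintype.sum_eq_add i j h]
  · simp [uu, ps, h, h.symm]; ring
  · intro a ha; simp [uu, ps, ha.1, ha.2]

def num (q : ι → ℕ) (s : ι → Bool) : ℕ := ∏ p, if s p then q p else 1
noncomputable def wt (t : ι → ℝ) (s : ι → Bool) : ℝ := ∏ p, if s p then t p else 1
def row (c : ι → Option κ) (i : κ) : ι → Bool := fun p => decide (c p = some i)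
noncomputable def yy (q : ι → ℕ) (G : (ι → Bool) → ℝ) (R : ℝ) (c : ι → Option κ) : ℝ := if (numc q c : ℝ) ≤ R then ∏ i, G (row c i) else 0
noncomputable def ze (t : ℝ) (m : κ) (a b : Option κ) : ℝ := if a = some m then (if b = none then t else 0) else if a = b then 1 else 0
noncomputable def zz (t : ι → ℝ) (m : κ) (y : (ι → Option κ) → ℝ) (c : ι → Option κ) : ℝ := ∑ a, y a * ∏ p, ze (t p) m (a p) (c p)

theorem ze_nonneg {t : ℝ} (h : 0 ≤ t) (m : κ) (a b : Option κ) : 0 ≤ ze t m a b := by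
  unfold ze; split_ifs <;> simp [h]

theorem ze_sum_none (t : ℝ) (m : κ) : ∑ a, ze t m a none = 1 + t := by
  rw [Fintype.sum_option, Fintype.sum_eq_single m]
  · simp [ze]
  · intro a ha; simp [ze, ha]

theorem ze_sum_some (t : ℝ) (m j : κ) : ∑ a, ze t m a (some j) ≤ 1 := by
  rw [Fintype.sum_eq_single (some j)]
  · simp only [ze]; split_ifs <;> simp_all
  · intro a ha; simp [ze, ha]

theorem zz_nu (t : ι → ℝ) (m : κ) (y : (ι → Option κ) → ℝ) (s : ι → Option κ) (hs : ∀ p, s p ≠ some m) :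
    ∑ c, y c * ∏ p, ps (t p) (c p) (s p) = ∑ c, zz t m y c * ∏ p, ps (t p) (c p) (s p) := by
  simp only [zz, sum_mul]
  rw [sum_comm]
  refine sum_congr rfl fun a _ => ?_
  simp only [mul_assoc, ← prod_mul_distrib]
  rw [← mul_sum, ← pse (fun p b => ze (t p) m (a p) b * ps (t p) b (s p))]
  congr 1
  refine prod_congr rfl fun p _ => ?_
  by_cases h : a p = some m
  · rw [Fintype.sum_eq_single none]
    · simp [ze, h, ps, hs]
    · intro b hb; simp [ze, h, hb]
  · rw [Fintype.sum_eq_single (a p)]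
    · simp [ze, h]
    · intro b hb; simp [ze, h, hb.symm]

theorem zz_ex {t : ι → ℝ} {m : κ} {y : (ι → Option κ) → ℝ} {c : ι → Option κ} (h : zz t m y c ≠ 0) :
    (∀ p, c p ≠ some m) ∧ ∃ a, y a ≠ 0 ∧ er c a := by
  obtain ⟨a, -, ha⟩ := exists_ne_zero_of_sum_ne_zero h
  simp only [mul_ne_zero_iff, prod_ne_zero_iff, mem_univ, true_implies] at ha
  refine ⟨fun p hp => ?_, a, ha.1, fun p => ?_⟩ <;> have h3 := ha.2 p <;> simp only [ze] at h3 <;> split_ifs at h3 with h4 h5 h6 <;> simp_all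

variable {t : ι → ℝ} {q : ι → ℕ} {G : (ι → Bool) → ℝ} {R Y : ℝ}

theorem numc_mono (hq : ∀ p, 1 ≤ q p) {c d : ι → Option κ} (h : er d c) : numc q d ≤ numc q c := by
  refine prod_le_prod' fun p _ => ?_
  rcases h p with h | h <;> rw [h]
  simp only [if_true]; split_ifs <;> simp [hq]

theorem yy_nonneg (hG : ∀ s, 0 ≤ G s) (c : ι → Option κ) : 0 ≤ yy q G R c := by
  unfold yy; split_ifs
  · exact prod_nonneg fun _ _ => hG _
  · exact le_rfl

theorem yy_le_one (hG : ∀ s, 0 ≤ G s) (hG1 : ∀ s, G s ≤ 1) (c : ι → Option κ) : yy q G R c ≤ 1 := by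
  unfold yy; split_ifs
  · exact prod_le_one (fun _ _ => hG _) fun _ _ => hG1 _
  · exact zero_le_one

theorem yy_mono (hq : ∀ p, 1 ≤ q p) (hG : ∀ s, 0 ≤ G s) (hm : ∀ s s' : ι → Bool, (∀ p, s p → s' p) → G s' ≤ G s) (c d : ι → Option κ) (h : er d c) :
    yy q G R c ≤ yy q G R d := by
  by_cases hc : (numc q c : ℝ) ≤ R
  · have hd : (numc q d : ℝ) ≤ R := le_trans (by exact_mod_cast numc_mono hq h) hc
    rw [yy, yy, if_pos hc, if_pos hd]
    refine prod_le_prod (fun _ _ => hG _) fun i _ => hm _ _ fun p hp => ?_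
    simp only [row, decide_eq_true_eq] at hp ⊢
    rcases h p with h | h <;> simp_all
  · rw [yy, if_neg hc]; exact yy_nonneg hG d

theorem zz_nonneg (ht : ∀ p, 0 ≤ t p) {y : (ι → Option κ) → ℝ} (hy : ∀ c, 0 ≤ y c) (m : κ) (c) : 0 ≤ zz t m y c :=
  sum_nonneg fun _ _ => mul_nonneg (hy _) (prod_nonneg fun _ _ => ze_nonneg (ht _) _ _ _)

theorem zz_le (ht : ∀ p, 0 ≤ t p) {y : (ι → Option κ) → ℝ} (hy1 : ∀ c, y c ≤ 1) (m : κ) (c : ι → Option κ) :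
    zz t m y c ≤ ∏ p, (1 + t p) := by
  calc _ ≤ ∑ a : ι → Option κ, ∏ p, ze (t p) m (a p) (c p) :=
        sum_le_sum fun _ _ => mul_le_of_le_one_left (prod_nonneg fun _ _ => ze_nonneg (ht _) _ _ _) (hy1 _)
    _ = ∏ p, ∑ a, ze (t p) m a (c p) := by rw [pse]
    _ ≤ _ := prod_le_prod (fun p _ => sum_nonneg fun _ _ => ze_nonneg (ht p) _ _ _) fun p _ => by
        rcases c p with _ | j
        · rw [ze_sum_none]
        · exact (ze_sum_some _ _ _).trans (by linarith [ht p])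

theorem zz_mono (ht : ∀ p, 0 ≤ t p) {y : (ι → Option κ) → ℝ} (hy : ∀ c, 0 ≤ y c) (hym : ∀ c d, er d c → y c ≤ y d) (m : κ)
    (c d : ι → Option κ) (h : er d c) : zz t m y c ≤ zz t m y d := by
  have := transport (fun p a => ze (t p) m a (c p)) (fun p a => ze (t p) m a (d p))
    (fun p a b => if b = (if d p = c p then a else none) then ze (t p) m a (c p) else 0) (fun _ => 1) y y
    (fun p a b => by split_ifs <;> simp [ze_nonneg (ht p)]) (fun p a => ze_nonneg (ht p) _ _ _) (fun p a => by simp) (fun p b => ?_) hy hy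
    fun a b hab => hym _ _ fun p => ?_
  · simpa [zz] using this
  · by_cases hp : d p = c p
    · simp [hp]
    · have h0 : d p = none := (h p).resolve_right hp
      obtain ⟨j, hj⟩ := Option.ne_none_iff_exists'.1 (fun h' => hp (h0.trans h'.symm) : c p ≠ none)
      simp only [hp, if_false, one_mul, h0, hj]
      by_cases hb : b = none
      · subst hb; simpa [ze] using ze_sum_some (t p) m j
      · simpa [hb] using ze_nonneg (ht p) m b none
  · have := hab p
    split_ifs at this with h1 h2 <;> simp_all

theorem D1_le (ht : ∀ p, 0 ≤ t p) (hG : ∀ s, 0 ≤ G s) :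
    ∑ c : ι → Option κ, yy q G R c ^ 2 * ∏ p, (if c p = none then 1 else t p) ≤ (∑ s, G s ^ 2 * wt t s) ^ Fintype.card κ := by
  have := transport (fun p (a : Option κ) => if a = none then 1 else t p) (fun p (e : κ → Bool) => ∏ i, if e i then t p else 1)
    (fun p a e => if e = (fun i => decide (a = some i)) then (if a = none then 1 else t p) else 0) (fun _ => 1) (fun c => yy q G R c ^ 2)
    (fun e => ∏ i, G (fun p => e p i) ^ 2) (fun p a b => by split_ifs <;> simp [ht]) (fun p a => by split_ifs <;> simp [ht])
    (fun p a => by simp) (fun p e => ?_) (fun _ => sq_nonneg _) (fun _ => prod_nonneg fun _ _ => sq_nonneg _) fun a b hab => ?_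
  · refine this.trans (le_of_eq ?_)
    rw [prod_const_one, one_mul, ← card_univ, ← prod_const, pse]
    refine Fintype.sum_equiv (Equiv.piComm _) _ _ fun e => ?_
    rw [Finset.prod_comm, ← prod_mul_distrib]; rfl
  · rw [one_mul]
    have h0 : 0 ≤ ∏ i, (if e i then t p else 1) := prod_nonneg fun _ _ => by split_ifs <;> simp [ht]
    by_cases h : ∃ a : Option κ, e = fun i => decide (a = some i)
    · obtain ⟨a, rfl⟩ := h
      rw [Fintype.sum_eq_single a]
      · rcases a with _ | a
        · simp
        · simp only [if_true, reduceCtorEq, if_false, Option.some.injEq, decide_eq_true_eq]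
          rw [prod_ite_eq]; simp
      · intro b hb
        refine if_neg fun h => hb ?_
        rcases b with _ | b <;> rcases a with _ | a
        · rfl
        · simpa using congrFun h a
        · simpa using congrFun h b
        · simpa using (congrFun h a).symm
    · rw [sum_eq_zero fun a _ => if_neg fun h' => h ⟨a, h'⟩]; exact h0
  · have : ∀ i, (fun p => b p i) = row a i := fun i => by
      funext p
      have := hab p
      simp only [ne_eq, ite_eq_right_iff, Classical.not_imp] at this
      rw [this.1, row]
    simp only [this, prod_pow]
    refine pow_le_pow_left₀ (yy_nonneg hG a) ?_ 2
    unfold yy; split_ifs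
    · exact le_rfl
    · exact prod_nonneg fun _ _ => hG _
end
end MG

namespace MG
open Finset Filter Topology
section
variable {ι κ : Type*} [Fintype ι] [DecidableEq ι] [Fintype κ] [DecidableEq κ] {t : ι → ℝ} {q : ι → ℕ} {G : (ι → Bool) → ℝ} {R Y : ℝ}

theorem zz_lower (ht : ∀ p, 0 ≤ t p) (hq : ∀ p, 1 ≤ q p) (hG : ∀ s, 0 ≤ G s) (hm : ∀ s s' : ι → Bool, (∀ p, s p → s' p) → G s' ≤ G s)
    (hY : ∀ s, G s ≠ 0 → (num q s : ℝ) ≤ Y) (m : κ) (c : ι → Option κ) (hc : ∀ p, c p ≠ some m) (hR : numc q c * Y ≤ R) :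
    (∏ i : {i // i ≠ m}, G (row c i)) * ∑ s, G s * wt t s ≤ (∏ p, if c p = none then 1 else 1 + t p) * zz t m (yy q G R) c := by
  have := transport (fun p (s : Bool) => if s then t p else 1) (fun p b => ze (t p) m b (c p))
    (fun p s b => if b = (if c p = none then (if s then some m else none) else c p) then (if s then t p else 1) else 0)
    (fun p => if c p = none then 1 else 1 + t p) (fun s => (∏ i : {i // i ≠ m}, G (row c i)) * G s) (yy q G R)
    (fun p a b => by split_ifs <;> simp [ht]) (fun p a => by split_ifs <;> simp [ht]) (fun p a => by simp) (fun p b => ?_)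
    (fun _ => mul_nonneg (prod_nonneg fun _ _ => hG _) (hG _)) (yy_nonneg hG) fun s b hab => ?_
  · rw [mul_sum]; simpa only [mul_assoc, wt, zz] using this
  · rw [Fintype.sum_bool]
    rcases hp : c p with _ | j
    · rcases b with _ | b
      · simp [ze]
      · by_cases hb : b = m <;> simp [ze, hb]
    · have : j ≠ m := fun h => hc p (by rw [hp, h])
      by_cases hb : b = some j
      · simp [ze, hb, this]; linarith
      · simp [hb, ze]
  · by_cases h0 : G s = 0
    · rw [h0, mul_zero]; exact yy_nonneg hG b
    have hb : ∀ p, b p = (if c p = none then (if s p then some m else none) else c p) := fun p => by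
      by_contra h; exact hab p (if_neg h)
    have hn : numc q b ≤ numc q c * num q s := by
      rw [numc, numc, num, ← prod_mul_distrib]
      refine prod_le_prod' fun p _ => ?_
      have := hq p
      rw [hb p]; split_ifs <;> simp_all
      exact Nat.le_mul_of_pos_left _ (hq p)
    have hR' : (numc q b : ℝ) ≤ R := by
      refine le_trans ?_ hR
      calc (numc q b : ℝ) ≤ numc q c * num q s := by exact_mod_cast hn
        _ ≤ _ := by gcongr; exact hY s h0
    rw [yy, if_pos hR', Fintype.prod_eq_mul_prod_subtype_ne _ m, mul_comm]
    refine mul_le_mul (hm _ _ fun p hp => ?_) (le_of_eq (prod_congr rfl fun i _ => ?_)) (prod_nonneg fun _ _ => hG _) (hG _)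
    · have h1 := hc p
      simp only [row, decide_eq_true_eq, hb p] at hp
      split_ifs at hp <;> simp_all
    · congr 1; funext p
      have := i.2
      simp only [row, hb p]
      split_ifs with h1 h2 <;> simp [h1, this.symm]

theorem one_add_pow_le {t : ℝ} (h0 : 0 ≤ t) (h1 : t ≤ 1) (r : ℕ) : (1 + t) ^ r ≤ 1 + r * t + 4 ^ r * t ^ 2 := by
  induction r with
  | zero => simp; positivity
  | succ r ih =>
    have h4 : (r : ℝ) ≤ 4 ^ r := by exact_mod_cast (Nat.lt_pow_self (by norm_num : 1 < 4)).le
    calc (1 + t) ^ (r + 1) = (1 + t) ^ r * (1 + t) := pow_succ _ _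
      _ ≤ (1 + r * t + 4 ^ r * t ^ 2) * (1 + t) := by gcongr
      _ = 1 + (r + 1) * t + (r + 4 ^ r + 4 ^ r * t) * t ^ 2 := by ring
      _ ≤ 1 + (r + 1) * t + (4 ^ (r + 1)) * t ^ 2 := by
        gcongr
        have : (4 : ℝ) ^ r * t ≤ 4 ^ r * 1 := by gcongr
        rw [pow_succ]; linarith [show (0 : ℝ) ≤ 4 ^ r by positivity]
      _ = _ := by push_cast; ring

theorem D2_ge (ht : ∀ p, 0 ≤ t p) (ht1 : ∀ p, t p ≤ 1) (hq : ∀ p, 1 ≤ q p) (hG : ∀ s, 0 ≤ G s)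
    (hm : ∀ s s' : ι → Bool, (∀ p, s p → s' p) → G s' ≤ G s) (hY0 : 0 ≤ Y)
    (hY : ∀ s, G s ≠ 0 → (num q s : ℝ) ≤ Y) (m : κ) (b : ι → Option κ → ℝ) (hb0 : ∀ p, b p none = 1) (hb : ∀ p i, i ≠ m → t p ≤ b p (some i)) :
    (∑ s, G s * wt t s) ^ 2 * ∑ e : {i // i ≠ m} → ι → Bool, (if (∏ i, (num q (e i) : ℝ)) * Y ≤ R then 1 else 0) * ∏ i, (G (e i) ^ 2 * wt t (e i)) ≤
      (∏ p, (1 + (4 ^ Fintype.card {i // i ≠ m} + 2 * Fintype.card {i // i ≠ m}) * t p ^ 2)) *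
        ∑ c, zz t m (yy q G R) c ^ 2 * ∏ p, b p (c p) := by
  classical
  set r := Fintype.card {i // i ≠ m} with hr
  let u : ι → ({i // i ≠ m} → Bool) → ℝ := fun p e => ∏ i, if e i then t p else 1
  have hu : ∀ p e, 0 ≤ u p e := fun p e => prod_nonneg fun _ _ => by split_ifs <;> simp [ht]
  let sg : {i // i ≠ m} → {i // i ≠ m} → Bool := fun j i => decide (i = j)
  have hsg : ∀ j j', sg j = sg j' → j = j' := fun j j' h => by simpa [sg] using congrFun h j
  have husg : ∀ p j, u p (sg j) = t p := fun p j => by simp [u, sg]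
  let ρ : ι → ℝ := fun p => t p / (1 + t p) ^ 2
  have hρ0 : ∀ p, 0 ≤ ρ p := fun p => div_nonneg (ht p) (sq_nonneg _)
  have hρ1 : ∀ p, ρ p ≤ t p := fun p => div_le_self (ht p) (by nlinarith [ht p])
  have hρ2 : ∀ p, t p - 2 * t p ^ 2 ≤ ρ p := fun p => by
    have := ht p
    rw [le_div_iff₀ (by positivity)]
    have : 0 ≤ t p ^ 3 := by positivity
    nlinarith [mul_nonneg this (ht p)]
  let g : ι → ({i // i ≠ m} → Bool) → {i // i ≠ m} → ℝ := fun p e j => if e = sg j then ρ p else 0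
  have hg : ∀ p e, ∑ j, g p e j ≤ u p e := fun p e => by
    by_cases h : ∃ j, e = sg j
    · obtain ⟨j, rfl⟩ := h
      rw [Fintype.sum_eq_single j fun i hi => if_neg fun h => hi (hsg _ _ h).symm, husg]
      simp [g, hρ1]
    · rw [sum_eq_zero fun a _ => if_neg fun h' => h ⟨a, h'⟩]; exact hu p e
  let τ : ι → ({i // i ≠ m} → Bool) → Option {i // i ≠ m} → ℝ := fun p e a => a.elim (u p e - ∑ j, g p e j) (g p e)
  let em : (ι → Option {i // i ≠ m}) → (ι → Option κ) := fun c p => (c p).map Subtype.val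
  have hem : ∀ c p, em c p ≠ some m := fun c p h => by
    simp only [em, Option.map_eq_some_iff] at h
    obtain ⟨a, -, ha⟩ := h; exact a.2 ha
  have key := transport u (fun p a => a.elim 1 fun _ => ρ p) τ (fun p => 1 + (4 ^ r + 2 * r) * t p ^ 2)
    (fun e : ι → {i // i ≠ m} → Bool => (if (∏ i, (num q (fun p => e p i) : ℝ)) * Y ≤ R then 1 else 0) * ∏ i, G (fun p => e p i) ^ 2)
    (fun c => if numc q (em c) * Y ≤ R then (∏ i : {i // i ≠ m}, G (row (em c) i)) ^ 2 else 0)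
    (fun p e a => ?_) hu (fun p e => ?_) (fun p a => ?_) (fun e => ?_) (fun c => ?_) (fun e c h => ?_)
  · have e1 : ∑ e : {i // i ≠ m} → ι → Bool, (if (∏ i, (num q (e i) : ℝ)) * Y ≤ R then 1 else 0) * ∏ i, (G (e i) ^ 2 * wt t (e i)) =
        ∑ e : ι → {i // i ≠ m} → Bool, ((if (∏ i, (num q (fun p => e p i) : ℝ)) * Y ≤ R then 1 else 0) * ∏ i, G (fun p => e p i) ^ 2) * ∏ p, u p (e p) := by
      refine Fintype.sum_equiv (Equiv.piComm _) _ _ fun e => ?_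
      simp only [u, Equiv.piComm_apply]
      rw [Finset.prod_comm, mul_assoc, ← prod_mul_distrib]; rfl
    rw [e1]
    refine (mul_le_mul_of_nonneg_left key (sq_nonneg _)).trans ?_
    rw [mul_left_comm]
    refine mul_le_mul_of_nonneg_left ?_ (prod_nonneg fun p _ => by positivity)
    rw [mul_sum]
    have hz := zz_nonneg (y := yy q G R) ht (yy_nonneg hG) m
    have hbn : ∀ c : ι → Option κ, (∀ p, c p ≠ some m) → 0 ≤ ∏ p, b p (c p) := fun c hc => prod_nonneg fun p _ => by
      rcases h : c p with _ | j
      · rw [hb0]; exact zero_le_one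
      · exact (ht p).trans (hb p j fun h' => hc p (by rw [h, h']))
    calc _ ≤ ∑ c, zz t m (yy q G R) (em c) ^ 2 * ∏ p, b p (em c p) := sum_le_sum fun c _ => ?_
      _ = ∑ c ∈ univ.image em, zz t m (yy q G R) c ^ 2 * ∏ p, b p (c p) := by
        rw [sum_image]
        intro c _ d _ h
        funext p
        exact Option.map_injective Subtype.val_injective (congrFun h p)
      _ ≤ _ := sum_le_sum_of_subset_of_nonneg (subset_univ _) fun c _ _ => by
        by_cases h : zz t m (yy q G R) c = 0
        · simp [h]
        · exact mul_nonneg (sq_nonneg _) (hbn c (zz_ex h).1)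
    split_ifs with hR
    · have h1 := zz_lower ht hq hG hm hY m (em c) (hem c) hR
      have h2 : 0 ≤ (∏ i : {i // i ≠ m}, G (row (em c) i)) * ∑ s, G s * wt t s :=
        mul_nonneg (prod_nonneg fun _ _ => hG _) (sum_nonneg fun s _ => mul_nonneg (hG s) (prod_nonneg fun _ _ => by split_ifs <;> simp [ht]))
      calc _ = ((∏ i : {i // i ≠ m}, G (row (em c) i)) * ∑ s, G s * wt t s) ^ 2 * ∏ p, (c p).elim 1 fun _ => ρ p := by ring
        _ ≤ ((∏ p, if em c p = none then 1 else 1 + t p) * zz t m (yy q G R) (em c)) ^ 2 * ∏ p, (c p).elim 1 fun _ => ρ p := by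
            refine mul_le_mul_of_nonneg_right (pow_le_pow_left₀ h2 h1 2) (prod_nonneg fun p _ => ?_)
            rcases c p with _ | j <;> simp [hρ0]
        _ = zz t m (yy q G R) (em c) ^ 2 * ∏ p, ((if em c p = none then 1 else 1 + t p) ^ 2 * (c p).elim 1 fun _ => ρ p) := by
            rw [prod_mul_distrib, prod_pow]; ring
        _ ≤ _ := by
            refine mul_le_mul_of_nonneg_left (prod_le_prod (fun p _ => ?_) fun p _ => ?_) (sq_nonneg _) <;> rcases h : c p with _ | j <;> simp only [em, h, Option.map_none, Option.map_some, Option.elim, if_true, reduceCtorEq, if_false]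
            · norm_num
            · exact mul_nonneg (sq_nonneg _) (hρ0 p)
            · rw [hb0]; norm_num
            · refine le_trans (le_of_eq ?_) (hb p j j.2)
              have := ht p
              simp only [ρ]; field_simp
    · rw [zero_mul, mul_zero]; exact mul_nonneg (sq_nonneg _) (hbn _ (hem c))
  · rcases a with _ | j
    · exact sub_nonneg.2 (hg p e)
    · simp only [τ, g, Option.elim]; split_ifs <;> simp [hρ0]
  · rw [Fintype.sum_option]; simp [τ]
  · rcases a with _ | j
    · simp only [τ, Option.elim, sum_sub_distrib, mul_one]
      rw [sum_comm]
      simp only [g, sum_ite_eq', mem_univ, if_true, sum_const, card_univ, nsmul_eq_mul, ← hr]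
      have h1 : ∑ e, u p e = (1 + t p) ^ r := by
        simp only [u]
        rw [← pse (fun (_ : {i // i ≠ m}) (a : Bool) => if a then t p else 1), prod_const, card_univ, ← hr]
        simp [add_comm]
      rw [h1]
      have h2 := one_add_pow_le (ht p) (ht1 p) r
      have h3 := mul_le_mul_of_nonneg_left (hρ2 p) (Nat.cast_nonneg (α := ℝ) r)
      linarith
    · simp only [τ, Option.elim, g, sum_ite_eq', mem_univ, if_true]
      exact le_mul_of_one_le_left (hρ0 p) (le_add_of_nonneg_right (by positivity))
  · exact mul_nonneg (by split_ifs <;> simp) (prod_nonneg fun _ _ => sq_nonneg _)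
  · split_ifs <;> positivity
  · have h1 : ∀ p j, c p = some j → e p = sg j := fun p j hj => by
      have := h p; simp only [τ, hj, Option.elim, g] at this
      by_contra h'; exact this (if_neg h')
    have hn : numc q (em c) ≤ ∏ i, num q (fun p => e p i) := by
      simp only [num]
      rw [Finset.prod_comm, numc]
      refine prod_le_prod' fun p _ => ?_
      rcases hc : c p with _ | j
      · simp only [em, hc, Option.map_none, if_true]
        exact one_le_prod' fun i _ => by split_ifs <;> simp [hq]
      · simp [em, hc, h1 p j hc, sg]
    by_cases hR : (∏ i, (num q (fun p => e p i) : ℝ)) * Y ≤ R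
    · have hR' : numc q (em c) * Y ≤ R := le_trans (mul_le_mul_of_nonneg_right (by exact_mod_cast hn) hY0) hR
      rw [if_pos hR, if_pos hR', one_mul, ← prod_pow]
      refine prod_le_prod (fun _ _ => sq_nonneg _) fun i _ => pow_le_pow_left₀ (hG _) (hm _ _ fun p hp => ?_) 2
      simp only [row, em, decide_eq_true_eq, Option.map_eq_some_iff] at hp
      obtain ⟨j, hj, hji⟩ := hp
      have : j = i := Subtype.ext hji
      subst this
      simp [h1 p j hj, sg]
    · rw [if_neg hR, zero_mul]; split_ifs <;> positivity
end
end MG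

namespace MG
open Finset Filter Topology

theorem chern {S κ : Type*} [Fintype S] [Fintype κ] [DecidableEq κ] (w G V : S → ℝ) (A T k : ℝ) (hA : 1 ≤ A) (hT : 0 < T) (hk : 32 * A ^ 3 * T ≤ k)
    (hr : Fintype.card κ ≤ k) (hw : ∀ s, 0 ≤ w s) (hV : ∀ s, 0 ≤ V s) (hGV : ∀ s, G s ≠ 0 → V s ≤ T) (hG : ∀ s, A * (G s ^ 2 * V s) = G s - G s ^ 2)
    (hI : ∑ s, G s * w s ≤ (A + 1 / 2) * ∑ s, G s ^ 2 * w s) :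
    (1 - Real.exp (-A)) * (∑ s, G s ^ 2 * w s) ^ Fintype.card κ ≤
      ∑ e : κ → S, (if ∑ i, V (e i) ≤ k - T then 1 else 0) * ∏ i, (G (e i) ^ 2 * w (e i)) := by
  set I := ∑ s, G s ^ 2 * w s with hI'
  set r := Fintype.card κ
  have hI0 : 0 ≤ I := sum_nonneg fun s _ => mul_nonneg (sq_nonneg _) (hw s)
  obtain ⟨v, hv⟩ : ∃ v, v = 1 / (8 * A * T) := ⟨_, rfl⟩
  have hv0 : 0 < v := by rw [hv]; positivity
  have hvT : v * T = 1 / (8 * A) := by rw [hv]; field_simp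
  have hvT1 : v * T ≤ 1 := by rw [hvT, div_le_one (by positivity)]; linarith
  have h1 : ∑ s, G s ^ 2 * w s * Real.exp (v * V s) ≤ I * Real.exp ((v + v * (v * T)) * (1 - 1 / (2 * A))) := by
    calc _ ≤ ∑ s, (G s ^ 2 * w s + (v + v * (v * T)) / A * (G s * w s - G s ^ 2 * w s)) := sum_le_sum fun s _ => by
          by_cases h0 : G s = 0
          · simp [h0]
          have hVT := mul_le_mul_of_nonneg_left (hGV s h0) hv0.le
          have hV0 := mul_nonneg hv0.le (hV s)
          have h2 := (abs_le.1 (Real.abs_exp_sub_one_sub_id_le (abs_le.2 ⟨by linarith, hVT.trans hvT1⟩))).2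
          have h3 : Real.exp (v * V s) ≤ 1 + (v + v * (v * T)) * V s := by nlinarith
          have h4 : (v + v * (v * T)) / A * (G s * w s - G s ^ 2 * w s) = G s ^ 2 * w s * ((v + v * (v * T)) * V s) := by
            rw [← sub_mul, ← hG s]; field_simp
          rw [h4]
          nlinarith [mul_le_mul_of_nonneg_left h3 (mul_nonneg (sq_nonneg (G s)) (hw s))]
      _ = I + (v + v * (v * T)) / A * (∑ s, G s * w s - I) := by rw [sum_add_distrib, ← mul_sum, sum_sub_distrib]
      _ ≤ I + (v + v * (v * T)) / A * ((A + 1 / 2) * I - I) := by gcongr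
      _ = I * ((v + v * (v * T)) * (1 - 1 / (2 * A)) + 1) := by field_simp; ring
      _ ≤ _ := by gcongr; exact Real.add_one_le_exp _
  have h2 : ∀ e : κ → S, (1 : ℝ) - Real.exp (v * (∑ i, V (e i)) - v * (k - T)) ≤ if ∑ i, V (e i) ≤ k - T then 1 else 0 := fun e => by
    split_ifs with h
    · linarith [Real.exp_pos (v * (∑ i, V (e i)) - v * (k - T))]
    · rw [sub_nonpos]; exact Real.one_le_exp (by rw [← mul_sub]; exact mul_nonneg hv0.le (by linarith))
  have h3 : ∑ e : κ → S, (1 - Real.exp (v * (∑ i, V (e i)) - v * (k - T))) * ∏ i, (G (e i) ^ 2 * w (e i)) =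
      I ^ r - Real.exp (-(v * (k - T))) * (∑ s, G s ^ 2 * w s * Real.exp (v * V s)) ^ r := by
    rw [show r = (univ : Finset κ).card from rfl, ← prod_const, ← prod_const, pse (fun (_ : κ) s => G s ^ 2 * w s), pse (fun (_ : κ) s => G s ^ 2 * w s * Real.exp (v * V s)), mul_sum,
      ← sum_sub_distrib]
    refine sum_congr rfl fun e _ => ?_
    rw [prod_mul_distrib (f := fun i => G (e i) ^ 2 * w (e i)), ← Real.exp_sum, sub_eq_add_neg (v * _), Real.exp_add, mul_sum]; ring
  refine le_trans ?_ (sum_le_sum fun e _ => mul_le_mul_of_nonneg_right (h2 e) (prod_nonneg fun i _ => mul_nonneg (sq_nonneg _) (hw _)))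
  rw [h3]
  have h4 : (∑ s, G s ^ 2 * w s * Real.exp (v * V s)) ^ r ≤ (I * Real.exp ((v + v * (v * T)) * (1 - 1 / (2 * A)))) ^ r :=
    pow_le_pow_left₀ (sum_nonneg fun s _ => mul_nonneg (mul_nonneg (sq_nonneg _) (hw s)) (Real.exp_pos _).le) h1 r
  have h5 : -(v * (k - T)) + r * ((v + v * (v * T)) * (1 - 1 / (2 * A))) ≤ -A := by
    have hA2 : 1 / (2 * A) ≤ 1 := by rw [div_le_one (by positivity)]; linarith
    have : (r : ℝ) * ((v + v * (v * T)) * (1 - 1 / (2 * A))) ≤ k * ((v + v * (v * T)) * (1 - 1 / (2 * A))) := by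
      refine mul_le_mul_of_nonneg_right hr (mul_nonneg (by positivity) (by linarith))
    have h6 : k * ((v + v * (v * T)) * (1 - 1 / (2 * A))) - v * k ≤ - (3 / (8 * A)) * (v * k) := by
      have hk0 : 0 ≤ k := le_trans (by positivity) hk
      have : k * ((v + v * (v * T)) * (1 - 1 / (2 * A))) - v * k = (v * k) * (- (3 / (8 * A)) - 1 / (16 * A ^ 2)) := by
        rw [hvT]; field_simp; ring
      rw [this]
      have : 0 ≤ v * k * (1 / (16 * A ^ 2)) := by positivity
      nlinarith
    have h7 : 4 * A ^ 2 ≤ v * k := by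
      calc 4 * A ^ 2 = v * (32 * A ^ 3 * T) := by rw [hv]; field_simp; ring
        _ ≤ _ := by gcongr
    have h8 : 3 / (8 * A) * (4 * A ^ 2) ≤ 3 / (8 * A) * (v * k) := by gcongr
    have h9 : 3 / (8 * A) * (4 * A ^ 2) = 3 / 2 * A := by field_simp; ring
    have h10 : v * T ≤ 1 / 8 := by rw [hvT]; gcongr; linarith
    nlinarith
  have h6 : Real.exp (-(v * (k - T))) * (I * Real.exp ((v + v * (v * T)) * (1 - 1 / (2 * A)))) ^ r ≤ Real.exp (-A) * I ^ r := by
    rw [mul_pow, ← Real.exp_nat_mul, mul_left_comm, ← Real.exp_add, mul_comm]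
    gcongr
  have := mul_le_mul_of_nonneg_left h4 (Real.exp_pos (-(v * (k - T)))).le
  linarith

section
variable {ι κ : Type*} [Fintype ι] [DecidableEq ι] [Fintype κ] [DecidableEq κ] {t : ι → ℝ} {q : ι → ℕ} {G : (ι → Bool) → ℝ} {R Y : ℝ}

noncomputable def er0 (q : ι → ℕ) (t : ι → ℝ) (R : ℝ) (E : (ι → Option κ) → ℝ) : ℝ :=
  ∑ T : ι → Option κ with (numc q T : ℝ) ≤ R ^ 2, E T * ∏ p, (if T p = none then 1 + (Fintype.card κ + 1 : ℝ) ^ 2 * t p else 2 * (Fintype.card κ + 1 : ℝ) ^ 2)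

theorem S1_le (ht : ∀ p, 0 ≤ t p) (ht1 : ∀ p, t p ≤ 1) (hq : ∀ p, 1 ≤ q p) (hG : ∀ s, 0 ≤ G s) (hG1 : ∀ s, G s ≤ 1)
    (hm : ∀ s s' : ι → Bool, (∀ p, s p → s' p) → G s' ≤ G s) (I : Finset ℕ) (s : ℕ → ι → Option κ) (w : ℕ → ℝ) (X : ℝ) (hX : 0 ≤ X) (E : (ι → Option κ) → ℝ)
    (hE : ∀ T : ι → Option κ, (numc q T : ℝ) ≤ R ^ 2 →
      |∑ n ∈ I with ∀ p, T p = none ∨ s n p = T p, w n - X * ∏ p, (T p).elim 1 (fun _ => t p / (1 + t p))| ≤ E T) :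
    ∑ n ∈ I, w n * (∑ c, yy q G R c * ∏ p, ps (t p) (c p) (s n p)) ^ 2 ≤
      X * ((∏ p, (1 + 2 * (Fintype.card κ + 1) ^ 2 * t p ^ 2)) * (∑ s, G s ^ 2 * wt t s) ^ Fintype.card κ) + er0 q t R E := by
  have hp : ∀ p, 0 < 1 + t p := fun p => by linarith [ht p]
  have h1 := (abs_le.1 (sieve_err q hq t ht ht1 I s w (yy q G R) (fun p _ => t p / (1 + t p)) X 1 R E
    (fun c => by rw [abs_of_nonneg (yy_nonneg hG c)]; exact yy_le_one hG hG1 c) (fun c hc => by by_contra h; exact hc (if_neg h)) hE)).2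
  have hss : ∀ p (i : κ), Bm (t p) (fun _ => t p / (1 + t p)) (some i) (some i) = t p := fun p i => by
    rw [Bm_ss]; have := (hp p).ne'; field_simp; ring
  have h2 := (abs_le.1 (QF t (fun p => Bm (t p) (fun _ : κ => t p / (1 + t p))) (fun _ => True) (yy q G R) (yy_nonneg hG) (fun _ _ _ => trivial) trivial
    (yy_mono hq hG hm) (fun p => Bm_nn _ _) (fun p i _ => ?_) (fun p i j _ _ hij => ?_))).2
  · have h3 : ∑ c, yy q G R c ^ 2 * ∏ p, Bm (t p) (fun _ : κ => t p / (1 + t p)) (c p) (c p) ≤ (∑ s, G s ^ 2 * wt t s) ^ Fintype.card κ := by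
      refine le_trans (le_of_eq (sum_congr rfl fun c _ => ?_)) (D1_le (R := R) (q := q) (κ := κ) ht hG)
      congr 1; refine prod_congr rfl fun p _ => ?_
      rcases c p with _ | i
      · simp [Bm_nn]
      · simp [hss]
    have hK : 0 ≤ ∏ p, (1 + 2 * ((Fintype.card κ : ℝ) + 1) ^ 2 * t p ^ 2) := prod_nonneg fun p _ => by positivity
    have h4 := mul_le_mul_of_nonneg_left h3 hK
    have h5 : ∑ c, ∑ c', yy q G R c * yy q G R c' * ∏ p, Bm (t p) (fun _ : κ => t p / (1 + t p)) (c p) (c' p) ≤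
        (∏ p, (1 + 2 * ((Fintype.card κ : ℝ) + 1) ^ 2 * t p ^ 2)) * (∑ s, G s ^ 2 * wt t s) ^ Fintype.card κ := by
      refine le_trans ?_ h4; linarith
    have h6 := mul_le_mul_of_nonneg_left h5 hX
    rw [er0]; rw [one_pow, one_mul] at h1; linarith
  · rcases i with _ | i
    · rw [Bm_nn]; exact zero_le_one
    · rw [hss]; exact ht p
  · have h0 := (hp p).ne'
    have hsn : ∀ i : κ, Bm (t p) (fun _ => t p / (1 + t p)) (some i) none = 0 := fun i => by rw [Bm_sn]; field_simp; ring
    rcases i with _ | i <;> rcases j with _ | j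
    · exact absurd rfl hij
    · rw [Bm_comm, hsn, abs_zero]; positivity
    · rw [hsn, abs_zero]; positivity
    · rw [Bm_ij _ _ (fun h => hij (by rw [h]))]
      have : t p ^ 2 - t p * (1 + t p) * (t p / (1 + t p) + t p / (1 + t p)) = - t p ^ 2 := by field_simp; ring
      rw [this, abs_neg, abs_of_nonneg (sq_nonneg _)]; nlinarith [sq_nonneg (t p)]

theorem S2_ge (ht : ∀ p, 0 ≤ t p) (ht1 : ∀ p, t p ≤ 1 / 2) (hq : ∀ p, 1 ≤ q p) (hG : ∀ s, 0 ≤ G s) (hG1 : ∀ s, G s ≤ 1)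
    (hm : ∀ s s' : ι → Bool, (∀ p, s p → s' p) → G s' ≤ G s) (hY0 : 0 ≤ Y) (hY : ∀ s, G s ≠ 0 → (num q s : ℝ) ≤ Y)
    (I : Finset ℕ) (s : ℕ → ι → Option κ) (w : ℕ → ℝ) (X : ℝ) (hX : 0 ≤ X) (E : (ι → Option κ) → ℝ) (m : κ) (hw : ∀ n ∈ I, w n ≠ 0 → ∀ p, s n p ≠ some m)
    (hK : ∏ p, (1 + 2 * (Fintype.card κ + 1) ^ 2 * t p ^ 2) ≤ 2)
    (hE : ∀ T : ι → Option κ, (numc q T : ℝ) ≤ R ^ 2 →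
      |∑ n ∈ I with ∀ p, T p = none ∨ s n p = T p, w n - X * ∏ p, (T p).elim 1 (fun a => if a = m then 0 else t p)| ≤ E T) :
    X * (2 - ∏ p, (1 + 2 * (Fintype.card κ + 1) ^ 2 * t p ^ 2)) * ((∑ s, G s * wt t s) ^ 2 *
      ∑ e : {i // i ≠ m} → ι → Bool, (if (∏ i, (num q (e i) : ℝ)) * Y ≤ R then 1 else 0) * ∏ i, (G (e i) ^ 2 * wt t (e i))) ≤
    (∏ p, (1 + (4 ^ Fintype.card {i // i ≠ m} + 2 * Fintype.card {i // i ≠ m}) * t p ^ 2)) *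
      (∑ n ∈ I, w n * (∑ c, yy q G R c * ∏ p, ps (t p) (c p) (s n p)) ^ 2 + (∏ p, (1 + t p)) ^ 2 * er0 q t R E) := by
  let ϖ : ι → κ → ℝ := fun p a => if a = m then 0 else t p
  have ht2 : ∀ p, t p ≤ 1 := fun p => (ht1 p).trans (by norm_num)
  have hzz := zz_nonneg (y := yy q G R) ht (yy_nonneg hG) m
  have h1 := (abs_le.1 (sieve_err q hq t ht ht2 I s w (zz t m (yy q G R)) ϖ X (∏ p, (1 + t p)) R E
    (fun c => by rw [abs_of_nonneg (hzz c)]; exact zz_le ht (yy_le_one hG hG1) m c)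
    (fun c hc => by
      obtain ⟨-, a, ha, hac⟩ := zz_ex hc
      refine le_trans (by exact_mod_cast numc_mono hq hac) (?_ : (numc q a : ℝ) ≤ R)
      by_contra h; exact ha (if_neg h)) hE)).1
  have hss : ∀ p (i : κ), i ≠ m → t p ≤ Bm (t p) (ϖ p) (some i) (some i) := fun p i hi => by
    rw [Bm_ss]; simp only [ϖ, if_neg hi]
    nlinarith [mul_nonneg (sq_nonneg (t p)) (sub_nonneg.2 (ht2 p))]
  have h2 := (abs_le.1 (QF t (fun p => Bm (t p) (ϖ p)) (fun i => i ≠ some m) (zz t m (yy q G R)) hzz (fun c h => (zz_ex h).1) (by simp)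
    (zz_mono ht (yy_nonneg hG) (yy_mono hq hG hm) m) (fun p => Bm_nn _ _) (fun p i hi => ?_) (fun p i j hi hj hij => ?_))).1
  · have h3 := D2_ge (R := R) ht ht2 hq hG hm hY0 hY m (fun p i => Bm (t p) (ϖ p) i i) (fun p => Bm_nn _ _) hss
    set D := ∑ c, zz t m (yy q G R) c ^ 2 * ∏ p, Bm (t p) (ϖ p) (c p) (c p)
    set K := ∏ p, (1 + 2 * ((Fintype.card κ : ℝ) + 1) ^ 2 * t p ^ 2)
    have h4 : ∑ n ∈ I, w n * (∑ c, yy q G R c * ∏ p, ps (t p) (c p) (s n p)) ^ 2 =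
        ∑ n ∈ I, w n * (∑ c, zz t m (yy q G R) c * ∏ p, ps (t p) (c p) (s n p)) ^ 2 := sum_congr rfl fun n hn => by
      by_cases h : w n = 0
      · simp [h]
      · rw [zz_nu t m _ _ (hw n hn h)]
    rw [h4]
    have h5 : X * ((2 - K) * D) ≤ X * ∑ c, ∑ c', zz t m (yy q G R) c * zz t m (yy q G R) c' * ∏ p, Bm (t p) (ϖ p) (c p) (c' p) :=
      mul_le_mul_of_nonneg_left (by linarith) hX
    have h6 := mul_le_mul_of_nonneg_left h3 (mul_nonneg hX (sub_nonneg.2 hK))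
    refine h6.trans ?_
    rw [mul_left_comm]
    refine mul_le_mul_of_nonneg_left ?_ (prod_nonneg fun p _ => by positivity)
    rw [er0]; linarith
  · rcases i with _ | i
    · rw [Bm_nn]; exact zero_le_one
    · exact (ht p).trans (hss p i fun h => hi (by rw [h]))
  · have h0 := ht p
    have hsn : ∀ i : κ, i ≠ m → |Bm (t p) (ϖ p) (some i) none| ≤ 2 * t p ^ 2 := fun i hi => by
      rw [Bm_sn]; simp only [ϖ, if_neg hi]; rw [abs_le]; constructor <;> nlinarith
    rcases i with _ | i <;> rcases j with _ | j
    · exact absurd rfl hij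
    · rw [Bm_comm]; exact hsn j fun h => hj (by rw [h])
    · exact hsn i fun h => hi (by rw [h])
    · have h1 : i ≠ m := fun h => hi (by rw [h])
      have h2 : j ≠ m := fun h => hj (by rw [h])
      rw [Bm_ij _ _ (fun h => hij (by rw [h]))]
      simp only [ϖ, if_neg h1, if_neg h2]
      have := mul_nonneg (sq_nonneg (t p)) (sub_nonneg.2 (ht1 p))
      have := mul_nonneg (sq_nonneg (t p)) h0
      rw [abs_le]; constructor <;> nlinarith
end
end MG

namespace MG
open Finset Filter Topology

theorem cop_blk (W J : ℕ) : ((Ioc (J * W) ((J + 1) * W)).filter (W.Coprime)).card = W.totient := by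
  rw [← Nat.filter_coprime_Ico_eq_totient W (J * W + 1)]
  congr 1; ext n; simp only [mem_filter, mem_Ioc, mem_Ico, add_mul, one_mul]; omega

theorem cop_rec (W J : ℕ) (f : ℕ → ℝ) : ∑ n ∈ (Ioc 0 ((J + 1) * W)).filter W.Coprime, f n =
    ∑ n ∈ (Ioc 0 (J * W)).filter W.Coprime, f n + ∑ n ∈ (Ioc (J * W) ((J + 1) * W)).filter W.Coprime, f n := by
  rw [← sum_union]
  · rw [← filter_union, Ioc_union_Ioc_eq_Ioc (Nat.zero_le _) (by gcongr; omega)]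
  · exact disjoint_filter_filter (by
      rw [disjoint_left]; intro a; simp only [mem_Ioc]; omega)

theorem cop_low {W : ℕ} (hW : 0 < W) (J : ℕ) : (W.totient / W : ℝ) * Real.log (J + 1) ≤ ∑ n ∈ (Ioc 0 (J * W)).filter W.Coprime, (1 / n : ℝ) := by
  have hW' : (0 : ℝ) < W := by exact_mod_cast hW
  induction J with
  | zero => simp
  | succ J ih =>
    rw [cop_rec]
    have h1 : W.totient • (1 / ((J + 1) * W) : ℝ) ≤ ∑ n ∈ (Ioc (J * W) ((J + 1) * W)).filter W.Coprime, (1 / n : ℝ) := by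
      rw [← cop_blk W J]
      refine card_nsmul_le_sum _ _ _ fun n hn => ?_
      simp only [mem_filter, mem_Ioc] at hn
      have h2 : (n : ℝ) ≤ (J + 1) * W := by exact_mod_cast hn.1.2
      have h3 : (0 : ℝ) < n := by exact_mod_cast (by omega : 0 < n)
      exact one_div_le_one_div_of_le h3 h2
    have h2 : Real.log ((J + 1 : ℕ) + 1) ≤ Real.log (J + 1) + 1 / (J + 1) := by
      have hJ : (0 : ℝ) < J + 1 := by positivity
      have := Real.log_le_sub_one_of_pos (show (0 : ℝ) < ((J + 1 : ℕ) + 1) / (J + 1) by positivity)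
      rw [Real.log_div (by positivity) hJ.ne'] at this
      have h4 : (((J + 1 : ℕ) : ℝ) + 1) / (J + 1) - 1 = 1 / (J + 1) := by push_cast; field_simp; ring
      linarith
    rw [nsmul_eq_mul] at h1
    have h3 : (W.totient / W : ℝ) * (Real.log (J + 1) + 1 / (J + 1)) = (W.totient / W : ℝ) * Real.log (J + 1) + W.totient * (1 / ((J + 1) * W)) := by
      field_simp
    have := mul_le_mul_of_nonneg_left h2 (show (0 : ℝ) ≤ W.totient / W by positivity)
    linarith

theorem cop_upp {W : ℕ} (hW : 0 < W) (J : ℕ) : ∑ n ∈ (Ioc 0 ((J + 1) * W)).filter W.Coprime, (1 / n : ℝ) ≤ W.totient + (W.totient / W : ℝ) * ∑ a ∈ Ioc 0 J, (1 / a : ℝ) := by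
  have hW' : (0 : ℝ) < W := by exact_mod_cast hW
  induction J with
  | zero =>
    rw [cop_rec]
    have h1 : ∑ n ∈ (Ioc (0 * W) ((0 + 1) * W)).filter W.Coprime, (1 / n : ℝ) ≤ W.totient • (1 : ℝ) := by
      rw [← cop_blk W 0]
      refine sum_le_card_nsmul _ _ _ fun n hn => ?_
      simp only [mem_filter, mem_Ioc] at hn
      exact div_le_one_of_le₀ (by exact_mod_cast (by omega : 1 ≤ n)) (by positivity)
    simpa using h1
  | succ J ih =>
    rw [cop_rec]
    have h1 : ∑ n ∈ (Ioc ((J + 1) * W) ((J + 1 + 1) * W)).filter W.Coprime, (1 / n : ℝ) ≤ W.totient • (1 / ((J + 1) * W) : ℝ) := by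
      rw [← cop_blk W (J + 1)]
      refine sum_le_card_nsmul _ _ _ fun n hn => ?_
      simp only [mem_filter, mem_Ioc] at hn
      exact one_div_le_one_div_of_le (by positivity) (by exact_mod_cast hn.1.1.le)
    rw [sum_Ioc_succ_top (Nat.zero_le _), mul_add]
    rw [nsmul_eq_mul] at h1
    have h3 : (W.totient / W : ℝ) * (1 / (J + 1 : ℕ)) = W.totient * (1 / ((J + 1) * W)) := by push_cast; field_simp
    linarith

theorem cop_both (W : ℕ) (hW : 0 < W) : ∃ C : ℝ, 0 ≤ C ∧ ∀ y : ℕ, 1 ≤ y →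
    (W.totient / W : ℝ) * Real.log y - C ≤ ∑ n ∈ (Ioc 0 y).filter W.Coprime, (1 / n : ℝ) ∧
    ∑ n ∈ (Ioc 0 y).filter W.Coprime, (1 / n : ℝ) ≤ (W.totient / W : ℝ) * Real.log y + C := by
  have hW' : (0 : ℝ) < W := by exact_mod_cast hW
  have hB : (0 : ℝ) ≤ W.totient / W := by positivity
  have hlW := Real.log_natCast_nonneg W
  refine ⟨W.totient + (W.totient / W : ℝ) * (1 + Real.log W), by positivity, fun y hy => ?_⟩
  have hy1 : y < (y / W + 1) * W := by rw [add_mul, one_mul]; have := Nat.div_add_mod y W; have := Nat.mod_lt y hW; nlinarith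
  have hy' : (0 : ℝ) < y := by exact_mod_cast hy
  constructor
  · have h1 : Real.log y ≤ Real.log ((y / W : ℕ) + 1) + Real.log W := by
      rw [← Real.log_mul (by positivity) hW'.ne']
      exact Real.log_le_log hy' (by exact_mod_cast hy1.le)
    have h2 := cop_low hW (y / W)
    have h3 : ∑ n ∈ (Ioc 0 (y / W * W)).filter W.Coprime, (1 / n : ℝ) ≤ ∑ n ∈ (Ioc 0 y).filter W.Coprime, (1 / n : ℝ) :=
      sum_le_sum_of_subset_of_nonneg (filter_subset_filter _ (Ioc_subset_Ioc_right (Nat.div_mul_le_self y W))) fun _ _ _ => by positivity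
    have h4 := mul_le_mul_of_nonneg_left h1 hB
    have : (0 : ℝ) ≤ W.totient := by positivity
    linarith
  · have h2 := cop_upp hW (y / W)
    have h3 : ∑ n ∈ (Ioc 0 y).filter W.Coprime, (1 / n : ℝ) ≤ ∑ n ∈ (Ioc 0 ((y / W + 1) * W)).filter W.Coprime, (1 / n : ℝ) :=
      sum_le_sum_of_subset_of_nonneg (filter_subset_filter _ (Ioc_subset_Ioc_right hy1.le)) fun _ _ _ => by positivity
    have h4 : Real.log (y / W : ℕ) ≤ Real.log y := by
      rcases Nat.eq_zero_or_pos (y / W) with h | h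
      · rw [h]; simpa using Real.log_natCast_nonneg y
      · exact Real.log_le_log (by exact_mod_cast h) (by exact_mod_cast Nat.div_le_self y W)
    have h5 := mul_le_mul_of_nonneg_left ((harm_Ioc (y / W)).trans (add_le_add_right h4 1)) hB
    have := mul_nonneg hB hlW
    linarith

theorem abel_le {d f : ℕ → ℝ} {C : ℝ} {N : ℕ} (hC : 0 ≤ C) (hf : ∀ n, 1 ≤ n → f (n + 1) ≤ f n) (hf0 : ∀ n, 0 ≤ f n)
    (hd : ∀ n, 1 ≤ n → n ≤ N → ∑ a ∈ Ioc 0 n, d a ≤ C) : ∑ a ∈ Ioc 0 N, d a * f a ≤ C * f 1 := by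
  have : ∀ M, 1 ≤ M → M ≤ N → ∑ a ∈ Ioc 0 M, d a * f a ≤ C * f 1 + (∑ a ∈ Ioc 0 M, d a - C) * f M := by
    intro M hM
    induction M, hM using Nat.le_induction with
    | base => intro _; simp; linarith
    | succ M hM ih =>
      intro h
      rw [sum_Ioc_succ_top (Nat.zero_le _), sum_Ioc_succ_top (Nat.zero_le _)]
      nlinarith [ih (by omega), mul_nonneg (sub_nonneg.2 (hd M hM (by omega))) (sub_nonneg.2 (hf M hM))]
  rcases Nat.eq_zero_or_pos N with h | h
  · subst h; simpa using mul_nonneg hC (hf0 1)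
  · nlinarith [this N h le_rfl, mul_nonneg (sub_nonneg.2 (hd N h le_rfl)) (hf0 N)]

noncomputable def dl (n : ℕ) : ℝ := Real.log n - Real.log (n - 1 : ℕ)

theorem sum_dl (N : ℕ) : ∑ n ∈ Ioc 0 N, dl n = Real.log N := by
  induction N with
  | zero => simp
  | succ N ih => rw [sum_Ioc_succ_top (Nat.zero_le _), ih]; simp [dl]

/-- integral comparison -/
theorem dl_sum {f H : ℕ → ℝ} (hf0 : ∀ n, 0 ≤ f n) (hf1 : f 1 ≤ 1) (hf : ∀ n, 1 ≤ n → f (n + 1) ≤ f n) (h1 : H 1 = 0)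
    (hu : ∀ n, 1 ≤ n → f (n + 1) * dl (n + 1) ≤ H (n + 1) - H n) (hl : ∀ n, 1 ≤ n → H (n + 1) - H n ≤ f n * dl (n + 1)) (N : ℕ) (hN : 1 ≤ N) :
    ∑ n ∈ Ioc 0 N, dl n * f n ≤ H N ∧ H (N + 1) - 2 ≤ ∑ n ∈ Ioc 0 N, dl n * f n := by
  have hd : ∀ n : ℕ, 1 ≤ n → 0 ≤ dl (n + 1) ∧ dl (n + 1) ≤ 1 := fun n hn => by
    have hn' : (1 : ℝ) ≤ n := by exact_mod_cast hn
    simp only [dl, Nat.add_sub_cancel]; push_cast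
    rw [← Real.log_div (by positivity) (by positivity)]
    have h2 : ((n : ℝ) + 1) / n = 1 + 1 / n := by field_simp
    rw [h2]
    have h3 : 1 / (n : ℝ) ≤ 1 := div_le_one_of_le₀ hn' (by positivity)
    have h4 : 0 ≤ 1 / (n : ℝ) := by positivity
    exact ⟨Real.log_nonneg (by linarith), (Real.log_le_sub_one_of_pos (by linarith)).trans (by linarith)⟩
  have key : ∑ n ∈ Ioc 0 N, dl n * f n ≤ H N ∧ H N - (f 1 - f N) ≤ ∑ n ∈ Ioc 0 N, dl n * f n := by
    induction N, hN using Nat.le_induction with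
    | base => simp [dl, h1]
    | succ N hN ih =>
      rw [sum_Ioc_succ_top (Nat.zero_le _)]
      have h2 := hl N hN
      have h3 := mul_le_mul_of_nonneg_left (hd N hN).2 (sub_nonneg.2 (hf N hN))
      exact ⟨by linarith [hu N hN], by linarith⟩
  have hfN : f N ≤ 1 := by
    clear key
    induction N, hN using Nat.le_induction with
    | base => exact hf1
    | succ N hN ih => exact (hf N hN).trans ih
  refine ⟨key.1, ?_⟩
  have := hl N hN
  have := mul_le_mul hfN (hd N hN).2 (hd N hN).1 zero_le_one
  linarith [hf0 N]
end MG

namespace MG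
open Finset Filter Topology

abbrev PP (D M : ℕ) := {p // p ∈ (Ioc D M).filter Nat.Prime}
def qq {D M : ℕ} (p : PP D M) : ℕ := p.1
noncomputable def tt {D M : ℕ} (p : PP D M) : ℝ := 1 / ((p.1 : ℝ) - 1)

section
variable {D M : ℕ}
theorem qP (p : PP D M) : (qq p).Prime := (mem_filter.1 p.2).2
theorem qD (p : PP D M) : D < qq p := (mem_Ioc.1 (mem_filter.1 p.2).1).1
theorem qM (p : PP D M) : qq p ≤ M := (mem_Ioc.1 (mem_filter.1 p.2).1).2
theorem q2 (p : PP D M) : (2 : ℝ) ≤ (p.1 : ℝ) := by exact_mod_cast (qP p).two_le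
theorem tt0 (p : PP D M) : 0 ≤ tt p := div_nonneg zero_le_one (by linarith [q2 p])
theorem tt_D (hD : 1 ≤ D) (p : PP D M) : tt p ≤ 1 / D := by
  have : (D : ℝ) + 1 ≤ (p.1 : ℝ) := by exact_mod_cast qD p
  exact one_div_le_one_div_of_le (by exact_mod_cast hD) (by linarith)

theorem qdvd (p p' : PP D M) (h : qq p ∣ qq p') : p = p' := Subtype.ext ((Nat.prime_dvd_prime_iff_eq (qP p) (qP p')).1 h)

theorem num_dvd (s : PP D M → Bool) (p : PP D M) : qq p ∣ num qq s ↔ s p := by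
  constructor
  · intro h
    obtain ⟨p', -, h'⟩ := ((qP p).prime.dvd_finsetProd_iff _).1 h
    split_ifs at h' with hs
    · rwa [qdvd p p' h']
    · exact absurd (Nat.dvd_one.1 h') (qP p).ne_one
  · intro h
    exact (dvd_of_eq (by simp [h])).trans (dvd_prod_of_mem (fun p => if s p then qq p else 1) (mem_univ p))

theorem num_inj (s s' : PP D M → Bool) (h : num qq s = num qq s') : s = s' := by
  funext p; rw [Bool.eq_iff_iff, ← num_dvd, ← num_dvd, h]

theorem num_pos (s : PP D M → Bool) : 0 < num qq s := prod_pos fun p _ => by split_ifs; exacts [(qP p).pos, one_pos]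

theorem cop_W (p : PP D M) : (primorial D).Coprime (qq p) := by
  refine Nat.Coprime.symm ((Nat.Prime.coprime_iff_not_dvd (qP p)).2 fun h => ?_)
  obtain ⟨p', hp', h'⟩ := ((qP p).prime.dvd_finsetProd_iff _).1 h
  simp only [mem_filter, mem_range] at hp'
  have := Nat.le_of_dvd hp'.2.pos h'
  have := qD p; omega

theorem num_cop (s : PP D M → Bool) : (primorial D).Coprime (num qq s) :=
  Nat.Coprime.prod_right fun p _ => by split_ifs; exacts [cop_W p, Nat.coprime_one_right _]

theorem prodK (C : ℝ) (hC : 0 ≤ C) (hD : 1 ≤ D) : ∏ p : PP D M, (1 + C * tt p ^ 2) ≤ Real.exp (2 * C / D) := by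
  calc _ ≤ ∏ p : PP D M, Real.exp (C * tt p ^ 2) := prod_le_prod (fun p _ => by positivity) fun p _ => by
        rw [add_comm]; exact Real.add_one_le_exp _
    _ = Real.exp (C * ∑ p : PP D M, tt p ^ 2) := by rw [← Real.exp_sum, mul_sum]
    _ ≤ _ := by
      rw [mul_comm 2 C, mul_div_assoc]
      gcongr
      have h1 : ∀ M : ℕ, D ≤ M → ∑ n ∈ Ioc D M, (1 / ((n : ℝ) - 1)) ^ 2 ≤ 2 / (D : ℝ) - 2 / (M : ℝ) := by
        intro M hM
        induction M, hM using Nat.le_induction with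
        | base => simp
        | succ M hM ih =>
          rw [sum_Ioc_succ_top hM]
          have hM0 : (1 : ℝ) ≤ M := by exact_mod_cast (by omega : 1 ≤ M)
          have : (1 / (((M + 1 : ℕ) : ℝ) - 1)) ^ 2 ≤ 2 / (M : ℝ) - 2 / (M + 1 : ℕ) := by
            push_cast
            rw [add_sub_cancel_right, div_pow, one_pow, div_sub_div _ _ (by positivity) (by positivity), div_le_div_iff₀ (by positivity) (by positivity)]
            nlinarith [mul_pos (show (0 : ℝ) < M by linarith) (show (0 : ℝ) < M by linarith)]
          linarith
      rcases le_or_gt D M with h | h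
      · calc ∑ p : PP D M, tt p ^ 2 = ∑ n ∈ (Ioc D M).filter Nat.Prime, (1 / ((n : ℝ) - 1)) ^ 2 :=
              sum_coe_sort ((Ioc D M).filter Nat.Prime) (fun n : ℕ => (1 / ((n : ℝ) - 1)) ^ 2)
          _ ≤ ∑ n ∈ Ioc D M, (1 / ((n : ℝ) - 1)) ^ 2 := sum_le_sum_of_subset_of_nonneg (filter_subset _ _) fun _ _ _ => sq_nonneg _
          _ ≤ _ := (h1 M h).trans (sub_le_self _ (by positivity))
      · have : IsEmpty (PP D M) := ⟨fun p => by have := qD p; have := qM p; omega⟩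
        rw [Fintype.sum_empty]; positivity

theorem TW_up (hD : 1 ≤ D) (N : ℕ) : ∑ s : PP D M → Bool, (if num qq s ≤ N then 1 else 0) * wt tt s ≤
    Real.exp (2 / D) * ∑ n ∈ (Ioc 0 N).filter (primorial D).Coprime, (1 / n : ℝ) := by
  have h := transport (fun (p : PP D M) (s : Bool) => if s then tt p else 1) (fun p s => if s then 1 / (p.1 : ℝ) else 1)
    (fun p s s' => if s then (if s' then 1 / (p.1 : ℝ) else tt p ^ 2) else (if s' then 0 else 1)) (fun p => 1 + 1 * tt p ^ 2)
    (fun s => if num qq s ≤ N then 1 else 0) (fun s => if num qq s ≤ N then 1 else 0)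
    (fun p a b => by split_ifs <;> positivity) (fun p a => by have := tt0 p; split_ifs <;> positivity)
    (fun p a => ?_) (fun p b => ?_) (fun _ => by split_ifs <;> norm_num) (fun _ => by split_ifs <;> norm_num) (fun a b hab => ?_)
  · refine h.trans (mul_le_mul ((prodK 1 zero_le_one hD).trans (by rw [mul_one])) ?_ (sum_nonneg fun s _ => mul_nonneg (by split_ifs <;> norm_num) (prod_nonneg fun _ _ => by split_ifs <;> positivity)) (Real.exp_pos _).le)
    have h2 : ∀ s : PP D M → Bool, (if num qq s ≤ N then (1 : ℝ) else 0) * ∏ p, (if s p then 1 / (p.1 : ℝ) else 1) = if num qq s ≤ N then 1 / (num qq s : ℝ) else 0 := fun s => by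
      split_ifs
      · rw [one_mul, num, Nat.cast_prod, one_div, ← prod_inv_distrib]
        refine prod_congr rfl fun p _ => ?_
        split_ifs <;> simp [qq]
      · simp
    rw [sum_congr rfl fun s _ => h2 s, ← sum_filter, ← sum_image (f := fun n : ℕ => (1 / n : ℝ)) (g := num qq) fun s _ s' _ h => num_inj s s' h]
    refine sum_le_sum_of_subset_of_nonneg (fun n hn => ?_) fun _ _ _ => by positivity
    obtain ⟨s, hs, rfl⟩ := mem_image.1 hn
    exact mem_filter.2 ⟨mem_Ioc.2 ⟨num_pos s, (mem_filter.1 hs).2⟩, num_cop s⟩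
  · rw [Fintype.sum_bool]
    have := q2 p
    rcases a <;> simp
    rw [tt, ← one_div, div_pow, div_add_div _ _ (by positivity) (by nlinarith), div_le_div_iff₀ (by linarith) (by nlinarith)]
    nlinarith
  · rw [Fintype.sum_bool]
    have := q2 p
    rcases b <;> simp
    · linarith
    · exact le_mul_of_one_le_left (by positivity) (by nlinarith [sq_nonneg (tt p)])
  · have : num qq b ≤ num qq a := prod_le_prod' fun p _ => by
      have := hab p
      rcases ha : a p <;> rcases hb : b p <;> simp_all [(qP p).one_le]
    split_ifs <;> first | omega | norm_num

theorem TW_lo (N : ℕ) (hN : N ≤ M) : ∑ n ∈ (Ioc 0 N).filter (primorial D).Coprime, (1 / n : ℝ) ≤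
    ∑ s : PP D M → Bool, (if num qq s ≤ N then 1 else 0) * wt tt s := by
  have h := transport (fun (p : PP D M) (a : Fin (N + 1)) => (1 / (p.1 : ℝ)) ^ a.1) (fun p s => if s then tt p else 1)
    (fun p a s => if s = decide (a.1 ≠ 0) then (1 / (p.1 : ℝ)) ^ a.1 else 0) (fun p => 1)
    (fun a => if ∏ p, qq p ^ (a p).1 ≤ N then 1 else 0) (fun s => if num qq s ≤ N then 1 else 0)
    (fun p a b => by split_ifs <;> positivity) (fun p a => by positivity)
    (fun p a => ?_) (fun p b => ?_) (fun _ => by split_ifs <;> norm_num) (fun _ => by split_ifs <;> norm_num) (fun a b hab => ?_)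
  · rw [prod_const_one, one_mul] at h
    refine le_trans ?_ h
    let φ : ℕ → PP D M → Fin (N + 1) := fun n p => Fin.ofNat (N + 1) (n.factorization p.1)
    have hφ : ∀ n ∈ (Ioc 0 N).filter (primorial D).Coprime, ∏ p, qq p ^ (φ n p).1 = n := fun n hn => by
      simp only [mem_filter, mem_Ioc] at hn
      have h1 : ∀ p, (φ n p).1 = n.factorization p.1 := fun p => by
        refine Nat.mod_eq_of_lt ?_
        have := Nat.factorization_lt p.1 (by omega : n ≠ 0); omega
      simp only [h1, qq]
      rw [prod_coe_sort ((Ioc D M).filter Nat.Prime) (fun p => p ^ n.factorization p)]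
      rw [← Finsupp.prod_of_support_subset n.factorization (s := (Ioc D M).filter Nat.Prime) _ (fun p e => p ^ e) (by simp)]
      · exact Nat.prod_factorization_pow_eq_self (by omega)
      · intro p hp
        rw [Nat.support_factorization, Nat.mem_primeFactors] at hp
        have := Nat.le_of_dvd hn.1.1 hp.2.1
        refine mem_filter.2 ⟨mem_Ioc.2 ⟨?_, by omega⟩, hp.1⟩
        by_contra h
        have : p ∣ primorial D := dvd_prod_of_mem (fun p => p) (mem_filter.2 ⟨mem_range.2 (by omega), hp.1⟩)
        exact hp.1.ne_one (Nat.dvd_one.1 (hn.2 ▸ Nat.dvd_gcd this hp.2.1))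
    calc _ = ∑ n ∈ (Ioc 0 N).filter (primorial D).Coprime, (if ∏ p, qq p ^ (φ n p).1 ≤ N then (1 : ℝ) else 0) * ∏ p, (1 / (p.1 : ℝ)) ^ (φ n p).1 :=
          sum_congr rfl fun n hn => by
            rw [hφ n hn, if_pos (mem_Ioc.1 (mem_filter.1 hn).1).2, one_mul]
            conv_lhs => rw [← hφ n hn]
            simp [qq]
      _ = ∑ a ∈ ((Ioc 0 N).filter (primorial D).Coprime).image φ, (if ∏ p, qq p ^ (a p).1 ≤ N then (1 : ℝ) else 0) * ∏ p, (1 / (p.1 : ℝ)) ^ (a p).1 := by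
          rw [sum_image]
          intro n hn n' hn' h
          rw [← hφ n hn, ← hφ n' hn', h]
      _ ≤ _ := sum_le_sum_of_subset_of_nonneg (subset_univ _) fun a _ _ => mul_nonneg (by split_ifs <;> norm_num) (prod_nonneg fun _ _ => by positivity)
  · rw [sum_ite_eq', if_pos (mem_univ _)]
  · have h2 := q2 p
    rw [Fin.sum_univ_succ, one_mul]
    cases b
    · simp
    · simp only [Fin.val_zero, Fin.val_succ, ne_eq, not_true, decide_false, Bool.true_eq_false, if_false, zero_add, Nat.add_eq_zero_iff, one_ne_zero, and_false, not_false_eq_true, decide_true, if_true]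
      rw [Fin.sum_univ_eq_sum_range (fun i => (1 / (p.1 : ℝ)) ^ (i + 1))]
      simp only [pow_succ]
      have h3 : 1 / (p.1 : ℝ) < 1 := by rw [div_lt_one (by linarith)]; linarith
      rw [← sum_mul, geom_sum_eq h3.ne]
      have h4 : 0 ≤ (1 / (p.1 : ℝ)) ^ N := by positivity
      have h5 : ((1 / (p.1 : ℝ)) ^ N - 1) / (1 / (p.1 : ℝ) - 1) * (1 / (p.1 : ℝ)) = (1 - (1 / (p.1 : ℝ)) ^ N) * tt p := by
        have : (p.1 : ℝ) - 1 ≠ 0 := by linarith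
        have : 1 - (p.1 : ℝ) ≠ 0 := by linarith
        rw [tt]; field_simp; ring
      rw [h5]
      exact mul_le_of_le_one_left (tt0 p) (by linarith)
  · have : num qq b ≤ ∏ p, qq p ^ (a p).1 := prod_le_prod' fun p _ => by
      have := hab p
      have h1 := (qP p).one_le
      simp only [ne_eq, ite_eq_right_iff, not_forall] at this
      obtain ⟨h2, -⟩ := this
      rw [h2]
      split_ifs with h3
      · exact Nat.le_self_pow (by simpa using h3) _
      · exact Nat.one_le_pow _ _ h1
    split_ifs <;> first | omega | norm_num

theorem fib (N : ℕ) (f : ℕ → ℝ) : ∑ s : PP D M → Bool, (if num qq s ≤ N then f (num qq s) else 0) * wt tt s =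
    ∑ n ∈ Ioc 0 N, (∑ s : PP D M → Bool with num qq s = n, wt tt s) * f n := by
  simp only [ite_mul, zero_mul]
  rw [← sum_filter, ← sum_fiberwise_of_maps_to (t := Ioc 0 N) (g := num qq) fun s hs => mem_Ioc.2 ⟨num_pos s, (mem_filter.1 hs).2⟩]
  refine sum_congr rfl fun n hn => ?_
  rw [sum_mul, filter_filter]
  refine sum_congr ?_ fun s hs => ?_
  · ext s; simp only [mem_filter, mem_univ, true_and]
    exact ⟨fun h => h.2, fun h => ⟨h ▸ (mem_Ioc.1 hn).2, h⟩⟩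
  · rw [(mem_filter.1 hs).2, mul_comm]
end

theorem oneD (D : ℕ) (hD : 1 ≤ D) : ∃ C : ℝ, 0 ≤ C ∧ ∀ M N : ℕ, 1 ≤ N → N ≤ M → ∀ f : ℕ → ℝ, (∀ n, 1 ≤ n → f (n + 1) ≤ f n) → (∀ n, 0 ≤ f n) → f 1 ≤ 1 →
    ((primorial D).totient / primorial D : ℝ) * ∑ n ∈ Ioc 0 N, dl n * f n - C ≤ ∑ s : PP D M → Bool, (if num qq s ≤ N then f (num qq s) else 0) * wt tt s ∧
    ∑ s : PP D M → Bool, (if num qq s ≤ N then f (num qq s) else 0) * wt tt s ≤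
      Real.exp (2 / D) * ((primorial D).totient / primorial D : ℝ) * ∑ n ∈ Ioc 0 N, dl n * f n + C := by
  obtain ⟨C, hC, h⟩ := cop_both (primorial D) (primorial_pos D)
  refine ⟨Real.exp (2 / D) * C, by positivity, fun M N hN hNM f hf hf0 hf1 => ?_⟩
  have he : 1 ≤ Real.exp (2 / D) := Real.one_le_exp (by positivity)
  set B := ((primorial D).totient / primorial D : ℝ)
  have hS : ∀ n, ∑ a ∈ Ioc 0 n, (∑ s : PP D M → Bool with num qq s = a, wt tt s) = ∑ s : PP D M → Bool, (if num qq s ≤ n then 1 else 0) * wt tt s := fun n => by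
    rw [fib n (fun _ => 1)]; simp
  rw [fib]
  have hC' : C ≤ Real.exp (2 / D) * C := le_mul_of_one_le_left hC he
  have hf1' := mul_le_mul_of_nonneg_left hf1 (hC.trans hC')
  constructor
  · have := abel_le (d := fun n => B * dl n - ∑ s : PP D M → Bool with num qq s = n, wt tt s) (f := f) (N := N) (hC.trans hC') hf hf0 fun n hn hn' => by
      rw [sum_sub_distrib, ← mul_sum, sum_dl, hS]
      have := (h n hn).1; have := TW_lo (D := D) (M := M) n (by omega)
      linarith
    simp only [sub_mul, sum_sub_distrib, mul_assoc, ← mul_sum] at this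
    linarith
  · have := abel_le (d := fun n => (∑ s : PP D M → Bool with num qq s = n, wt tt s) - Real.exp (2 / D) * B * dl n) (f := f) (N := N) (hC.trans hC') hf hf0 fun n hn hn' => by
      rw [sum_sub_distrib, ← mul_sum, sum_dl, hS]
      have := mul_le_mul_of_nonneg_left (h n hn).2 (Real.exp_pos (2 / D)).le; have := TW_up (M := M) hD n
      linarith
    simp only [sub_mul, sum_sub_distrib, mul_assoc, ← mul_sum] at this ⊢
    linarith
end MG

namespace MG
open Finset Filter Topology

noncomputable def NY (A k L : ℝ) : ℕ := ⌊Real.exp ((Real.exp A - 1) / A * L / k)⌋₊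
noncomputable def ff (b : ℝ) (n : ℕ) : ℝ := 1 / (1 + b * Real.log n)
noncomputable def gG {D M : ℕ} (A k L : ℝ) (s : PP D M → Bool) : ℝ := if num qq s ≤ NY A k L then ff (A * k / L) (num qq s) else 0

theorem ff_den {b : ℝ} (hb : 0 < b) (n : ℕ) : 1 ≤ 1 + b * Real.log n := by
  have := mul_nonneg hb.le (Real.log_natCast_nonneg n); linarith

theorem log_succ_le {n : ℕ} (hn : 1 ≤ n) : Real.log n ≤ Real.log (n + 1 : ℕ) :=
  Real.log_le_log (by exact_mod_cast hn) (by push_cast; linarith)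

theorem ff_anti {b : ℝ} (hb : 0 < b) {n : ℕ} (hn : 1 ≤ n) : ff b (n + 1) ≤ ff b n :=
  one_div_le_one_div_of_le (by linarith [ff_den hb n]) (by linarith [mul_le_mul_of_nonneg_left (log_succ_le hn) hb.le])

theorem ff0 {b : ℝ} (hb : 0 < b) (n : ℕ) : 0 ≤ ff b n := div_nonneg zero_le_one (by linarith [ff_den hb n])
theorem ff1 {b : ℝ} (hb : 0 < b) (n : ℕ) : ff b n ≤ 1 := div_le_one_of_le₀ (ff_den hb n) (by linarith [ff_den hb n])

theorem ff_sums {b : ℝ} (hb : 0 < b) (N : ℕ) (hN : 1 ≤ N) :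
    (∑ n ∈ Ioc 0 N, dl n * ff b n ≤ Real.log (1 + b * Real.log N) / b ∧ Real.log (1 + b * Real.log (N + 1 : ℕ)) / b - 2 ≤ ∑ n ∈ Ioc 0 N, dl n * ff b n) ∧
    (∑ n ∈ Ioc 0 N, dl n * ff b n ^ 2 ≤ (1 - 1 / (1 + b * Real.log N)) / b ∧ (1 - 1 / (1 + b * Real.log (N + 1 : ℕ))) / b - 2 ≤ ∑ n ∈ Ioc 0 N, dl n * ff b n ^ 2) := by
  have key : ∀ n : ℕ, 1 ≤ n → ∃ u v : ℝ, 1 ≤ u ∧ u ≤ v ∧ 1 + b * Real.log n = u ∧ 1 + b * Real.log (n + 1 : ℕ) = v ∧ dl (n + 1) = (v - u) / b := fun n hn =>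
    ⟨_, _, ff_den hb n, by linarith [mul_le_mul_of_nonneg_left (log_succ_le hn) hb.le], rfl, rfl, by rw [dl, Nat.add_sub_cancel]; field_simp; ring⟩
  constructor
  · refine dl_sum (f := ff b) (H := fun n => Real.log (1 + b * Real.log n) / b) (ff0 hb) (ff1 hb 1) (fun n hn => ff_anti hb hn) (by simp) (fun n hn => ?_) (fun n hn => ?_) N hN <;>
    obtain ⟨u, v, hu, huv, h1, h2, h3⟩ := key n hn <;> have hv := hu.trans huv <;> simp only [ff, h1, h2, h3]
    · have := Real.one_sub_inv_le_log_of_pos (show 0 < v / u by positivity)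
      rw [Real.log_div (by positivity) (by positivity), inv_div] at this
      rw [← sub_div, ← mul_div_assoc]; gcongr
      refine le_trans (le_of_eq ?_) this
      field_simp
    · have := Real.log_le_sub_one_of_pos (show 0 < v / u by positivity)
      rw [Real.log_div (by positivity) (by positivity)] at this
      rw [← sub_div, ← mul_div_assoc]; gcongr
      refine this.trans (le_of_eq ?_)
      field_simp
  · refine dl_sum (f := fun n => ff b n ^ 2) (H := fun n => (1 - 1 / (1 + b * Real.log n)) / b) (fun n => sq_nonneg _) (pow_le_one₀ (ff0 hb 1) (ff1 hb 1))
      (fun n hn => pow_le_pow_left₀ (ff0 hb _) (ff_anti hb hn) 2) (by simp) (fun n hn => ?_) (fun n hn => ?_) N hN <;>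
    obtain ⟨u, v, hu, huv, h1, h2, h3⟩ := key n hn <;> have hv := hu.trans huv <;> simp only [ff, h1, h2, h3] <;>
    have hu0 : 0 < u := by linarith
    all_goals
      have hv0 : 0 < v := by linarith
      have e : (1 - 1 / v) / b - (1 - 1 / u) / b = 1 / (u * v) * ((v - u) / b) := by field_simp; ring
      rw [e]
      refine mul_le_mul_of_nonneg_right ?_ (div_nonneg (by linarith) hb.le)
      rw [div_pow, one_pow]
      exact one_div_le_one_div_of_le (by positivity) (by nlinarith)

theorem I12_ar {A C C' E η x I1 I2 : ℝ} (hA : 1 ≤ A) (hC : 0 ≤ C) (hC'0 : 0 ≤ C') (hE1 : 1 ≤ E) (hη : E < 1 + η) (hE2 : E ≤ 1 + 1 / (4 * A))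
    (hx1 : 16 * (A * C' + A + C' + C + 1) * A ≤ x) (hx2 : (C + (1 + η) * 2 * C') * A / (1 + η - E) ≤ x) (d1 : x - C' ≤ I1) (d2 : I1 ≤ E * x + C)
    (d3 : (1 - 1 / (8 * A)) * (x / A) - C' ≤ I2) (d4 : I2 ≤ E * (x / A) + C) : 1 ≤ I2 ∧ I1 ≤ (A + 1 / 2) * I2 ∧ A * x * I2 ≤ (1 + η) * I1 ^ 2 := by
  have hA8 : 1 / (8 * A) ≤ 1 / 8 := one_div_le_one_div_of_le (by norm_num) (by linarith)
  have hxA2 : 16 * (A * C' + A + C' + C + 1) ≤ x / A := by rw [le_div_iff₀ (by linarith)]; exact hx1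
  have hAC : 0 ≤ A * C' := by positivity
  have hxe : x = A * (x / A) := by field_simp
  obtain ⟨y, hy⟩ : ∃ y, y = x / A := ⟨_, rfl⟩
  rw [← hy] at d3 d4 hxA2 hxe
  have hy0 : 0 ≤ y := by linarith
  have hx0 : 0 ≤ x := by rw [hxe]; positivity
  have hAy : y ≤ A * y := le_mul_of_one_le_left hy0 hA
  refine ⟨?_, ?_, ?_⟩
  · linarith [mul_le_mul_of_nonneg_right hA8 hy0]
  · have f1 := mul_le_mul_of_nonneg_left d3 (show 0 ≤ A + 1 / 2 by linarith)
    refine le_trans ?_ f1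
    refine d2.trans ?_
    have f2 : (A + 1 / 2) * ((1 - 1 / (8 * A)) * y - C') = A * y + (3 / 8 - 1 / (16 * A)) * y - (A + 1 / 2) * C' := by field_simp; ring
    have f3 : E * x ≤ A * y + 1 / 4 * y := by
      calc E * x ≤ (1 + 1 / (4 * A)) * x := by gcongr
        _ = _ := by rw [hxe]; field_simp
    have f4 : 1 / (16 * A) ≤ 1 / 16 := one_div_le_one_div_of_le (by norm_num) (by linarith)
    rw [f2]; linarith [mul_le_mul_of_nonneg_right f4 hy0]
  · have hxC : C' ≤ x := by rw [hxe]; linarith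
    have f1 : A * x * I2 ≤ A * x * (E * y + C) := mul_le_mul_of_nonneg_left d4 (by positivity)
    have f2 : (x - C') ^ 2 ≤ I1 ^ 2 := pow_le_pow_left₀ (by linarith) d1 2
    have f3 : A * x * (E * y + C) = E * x ^ 2 + A * C * x := by rw [hxe]; ring
    have hη0 : 0 < 1 + η - E := by linarith
    have f4 : (C * A + (1 + η) * 2 * C') ≤ (1 + η - E) * x := by
      rw [div_le_iff₀ hη0] at hx2
      have : 0 ≤ (1 + η) * 2 * C' * (A - 1) := by
        have : 0 ≤ (1 + η) * 2 * C' := mul_nonneg (by linarith) hC'0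
        exact mul_nonneg this (by linarith)
      linarith
    have f5 := mul_le_mul_of_nonneg_right f4 hx0
    have f6 := mul_le_mul_of_nonneg_left f2 (show 0 ≤ 1 + η by linarith)
    nlinarith [mul_nonneg (show 0 ≤ 1 + η by linarith) (sq_nonneg C')]

theorem I12 (D : ℕ) (A k η : ℝ) (hD : 1 ≤ D) (hA : 1 ≤ A) (hAe : 8 * A ≤ Real.exp A) (hk : 0 < k) (hη : Real.exp (2 / D) < 1 + η) (hη1 : η ≤ 1 / (4 * A)) :
    ∀ᶠ L in atTop, 0 < L ∧ ∀ M : ℕ, NY A k L ≤ M → 1 ≤ ∑ s : PP D M → Bool, gG A k L s ^ 2 * wt tt s ∧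
      ∑ s : PP D M → Bool, gG A k L s * wt tt s ≤ (A + 1 / 2) * ∑ s : PP D M → Bool, gG A k L s ^ 2 * wt tt s ∧
      A * ((primorial D).totient / primorial D * (L / k)) * ∑ s : PP D M → Bool, gG A k L s ^ 2 * wt tt s ≤ (1 + η) * (∑ s : PP D M → Bool, gG A k L s * wt tt s) ^ 2 := by
  obtain ⟨C, hC, h⟩ := oneD D hD
  set B := ((primorial D).totient / primorial D : ℝ) with hB'
  have hB : 0 < B := div_pos (by exact_mod_cast Nat.totient_pos.2 (primorial_pos D)) (by exact_mod_cast primorial_pos D)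
  have hx : ∀ z : ℝ, ∀ᶠ L : ℝ in atTop, z ≤ B * (L / k) := fun z => by
    filter_upwards [eventually_ge_atTop (z * k / B)] with L hL
    rw [div_le_iff₀ hB] at hL
    rw [← mul_div_assoc, le_div_iff₀ hk]; linarith
  obtain ⟨E, hE⟩ : ∃ E, E = Real.exp (2 / D) := ⟨_, rfl⟩
  rw [← hE] at hη h
  have hE1 : 1 ≤ E := hE ▸ Real.one_le_exp (by positivity)
  obtain ⟨C', hC'⟩ : ∃ C', C' = C + 2 * B := ⟨_, rfl⟩
  have hC'0 : 0 ≤ C' := by rw [hC']; positivity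
  have hE2 : E ≤ 1 + 1 / (4 * A) := by linarith
  filter_upwards [eventually_gt_atTop (0 : ℝ), hx (16 * (A * C' + A + C' + C + 1) * A), hx ((C + (1 + η) * 2 * C') * A / (1 + η - E))] with L hL hx1 hx2
  refine ⟨hL, fun M hM => ?_⟩
  obtain ⟨x, hxd⟩ : ∃ x, x = B * (L / k) := ⟨_, rfl⟩
  rw [← hxd] at hx1 hx2 ⊢
  set b := A * k / L with hb'
  have hb : 0 < b := by positivity
  have hbx : A * (1 / b) * B = x := by rw [hxd, hb']; field_simp
  have hN1 : 1 ≤ NY A k L := Nat.le_floor (by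
    rw [Nat.cast_one]; refine Real.one_le_exp (div_nonneg (mul_nonneg (div_nonneg ?_ ?_) ?_) ?_) <;> linarith)
  set N := NY A k L with hN
  have hNY : (N : ℝ) ≤ Real.exp ((Real.exp A - 1) / A * L / k) := Nat.floor_le (Real.exp_pos _).le
  have hNY2 : Real.exp ((Real.exp A - 1) / A * L / k) ≤ (N + 1 : ℕ) := by push_cast; exact (Nat.lt_floor_add_one _).le
  have hbe : b * ((Real.exp A - 1) / A * L / k) = Real.exp A - 1 := by rw [hb']; field_simp
  have hu1 : 1 + b * Real.log N ≤ Real.exp A := by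
    have := mul_le_mul_of_nonneg_left ((Real.log_le_iff_le_exp (by exact_mod_cast hN1)).2 hNY) hb.le; linarith
  have hu2 : Real.exp A ≤ 1 + b * Real.log (N + 1 : ℕ) := by
    have := mul_le_mul_of_nonneg_left ((Real.le_log_iff_exp_le (by positivity)).2 hNY2) hb.le; linarith
  have hd := ff_den hb N
  obtain ⟨⟨a1, a2⟩, a3, a4⟩ := ff_sums hb N hN1
  have b1 : Real.log (1 + b * Real.log N) / b ≤ A * (1 / b) := by
    rw [div_eq_mul_one_div]; gcongr; exact (Real.log_le_iff_le_exp (by linarith)).2 hu1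
  have b2 : A * (1 / b) ≤ Real.log (1 + b * Real.log (N + 1 : ℕ)) / b := by
    rw [div_eq_mul_one_div (Real.log _)]; gcongr; exact (Real.le_log_iff_exp_le (lt_of_lt_of_le (Real.exp_pos _) hu2)).2 hu2
  have b3 : (1 - 1 / (1 + b * Real.log N)) / b ≤ 1 / b := by
    gcongr; exact sub_le_self _ (by positivity)
  have b4 : (1 - 1 / (8 * A)) * (1 / b) ≤ (1 - 1 / (1 + b * Real.log (N + 1 : ℕ))) / b := by
    rw [div_eq_mul_one_div (1 - _) b]; gcongr; linarith
  obtain ⟨c1, c2⟩ := h M N hN1 hM (ff b) (fun n hn => ff_anti hb hn) (ff0 hb) (ff1 hb 1)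
  obtain ⟨c3, c4⟩ := h M N hN1 hM (fun n => ff b n ^ 2) (fun n hn => pow_le_pow_left₀ (ff0 hb _) (ff_anti hb hn) 2) (fun n => sq_nonneg _) (pow_le_one₀ (ff0 hb 1) (ff1 hb 1))
  have e2 : ∀ s : PP D M → Bool, gG A k L s ^ 2 = if num qq s ≤ N then ff b (num qq s) ^ 2 else 0 := fun s => by
    rw [gG]; split_ifs <;> simp [hb']
  simp only [← e2] at c3 c4
  change _ ≤ ∑ s : PP D M → Bool, gG A k L s * wt tt s at c1
  change ∑ s : PP D M → Bool, gG A k L s * wt tt s ≤ _ at c2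
  set I1 := ∑ s : PP D M → Bool, gG A k L s * wt tt s
  set I2 := ∑ s : PP D M → Bool, gG A k L s ^ 2 * wt tt s
  have d1 : x - C' ≤ I1 := by
    have := mul_le_mul_of_nonneg_left (b2.trans (sub_le_iff_le_add.1 a2)) hB.le; rw [hC', ← hbx]; linarith
  have d2 : I1 ≤ E * x + C := by
    have := mul_le_mul_of_nonneg_left (a1.trans b1) (show 0 ≤ E * B by positivity); rw [← hbx]; linarith
  have hxA : x / A = B * (1 / b) := by rw [← hbx]; field_simp
  have d3 : (1 - 1 / (8 * A)) * (x / A) - C' ≤ I2 := by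
    have := mul_le_mul_of_nonneg_left (b4.trans (sub_le_iff_le_add.1 a4)) hB.le; rw [hC', hxA]; linarith
  have d4 : I2 ≤ E * (x / A) + C := by
    have := mul_le_mul_of_nonneg_left (a3.trans b3) (show 0 ≤ E * B by positivity); rw [hxA]; linarith
  exact I12_ar hA hC hC'0 hE1 hη hE2 hx1 hx2 d1 d2 d3 d4
end MG

namespace MG
open Finset Filter Topology

theorem dyad (J : ℕ) (hJ : 1 ≤ J) : ∑ p ∈ (Ioc (2 ^ J) (2 ^ (J + 1))).filter Nat.Prime, 1 / ((p : ℝ) - 1) ≤ 4 / J := by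
  set S := (Ioc (2 ^ J) (2 ^ (J + 1))).filter Nat.Prime
  have h1 : (2 ^ J) ^ S.card ≤ 4 ^ (2 ^ (J + 1)) := by
    refine le_trans ?_ (primorial_le_four_pow _)
    calc _ ≤ ∏ p ∈ S, p := by rw [← prod_const]; exact prod_le_prod' fun p hp => (mem_Ioc.1 (mem_filter.1 hp).1).1.le
      _ ≤ _ := prod_le_prod_of_subset_of_one_le' (fun p hp => by
          have := mem_filter.1 hp; have h2 := mem_Ioc.1 this.1
          exact mem_filter.2 ⟨mem_range.2 (by omega), this.2⟩) fun p hp _ => (mem_filter.1 hp).2.one_le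
  rw [← pow_mul, show 4 = 2 ^ 2 by norm_num, ← pow_mul] at h1
  have h2 : J * S.card ≤ 2 * 2 ^ (J + 1) := (Nat.pow_le_pow_iff_right (by norm_num)).1 h1
  have h3 : (J : ℝ) * S.card ≤ 4 * 2 ^ J := by rw [pow_succ] at h2; exact_mod_cast (by linarith : J * S.card ≤ 4 * 2 ^ J)
  have hJ' : (0 : ℝ) < J := by exact_mod_cast hJ
  calc _ ≤ ∑ p ∈ S, 1 / (2 ^ J : ℝ) := sum_le_sum fun p hp => by
        have : (2 : ℝ) ^ J + 1 ≤ p := by exact_mod_cast (mem_Ioc.1 (mem_filter.1 hp).1).1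
        exact one_div_le_one_div_of_le (by positivity) (by linarith)
    _ ≤ _ := by
        rw [sum_const, nsmul_eq_mul, mul_one_div, div_le_div_iff₀ (by positivity) hJ']; linarith

theorem dyad' (J : ℕ) : ∑ p ∈ (Ioc 1 (2 ^ (J + 1))).filter Nat.Prime, 1 / ((p : ℝ) - 1) ≤ 1 + 4 * ∑ a ∈ Ioc 0 J, (1 / a : ℝ) := by
  induction J with
  | zero =>
    have : (Ioc 1 2).filter Nat.Prime = {2} := by decide
    rw [zero_add, pow_one, this, sum_singleton]; norm_num
  | succ J ih =>
    have h2 : 1 ≤ 2 ^ (J + 1) := Nat.one_le_two_pow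
    have h3 : 2 ^ (J + 1) ≤ 2 ^ (J + 1 + 1) := Nat.pow_le_pow_right (by norm_num) (by omega)
    rw [sum_filter, ← sum_Ioc_consecutive _ h2 h3, ← sum_filter, ← sum_filter, sum_Ioc_succ_top (by omega)]
    have := dyad (J + 1) (by omega)
    rw [mul_add, mul_one_div]; linarith

theorem pl (D M : ℕ) (l : ℝ) (hD : 1 ≤ D) (hl : 1 ≤ l) (hM : (M : ℝ) ≤ Real.exp l) : ∑ p : PP D M, tt p ≤ 20 * (1 + Real.log l) := by
  set J := ⌈2 * l⌉₊
  have hJ : (J : ℝ) ≤ 3 * l := by have := Nat.ceil_lt_add_one (show 0 ≤ 2 * l by linarith); linarith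
  have hM2 : M ≤ 2 ^ (J + 1) := by
    have : (M : ℝ) ≤ 2 ^ (J + 1) := hM.trans (by
      rw [← Real.exp_log (show (0 : ℝ) < 2 by norm_num), ← Real.exp_nat_mul]
      refine Real.exp_le_exp.2 ?_
      have h1 := Real.log_two_gt_d9
      have h2 := Nat.le_ceil (2 * l)
      push_cast
      nlinarith)
    exact_mod_cast this
  have h3 := harm_Ioc J
  have hJ0 : (0 : ℝ) < J := by have := Nat.le_ceil (2 * l); linarith
  have h4 : Real.log J ≤ 2 + Real.log l := by
    refine (Real.log_le_log hJ0 hJ).trans ?_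
    rw [Real.log_mul (by norm_num) (by linarith)]
    have := Real.log_le_sub_one_of_pos (show (0 : ℝ) < 3 by norm_num)
    linarith
  have h0 := Real.log_nonneg hl
  calc ∑ p : PP D M, tt p = ∑ n ∈ (Ioc D M).filter Nat.Prime, (1 / ((n : ℝ) - 1)) :=
        sum_coe_sort ((Ioc D M).filter Nat.Prime) (fun n : ℕ => (1 / ((n : ℝ) - 1)))
    _ ≤ ∑ n ∈ (Ioc 1 (2 ^ (J + 1))).filter Nat.Prime, (1 / ((n : ℝ) - 1)) := by
        refine sum_le_sum_of_subset_of_nonneg (filter_subset_filter _ (Ioc_subset_Ioc hD hM2)) fun p hp _ => ?_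
        have : (1 : ℝ) ≤ p := by exact_mod_cast (mem_filter.1 hp).2.one_le
        exact one_div_nonneg.2 (by linarith)
    _ ≤ _ := (dyad' J).trans (by linarith)

theorem plp {C : ℝ} (hC : 0 ≤ C) (D M : ℕ) (l : ℝ) (hD : 1 ≤ D) (hl : 1 ≤ l) (hM : (M : ℝ) ≤ Real.exp l) :
    ∏ p : PP D M, (1 + C * tt p) ≤ Real.exp (20 * C) * l ^ (20 * C) := by
  calc _ ≤ ∏ p : PP D M, Real.exp (C * tt p) := prod_le_prod (fun p _ => by have := tt0 p; positivity) fun p _ => by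
        rw [add_comm]; exact Real.add_one_le_exp _
    _ = Real.exp (C * ∑ p : PP D M, tt p) := by rw [← Real.exp_sum, mul_sum]
    _ ≤ Real.exp (C * (20 * (1 + Real.log l))) := by gcongr; exact pl D M l hD hl hM
    _ = _ := by rw [Real.rpow_def_of_pos (by linarith), ← Real.exp_add]; congr 1; ring

section
variable {κ : Type*} [Fintype κ] [DecidableEq κ] {D M : ℕ}

noncomputable def cc (κ : Type*) [Fintype κ] : ℝ := (Fintype.card κ + 1 : ℝ) ^ 2

theorem tt1 (hD : 1 ≤ D) (p : PP D M) : tt p ≤ 1 := (tt_D hD p).trans (by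
  rw [div_le_one (by positivity)]; exact_mod_cast hD)

theorem qinv (p : PP D M) : 1 / (qq p : ℝ) ≤ tt p := by
  have := q2 p; exact one_div_le_one_div_of_le (by linarith) (by rw [qq]; linarith)

theorem er0_1 (R B : ℝ) (hB : 0 ≤ B) : er0 qq tt R (fun _ : PP D M → Option κ => B) ≤
    B * R ^ 2 * ∏ p : PP D M, (1 + (cc κ + 2 * Fintype.card κ * cc κ) * tt p) := by
  have hc : 0 ≤ cc κ := sq_nonneg _
  rw [er0, sum_filter]
  calc _ ≤ ∑ T : PP D M → Option κ, B * R ^ 2 * ∏ p, (if T p = none then 1 + cc κ * tt p else 2 * cc κ * tt p) := by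
        refine sum_le_sum fun T _ => ?_
        split_ifs with h
        · rw [mul_assoc]
          refine mul_le_mul_of_nonneg_left ?_ hB
          have h1 : 1 ≤ R ^ 2 * ∏ p, (if T p = none then 1 else 1 / (qq p : ℝ)) := by
            refine le_trans ?_ (mul_le_mul_of_nonneg_right h (prod_nonneg fun p _ => by split_ifs <;> positivity))
            rw [numc, Nat.cast_prod, ← prod_mul_distrib, prod_eq_one]
            intro p _
            have := (qP p).pos
            split_ifs <;> field_simp <;> simp
          calc _ ≤ (∏ p, (if T p = none then 1 + cc κ * tt p else 2 * cc κ)) * (R ^ 2 * ∏ p, (if T p = none then 1 else 1 / (qq p : ℝ))) :=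
                le_mul_of_one_le_right (prod_nonneg fun p _ => by have := tt0 p; split_ifs <;> positivity) h1
            _ ≤ _ := by
                rw [mul_left_comm, ← prod_mul_distrib]
                refine mul_le_mul_of_nonneg_left (prod_le_prod (fun p _ => by have := tt0 p; split_ifs <;> positivity) fun p _ => ?_) (sq_nonneg _)
                split_ifs
                · simp
                · exact mul_le_mul_of_nonneg_left (qinv p) (by positivity)
        · exact mul_nonneg (by positivity) (prod_nonneg fun p _ => by have := tt0 p; split_ifs <;> positivity)
    _ = _ := by
        rw [← mul_sum, ← pse (fun (p : PP D M) (a : Option κ) => if a = none then 1 + cc κ * tt p else 2 * cc κ * tt p)]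
        congr 1
        refine prod_congr rfl fun p _ => ?_
        rw [Fintype.sum_option]; simp; ring

theorem er0_2 {R θ Z S : ℝ} {Q W : ℕ} (hW : 0 < W) (hD : 1 ≤ D) (hθ : 0 < θ) (hZ : 0 ≤ Z) (F : ℕ → ℝ) (E : (PP D M → Option κ) → ℝ)
    (hF : ∀ q ∈ Ioc 0 Q, 0 ≤ F q) (hQ : W * R ^ 2 ≤ Q) (hS : ∑ q ∈ Ioc 0 Q, F q ≤ S)
    (hE1 : ∀ T, (numc qq T : ℝ) ≤ R ^ 2 → E T ≤ F (W * numc qq T))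
    (hE2 : ∀ T, (numc qq T : ℝ) ≤ R ^ 2 → E T ≤ Z * ∏ p, (if T p = none then 1 else tt p)) :
    er0 qq tt R E ≤ θ * S + θ⁻¹ * Z * ∏ p : PP D M, (1 + (2 * cc κ + cc κ ^ 2 + 4 * cc κ ^ 2 * (Fintype.card κ : ℝ) ^ 2) * tt p) := by
  have hc : 0 ≤ cc κ := sq_nonneg _
  set k : ℝ := (Fintype.card κ : ℝ)
  have hk : 0 ≤ k := Nat.cast_nonneg _
  have hmem : ∀ x : ℕ, 0 < x → (x : ℝ) ≤ R ^ 2 → W * x ∈ Ioc 0 Q := fun x hx h => mem_Ioc.2 ⟨Nat.mul_pos hW hx, by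
    have : ((W * x : ℕ) : ℝ) ≤ Q := by push_cast; exact (mul_le_mul_of_nonneg_left h (by positivity)).trans hQ
    exact_mod_cast this⟩
  have hpos : ∀ T : PP D M → Option κ, 0 < numc qq T := fun T => prod_pos fun p _ => by split_ifs; exacts [one_pos, (qP p).pos]
  calc _ ≤ ∑ T : PP D M → Option κ, (θ * ((if (numc qq T : ℝ) ≤ R ^ 2 then F (W * numc qq T) else 0) * ∏ p, (if T p = none then 1 else 1 / k)) +
        θ⁻¹ * Z * ∏ p, (if T p = none then 1 + (2 * cc κ + cc κ ^ 2) * tt p else 4 * cc κ ^ 2 * k * tt p)) := by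
        rw [er0, sum_filter]
        refine sum_le_sum fun T _ => ?_
        have hn1 : (0 : ℝ) ≤ ∏ p, (if T p = none then 1 else 1 / k) := prod_nonneg fun p _ => by split_ifs <;> positivity
        have hn2 : (0 : ℝ) ≤ θ⁻¹ * Z * ∏ p, (if T p = none then 1 + (2 * cc κ + cc κ ^ 2) * tt p else 4 * cc κ ^ 2 * k * tt p) :=
          mul_nonneg (by positivity) (prod_nonneg fun p _ => by have := tt0 p; split_ifs <;> positivity)
        split_ifs with h
        · change E T * ∏ p, (if T p = none then 1 + cc κ * tt p else 2 * cc κ) ≤ _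
          set c := ∏ p, (if T p = none then 1 + cc κ * tt p else 2 * cc κ)
          have hc0 : 0 ≤ c := prod_nonneg fun p _ => by have := tt0 p; split_ifs <;> positivity
          rcases le_or_gt c (θ * ∏ p, (if T p = none then 1 else 1 / k)) with h1 | h1
          · have := mul_le_mul (hE1 T h) h1 hc0 (hF _ (hmem _ (hpos T) h))
            linarith
          · have hF0 := hF _ (hmem _ (hpos T) h)
            have : E T * c ≤ (Z * ∏ p, (if T p = none then 1 else tt p)) * (θ⁻¹ * c ^ 2 * ∏ p, (if T p = none then 1 else k)) := by
              refine mul_le_mul (hE2 T h) ?_ hc0 (mul_nonneg hZ (prod_nonneg fun p _ => by have := tt0 p; split_ifs <;> positivity))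
              have h3 : (∏ p, (if T p = none then 1 else 1 / k)) * ∏ p, (if T p = none then 1 else k) = 1 := by
                rw [← prod_mul_distrib, prod_eq_one]
                intro p _
                rcases hT : T p with _ | i
                · simp
                · have : k ≠ 0 := by have := Fintype.card_pos_iff.2 ⟨i⟩; positivity
                  simp [this]
              have h4 : 0 ≤ ∏ p, (if T p = none then 1 else k) := prod_nonneg fun p _ => by split_ifs <;> positivity
              have h5 : 1 ≤ θ⁻¹ * (c * ∏ p, (if T p = none then 1 else k)) := by
                rw [inv_mul_eq_div, one_le_div hθ]
                have := mul_le_mul_of_nonneg_right h1.le h4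
                rwa [mul_assoc, h3, mul_one] at this
              calc c = c * 1 := by ring
                _ ≤ c * (θ⁻¹ * (c * ∏ p, (if T p = none then 1 else k))) := mul_le_mul_of_nonneg_left h5 hc0
                _ = _ := by ring
            refine this.trans (le_trans ?_ (le_add_of_nonneg_left (mul_nonneg hθ.le (mul_nonneg hF0 hn1))))
            calc _ = θ⁻¹ * Z * ∏ p, ((if T p = none then 1 else tt p) * (if T p = none then 1 + cc κ * tt p else 2 * cc κ) ^ 2 * (if T p = none then 1 else k)) := by
                  rw [prod_mul_distrib, prod_mul_distrib, prod_pow]; ring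
              _ ≤ _ := by
                  refine mul_le_mul_of_nonneg_left (prod_le_prod (fun p _ => by have := tt0 p; split_ifs <;> positivity) fun p _ => ?_) (by positivity)
                  have h0 := tt0 p
                  have h1 := tt1 hD p
                  split_ifs
                  · nlinarith [mul_nonneg (sq_nonneg (cc κ)) (mul_nonneg h0 (sub_nonneg.2 h1))]
                  · apply le_of_eq; ring
        · simpa using hn2
    _ ≤ _ := by
        rw [sum_add_distrib, ← mul_sum, ← mul_sum]
        refine add_le_add (mul_le_mul_of_nonneg_left ?_ hθ.le) (mul_le_mul_of_nonneg_left (le_of_eq ?_) (by positivity))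
        · have h := transport (fun (p : PP D M) (a : Option κ) => if a = none then 1 else 1 / k) (fun _ (_ : Bool) => 1)
            (fun p a b => if b = decide (a ≠ none) then (if a = none then 1 else 1 / k) else 0) (fun _ => 1)
            (fun T => if (numc qq T : ℝ) ≤ R ^ 2 then F (W * numc qq T) else 0) (fun s => if (num qq s : ℝ) ≤ R ^ 2 then F (W * num qq s) else 0)
            (fun p a b => by split_ifs <;> positivity) (fun p a => by split_ifs <;> positivity)
            (fun p a => by rw [sum_ite_eq', if_pos (mem_univ _)]) (fun p b => ?_)
            (fun T => by split_ifs with h; exacts [hF _ (hmem _ (hpos T) h), le_rfl])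
            (fun s => by split_ifs with h; exacts [hF _ (hmem _ (num_pos s) h), le_rfl]) (fun a b hab => ?_)
          · refine h.trans (le_trans ?_ hS)
            simp only [prod_const_one, one_mul, mul_one]
            rw [← sum_filter, ← sum_image (f := F) (g := fun s => W * num qq s) fun s _ s' _ h => num_inj s s' (Nat.eq_of_mul_eq_mul_left hW h)]
            refine sum_le_sum_of_subset_of_nonneg (fun x hx => ?_) fun q hq _ => hF q hq
            obtain ⟨s, hs, rfl⟩ := mem_image.1 hx
            exact hmem _ (num_pos s) (mem_filter.1 hs).2
          · rw [Fintype.sum_option]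
            cases b
            · simp
            · simp; exact mul_inv_le_one
          · have : numc qq a = num qq b := prod_congr rfl fun p _ => by
              have := hab p
              rcases ha : a p <;> rcases hb : b p <;> simp_all
            rw [this]
        · rw [← pse (fun (p : PP D M) (a : Option κ) => if a = none then 1 + (2 * cc κ + cc κ ^ 2) * tt p else 4 * cc κ ^ 2 * k * tt p)]
          refine prod_congr rfl fun p _ => ?_
          rw [Fintype.sum_option]; simp; ring
end
end MG

namespace MG
open Finset Filter Topology

theorem ap_gw (l : ℝ) (N q a : ℕ) (hq : 0 < q) : |∑ n ∈ Ioc 0 N with n ≡ a [MOD q], gw l n - (∑ n ∈ Ioc 0 N, gw l n) / q| ≤ 2 + Real.log N := by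
  have hq' : (0 : ℝ) < q := by exact_mod_cast hq
  have hBS : BS (fun n => (((if n ≡ a [MOD q] then 1 else 0) - 1 / q : ℝ) : ℂ)) 1 := by
    refine ⟨fun n => ?_, fun K => ?_, le_rfl⟩
    · rw [Complex.norm_real, Real.norm_eq_abs, abs_le]
      have h1 : 1 / (q : ℝ) ≤ 1 := (div_le_one hq').2 (by exact_mod_cast hq)
      have h2 : 0 ≤ 1 / (q : ℝ) := by positivity
      split_ifs <;> constructor <;> linarith
    rw [SS, ← Complex.ofReal_sum, range_eq_Ico, sum_Ico_add' (fun n : ℕ => ((if n ≡ a [MOD q] then 1 else 0) - 1 / q : ℝ)) 0 K 1, zero_add, show Ico 1 (K + 1) = Ioc 0 K from by ext; simp; omega, Complex.norm_real, Real.norm_eq_abs, sum_sub_distrib, sum_boole, sum_const, nsmul_eq_mul, Nat.card_Ioc, Nat.sub_zero]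
    have h := Nat.Ioc_filter_modEq_card 0 K hq a
    rw [max_eq_left (sub_nonneg.2 (Int.floor_le_floor (by gcongr; positivity)))] at h
    have h' : (((Ioc 0 K).filter (fun n => n ≡ a [MOD q])).card : ℚ) = ⌊((K : ℚ) - a) / q⌋ - ⌊(((0 : ℕ) : ℚ) - a) / q⌋ := by exact_mod_cast h
    have h1 := Int.floor_le (((K : ℚ) - a) / q)
    have h2 := Int.lt_floor_add_one (((K : ℚ) - a) / q)
    have h3 := Int.floor_le ((((0 : ℕ) : ℚ) - a) / q)
    have h4 := Int.lt_floor_add_one ((((0 : ℕ) : ℚ) - a) / q)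
    have h5 : ((K : ℚ) - a) / q - (((0 : ℕ) : ℚ) - a) / q = K * (1 / q) := by push_cast; ring
    have h6 : |(((Ioc 0 K).filter (fun n => n ≡ a [MOD q])).card : ℚ) - K * (1 / q)| ≤ 1 := by
      rw [h', abs_le]; constructor <;> linarith
    have h7 := (Rat.cast_le (K := ℝ)).2 h6
    push_cast at h7 ⊢
    exact h7
  have := tv hBS (fun n => gw l n) N zero_le_one zero_le_one (fun _ => by rw [abs_of_nonneg (gw_nonneg _ _)]; exact gw_le_one _ _)
    (fun k hk _ => by have := gw_step l (d := 1) le_rfl hk; rwa [one_mul, one_mul] at this)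
  rw [sum_congr rfl fun k _ => (Complex.ofReal_mul _ _).symm, ← Complex.ofReal_sum, Complex.norm_real, Real.norm_eq_abs] at this
  refine le_trans (le_of_eq ?_) (this.trans (by push_cast; linarith))
  congr 1
  rw [sum_filter, sum_div, ← sum_sub_distrib]
  refine sum_congr rfl fun n _ => ?_
  split_ifs <;> ring

section
variable {κ : Type*} [Fintype κ] [DecidableEq κ] {D M : ℕ} {h : κ → ℕ}

open Classical in
noncomputable def sc (h : κ → ℕ) (n : ℕ) (p : PP D M) : Option κ := if H : ∃ i, qq p ∣ n + h i then some H.choose else none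

theorem sc_iff (hi : Function.Injective h) (hD : ∀ i, h i ≤ D) (n : ℕ) (p : PP D M) (i : κ) : sc h n p = some i ↔ qq p ∣ n + h i := by
  rw [sc]
  constructor
  · intro H
    split_ifs at H with H'
    cases H; exact H'.choose_spec
  · intro H
    have H' : ∃ i, qq p ∣ n + h i := ⟨i, H⟩
    rw [dif_pos H']
    congr 1
    apply hi
    have h1 := H'.choose_spec
    have h2 : (qq p : ℤ) ∣ (h (H'.choose) : ℤ) - h i := by
      have := dvd_sub (Int.natCast_dvd_natCast.2 h1) (Int.natCast_dvd_natCast.2 H)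
      push_cast at this; simpa using this
    have := Int.eq_zero_of_abs_lt_dvd h2 (by
      have := hD (H'.choose); have := hD i; have := qD p
      rw [abs_lt]; constructor <;> omega)
    omega

theorem numc_num (T : PP D M → Option κ) : numc qq T = num qq (fun p => decide (T p ≠ none)) := prod_congr rfl fun p _ => by
  rcases hT : T p <;> simp [hT]

theorem cop_if (T : PP D M → Option κ) : Pairwise (Function.onFun Nat.Coprime fun p => if T p = none then 1 else qq p) := fun p p' hp => by
  simp only [Function.onFun]
  split_ifs
  iterate 3 simp
  exact (Nat.coprime_primes (qP p) (qP p')).2 fun e => hp (Subtype.ext e)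

theorem tot_num (T : PP D M → Option κ) : 1 / ((primorial D * numc qq T).totient : ℝ) = 1 / (primorial D).totient * ∏ p, (if T p = none then 1 else tt p) := by
  have h1 : ∀ S : Finset (PP D M), 1 / ((∏ p ∈ S, if T p = none then 1 else qq p : ℕ).totient : ℝ) = ∏ p ∈ S, (if T p = none then 1 else tt p) := fun S => by
    induction S using Finset.induction_on with
    | empty => simp
    | insert p S hp ih =>
      rw [prod_insert hp, prod_insert hp, Nat.totient_mul, ← ih]
      · push_cast
        rw [← one_div_mul_one_div]
        congr 1
        split_ifs
        · simp
        · rw [Nat.totient_prime (qP p), Nat.cast_sub (qP p).one_le]; simp [tt, qq]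
      · exact Nat.Coprime.prod_right fun p' hp' => cop_if T fun e => hp (e ▸ hp')
  rw [Nat.totient_mul (by rw [numc_num]; exact num_cop _), ← h1]
  push_cast; rw [← one_div_mul_one_div]; rfl

theorem crt (hi : Function.Injective h) (hD : ∀ i, h i ≤ D) (v : ℕ) (T : PP D M → Option κ) :
    ∃ a, ∀ n, (n ≡ v [MOD primorial D] ∧ ∀ p, T p = none ∨ sc h n p = T p) ↔ n ≡ a [MOD primorial D * numc qq T] := by
  have hco : (primorial D).Coprime (numc qq T) := by rw [numc_num]; exact num_cop _
  obtain ⟨a0, ha0⟩ := Nat.chineseRemainderOfFinset (fun p : PP D M => (qq p - 1) * (T p).elim 0 h) (fun p => if T p = none then 1 else qq p) univ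
    (fun p _ => by split_ifs; exacts [one_ne_zero, (qP p).ne_zero]) (fun p _ p' _ hp => cop_if T hp)
  obtain ⟨a, ha, ha'⟩ := Nat.chineseRemainder hco v a0
  refine ⟨a, fun n => ?_⟩
  rw [← Nat.modEq_and_modEq_iff_modEq_mul hco]
  refine and_congr ⟨fun H => H.trans ha.symm, fun H => H.trans ha⟩ ?_
  have h1 : n ≡ a [MOD numc qq T] ↔ ∀ p, n ≡ a0 [MOD if T p = none then 1 else qq p] := by
    constructor
    · intro H p
      exact (H.trans ha').of_dvd (dvd_prod_of_mem (fun p => if T p = none then 1 else qq p) (mem_univ p))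
    · intro H
      refine Nat.ModEq.trans ?_ ha'.symm
      rw [Nat.modEq_iff_dvd, numc, Nat.cast_prod]
      exact prod_dvd_of_coprime (fun p _ p' _ hp => Nat.isCoprime_iff_coprime.2 (cop_if T hp)) fun p _ => Nat.modEq_iff_dvd.1 (H p)
  rw [h1]
  refine forall_congr' fun p => ?_
  have h2 := ha0 p (mem_univ p)
  rcases hT : T p with _ | i
  · simp [Nat.modEq_one]
  · simp only [hT, reduceCtorEq, if_false, false_or, Option.elim] at h2 ⊢
    rw [sc_iff hi hD, ← Nat.modEq_zero_iff_dvd]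
    have h3 : (qq p - 1) * h i + h i ≡ 0 [MOD qq p] := by
      rw [Nat.modEq_zero_iff_dvd]
      refine ⟨h i, ?_⟩
      have := (qP p).pos
      obtain ⟨x, hx⟩ : ∃ x, qq p = x + 1 := ⟨qq p - 1, by omega⟩
      rw [hx]; simp; ring
    constructor
    · intro H
      exact (Nat.ModEq.add_right_cancel' (h i) (H.trans h3.symm)).trans h2.symm
    · intro H
      exact ((H.trans h2).add_right _).trans h3

theorem crt_cop (hi : Function.Injective h) (hD : ∀ i, h i ≤ D) {v a : ℕ} {T : PP D M → Option κ} {m : κ} (hv : (v + h m).Coprime (primorial D))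
    (hT : ∀ p, T p ≠ some m) (ha : a ≡ v [MOD primorial D] ∧ ∀ p, T p = none ∨ sc h a p = T p) : (a + h m).Coprime (primorial D * numc qq T) := by
  refine Nat.Coprime.mul_right ?_ (Nat.Coprime.prod_right fun p _ => ?_)
  · have := (ha.1.add_right (h m)).gcd_eq
    rw [Nat.Coprime, this]; exact hv
  · split_ifs with H
    · exact Nat.coprime_one_right _
    · refine ((Nat.Prime.coprime_iff_not_dvd (qP p)).2 fun H' => ?_).symm
      rw [← sc_iff hi hD] at H'
      rcases ha.2 p with h1 | h1
      · exact H h1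
      · exact hT p (h1 ▸ H')
end
end MG

namespace MG
open Finset Filter Topology

theorem gw_div (l : ℝ) {n : ℕ} (hn : 0 < n) : gw l n ≤ 2 * Real.exp l * (1 / n) := by
  have hn' : (0 : ℝ) < n := by exact_mod_cast hn
  rw [mul_one_div, le_div_iff₀ hn', gw]
  have h2 : Real.exp (1 / 2) ≤ 2 := by
    have : Real.exp (1 / 2) ^ 2 = Real.exp 1 := by rw [← Real.exp_nat_mul]; norm_num
    nlinarith [Real.exp_one_lt_d9, Real.exp_pos (1 / 2)]
  conv_lhs => rhs; rw [← Real.exp_log hn']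
  rw [← Real.exp_add]
  calc _ ≤ Real.exp (1 / 2 + l) := Real.exp_le_exp.2 (by nlinarith [sq_nonneg (Real.log n - l - 1)])
    _ ≤ _ := by rw [Real.exp_add]; gcongr

theorem th0 (l : ℝ) (n : ℕ) : 0 ≤ th l n := by
  rw [th]; split_ifs
  exacts [mul_nonneg (Real.log_natCast_nonneg n) (gw_nonneg _ _), le_rfl]

theorem ap_inv {N0 N q : ℕ} (a : ℕ) (hq : 0 < q) (hN : q ≤ N0) : ∑ n ∈ Ioc N0 N with n ≡ a [MOD q], (1 / n : ℝ) ≤ 1 / q * (1 + Real.log N) := by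
  calc _ ≤ ∑ n ∈ Ioc N0 N with n ≡ a [MOD q], 1 / (q : ℝ) * (1 / (n / q : ℕ) : ℝ) := sum_le_sum fun n hn => by
        have h1 := mem_Ioc.1 (mem_filter.1 hn).1
        have h2 : 0 < n / q := Nat.div_pos (by omega) hq
        rw [one_div_mul_one_div]
        refine one_div_le_one_div_of_le (by positivity) ?_
        exact_mod_cast Nat.mul_div_le n q
    _ ≤ _ := by
        rw [← mul_sum, ← sum_image (f := fun b : ℕ => (1 / b : ℝ)) (g := fun n => n / q)]
        · refine mul_le_mul_of_nonneg_left (le_trans (sum_le_sum_of_subset_of_nonneg ?_ fun _ _ _ => by positivity) (harm_Ioc N)) (by positivity)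
          intro b hb
          obtain ⟨n, hn, rfl⟩ := mem_image.1 hb
          have h1 := mem_Ioc.1 (mem_filter.1 hn).1
          exact mem_Ioc.2 ⟨Nat.div_pos (by omega) hq, (Nat.div_le_self _ _).trans h1.2⟩
        · intro n hn n' hn' he
          have h1 : n % q = n' % q := (mem_filter.1 hn).2.trans (mem_filter.1 hn').2.symm
          rw [← Nat.div_add_mod n q, ← Nat.div_add_mod n' q, h1, show n / q = n' / q from he]

theorem triv (l : ℝ) {N0 N q : ℕ} (a : ℕ) (hq : 0 < q) (hN : q ≤ N0) :
    ∑ n ∈ Ioc N0 N with n ≡ a [MOD q], th l n ≤ (2 * Real.exp l * (1 + Real.log N) ^ 2) / q.totient := by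
  have hL := Real.log_natCast_nonneg N
  calc _ ≤ ∑ n ∈ Ioc N0 N with n ≡ a [MOD q], Real.log N * (2 * Real.exp l) * (1 / n : ℝ) := sum_le_sum fun n hn => by
        have h1 := mem_Ioc.1 (mem_filter.1 hn).1
        have hn' : (0 : ℝ) < n := by exact_mod_cast (by omega : 0 < n)
        rw [th]; split_ifs
        · rw [mul_assoc]
          refine mul_le_mul (Real.log_le_log hn' (by exact_mod_cast h1.2)) (gw_div l (by omega)) (gw_nonneg _ _) hL
        · positivity
    _ ≤ Real.log N * (2 * Real.exp l) * (1 / q.totient * (1 + Real.log N)) := by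
        rw [← mul_sum]
        refine mul_le_mul_of_nonneg_left ((ap_inv a hq hN).trans (mul_le_mul_of_nonneg_right (one_div_le_one_div_of_le ?_ ?_) (by linarith))) (by positivity)
        · exact_mod_cast Nat.totient_pos.2 hq
        · exact_mod_cast Nat.totient_le q
    _ ≤ _ := by
        rw [div_eq_mul_one_div (2 * Real.exp l * _)]
        have : 0 ≤ Real.exp l * (1 + Real.log N) * (1 / (q.totient : ℝ)) := by positivity
        nlinarith

section
variable {κ : Type*} [Fintype κ] [DecidableEq κ] {D M : ℕ} {h : κ → ℕ} {G : (PP D M → Bool) → ℝ} {R Y l : ℝ} {N v : ℕ}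

noncomputable def nu (h : κ → ℕ) (G : (PP D M → Bool) → ℝ) (R : ℝ) (n : ℕ) : ℝ := (∑ c, yy qq G R c * ∏ p, ps (tt p) (c p) (sc h n p)) ^ 2

theorem S1' (hD1 : 1 ≤ D) (hi : Function.Injective h) (hD : ∀ i, h i ≤ D) (hG : ∀ s, 0 ≤ G s) (hG1 : ∀ s, G s ≤ 1)
    (hm : ∀ s s' : PP D M → Bool, (∀ p, s p → s' p) → G s' ≤ G s) :
    ∑ n ∈ Ioc 0 N with n ≡ v [MOD primorial D], gw l n * nu h G R n ≤
      (∑ n ∈ Ioc 0 N, gw l n) / primorial D * ((∏ p : PP D M, (1 + 2 * cc κ * tt p ^ 2)) * (∑ s, G s ^ 2 * wt tt s) ^ Fintype.card κ) +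
      (2 + Real.log N) * R ^ 2 * ∏ p : PP D M, (1 + (cc κ + 2 * Fintype.card κ * cc κ) * tt p) := by
  have hL := Real.log_natCast_nonneg N
  refine (S1_le tt0 (tt1 hD1) (fun p => (qP p).one_le) hG hG1 hm _ (sc h) (fun n => gw l n) ((∑ n ∈ Ioc 0 N, gw l n) / primorial D)
    (div_nonneg (sum_nonneg fun _ _ => gw_nonneg _ _) (Nat.cast_nonneg _)) (fun _ => 2 + Real.log N) fun T _ => ?_).trans
    (add_le_add le_rfl (er0_1 R _ (by positivity)))
  obtain ⟨a, ha⟩ := crt hi hD v T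
  have hT : 0 < primorial D * numc qq T := Nat.mul_pos (primorial_pos D) (by rw [numc_num]; exact num_pos _)
  refine le_trans (le_of_eq ?_) (ap_gw l N _ a hT)
  rw [filter_filter, filter_congr fun n _ => ha n]
  congr 2
  push_cast
  rw [← div_div, numc, Nat.cast_prod, div_eq_mul_inv (_ / _ : ℝ), ← prod_inv_distrib]
  congr 1
  refine prod_congr rfl fun p _ => ?_
  have := q2 p
  rcases T p with _ | i
  · simp
  · simp only [Option.elim, reduceCtorEq, if_false, tt, qq]
    have : (p.1 : ℝ) - 1 ≠ 0 := by linarith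
    rw [one_add_div this, sub_add_cancel, div_div_div_cancel_right₀ this, one_div]

theorem S2' (hD1 : 2 ≤ D) (hi : Function.Injective h) (hD : ∀ i, h i ≤ D) (hG : ∀ s, 0 ≤ G s) (hG1 : ∀ s, G s ≤ 1)
    (hm : ∀ s s' : PP D M → Bool, (∀ p, s p → s' p) → G s' ≤ G s) (hY0 : 0 ≤ Y) (hY : ∀ s, G s ≠ 0 → (num qq s : ℝ) ≤ Y)
    (hK : ∏ p : PP D M, (1 + 2 * cc κ * tt p ^ 2) ≤ 2) (m : κ) (hv : (v + h m).Coprime (primorial D))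
    {N0 Q : ℕ} {θ S : ℝ} (hθ : 0 < θ) (hN0 : D ≤ N0) (hMN : M ≤ N0) (hQN : Q ≤ N0) (hQ : primorial D * R ^ 2 ≤ Q) (F : ℕ → ℝ) (hS : ∑ q ∈ Ioc 0 Q, F q ≤ S)
    (hF : ∀ q ∈ Ioc 0 Q, ∀ a : ℕ, a.Coprime q → |∑ n ∈ Ioc N0 N with n ≡ a [MOD q], th l n - (∑ n ∈ Ioc N0 N, th l n) / q.totient| ≤ F q) :
    (∑ n ∈ Ioc N0 N, th l n) / (primorial D).totient * (2 - ∏ p : PP D M, (1 + 2 * cc κ * tt p ^ 2)) * ((∑ s, G s * wt tt s) ^ 2 *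
      ∑ e : {i // i ≠ m} → PP D M → Bool, (if (∏ i, (num qq (e i) : ℝ)) * Y ≤ R then 1 else 0) * ∏ i, (G (e i) ^ 2 * wt tt (e i))) ≤
    (∏ p : PP D M, (1 + (4 ^ Fintype.card {i // i ≠ m} + 2 * Fintype.card {i // i ≠ m}) * tt p ^ 2)) *
      (∑ n ∈ Ioc 0 N with n ≡ v [MOD primorial D], (if n + h m ∈ Ioc N0 N then th l (n + h m) else 0) * nu h G R n + (∏ p : PP D M, (1 + tt p)) ^ 2 *
      (θ * S + θ⁻¹ * (2 * Real.exp l * (1 + Real.log N) ^ 2) * ∏ p : PP D M, (1 + (2 * cc κ + cc κ ^ 2 + 4 * cc κ ^ 2 * (Fintype.card κ : ℝ) ^ 2) * tt p))) := by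
  have hL := Real.log_natCast_nonneg N
  set w : ℕ → ℝ := fun n => if n + h m ∈ Ioc N0 N then th l (n + h m) else 0
  have hX : 0 ≤ ∑ n ∈ Ioc N0 N, th l n := sum_nonneg fun _ _ => th0 _ _
  have hw : ∀ n, w n ≠ 0 → ∀ p : PP D M, sc h n p ≠ some m := fun n hn p H => by
    rw [sc_iff hi hD] at H
    simp only [w] at hn
    split_ifs at hn with h1
    · rw [th] at hn
      split_ifs at hn with h2
      · have := (Nat.prime_dvd_prime_iff_eq (qP p) h2).1 H
        have := qM p; have := (mem_Ioc.1 h1).1; omega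
      · exact hn rfl
    · exact hn rfl
  set E : (PP D M → Option κ) → ℝ := fun T => |∑ n ∈ (Ioc 0 N).filter (· ≡ v [MOD primorial D]) with ∀ p, T p = none ∨ sc h n p = T p, w n -
    (∑ n ∈ Ioc N0 N, th l n) / (primorial D).totient * ∏ p, (T p).elim 1 (fun a => if a = m then 0 else tt p)|
  refine (S2_ge tt0 (fun p => (tt_D (by omega) p).trans (one_div_le_one_div_of_le two_pos (by exact_mod_cast hD1))) (fun p => (qP p).one_le) hG hG1 hm hY0 hY _ (sc h) w
    ((∑ n ∈ Ioc N0 N, th l n) / (primorial D).totient) (div_nonneg hX (Nat.cast_nonneg _)) E m (fun n _ => hw n) hK fun T _ => le_rfl).trans ?_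
  refine mul_le_mul_of_nonneg_left (add_le_add le_rfl (mul_le_mul_of_nonneg_left ?_ (sq_nonneg _))) (prod_nonneg fun p _ => by positivity)
  have hmem : ∀ T : PP D M → Option κ, (numc qq T : ℝ) ≤ R ^ 2 → primorial D * numc qq T ∈ Ioc 0 Q := fun T hT => mem_Ioc.2
    ⟨Nat.mul_pos (primorial_pos D) (by rw [numc_num]; exact num_pos _), by
      have : ((primorial D * numc qq T : ℕ) : ℝ) ≤ Q := by push_cast; exact (mul_le_mul_of_nonneg_left hT (by positivity)).trans hQ
      exact_mod_cast this⟩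
  have hF0 : ∀ q ∈ Ioc 0 Q, 0 ≤ F q := fun q hq => (abs_nonneg _).trans (hF q hq 1 (Nat.coprime_one_left q))
  have hE0 : ∀ T : PP D M → Option κ, (∃ p, T p = some m) → E T = 0 := fun T ⟨p, hp⟩ => by
    simp only [E]
    rw [prod_eq_zero (mem_univ p) (by simp [hp]), mul_zero, sub_zero, sum_eq_zero, abs_zero]
    intro n hn
    by_contra H
    rcases (mem_filter.1 hn).2 p with h1 | h1
    · simp [hp] at h1
    · exact hw n H p (h1.trans hp)
  have hE1 : ∀ T : PP D M → Option κ, (¬∃ p, T p = some m) → ∃ a : ℕ, a.Coprime (primorial D * numc qq T) ∧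
      E T = |∑ n ∈ Ioc N0 N with n ≡ a [MOD primorial D * numc qq T], th l n - (∑ n ∈ Ioc N0 N, th l n) / (primorial D * numc qq T).totient| := fun T hT => by
    push Not at hT
    obtain ⟨a, ha⟩ := crt hi hD v T
    refine ⟨a + h m, crt_cop hi hD hv hT ((ha a).2 rfl), ?_⟩
    simp only [E]
    congr 2
    · rw [filter_filter, filter_congr fun n _ => ha n]
      simp only [w]
      rw [← sum_filter, filter_filter]
      refine sum_bij (fun n _ => n + h m) (fun n hn => ?_) (fun n _ n' _ => by simp) (fun n hn => ?_) (fun _ _ => rfl)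
      · simp only [mem_filter] at hn ⊢
        exact ⟨hn.2.2, hn.2.1.add_right _⟩
      · simp only [mem_filter, mem_Ioc] at hn
        have := hD m
        refine ⟨n - h m, ?_, by omega⟩
        simp only [mem_filter, mem_Ioc]
        have e : n - h m + h m = n := by omega
        rw [e]
        exact ⟨⟨by omega, by omega⟩, Nat.ModEq.add_right_cancel' (h m) (by rw [e]; exact hn.2), hn.1⟩
    · rw [div_eq_mul_one_div _ ((primorial D * numc qq T).totient : ℝ), tot_num, div_eq_mul_one_div, mul_assoc]
      congr 2
      refine prod_congr rfl fun p _ => ?_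
      have := hT p
      rcases hTp : T p with _ | i
      · simp
      · have : i ≠ m := fun e => this (e ▸ hTp)
        simp [this]
  refine er0_2 (primorial_pos D) (by omega) hθ (by positivity) F E hF0 hQ hS (fun T hT => ?_) (fun T hT => ?_)
  · by_cases H : ∃ p, T p = some m
    · rw [hE0 T H]; exact hF0 _ (hmem T hT)
    · obtain ⟨a, ha, hE⟩ := hE1 T H
      rw [hE]; exact hF _ (hmem T hT) a ha
  · have hp : 0 ≤ ∏ p, (if T p = none then 1 else tt p) := prod_nonneg fun p _ => by have := tt0 p; split_ifs <;> positivity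
    by_cases H : ∃ p, T p = some m
    · rw [hE0 T H]; positivity
    · obtain ⟨a, ha, hE⟩ := hE1 T H
      have hq := mem_Ioc.1 (hmem T hT)
      rw [hE]
      have h1 := triv l (N0 := N0) (N := N) a hq.1 (hq.2.trans hQN)
      have h2 := triv l (N0 := N0) (N := N) (q := 1) 0 one_pos (by omega)
      simp only [Nat.modEq_one, filter_true, Nat.totient_one, Nat.cast_one, div_one] at h2
      have h3 : 0 ≤ ∑ n ∈ Ioc N0 N with n ≡ a [MOD primorial D * numc qq T], th l n := sum_nonneg fun _ _ => th0 _ _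
      have h4 : (∑ n ∈ Ioc N0 N, th l n) / (primorial D * numc qq T).totient ≤ (2 * Real.exp l * (1 + Real.log N) ^ 2) / (primorial D * numc qq T).totient := by gcongr
      refine (abs_sub_le_of_nonneg_of_le h3 h1 (by positivity) h4).trans ?_
      rw [div_eq_mul_one_div _ ((primorial D * numc qq T).totient : ℝ), tot_num]
      refine mul_le_mul_of_nonneg_left (mul_le_of_le_one_left hp ?_) (by positivity)
      have : 0 < (primorial D).totient := Nat.totient_pos.2 (primorial_pos D)
      rw [div_le_one (by positivity)]; exact_mod_cast this
end
end MG

namespace MG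
open Finset Filter Topology

theorem logN (ε l : ℝ) (h : 0 ≤ (1 + ε) * l) : Real.log (NN ε l) ≤ (1 + ε) * l := by
  rcases Nat.eq_zero_or_pos (NN ε l) with h0 | h0
  · rw [h0]; simpa using h
  · rw [← Real.log_exp ((1 + ε) * l)]
    exact Real.log_le_log (by exact_mod_cast h0) (Nat.floor_le (Real.exp_pos _).le)

theorem X1_ge {ε : ℝ} (hε : 0 < ε) : ∀ᶠ l : ℝ in atTop, Real.exp l / 4 ≤ ∑ n ∈ Ioc 0 (NN ε l), gw l n := by
  filter_upwards [eventually_ge_atTop (1 / ε), eventually_ge_atTop 1] with l h1 h2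
  have he : 2 ≤ Real.exp l := by have := Real.add_one_le_exp l; linarith
  have hs : Ioc ⌊Real.exp l⌋₊ ⌊2 * Real.exp l⌋₊ ⊆ Ioc 0 (NN ε l) := Ioc_subset_Ioc (Nat.zero_le _) (Nat.floor_le_floor (by
    rw [add_mul, one_mul, Real.exp_add, mul_comm]
    gcongr
    have : 1 ≤ ε * l := by rwa [div_le_iff₀' hε] at h1
    have := Real.add_one_le_exp (ε * l); linarith))
  refine le_trans ?_ (sum_le_sum_of_subset_of_nonneg hs fun _ _ _ => gw_nonneg _ _)
  calc _ ≤ ((Ioc ⌊Real.exp l⌋₊ ⌊2 * Real.exp l⌋₊).card : ℝ) * (1 / 2) := by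
        rw [Nat.card_Ioc, Nat.cast_sub (Nat.floor_le_floor (by linarith))]
        have := Nat.floor_le (Real.exp_pos l).le
        have := Nat.lt_floor_add_one (2 * Real.exp l)
        linarith
    _ ≤ _ := by
        rw [← nsmul_eq_mul]
        refine card_nsmul_le_sum _ _ _ fun n hn => ?_
        rw [mem_Ioc, Nat.floor_lt (Real.exp_pos l).le] at hn
        have h3 : (n : ℝ) ≤ 2 * Real.exp l := (Nat.cast_le.2 hn.2).trans (Nat.floor_le (by positivity))
        have hn0 : (0 : ℝ) < n := (Real.exp_pos l).trans hn.1
        have h4 : l ≤ Real.log n := (Real.le_log_iff_exp_le hn0).2 hn.1.le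
        have h5 : Real.log n ≤ 1 + l := by
          refine (Real.log_le_log hn0 h3).trans ?_
          rw [Real.log_mul two_ne_zero (Real.exp_pos l).ne', Real.log_exp]
          linarith [Real.log_two_lt_d9]
        rw [gw]
        have := Real.add_one_le_exp (-(Real.log n - l) ^ 2 / 2)
        nlinarith

theorem X'_ge {ε η : ℝ} (hε : 0 < ε) (hε1 : ε ≤ 1 / 4) (hη : 0 < η) :
    ∀ᶠ l : ℝ in atTop, (1 - η) * ∑ n ∈ Ioc 0 (NN ε l), gw l n ≤ ∑ n ∈ Ioc (N0 l) (NN ε l), th l n := by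
  filter_upwards [X1_ge hε, PNT_w 1 zero_le_one, tail_sum hε (by linarith), eventually_ge_atTop 1, eventually_ge_atTop (16 / η),
    ev_exp 1 1 (-1) (show (0 : ℝ) < 1 by norm_num), ev_exp 4 1 (-1) (show (0 : ℝ) < 3 / 8 by norm_num), ev_exp 6 0 (-1) (show (0 : ℝ) < 1 / 2 by norm_num)] with l h1 h2 h3 h4 h5 h6 h7 h8
  have hM1 : 1 ≤ N0 l := Nat.le_floor (by rw [Nat.cast_one]; exact Real.one_le_exp (by linarith))
  have hMN : N0 l ≤ NN ε l := Nat.floor_le_floor (Real.exp_le_exp.2 (by nlinarith))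
  have h9 := th_lam l hM1 hMN (1 : DirichletCharacter ℂ 1)
  have h10 := h3 _ h2.1 (by simp) (fun n => by
    rw [norm_mul, Complex.norm_real, Real.norm_of_nonneg (gw_nonneg _ _)]
    refine mul_le_mul_of_nonneg_right ?_ (gw_nonneg _ _)
    rcases Nat.eq_zero_or_pos n with rfl | hn
    · simp
    · rw [if_neg (by omega), ← Complex.ofReal_one, ← Complex.ofReal_sub, Complex.norm_real, Real.norm_eq_abs, abs_le]
      have h11 := ArithmeticFunction.vonMangoldt_nonneg (n := n)
      have h12 := ArithmeticFunction.vonMangoldt_le_log (n := n)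
      have h13 : (1 : ℝ) ≤ n := by exact_mod_cast hn
      have h14 := Real.log_le_sub_one_of_pos (show (0 : ℝ) < n by linarith)
      constructor <;> linarith)
  have h11 : ∑ n ∈ Ioc (N0 l) (NN ε l), (th l n : ℂ) * (1 : DirichletCharacter ℂ 1) n - ∑ n ∈ Ioc 0 (NN ε l), (ArithmeticFunction.vonMangoldt n : ℂ) * ((1 : DirichletCharacter ℂ 1) n * gw l n) +
      ∑ n ∈ Ioc 0 (NN ε l), ((ArithmeticFunction.vonMangoldt n : ℂ) - (if n = 0 then 0 else 1)) * gw l n =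
      ((∑ n ∈ Ioc (N0 l) (NN ε l), th l n - ∑ n ∈ Ioc 0 (NN ε l), gw l n : ℝ) : ℂ) := by
    push_cast
    rw [sub_add, ← sum_sub_distrib]
    congr 1
    · refine sum_congr rfl fun n _ => by rw [MulChar.one_apply (isUnit_of_subsingleton _), mul_one]
    · refine sum_congr rfl fun n hn => by
        rw [MulChar.one_apply (isUnit_of_subsingleton _), if_neg (by have := mem_Ioc.1 hn; omega)]; ring
  have h12 := (norm_add_le_of_le h9 (h10.trans (add_le_add h2.2 le_rfl)))
  rw [h11, Complex.norm_real, Real.norm_eq_abs, abs_le] at h12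
  have e0 := Real.exp_pos l
  have b1 : l ≤ Real.exp l * l ^ (-1 : ℝ) := by
    rw [one_mul, Real.rpow_one] at h6
    calc l = Real.exp l * (l * Real.exp (-1 * l)) := by rw [mul_left_comm, ← Real.exp_add]; simp
      _ ≤ _ := mul_le_mul_of_nonneg_left h6 e0.le
  have b2 : 2 * Real.sqrt (NN ε l) * Real.log (NN ε l) ≤ Real.exp l * l ^ (-1 : ℝ) := by
    have c1 : Real.sqrt (NN ε l) ≤ Real.exp (5 / 8 * l) := by
      refine Real.sqrt_le_iff.2 ⟨(Real.exp_pos _).le, (Nat.floor_le (Real.exp_pos _).le).trans ?_⟩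
      rw [← Real.exp_nat_mul]; exact Real.exp_le_exp.2 (by push_cast; nlinarith)
    have c2 : Real.log (NN ε l) ≤ 2 * l := (logN ε l (by positivity)).trans (by nlinarith)
    calc _ ≤ 2 * Real.exp (5 / 8 * l) * (2 * l) := by gcongr
      _ = Real.exp l * (4 * l ^ (1 : ℝ) * Real.exp (-(3 / 8) * l)) := by
          rw [mul_left_comm (Real.exp l), ← Real.exp_add, Real.rpow_one, show l + -(3 / 8) * l = 5 / 8 * l by ring]; ring
      _ ≤ _ := mul_le_mul_of_nonneg_left h7 e0.le
  have b3 : 6 * (N0 l : ℝ) ≤ Real.exp l * l ^ (-1 : ℝ) := by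
    calc _ ≤ 6 * Real.exp (l / 2) := by gcongr; exact Nat.floor_le (Real.exp_pos _).le
      _ = Real.exp l * (6 * l ^ (0 : ℝ) * Real.exp (-(1 / 2) * l)) := by
          rw [mul_left_comm (Real.exp l), ← Real.exp_add, Real.rpow_zero, show l + -(1 / 2) * l = l / 2 by ring]; ring
      _ ≤ _ := mul_le_mul_of_nonneg_left h8 e0.le
  have b4 : Real.exp l * l ^ (-1 : ℝ) ≤ η * (Real.exp l / 16) := by
    rw [Real.rpow_neg_one, mul_comm, ← div_eq_inv_mul, div_le_iff₀ (by linarith)]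
    rw [div_le_iff₀ hη] at h5
    nlinarith
  nlinarith [h12.1]

theorem gw_shift (D : ℕ) {η : ℝ} (hη : 0 < η) : ∀ᶠ l : ℝ in atTop, D ≤ N0 l ∧ ∀ n h : ℕ, h ≤ D → N0 l < n + h → gw l (n + h : ℕ) ≤ (1 + η) * gw l n := by
  have hl : 0 < Real.log (1 + η) := Real.log_pos (by linarith)
  filter_upwards [ev_exp (D + 1 + D / Real.log (1 + η)) 1 0 (show (0 : ℝ) < 1 / 2 by norm_num), eventually_ge_atTop 1] with l h1 h2
  rw [Real.rpow_one, Real.rpow_zero, neg_mul, Real.exp_neg, ← div_eq_mul_inv, div_le_one (Real.exp_pos _), show 1 / 2 * l = l / 2 by ring] at h1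
  have h3 := Nat.lt_floor_add_one (Real.exp (l / 2))
  change _ < (N0 l : ℝ) + 1 at h3
  have hD0 : (0 : ℝ) ≤ D := Nat.cast_nonneg _
  have hx : 0 ≤ D / Real.log (1 + η) := by positivity
  have h4 : (D : ℝ) + D / Real.log (1 + η) * l ≤ N0 l := by nlinarith
  refine ⟨by have : (D : ℝ) ≤ N0 l := by { nlinarith }
             exact_mod_cast this, fun n h hh hn => ?_⟩
  have hn1 : (N0 l : ℝ) + 1 ≤ n + h := by exact_mod_cast hn
  have hh1 : (h : ℝ) ≤ D := by exact_mod_cast hh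
  have h5 : D / Real.log (1 + η) * l ≤ n := by linarith
  have hn0 : (1 : ℝ) ≤ n := by nlinarith
  rw [gw, gw]
  nth_rw 1 [← Real.exp_log (show 0 < 1 + η by linarith)]
  rw [← Real.exp_add]
  refine Real.exp_le_exp.2 ?_
  have hh0 : (0 : ℝ) ≤ h := Nat.cast_nonneg _
  have h6 : Real.log (n + h : ℕ) - Real.log n ≤ h / n := by
    push_cast
    rw [← Real.log_div (by linarith) (by linarith)]
    refine (Real.log_le_sub_one_of_pos (by positivity)).trans (le_of_eq ?_)
    field_simp; ring
  have h7 : 0 ≤ Real.log (n + h : ℕ) - Real.log n := sub_nonneg.2 (Real.log_le_log (by linarith) (by push_cast; linarith))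
  have h8 : h / n * l ≤ Real.log (1 + η) := by
    rw [div_mul_eq_mul_div, div_le_iff₀ hl] at h5
    rw [div_mul_eq_mul_div, div_le_iff₀ (by linarith)]
    nlinarith
  have h9 := Real.log_nonneg hn0
  nlinarith [mul_le_mul_of_nonneg_right h6 (show 0 ≤ l by linarith), mul_nonneg h7 h9, sq_nonneg (Real.log (n + h : ℕ) - Real.log n)]

theorem err1 {ε c : ℝ} (hε : 0 < ε) (hε1 : ε ≤ 1 / 4) (hc : 0 < c) (C : ℝ) : ∀ᶠ l : ℝ in atTop,
    (2 + Real.log (NN ε l)) * Real.exp ((1 / 4 - ε) * l) ^ 2 * (Real.exp (20 * C) * l ^ (20 * C)) ≤ c * Real.exp l := by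
  filter_upwards [ev_exp (4 * Real.exp (20 * C)) (1 + 20 * C) (-1) (show (0 : ℝ) < 1 / 2 by norm_num), eventually_ge_atTop 1, eventually_ge_atTop (1 / c)] with l h1 h2 h3
  have h4 : 2 + Real.log (NN ε l) ≤ 4 * l := by have := logN ε l (by positivity); nlinarith
  have h5 : Real.exp ((1 / 4 - ε) * l) ^ 2 ≤ Real.exp l * Real.exp (-(1 / 2) * l) := by
    rw [← Real.exp_nat_mul, ← Real.exp_add]; exact Real.exp_le_exp.2 (by push_cast; nlinarith)
  calc _ ≤ 4 * l * (Real.exp l * Real.exp (-(1 / 2) * l)) * (Real.exp (20 * C) * l ^ (20 * C)) := by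
        have := Real.log_natCast_nonneg (NN ε l)
        gcongr
    _ = Real.exp l * (4 * Real.exp (20 * C) * l ^ (1 + 20 * C) * Real.exp (-(1 / 2) * l)) := by
        rw [Real.rpow_add (by linarith), Real.rpow_one]; ring
    _ ≤ Real.exp l * c := by
        refine mul_le_mul_of_nonneg_left (h1.trans ?_) (Real.exp_pos _).le
        rw [Real.rpow_neg_one]
        rw [div_le_iff₀ hc] at h3
        exact inv_le_of_inv_le₀ hc (by rw [inv_eq_one_div, div_le_iff₀ hc]; linarith)
    _ = _ := mul_comm _ _

theorem err2 {ε c C : ℝ} (hε : 0 < ε) (hε1 : ε ≤ 1 / 4) (hc : 0 < c) (hC : 0 ≤ C) : ∀ᶠ l : ℝ in atTop,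
    (Real.exp (20 * 1) * l ^ (20 * 1 : ℝ)) ^ 2 * (l ^ (44 + 20 * C) * (Real.exp l * l ^ (-(2 * (44 + 20 * C)))) +
      (l ^ (44 + 20 * C))⁻¹ * (2 * Real.exp l * (1 + Real.log (NN ε l)) ^ 2) * (Real.exp (20 * C) * l ^ (20 * C))) ≤ c * Real.exp l := by
  set B := 44 + 20 * C with hB
  filter_upwards [ev_pow (Real.exp 20 ^ 2 * (1 + 18 * Real.exp (20 * C))) (show (-2 : ℝ) < -1 by norm_num), eventually_ge_atTop 1, eventually_ge_atTop (1 / c)] with l h1 h2 h3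
  have hl : 0 < l := by linarith
  have h4 : 1 + Real.log (NN ε l) ≤ 3 * l := by have := logN ε l (by positivity); nlinarith
  have e1 : l ^ B * l ^ (-(2 * B)) = l ^ (-B) := by rw [← Real.rpow_add hl]; congr 1; ring
  have e2 : (l ^ (20 * 1 : ℝ)) ^ 2 = l ^ (40 : ℝ) := by rw [← Real.rpow_natCast, ← Real.rpow_mul hl.le]; norm_num
  have e3 : l ^ (40 : ℝ) * l ^ (-B) * l ^ (2 : ℝ) * l ^ (20 * C) = l ^ (-2 : ℝ) := by
    rw [← Real.rpow_add hl, ← Real.rpow_add hl, ← Real.rpow_add hl]; congr 1; rw [hB]; ring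
  have e4 : 1 ≤ l ^ (2 : ℝ) * l ^ (20 * C) := by
    rw [← Real.rpow_add hl]; exact Real.one_le_rpow h2 (by positivity)
  have p0 : 0 ≤ l ^ (40 : ℝ) * l ^ (-B) := by positivity
  have e5 : l ^ (40 : ℝ) * l ^ (-B) ≤ l ^ (-2 : ℝ) := by rw [← e3]; nlinarith
  have h5 : (1 + Real.log (NN ε l)) ^ 2 ≤ 9 * l ^ (2 : ℝ) := by
    have := Real.log_natCast_nonneg (NN ε l)
    rw [Real.rpow_two]; nlinarith
  have hlog := Real.log_natCast_nonneg (NN ε l)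
  calc _ ≤ (Real.exp (20 * 1) * l ^ (20 * 1 : ℝ)) ^ 2 * (l ^ B * (Real.exp l * l ^ (-(2 * B))) +
      (l ^ B)⁻¹ * (2 * Real.exp l * (9 * l ^ (2 : ℝ))) * (Real.exp (20 * C) * l ^ (20 * C))) := by gcongr
    _ = Real.exp l * (Real.exp 20 ^ 2 * (l ^ (40 : ℝ) * l ^ (-B) + 18 * Real.exp (20 * C) * (l ^ (40 : ℝ) * l ^ (-B) * l ^ (2 : ℝ) * l ^ (20 * C)))) := by
        rw [mul_pow, e2, mul_left_comm (l ^ B), e1, ← Real.rpow_neg hl.le, mul_one]; ring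
    _ ≤ Real.exp l * (Real.exp 20 ^ 2 * (1 + 18 * Real.exp (20 * C)) * l ^ (-2 : ℝ)) := by
        rw [e3]
        refine mul_le_mul_of_nonneg_left ?_ (Real.exp_pos _).le
        rw [mul_assoc (Real.exp 20 ^ 2)]
        refine mul_le_mul_of_nonneg_left ?_ (by positivity)
        linarith
    _ ≤ Real.exp l * c := by
        refine mul_le_mul_of_nonneg_left (h1.trans ?_) (Real.exp_pos _).le
        rw [Real.rpow_neg_one]
        rw [div_le_iff₀ hc] at h3
        exact inv_le_of_inv_le₀ hc (by rw [inv_eq_one_div, div_le_iff₀ hc]; linarith)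
    _ = _ := mul_comm _ _
end MG

namespace MG
open Finset Filter Topology

section
variable {D M : ℕ} {A k L : ℝ}

theorem gG0 (hb : 0 < A * k / L) (s : PP D M → Bool) : 0 ≤ gG A k L s := by
  rw [gG]; split_ifs; exacts [ff0 hb _, le_rfl]
theorem gG1 (hb : 0 < A * k / L) (s : PP D M → Bool) : gG A k L s ≤ 1 := by
  rw [gG]; split_ifs; exacts [ff1 hb _, zero_le_one]
theorem gGm (hb : 0 < A * k / L) (s s' : PP D M → Bool) (h : ∀ p, s p → s' p) : gG A k L s' ≤ gG A k L s := by
  have hn : num qq s ≤ num qq s' := prod_le_prod' fun p _ => by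
    have := h p; have := (qP p).one_le
    split_ifs <;> simp_all
  by_cases h' : num qq s' ≤ NY A k L
  · rw [gG, gG, if_pos h', if_pos (hn.trans h'), ff, ff]
    have : (0 : ℝ) < num qq s := by exact_mod_cast num_pos s
    exact one_div_le_one_div_of_le (by linarith [ff_den hb (num qq s)]) (by gcongr)
  · rw [gG, if_neg h']; exact gG0 hb s
theorem gGY (s : PP D M → Bool) (h : gG A k L s ≠ 0) : (num qq s : ℝ) ≤ Real.exp ((Real.exp A - 1) / A * L / k) := by
  rw [gG] at h; split_ifs at h with h1
  exacts [(Nat.le_floor_iff (Real.exp_pos _).le).1 h1, absurd rfl h]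

theorem Zlow {κ : Type*} [Fintype κ] [DecidableEq κ] (hA : 1 ≤ A) (hk0 : 0 < k) (hL : 0 < L) (hk : 32 * A ^ 3 * ((Real.exp A - 1) / A) ≤ k)
    (hr : Fintype.card κ ≤ k) (hI : ∑ s : PP D M → Bool, gG A k L s * wt tt s ≤ (A + 1 / 2) * ∑ s : PP D M → Bool, gG A k L s ^ 2 * wt tt s) :
    (1 - Real.exp (-A)) * (∑ s : PP D M → Bool, gG A k L s ^ 2 * wt tt s) ^ Fintype.card κ ≤ ∑ e : κ → PP D M → Bool,
      (if (∏ i, (num qq (e i) : ℝ)) * Real.exp ((Real.exp A - 1) / A * L / k) ≤ Real.exp L then 1 else 0) * ∏ i, (gG A k L (e i) ^ 2 * wt tt (e i)) := by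
  have hb : 0 < A * k / L := by positivity
  have hn : ∀ s : PP D M → Bool, (0 : ℝ) < num qq s := fun s => by exact_mod_cast num_pos s
  have hw : ∀ s : PP D M → Bool, 0 ≤ wt tt s := fun s => prod_nonneg fun p _ => by split_ifs; exacts [tt0 p, zero_le_one]
  refine (chern (wt tt) (gG A k L) (fun s : PP D M → Bool => Real.log (num qq s) * k / L) A ((Real.exp A - 1) / A) k hA
    (div_pos (by linarith [Real.add_one_le_exp A]) (by linarith)) hk hr hw (fun s => div_nonneg (mul_nonneg (Real.log_natCast_nonneg _) hk0.le) hL.le)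
    (fun s hs => ?_) (fun s => ?_) hI).trans (sum_le_sum fun e _ => mul_le_mul_of_nonneg_right ?_ (prod_nonneg fun i _ => mul_nonneg (sq_nonneg _) (hw _)))
  · rw [div_le_iff₀ hL, ← le_div_iff₀ hk0, Real.log_le_iff_le_exp (hn s)]; exact gGY s hs
  · rw [gG]; split_ifs
    · have h1 := ff_den hb (num qq s)
      rw [ff]
      set x := Real.log (num qq s)
      have h2 : 1 + A * k / L * x ≠ 0 := by linarith
      have h3 : A * (x * k / L) = (1 + A * k / L * x) - 1 := by ring
      rw [mul_left_comm, h3]; field_simp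
    · simp
  · split_ifs with h1 h2
    · exact le_rfl
    · refine absurd ?_ h2
      rw [← sum_div, div_le_iff₀ hL, ← sum_mul, ← Real.log_prod (fun i _ => (hn (e i)).ne')] at h1
      set P := ∏ i, (num qq (e i) : ℝ)
      have hP : 0 < P := prod_pos fun i _ => hn (e i)
      have h3 : Real.log P ≤ L - (Real.exp A - 1) / A * L / k := by
        rw [← mul_le_mul_iff_left₀ hk0]; refine h1.trans (le_of_eq ?_); field_simp
      rw [← Real.exp_log hP, ← Real.exp_add]; exact Real.exp_le_exp.2 (by linarith)
    · exact zero_le_one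
    · exact le_rfl
end

theorem expA {m : ℝ} (hm : 1 ≤ m) : 8 * (4 * m + 4) ≤ Real.exp (4 * m + 4) ∧ m + 3 / 4 ≤ (m + 1) * (1 - Real.exp (-(4 * m + 4))) := by
  have h := Real.add_one_le_exp (m + 1)
  constructor
  · rw [show 4 * m + 4 = (4 : ℕ) * (m + 1) by push_cast; ring, Real.exp_nat_mul]
    refine le_trans ?_ (pow_le_pow_left₀ (by linarith) h 4)
    push_cast; nlinarith [sq_nonneg (m - 1), sq_nonneg ((m + 2) ^ 2 - 9)]
  · have h2 := Real.add_one_le_exp (4 * m + 4)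
    rw [Real.exp_neg]
    have : (Real.exp (4 * m + 4))⁻¹ ≤ (4 * (m + 1))⁻¹ := inv_anti₀ (by linarith) (by linarith)
    have h3 : (m + 1) * (4 * (m + 1))⁻¹ = 1 / 4 := by have : m + 1 ≠ 0 := by linarith
                                                      field_simp
    nlinarith

theorem per_ar {m δ l k X1 X' W φ I1 I2 J Z P1 P2 S e : ℝ} (hm : 1 ≤ m) (hδ : 0 < δ) (hδ1 : δ ≤ 1 / 100) (hl : 0 < l) (hk : 0 < k) (hX : 0 ≤ X1) (hX' : (1 - δ) * X1 ≤ X')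
    (hW : 0 < W) (hφ : 0 < φ) (hI2 : 1 ≤ I2) (hJ : 0 ≤ J) (hI : (4 * m + 4) * (φ / W * ((1 / 4 - δ) * l / k)) * I2 ≤ (1 + δ) * I1 ^ 2)
    (hZ : (1 - Real.exp (-(4 * m + 4))) * J ≤ Z) (hP1 : P1 ≤ 1 + δ) (hP2 : P2 ≤ 1 + δ) (hSe : 0 ≤ S + e)
    (h : X' / φ * (2 - P1) * (I1 ^ 2 * Z) ≤ P2 * (S + e)) : (1 - 8 * δ) * (m + 3 / 4) * l * (X1 / W * (I2 * J)) ≤ k * (S + e) := by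
  have hE := (expA hm).2
  set E := 1 - Real.exp (-(4 * m + 4))
  have hE0 : 0 ≤ E := by by_contra h; push Not at h; nlinarith
  have hZ0 : 0 ≤ Z := (mul_nonneg hE0 hJ).trans hZ
  have h1 : (1 - δ) * X1 / φ * (1 - δ) * (I1 ^ 2 * (E * J)) ≤ (1 + δ) * (S + e) := by
    refine le_trans ?_ (h.trans (mul_le_mul_of_nonneg_right hP2 hSe))
    have : 0 ≤ (1 - δ) * X1 := mul_nonneg (by linarith) hX
    have h2 : 1 - δ ≤ 2 - P1 := by linarith
    have h3 : 0 ≤ 1 - δ := by linarith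
    have h4 := this.trans hX'
    exact mul_le_mul (mul_le_mul (by gcongr) h2 h3 (by positivity)) (by gcongr) (by positivity) (mul_nonneg (by positivity) (by linarith))
  have h2 : (1 - δ) * X1 / φ * (1 - δ) * ((4 * m + 4) * (φ / W * ((1 / 4 - δ) * l / k)) * I2 * (E * J)) ≤ (1 + δ) ^ 2 * (S + e) := by
    calc _ ≤ (1 - δ) * X1 / φ * (1 - δ) * ((1 + δ) * I1 ^ 2 * (E * J)) := by
          have : 0 ≤ (1 - δ) * X1 := mul_nonneg (by linarith) hX
          have : 0 ≤ 1 - δ := by linarith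
          gcongr
      _ = (1 + δ) * ((1 - δ) * X1 / φ * (1 - δ) * (I1 ^ 2 * (E * J))) := by ring
      _ ≤ (1 + δ) * ((1 + δ) * (S + e)) := by gcongr
      _ = _ := by ring
  have h3 : (1 - δ) * X1 / φ * (1 - δ) * ((4 * m + 4) * (φ / W * ((1 / 4 - δ) * l / k)) * I2 * (E * J)) =
      (1 - δ) ^ 2 * (1 - 4 * δ) * ((m + 1) * E) * (l * (X1 / W * (I2 * J))) / k := by field_simp
  rw [h3, div_le_iff₀ hk] at h2
  set V := l * (X1 / W * (I2 * J))
  have hV : 0 ≤ V := by positivity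
  have h4 : (1 + δ) ^ 2 * (1 - 8 * δ) ≤ (1 - δ) ^ 2 * (1 - 4 * δ) := by nlinarith [sq_nonneg δ, mul_pos hδ hδ, mul_pos (mul_pos hδ hδ) hδ]
  have h5 : (1 + δ) ^ 2 * ((1 - 8 * δ) * (m + 3 / 4) * V) ≤ (1 + δ) ^ 2 * (k * (S + e)) := by
    calc _ = (1 + δ) ^ 2 * (1 - 8 * δ) * (m + 3 / 4) * V := by ring
      _ ≤ (1 - δ) ^ 2 * (1 - 4 * δ) * ((m + 1) * E) * V := by
        have : 0 ≤ 1 - 4 * δ := by linarith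
        gcongr
      _ ≤ _ := h2.trans (by linarith)
  have := le_of_mul_le_mul_left h5 (by positivity)
  linarith

theorem con_ar {m δ l U e1 S1 S2 ke : ℝ} (hm : 1 ≤ m) (hδ : δ = 1 / (100 * m)) (hl : 0 < l) (hU : 0 < U) (h1 : S1 ≤ (1 + δ) * U + e1) (he1 : e1 ≤ δ * U)
    (hke : ke ≤ δ * l * U) (h2 : S2 ≤ m * (1 + δ) ^ 2 * l * S1) (h : (1 - 8 * δ) * (m + 3 / 4) * l * U ≤ S2 + ke) : False := by
  have hδ0 : 0 < δ := by rw [hδ]; positivity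
  have hmδ : m * δ = 1 / 100 := by rw [hδ]; field_simp
  have hδ1 : δ ≤ 1 / 100 := by nlinarith
  have h3 : S1 ≤ (1 + 2 * δ) * U := by linarith
  have h4 : m * (1 + δ) ^ 2 * l * S1 ≤ m * (1 + δ) ^ 2 * l * ((1 + 2 * δ) * U) := by gcongr
  have h5 : (1 - 8 * δ) * (m + 3 / 4) * (l * U) ≤ (m * (1 + δ) ^ 2 * (1 + 2 * δ) + δ) * (l * U) := by linarith
  have h6 := le_of_mul_le_mul_right h5 (by positivity)
  have h7 : m * (1 + δ) ^ 2 * (1 + 2 * δ) = m + 4 * (m * δ) + 5 * (m * δ) * δ + 2 * (m * δ) * δ ^ 2 := by ring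
  rw [h7, hmδ] at h6
  nlinarith
end MG

namespace MG
open Finset Filter Topology

theorem ev_D (c : ℝ) {δ : ℝ} (hδ : 0 < δ) : ∀ᶠ D : ℕ in atTop, Real.exp (c / D) < 1 + δ := by
  have h : Tendsto (fun D : ℕ => Real.exp (c / D)) atTop (𝓝 (Real.exp 0)) := (Real.continuous_exp.tendsto 0).comp (tendsto_const_div_atTop_nhds_zero_nat c)
  rw [Real.exp_zero] at h
  exact h.eventually_lt_const (by linarith)

theorem e_ar {l a b c P P' Q Q' : ℝ} (hl : 0 < l) (h0 : 0 ≤ P) (h1 : P ≤ P') (h2 : 0 ≤ Q) (h3 : Q ≤ Q') :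
    0 ≤ P ^ 2 * (l ^ a * (Real.exp l * l ^ b) + (l ^ a)⁻¹ * (2 * Real.exp l * c ^ 2) * Q) ∧
    P ^ 2 * (l ^ a * (Real.exp l * l ^ b) + (l ^ a)⁻¹ * (2 * Real.exp l * c ^ 2) * Q) ≤ P' ^ 2 * (l ^ a * (Real.exp l * l ^ b) + (l ^ a)⁻¹ * (2 * Real.exp l * c ^ 2) * Q') :=
  ⟨by positivity, by gcongr⟩

set_option maxHeartbeats 2000000 in
theorem point {k m D : ℕ} {l δ A T L c1 c2 C2 : ℝ} (hm : 1 ≤ m) (h : Fin k → ℕ) (hi : Function.Injective h) (hA : A = 4 * m + 4) (hT : T = (Real.exp A - 1) / A)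
    (hk : 32 * A ^ 3 * T ≤ k) (hk0 : 0 < k) (hδ : δ = 1 / (100 * m)) (hL : L = (1 / 4 - δ) * l) (hD2 : 2 ≤ D) (hD : ∀ i, h i ≤ D)
    (hP1 : Real.exp (2 * (2 * cc (Fin k)) / D) ≤ 1 + δ) (hP2 : Real.exp (2 * (4 ^ (k - 1) + 2 * (k - 1 : ℕ)) / D) ≤ 1 + δ)
    {v : ℕ} (hv : ∀ i, (v + h i).Coprime (primorial D)) (hl : 1 ≤ l) (hC2 : C2 = 2 * cc (Fin k) + cc (Fin k) ^ 2 + 4 * cc (Fin k) ^ 2 * (k : ℝ) ^ 2)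
    (hB : BVp δ (2 * (44 + 20 * C2)) l) (hX1 : Real.exp l / 4 ≤ ∑ n ∈ Ioc 0 (NN δ l), gw l n)
    (hX : (1 - δ) * ∑ n ∈ Ioc 0 (NN δ l), gw l n ≤ ∑ n ∈ Ioc (N0 l) (NN δ l), th l n)
    (hg : D ≤ N0 l ∧ ∀ n h : ℕ, h ≤ D → N0 l < n + h → gw l (n + h : ℕ) ≤ (1 + δ) * gw l n)
    (hc1 : c1 = δ / (4 * primorial D)) (hc2 : c2 = δ / (4 * primorial D * k))
    (he1 : (2 + Real.log (NN δ l)) * Real.exp ((1 / 4 - δ) * l) ^ 2 * (Real.exp (20 * (cc (Fin k) + 2 * k * cc (Fin k))) * l ^ (20 * (cc (Fin k) + 2 * k * cc (Fin k)))) ≤ c1 * Real.exp l)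
    (he2 : (Real.exp (20 * 1) * l ^ (20 * 1 : ℝ)) ^ 2 * (l ^ (44 + 20 * C2) * (Real.exp l * l ^ (-(2 * (44 + 20 * C2)))) +
      (l ^ (44 + 20 * C2))⁻¹ * (2 * Real.exp l * (1 + Real.log (NN δ l)) ^ 2) * (Real.exp (20 * C2) * l ^ (20 * C2))) ≤ c2 * Real.exp l)
    (hI : 0 < L ∧ ∀ M, NY A k L ≤ M → 1 ≤ ∑ s : PP D M → Bool, gG A k L s ^ 2 * wt tt s ∧
      ∑ s : PP D M → Bool, gG A k L s * wt tt s ≤ (A + 1 / 2) * ∑ s : PP D M → Bool, gG A k L s ^ 2 * wt tt s ∧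
      A * ((primorial D).totient / primorial D * (L / k)) * ∑ s : PP D M → Bool, gG A k L s ^ 2 * wt tt s ≤ (1 + δ) * (∑ s : PP D M → Bool, gG A k L s * wt tt s) ^ 2)
    (hW : (primorial D + 1 : ℝ) ≤ Real.exp (δ * l)) : ∃ n, m < #{i | (n + h i).Prime ∧ N0 l < n + h i} := by
  by_contra hcon
  push Not at hcon
  have hm1 : (1 : ℝ) ≤ m := by exact_mod_cast hm
  have hkr : (0 : ℝ) < k := by exact_mod_cast hk0
  have hδ0 : 0 < δ := by rw [hδ]; positivity
  have hδ1 : δ ≤ 1 / 100 := by rw [hδ]; exact one_div_le_one_div_of_le (by norm_num) (by linarith)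
  have hl0 : 0 < l := by linarith
  have hA1 : 1 ≤ A := by linarith
  obtain ⟨hL0, hI⟩ := hI
  obtain ⟨M, hM⟩ : ∃ M, M = ⌊Real.exp L⌋₊ := ⟨_, rfl⟩
  have hT0 : 0 < T := by rw [hT]; exact div_pos (by linarith [Real.add_one_le_exp A]) (by linarith)
  have hTk : T ≤ k := by
    refine le_trans ?_ hk
    exact le_mul_of_one_le_left hT0.le (by linarith [one_le_pow₀ hA1 (n := 3)])
  have hMe : (M : ℝ) ≤ Real.exp L := by rw [hM]; exact Nat.floor_le (Real.exp_pos _).le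
  have hLl : L ≤ l / 2 := by rw [hL]; linarith [mul_pos hδ0 hl0]
  obtain ⟨hI2, hI1, hI12⟩ := hI M (by
    rw [hM, NY, ← hT]
    refine Nat.floor_mono (Real.exp_le_exp.2 ?_)
    rw [div_le_iff₀ hkr, mul_comm]; exact mul_le_mul_of_nonneg_left hTk hL0.le)
  have hb : 0 < A * k / L := by positivity
  have hMl : (M : ℝ) ≤ Real.exp l := hMe.trans (Real.exp_le_exp.2 (by linarith))
  have hcc : 0 ≤ cc (Fin k) := sq_nonneg _
  have hWp : (0 : ℝ) < primorial D := by exact_mod_cast primorial_pos D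
  set Pi1 := ∏ p : PP D M, (1 + 2 * cc (Fin k) * tt p ^ 2) with hPi1
  have hp1 : Pi1 ≤ 1 + δ := (prodK _ (by positivity) (by omega)).trans hP1
  clear_value Pi1
  set X1 := ∑ n ∈ Ioc 0 (NN δ l), gw l n with hX1'
  set I2 := ∑ s : PP D M → Bool, gG A k L s ^ 2 * wt tt s with hI2'
  set U := X1 / primorial D * I2 ^ k with hU
  clear_value X1 I2 U
  have hX10 : 0 < X1 := lt_of_lt_of_le (by positivity) hX1
  have hUe : Real.exp l / (4 * primorial D) ≤ U := by
    rw [hU, ← div_div]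
    refine le_trans (div_le_div_of_nonneg_right hX1 hWp.le) (le_mul_of_one_le_right (by positivity) (one_le_pow₀ hI2))
  have hU0 : 0 < U := lt_of_lt_of_le (by positivity) hUe
  set S1 := ∑ n ∈ Ioc 0 (NN δ l) with n ≡ v [MOD primorial D], gw l n * nu h (gG (D := D) (M := M) A k L) (Real.exp L) n with hS1
  clear_value S1
  have h1 := S1' (N := NN δ l) (v := v) (l := l) (R := Real.exp L) (h := h) (by omega) hi hD (gG0 (D := D) (M := M) hb) (gG1 hb) (gGm hb)
  rw [Fintype.card_fin, ← hS1, ← hPi1, ← hI2', ← hX1'] at h1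
  obtain ⟨F, hF, hFS⟩ := hB
  have hQ : (primorial D : ℝ) * Real.exp L ^ 2 ≤ QQ δ l := by
    have h1 : Real.exp ((1 / 2 - δ) * l) < QQ δ l + 1 := Nat.lt_floor_add_one _
    have h2 : Real.exp L ^ 2 * Real.exp (δ * l) = Real.exp ((1 / 2 - δ) * l) := by
      rw [← Real.exp_nat_mul, ← Real.exp_add]; congr 1; rw [hL]; push_cast; ring
    have h3 : 1 ≤ Real.exp L ^ 2 := one_le_pow₀ (Real.one_le_exp hL0.le)
    have h4 := mul_le_mul_of_nonneg_left hW (zero_le_one.trans h3)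
    rw [h2] at h4; linarith
  have hPl := fun {C : ℝ} (hC : 0 ≤ C) => plp hC D M l (by omega) hl hMl
  obtain ⟨e, he⟩ : ∃ e, e = (∏ p : PP D M, (1 + tt p)) ^ 2 * (l ^ (44 + 20 * C2) * (Real.exp l * l ^ (-(2 * (44 + 20 * C2)))) +
      (l ^ (44 + 20 * C2))⁻¹ * (2 * Real.exp l * (1 + Real.log (NN δ l)) ^ 2) * ∏ p : PP D M, (1 + C2 * tt p)) := ⟨_, rfl⟩
  have hC20 : 0 ≤ C2 := by rw [hC2]; positivity
  have ht0 : ∀ p : PP D M, 0 ≤ tt p := tt0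
  have hpn : ∀ {C : ℝ}, 0 ≤ C → 0 ≤ ∏ p : PP D M, (1 + C * tt p) := fun hC => prod_nonneg fun p _ => by have := ht0 p; positivity
  have hpn1 : 0 ≤ ∏ p : PP D M, (1 + tt p) := prod_nonneg fun p _ => by have := ht0 p; positivity
  have h1p := hPl zero_le_one
  simp only [one_mul] at h1p
  have hec : e ≤ c2 * Real.exp l := (he.trans_le (e_ar hl0 hpn1 h1p (hpn hC20) (hPl hC20)).2).trans he2
  have he0 : 0 ≤ e := (e_ar hl0 hpn1 h1p (hpn hC20) (hPl hC20)).1.trans_eq he.symm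
  set S2 : Fin k → ℝ := fun i => ∑ n ∈ Ioc 0 (NN δ l) with n ≡ v [MOD primorial D],
    (if n + h i ∈ Ioc (N0 l) (NN δ l) then th l (n + h i) else 0) * nu h (gG (D := D) (M := M) A k L) (Real.exp L) n with hS2
  have hnu : ∀ n, 0 ≤ nu h (gG (D := D) (M := M) A k L) (Real.exp L) n := fun n => sq_nonneg _
  have hper : ∀ i, (1 - 8 * δ) * (m + 3 / 4) * l * U ≤ k * (S2 i + e) := fun i => by
    have hci : Fintype.card {j // j ≠ i} = k - 1 := by
      rw [Fintype.card_subtype_compl, Fintype.card_subtype_eq, Fintype.card_fin]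
    have h2 := S2' (N := NN δ l) (v := v) (l := l) (R := Real.exp L) (h := h) hD2 hi hD (gG0 (D := D) (M := M) hb) (gG1 hb) (gGm hb) (Real.exp_pos _).le gGY
      (by rw [← hPi1]; linarith) i (hv i) (θ := l ^ (44 + 20 * C2)) (by positivity) hg.1
      (by rw [hM, N0]; exact Nat.floor_mono (Real.exp_le_exp.2 hLl))
      (by rw [QQ, N0]; exact Nat.floor_mono (Real.exp_le_exp.2 (by linarith [mul_pos hδ0 hl0]))) hQ F hFS hF
    rw [hci, Fintype.card_fin, ← hPi1, ← hC2, ← he] at h2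
    have hZ := Zlow (D := D) (M := M) (κ := {j // j ≠ i}) hA1 hkr hL0 (by rw [← hT]; exact hk) (by rw [hci]; exact_mod_cast Nat.sub_le _ _) (hI2' ▸ hI1)
    rw [hci, ← hI2'] at hZ
    have hUU : U = X1 / primorial D * (I2 * I2 ^ (k - 1)) := by
      rw [hU, ← pow_succ', Nat.sub_add_cancel hk0]
    rw [hUU]
    refine per_ar hm1 hδ0 hδ1 hl0 hkr hX10.le hX hWp (by exact_mod_cast Nat.totient_pos.2 (primorial_pos D)) hI2 (by positivity) (by rw [← hA, ← hL]; exact hI12)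
      (by rw [← hA]; exact hZ) hp1 ((prodK _ (by positivity) (by omega)).trans hP2) (add_nonneg (sum_nonneg fun n _ => mul_nonneg (by split_ifs; exacts [th0 _ _, le_rfl]) (hnu n)) he0) h2
  have hsum : (1 - 8 * δ) * (m + 3 / 4) * l * U ≤ ∑ i, S2 i + k * e := by
    have := sum_le_sum fun i (_ : i ∈ univ) => hper i
    rw [sum_const, card_univ, Fintype.card_fin, nsmul_eq_mul, ← mul_sum, sum_add_distrib, sum_const, card_univ, Fintype.card_fin, nsmul_eq_mul] at this
    exact le_of_mul_le_mul_left this hkr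
  refine con_ar hm1 hδ hl0 hU0 (e1 := (2 + Real.log (NN δ l)) * Real.exp L ^ 2 * ∏ p : PP D M, (1 + (cc (Fin k) + 2 * k * cc (Fin k)) * tt p))
    (h1.trans (add_le_add ?_ le_rfl)) ?_ ?_ ?_ hsum
  · rw [hU, mul_left_comm]
    exact mul_le_mul_of_nonneg_right hp1 (by positivity)
  · have hcp : 0 ≤ cc (Fin k) + 2 * k * cc (Fin k) := by positivity
    have h3 := hPl hcp
    have h4 := hpn hcp
    rw [← hL] at he1
    have h5 := Real.log_natCast_nonneg (NN δ l)
    refine le_trans (mul_le_mul_of_nonneg_left h3 (by positivity)) (he1.trans ?_)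
    calc c1 * Real.exp l = δ * (Real.exp l / (4 * primorial D)) := by rw [hc1]; ring
      _ ≤ _ := by gcongr
  · calc k * e ≤ k * (c2 * Real.exp l) := by gcongr
      _ = δ * (Real.exp l / (4 * primorial D)) := by rw [hc2]; field_simp
      _ ≤ δ * U := by gcongr
      _ ≤ _ := by rw [mul_right_comm]; exact le_mul_of_one_le_right (by positivity) hl
  · rw [hS2, sum_comm, hS1, mul_sum]
    refine sum_le_sum fun n _ => ?_
    rw [← sum_mul, ← mul_assoc]
    refine mul_le_mul_of_nonneg_right ?_ (hnu n)
    have hc0 : 0 ≤ (1 + δ) * l := mul_nonneg (by linarith) hl0.le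
    have hgn : 0 ≤ ((1 + δ) * l) * ((1 + δ) * gw l n) := mul_nonneg hc0 (mul_nonneg (by linarith) (gw_nonneg l n))
    calc _ ≤ ∑ i, if (n + h i).Prime ∧ N0 l < n + h i then ((1 + δ) * l) * ((1 + δ) * gw l n) else 0 := sum_le_sum fun i _ => by
          by_cases h1 : n + h i ∈ Ioc (N0 l) (NN δ l)
          · rw [if_pos h1, th]
            obtain ⟨h2, h3⟩ := mem_Ioc.1 h1
            by_cases h4 : (n + h i).Prime
            · rw [if_pos h4, if_pos ⟨h4, h2⟩]
              have h5 : Real.log (n + h i : ℕ) ≤ (1 + δ) * l :=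
                (Real.log_le_log (by exact_mod_cast h4.pos) (by exact_mod_cast h3)).trans (logN δ l hc0)
              exact mul_le_mul h5 (hg.2 n (h i) (hD i) h2) (gw_nonneg _ _) hc0
            · rw [if_neg h4, if_neg (fun h => h4 h.1)]
          · rw [if_neg h1]; split_ifs; exacts [hgn, le_rfl]
      _ = (#{i | (n + h i).Prime ∧ N0 l < n + h i} : ℝ) * (((1 + δ) * l) * ((1 + δ) * gw l n)) := by
          rw [← sum_filter, sum_const, nsmul_eq_mul]
      _ ≤ m * (((1 + δ) * l) * ((1 + δ) * gw l n)) := by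
          refine mul_le_mul_of_nonneg_right (by exact_mod_cast hcon n) hgn
      _ = _ := by ring

theorem sieve {k m : ℕ} {A T : ℝ} (hm : 1 ≤ m) (h : Fin k → ℕ) (hi : Function.Injective h) (hA : A = 4 * m + 4) (hT : T = (Real.exp A - 1) / A)
    (hk : 32 * A ^ 3 * T ≤ k) (hv : ∀ D, ∃ v, ∀ i, (v + h i).Coprime (primorial D)) :
    ∃ᶠ l : ℝ in atTop, ∃ n, m < #{i | (n + h i).Prime ∧ N0 l < n + h i} := by
  have hm1 : (1 : ℝ) ≤ m := by exact_mod_cast hm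
  obtain ⟨δ, hδ⟩ : ∃ δ : ℝ, δ = 1 / (100 * m) := ⟨_, rfl⟩
  have hδ0 : 0 < δ := by rw [hδ]; positivity
  have hδ1 : δ ≤ 1 / 100 := by rw [hδ]; exact one_div_le_one_div_of_le (by norm_num) (by linarith)
  have hA1 : 1 ≤ A := by linarith
  have hT0 : 0 < T := by rw [hT]; exact div_pos (by linarith [Real.add_one_le_exp A]) (by linarith)
  have hkr : (0 : ℝ) < k := lt_of_lt_of_le (by positivity) hk
  have hk0 : 0 < k := by exact_mod_cast hkr
  obtain ⟨D, d1, d2, d3, d4, d5⟩ := ((ev_D 2 hδ0).and ((ev_D (2 * (2 * cc (Fin k))) hδ0).and ((ev_D (2 * (4 ^ (k - 1) + 2 * (k - 1 : ℕ))) hδ0).and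
    ((eventually_ge_atTop 2).and (eventually_ge_atTop (univ.sup h)))))).exists
  obtain ⟨v, hv⟩ := hv D
  have hWp : (0 : ℝ) < primorial D := by exact_mod_cast primorial_pos D
  have hcc : 0 ≤ cc (Fin k) := sq_nonneg _
  have hL : Tendsto (fun l : ℝ => (1 / 4 - δ) * l) atTop atTop := tendsto_id.const_mul_atTop (by linarith)
  have hC20 : 0 ≤ 2 * cc (Fin k) + cc (Fin k) ^ 2 + 4 * cc (Fin k) ^ 2 * (k : ℝ) ^ 2 := by positivity
  have hd : δ ≤ 1 / 4 := by linarith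
  refine ((BV hδ0 hd (A := 2 * (44 + 20 * (2 * cc (Fin k) + cc (Fin k) ^ 2 + 4 * cc (Fin k) ^ 2 * (k : ℝ) ^ 2))) (by positivity)).and_eventually
    ((eventually_ge_atTop 1).and ((X1_ge hδ0).and ((X'_ge hδ0 hd hδ0).and ((gw_shift D hδ0).and ((err1 hδ0 hd (c := δ / (4 * primorial D)) (by positivity) (cc (Fin k) + 2 * k * cc (Fin k))).and
    ((err2 hδ0 hd (c := δ / (4 * primorial D * k)) (by positivity) hC20).and ((hL.eventually (I12 D A k δ (by omega) hA1 (by rw [hA]; exact (expA hm1).1) hkr d1 ?_)).and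
    ((Real.tendsto_exp_atTop.comp (tendsto_id.const_mul_atTop hδ0)).eventually_ge_atTop (primorial D + 1 : ℝ)))))))))).mono ?_
  · rw [hδ]; exact one_div_le_one_div_of_le (by linarith) (by linarith)
  · rintro l ⟨h1, h2, h3, h4, h5, h6, h7, h8, h9⟩
    exact point hm h hi hA hT hk hk0 hδ rfl d4 (fun i => (le_sup (mem_univ i)).trans d5) d2.le d3.le hv h2 rfl h1 h3 h4 h5 rfl rfl h6 h7 h8 h9
end MG

namespace MG
open Finset Filter Topology

theorem adm {k : ℕ} {h : Fin k → ℕ} (hp : ∀ i, (h i).Prime) (hk : ∀ i, k < h i) (D : ℕ) : ∃ v, ∀ i, (v + h i).Coprime (primorial D) := by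
  induction D with
  | zero => exact ⟨0, fun i => by rw [show primorial 0 = 1 from rfl]; exact Nat.coprime_one_right _⟩
  | succ D ih =>
    by_cases hD : (D + 1).Prime
    · obtain ⟨v, hv⟩ := ih
      have hW : primorial (D + 1) = (D + 1) * primorial D := by
        rw [primorial, range_add_one, filter_insert, if_pos hD, prod_insert (by simp), primorial]
      have hc : (D + 1).Coprime (primorial D) := by
        refine Nat.Coprime.prod_right fun p hp => ?_
        obtain ⟨h1, h2⟩ := mem_filter.1 hp
        exact (Nat.coprime_primes hD h2).2 (by have := mem_range.1 h1; omega)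
      obtain ⟨a, ha⟩ : ∃ a, ∀ i, ¬ (D + 1) ∣ a + h i := by
        by_cases hDk : D + 1 ≤ k
        · refine ⟨0, fun i hi => ?_⟩
          rw [zero_add, Nat.prime_dvd_prime_iff_eq hD (hp i)] at hi
          have := hk i; omega
        · haveI := Fact.mk hD
          obtain ⟨z, hz⟩ : ∃ z : ZMod (D + 1), z ∉ univ.image fun i => -(h i : ZMod (D + 1)) := by
            by_contra hn; push Not at hn
            have h1 := card_le_card (fun z _ => hn z : (univ : Finset (ZMod (D + 1))) ⊆ _)
            have h2 : #(univ.image fun i => -(h i : ZMod (D + 1))) ≤ k := card_image_le.trans (by simp)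
            rw [card_univ, ZMod.card] at h1; omega
          refine ⟨z.val, fun i hi => hz (mem_image.2 ⟨i, mem_univ i, ?_⟩)⟩
          rw [← ZMod.natCast_eq_zero_iff] at hi
          push_cast at hi
          rw [ZMod.natCast_zmod_val] at hi
          exact (eq_neg_of_add_eq_zero_left hi).symm
      refine ⟨Nat.chineseRemainder hc a v, fun i => ?_⟩
      obtain ⟨h1, h2⟩ := (Nat.chineseRemainder hc a v).2
      rw [hW]
      refine Nat.Coprime.mul_right ?_ ?_
      · rw [Nat.Coprime, (h1.add_right (h i)).gcd_eq]
        exact (Nat.coprime_comm.1 ((Nat.Prime.coprime_iff_not_dvd hD).2 (ha i)))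
      · rw [Nat.Coprime, (h2.add_right (h i)).gcd_eq]; exact hv i
    · have hW : primorial (D + 1) = primorial D := by
        rw [primorial, range_add_one, filter_insert, if_neg hD, primorial]
      rw [hW]; exact ih

theorem tup {A : ℝ} (hA : 8 ≤ A) : ∃ k : ℕ, 32 * A ^ 3 * ((Real.exp A - 1) / A) ≤ k ∧ ∃ h : Fin k → ℕ, Function.Injective h ∧ (∀ i, (h i).Prime) ∧
    (∀ i, k < h i) ∧ ∀ i, (h i : ℝ) ≤ 1000 * A ^ 3 * Real.exp A := by
  have hA0 : 0 < A := by linarith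
  obtain ⟨E, hE⟩ : ∃ E, E = Real.exp A := ⟨_, rfl⟩
  have hEA : A ≤ E := by rw [hE]; linarith [Real.add_one_le_exp A]
  have hE8 : 1000 ≤ E := by
    rw [hE]
    refine le_trans ?_ (Real.exp_le_exp.2 hA)
    rw [show (8 : ℝ) = (8 : ℕ) * 1 by norm_num, Real.exp_nat_mul]
    refine le_trans ?_ (pow_le_pow_left₀ (by norm_num) (show (2.7 : ℝ) ≤ Real.exp 1 by linarith [Real.exp_one_gt_d9]) 8)
    norm_num
  rw [← hE]
  obtain ⟨k, hk⟩ : ∃ k, k = ⌈32 * A ^ 2 * E⌉₊ := ⟨_, rfl⟩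
  obtain ⟨H, hH⟩ : ∃ H, H = ⌊1000 * A ^ 3 * E⌋₊ := ⟨_, rfl⟩
  have hA2 : 64 ≤ A ^ 2 := by nlinarith
  have hA2E : 1 ≤ A ^ 2 * E := by nlinarith
  have hA3E : 8 * (A ^ 2 * E) ≤ A ^ 3 * E := by rw [show A ^ 3 * E = A * (A ^ 2 * E) by ring]; gcongr
  have hk1 : 32 * A ^ 2 * E ≤ k := by rw [hk]; exact Nat.le_ceil _
  have hk2 : (k : ℝ) ≤ 33 * (A ^ 2 * E) := by
    have := Nat.ceil_lt_add_one (show 0 ≤ 32 * A ^ 2 * E by positivity)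
    rw [← hk] at this; linarith
  have hH1 : (H : ℝ) ≤ 1000 * A ^ 3 * E := by rw [hH]; exact Nat.floor_le (by positivity)
  have hH2 : 999 * (A ^ 3 * E) ≤ H := by
    have := Nat.lt_floor_add_one (1000 * A ^ 3 * E)
    rw [← hH] at this; linarith
  have hH3 : (2 : ℝ) ≤ H := by linarith
  have hlog : Real.log H ≤ 5 * A := by
    rw [Real.log_le_iff_le_exp (by linarith)]
    refine hH1.trans ?_
    rw [show 5 * A = (5 : ℕ) * A by norm_num, Real.exp_nat_mul, ← hE]
    calc 1000 * A ^ 3 * E ≤ E * E ^ 3 * E := by gcongr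
      _ = E ^ 5 := by ring
  have hlog1 : Real.log (H + 1) ≤ 5 * A + 1 := by
    have h1 : Real.log (H + 1) ≤ Real.log (2 * H) := Real.log_le_log (by linarith) (by linarith)
    rw [Real.log_mul two_ne_zero (by linarith)] at h1
    linarith [Real.log_two_lt_d9]
  have hlp : 0 < Real.log H := Real.log_pos (by linarith)
  have hpi : 2 * k ≤ H.primeCounting := by
    have h1 := Chebyshev.pi_ge H
    rw [div_le_iff₀ hlp] at h1
    have h2 := Real.log_two_gt_d9
    by_contra hcon
    push Not at hcon
    have h3 : (H.primeCounting : ℝ) ≤ 2 * k := by exact_mod_cast hcon.le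
    have h4 : (H.primeCounting : ℝ) * Real.log H ≤ 2 * (33 * (A ^ 2 * E)) * (5 * A) := by gcongr; linarith
    have h5 : 2 * (33 * (A ^ 2 * E)) * (5 * A) = 330 * (A ^ 3 * E) := by ring
    have h6 : 0.69 * (999 * (A ^ 3 * E)) ≤ H * Real.log 2 := by
      rw [mul_comm]; exact mul_le_mul hH2 (by linarith) (by norm_num) (by linarith)
    have h7 : A ≤ A ^ 3 * E := by
      refine le_trans ?_ (by gcongr : A ^ 3 * 1000 ≤ A ^ 3 * E)
      nlinarith
    rw [h5] at h4
    linarith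
  have hcard : k ≤ #((Ioc k H).filter Nat.Prime) := by
    rw [← Nat.primesLE_card_eq_primeCounting] at hpi
    have h1 : Nat.primesLE H ⊆ Ioc 0 k ∪ (Ioc k H).filter Nat.Prime := fun p hp => by
      have h2 := Nat.prime_of_mem_primesLE hp
      have h3 := h2.pos
      have h4 : p ≤ H := (Nat.mem_primesLE.1 hp).1
      rw [mem_union, mem_filter, mem_Ioc, mem_Ioc]
      by_cases h5 : p ≤ k
      · exact Or.inl ⟨h3, h5⟩
      · exact Or.inr ⟨⟨by omega, h4⟩, h2⟩
    have h2 := (card_le_card h1).trans (card_union_le _ _)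
    rw [Nat.card_Ioc] at h2; omega
  refine ⟨k, ?_, ?_⟩
  · refine le_trans (le_of_eq ?_) ((show 32 * A ^ 2 * (E - 1) ≤ 32 * A ^ 2 * E by gcongr; linarith).trans hk1)
    field_simp
  · obtain ⟨P, hP, hPk⟩ := exists_subset_card_eq hcard
    have hm : ∀ i, P.orderEmbOfFin hPk i ∈ (Ioc k H).filter Nat.Prime := fun i => hP (orderEmbOfFin_mem P hPk i)
    refine ⟨P.orderEmbOfFin hPk, (P.orderEmbOfFin hPk).injective, fun i => (mem_filter.1 (hm i)).2, fun i => (mem_Ioc.1 (mem_filter.1 (hm i)).1).1, fun i => ?_⟩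
    exact le_trans (by exact_mod_cast (mem_Ioc.1 (mem_filter.1 (hm i)).1).2) hH1

theorem nth_fr {k m : ℕ} {h : Fin k → ℕ} {B : ℝ} (hi : Function.Injective h) (hB : ∀ i, (h i : ℝ) ≤ B)
    (hf : ∃ᶠ l : ℝ in atTop, ∃ n, m < #{i | (n + h i).Prime ∧ N0 l < n + h i}) (N : ℕ) :
    ∃ j ≥ N, (Nat.nth Nat.Prime (j + m) : ℝ) - Nat.nth Nat.Prime j ≤ B := by
  have ht : Tendsto (fun l : ℝ => N0 l) atTop atTop :=
    tendsto_nat_floor_atTop.comp (Real.tendsto_exp_atTop.comp (tendsto_id.atTop_div_const two_pos))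
  obtain ⟨l, ⟨n, hn⟩, hl⟩ := (hf.and_eventually (ht.eventually_ge_atTop (Nat.nth Nat.Prime N))).exists
  set I : Finset (Fin k) := univ.filter fun i => (n + h i).Prime ∧ N0 l < n + h i
  have hI : ∀ i ∈ I, (n + h i).Prime ∧ N0 l < n + h i := fun i h => (mem_filter.1 h).2
  have hne : I.Nonempty := card_pos.1 (by omega)
  obtain ⟨i0, hi0, hmin⟩ := exists_min_image I h hne
  obtain ⟨i1, hi1, hmax⟩ := exists_max_image I h hne
  obtain ⟨hp0, hl0⟩ := hI i0 hi0
  have hj : Nat.nth Nat.Prime (Nat.count Nat.Prime (n + h i0)) = n + h i0 := Nat.nth_count hp0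
  refine ⟨Nat.count Nat.Prime (n + h i0), ?_, ?_⟩
  · refine ((Nat.nth_lt_nth Nat.infinite_setOf_prime).1 ?_).le
    exact (hl.trans_lt hl0).trans_eq hj.symm
  · have h1 : Nat.nth Nat.Prime (Nat.count Nat.Prime (n + h i0) + m) < n + h i1 + 1 := by
      refine Nat.nth_lt_of_lt_count ?_
      rw [Nat.count_eq_card_filter_range, Nat.count_eq_card_filter_range]
      have hs : (range (n + h i0)).filter Nat.Prime ∪ I.image (fun i => n + h i) ⊆ (range (n + h i1 + 1)).filter Nat.Prime := by
        refine union_subset (filter_subset_filter _ (range_subset_range.2 (by have := hmin i1 hi1; omega))) fun p hp => ?_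
        obtain ⟨i, h2, rfl⟩ := mem_image.1 hp
        exact mem_filter.2 ⟨mem_range.2 (by have := hmax i h2; omega), (hI i h2).1⟩
      have hd : Disjoint ((range (n + h i0)).filter Nat.Prime) (I.image (fun i => n + h i)) := by
        rw [disjoint_left]
        intro p hp hp'
        obtain ⟨i, h2, rfl⟩ := mem_image.1 hp'
        have h3 := mem_range.1 (mem_filter.1 hp).1
        have := hmin i h2; omega
      have := card_le_card hs
      rw [card_union_of_disjoint hd, card_image_of_injective _ fun a b hab => hi (by simpa using hab)] at this
      exact lt_of_lt_of_le (Nat.add_lt_add_left hn _) this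
    rw [hj]
    have h2 : (Nat.nth Nat.Prime (Nat.count Nat.Prime (n + h i0) + m) : ℝ) ≤ n + h i1 := by exact_mod_cast Nat.lt_succ_iff.1 h1
    have h3 : (0 : ℝ) ≤ h i0 := Nat.cast_nonneg _
    push_cast
    linarith [hB i1]

theorem final : ∃ C > (0 : ℝ), ∀ m : ℕ, 1 ≤ m → ∀ N : ℕ, ∃ j ≥ N, (Nat.nth Nat.Prime (j + m) : ℝ) - Nat.nth Nat.Prime j ≤ C * m ^ 3 * Real.exp (4 * m) := by
  refine ⟨512000 * Real.exp 4, by positivity, fun m hm N => ?_⟩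
  have hm1 : (1 : ℝ) ≤ m := by exact_mod_cast hm
  obtain ⟨k, hk, h, hi, hp, hkh, hB⟩ := tup (A := 4 * m + 4) (by linarith)
  refine nth_fr hi (fun i => (hB i).trans ?_) (sieve hm h hi rfl rfl hk (adm hp hkh)) N
  rw [Real.exp_add]
  calc 1000 * (4 * (m : ℝ) + 4) ^ 3 * (Real.exp (4 * m) * Real.exp 4) ≤ 1000 * (8 * m) ^ 3 * (Real.exp (4 * m) * Real.exp 4) := by gcongr; linarith
    _ = _ := by ring
end MG

/-- (Maynard) `liminf (p_{n+m} - p_n) ≪ m³ e^{4m}` uniformly in `m ≥ 1`. -/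
theorem maynard_bounded_gaps_m :
    ∃ C > (0 : ℝ), ∀ m : ℕ, 1 ≤ m →
      Filter.liminf (fun n : ℕ => ((nthPrime (n + m) : ℝ) - nthPrime n)) Filter.atTop
        ≤ C * m ^ 3 * Real.exp (4 * m) := by
  obtain ⟨C, hC, h⟩ := MG.final
  refine ⟨C, hC, fun m hm => liminf_le_of_frequently_le ?_ ⟨0, ?_⟩⟩
  · refine frequently_atTop.2 fun N => ?_
    obtain ⟨j, hj, h1⟩ := h m hm N
    refine ⟨j + 1, by omega, ?_⟩
    rw [nthPrime, nthPrime, show j + 1 + m - 1 = j + m by omega, Nat.add_sub_cancel]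
    exact h1
  · rw [eventually_map]
    refine Eventually.of_forall fun n => sub_nonneg.2 ?_
    exact_mod_cast Nat.nth_monotone Nat.infinite_setOf_prime (by omega)
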